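/- Let s ∈ (4/7, 1) and let ε > 0 be sufficiently small. For every B > 0 there is a constant C = C(s, ε, B) such that: for every T ≥ 1, every Schwartz initial datum φ₀ on ℝ² with ‖φ₀‖_{H^s(ℝ²)} ≤ B, and every solution φ of the cubic defocussing NLS on ℝ² × [0, T] with data φ₀, one has ‖φ(·, T)‖²_{H^s(ℝ²)} ≤ C (1 + T)^{(1−s)/((7/4)s−1) + ε}. (Main theorem, n = 2: global-in-time polynomial bound on the H^s norm for s > 4/7.) -/

import Mathlib

open MeasureTheory Complex Set
open scoped FourierTransform BigOperators RealInnerProductSpace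

noncomputable section

abbrev Rn (n : ℕ) := EuclideanSpace ℝ (Fin n)

/-- Japanese bracket of a vector. -/
def jap {n : ℕ} (ξ : Rn n) : ℝ := Real.sqrt (1 + ‖ξ‖ ^ 2)

/-- Japanese bracket of a real number. -/
def japR (x : ℝ) : ℝ := Real.sqrt (1 + x ^ 2)

/-- Inhomogeneous Sobolev norm ‖⟨ξ⟩^s f̂‖_{L²}. -/
def sobNorm (n : ℕ) (s : ℝ) (f : Rn n → ℂ) : ℝ :=
  (∫ ξ : Rn n, jap ξ ^ (2 * s) * ‖𝓕 f ξ‖ ^ 2) ^ (1/2 : ℝ)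

/-- Homogeneous Sobolev norm ‖|ξ|^s f̂‖_{L²}. -/
def sobNormHom (n : ℕ) (s : ℝ) (f : Rn n → ℂ) : ℝ :=
  (∫ ξ : Rn n, ‖ξ‖ ^ (2 * s) * ‖𝓕 f ξ‖ ^ 2) ^ (1/2 : ℝ)

/-- L^p norm on ℝⁿ. -/
def lpNorm (n : ℕ) (p : ℝ) (f : Rn n → ℂ) : ℝ :=
  (∫ x : Rn n, ‖f x‖ ^ p) ^ (1/p)

/-- Laplacian: sum of second partial derivatives. -/
def laplacian {n : ℕ} (f : Rn n → ℂ) (x : Rn n) : ℂ :=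
  ∑ i : Fin n, fderiv ℝ (fun y => fderiv ℝ f y (EuclideanSpace.single i 1)) x
    (EuclideanSpace.single i 1)

/-- Complex gradient as a vector in Euclidean space. -/
def gradC {n : ℕ} (f : Rn n → ℂ) (x : Rn n) : EuclideanSpace ℂ (Fin n) :=
  (WithLp.equiv 2 (Fin n → ℂ)).symm fun i => fderiv ℝ f x (EuclideanSpace.single i 1)

/-- φ is a solution of the cubic defocussing NLS on ℝⁿ × [0,T] with data φ₀:
smooth, Schwartz in x uniformly for t ∈ [0,T] (with all derivatives),
satisfying i∂ₜφ + Δφ = |φ|²φ and φ(·,0) = φ₀. -/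
def IsNLSSolution (n : ℕ) (T : ℝ) (φ : Rn n → ℝ → ℂ) (φ₀ : Rn n → ℂ) : Prop :=
  ContDiff ℝ (⊤ : ℕ∞) (fun p : Rn n × ℝ => φ p.1 p.2) ∧
  (∀ k l : ℕ, ∃ C : ℝ, ∀ t ∈ Icc (0:ℝ) T, ∀ x : Rn n,
      ‖x‖ ^ k * ‖iteratedFDeriv ℝ l (fun y => φ y t) x‖ ≤ C) ∧
  (∀ x : Rn n, ∀ t ∈ Icc (0:ℝ) T,
      Complex.I * deriv (fun t' => φ x t') t + laplacian (fun y => φ y t) x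
        = (‖φ x t‖ : ℂ) ^ 2 * φ x t) ∧
  (∀ x : Rn n, φ x 0 = φ₀ x)

/-- The energy E(f) = ∫ (1/2)|∇f|² + (1/4)|f|⁴. -/
def energy {n : ℕ} (f : Rn n → ℂ) : ℝ :=
  ∫ x : Rn n, ((1/2 : ℝ) * ∑ i : Fin n, ‖fderiv ℝ f x (EuclideanSpace.single i 1)‖ ^ 2
    + (1/4 : ℝ) * ‖f x‖ ^ 4)

/-- m₁ is a smooth, radially symmetric, nonincreasing multiplier with
m₁ = 1 on the unit ball, m₁(ξ) = |ξ|^{-(1-s)} for |ξ| ≥ 2, 0 < m₁ ≤ 1. -/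
def IsAdmissibleMultiplier (n : ℕ) (s : ℝ) (m₁ : Rn n → ℝ) : Prop :=
  ContDiff ℝ (⊤ : ℕ∞) m₁ ∧
  (∀ ξ : Rn n, 0 < m₁ ξ ∧ m₁ ξ ≤ 1) ∧
  (∀ ξ η : Rn n, ‖ξ‖ = ‖η‖ → m₁ ξ = m₁ η) ∧
  (∀ ξ η : Rn n, ‖ξ‖ ≤ ‖η‖ → m₁ η ≤ m₁ ξ) ∧
  (∀ ξ : Rn n, ‖ξ‖ ≤ 1 → m₁ ξ = 1) ∧
  (∀ ξ : Rn n, 2 ≤ ‖ξ‖ → m₁ ξ = ‖ξ‖ ^ (-(1 - s)))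

/-- The rescaled multiplier m_N(ξ) = m₁(ξ/N). -/
def mN {n : ℕ} (m₁ : Rn n → ℝ) (N : ℝ) (ξ : Rn n) : ℝ := m₁ (N⁻¹ • ξ)

/-- The smoothing operator I_N with Fourier multiplier m_N. -/
def Iop {n : ℕ} (m₁ : Rn n → ℝ) (N : ℝ) (f : Rn n → ℂ) : Rn n → ℂ :=
  fun x => 𝓕⁻ (fun ξ => (mN m₁ N ξ : ℂ) * 𝓕 f ξ) x

/-- The spatial multiplier ⟨∇⟩^s. -/
def japMul (n : ℕ) (s : ℝ) (f : Rn n → ℂ) : Rn n → ℂ :=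
  fun x => 𝓕⁻ (fun ξ => ((jap ξ ^ s : ℝ) : ℂ) * 𝓕 f ξ) x

/-- Sharp Littlewood–Paley projection onto {M ≤ ⟨ξ⟩ ≤ 2M}. -/
def LP (n : ℕ) (M : ℝ) (f : Rn n → ℂ) : Rn n → ℂ :=
  fun x => 𝓕⁻ (fun ξ => if M ≤ jap ξ ∧ jap ξ ≤ 2 * M then 𝓕 f ξ else 0) x

/-- Space-time Fourier transform ψ̃(ξ,τ). -/
def stFourier (n : ℕ) {E : Type*} [NormedAddCommGroup E] [NormedSpace ℂ E]
    (ψ : Rn n → ℝ → E) (ξ : Rn n) (τ : ℝ) : E :=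
  ∫ x : Rn n, ∫ t : ℝ,
    Complex.exp (Complex.I * ((-2 * Real.pi * (⟪x, ξ⟫ + t * τ) : ℝ) : ℂ)) • ψ x t

/-- The X_{s,b} norm ‖⟨ξ⟩^s ⟨τ-|ξ|²⟩^b ψ̃‖_{L²}. -/
def XNorm (n : ℕ) {E : Type*} [NormedAddCommGroup E] [NormedSpace ℂ E]
    (s b : ℝ) (ψ : Rn n → ℝ → E) : ℝ :=
  (∫ ξ : Rn n, ∫ τ : ℝ,
    jap ξ ^ (2 * s) * japR (τ - ‖ξ‖ ^ 2) ^ (2 * b) * ‖stFourier n ψ ξ τ‖ ^ 2) ^ (1/2 : ℝ)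

/-- The restricted norm X^δ_{s,b}: infimum over Schwartz extensions off ℝⁿ × [0,δ]. -/
def XRNorm (n : ℕ) {E : Type*} [NormedAddCommGroup E] [NormedSpace ℂ E]
    (s b δ : ℝ) (f : Rn n → ℝ → E) : ℝ :=
  sInf { r : ℝ | ∃ ψ : SchwartzMap (Rn n × ℝ) E,
    (∀ x : Rn n, ∀ t ∈ Icc (0:ℝ) δ, ψ (x, t) = f x t) ∧
    r = XNorm n s b (fun x t => ψ (x, t)) }

/-- Space-time L^p norm on ℝⁿ × ℝ. -/
def lpNormST (n : ℕ) {E : Type*} [NormedAddCommGroup E] (p : ℝ) (F : Rn n → ℝ → E) : ℝ :=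
  (∫ t : ℝ, ∫ x : Rn n, ‖F x t‖ ^ p) ^ (1/p)

/-- Space-time L^p norm on ℝⁿ × [0,δ]. -/
def lpNormSTt (n : ℕ) {E : Type*} [NormedAddCommGroup E] (p δ : ℝ) (F : Rn n → ℝ → E) : ℝ :=
  (∫ t in Icc (0:ℝ) δ, ∫ x : Rn n, ‖F x t‖ ^ p) ^ (1/p)

section
open scoped ENNReal NNReal Topology ComplexConjugate

/-! ### The Japanese bracket and the smoothing multiplier -/

lemma one_le_jap {n : ℕ} (x : Rn n) : 1 ≤ jap x := by
  unfold jap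
  exact Real.one_le_sqrt.mpr (by nlinarith [sq_nonneg ‖x‖])

lemma jap_pos {n : ℕ} (x : Rn n) : 0 < jap x := lt_of_lt_of_le one_pos (one_le_jap x)

lemma jap_sq {n : ℕ} (x : Rn n) : jap x ^ 2 = 1 + ‖x‖ ^ 2 := by
  unfold jap
  exact Real.sq_sqrt (by positivity)

lemma norm_le_jap {n : ℕ} (x : Rn n) : ‖x‖ ≤ jap x :=
  Real.le_sqrt_of_sq_le (by linarith)

lemma jap_le_one_add_norm {n : ℕ} (x : Rn n) : jap x ≤ 1 + ‖x‖ := by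
  unfold jap
  rw [Real.sqrt_le_left (by positivity)]
  nlinarith [norm_nonneg x]

lemma jap_neg {n : ℕ} (x : Rn n) : jap (-x) = jap x := by simp [jap]

lemma jap_add_le_norm {n : ℕ} (x y : Rn n) : jap (x + y) ≤ jap x + ‖y‖ := by
  have h1 := jap_pos x
  have h2 := norm_le_jap x
  have h3 := jap_sq x
  have h4 := norm_add_le x y
  unfold jap at h1 h2 h3 ⊢
  rw [Real.sqrt_le_left (by positivity)]
  nlinarith [norm_nonneg x, norm_nonneg y, norm_nonneg (x + y)]

lemma jap_add_le {n : ℕ} (x y : Rn n) : jap (x + y) ≤ jap x + jap y :=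
  (jap_add_le_norm x y).trans (by linarith [norm_le_jap y])

lemma jap_sub_le {n : ℕ} (x y : Rn n) : jap (x - y) ≤ jap x + jap y := by
  rw [sub_eq_add_neg, ← jap_neg y]
  exact jap_add_le _ _

lemma continuous_jap {n : ℕ} : Continuous (jap : Rn n → ℝ) := by
  unfold jap
  fun_prop

/-- The smoothing multiplier, as a function of the Japanese bracket. -/
def smoothMul (N s r : ℝ) : ℝ := min 1 ((N / r) ^ (1 - s))

/-- The Sobolev weight attached to the smoothing multiplier. -/
def smoothWt (N s r : ℝ) : ℝ := r * smoothMul N s r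

section multiplier
variable {N s : ℝ}

lemma smoothMul_pos (hN : 1 ≤ N) {r : ℝ} (hr : 0 < r) : 0 < smoothMul N s r := by
  unfold smoothMul
  have : 0 < N := by linarith
  positivity

lemma smoothMul_le_one (r : ℝ) : smoothMul N s r ≤ 1 := min_le_left _ _

lemma smoothMul_anti (hN : 1 ≤ N) (hs1 : s < 1) {r r' : ℝ} (hr : 0 < r) (h : r ≤ r') :
    smoothMul N s r' ≤ smoothMul N s r := by
  unfold smoothMul
  have : 0 < N := by linarith
  have hr' := hr.trans_le h
  refine min_le_min_left _ (Real.rpow_le_rpow (by positivity) ?_ (by linarith))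
  gcongr

lemma smoothMul_eq_one (hs1 : s < 1) {r : ℝ} (hr : 0 < r) (h : r ≤ N) :
    smoothMul N s r = 1 := by
  unfold smoothMul
  refine min_eq_left (Real.one_le_rpow ?_ (by linarith))
  rwa [one_le_div hr]

lemma smoothWt_eq (hN : 1 ≤ N) {r : ℝ} (hr : 0 < r) :
    smoothWt N s r = min r (N ^ (1 - s) * r ^ s) := by
  unfold smoothWt smoothMul
  rw [mul_min_of_nonneg _ _ hr.le, mul_one, Real.div_rpow (by linarith) hr.le]
  congr 1
  rw [mul_div_assoc', mul_comm r, mul_div_assoc]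
  congr 1
  rw [div_eq_iff (by positivity), ← Real.rpow_add hr]
  simp

lemma smoothWt_pos (hN : 1 ≤ N) {r : ℝ} (hr : 0 < r) : 0 < smoothWt N s r :=
  mul_pos hr (smoothMul_pos hN hr)

lemma smoothWt_mono (hN : 1 ≤ N) (hs0 : 0 < s) {r r' : ℝ} (hr : 0 < r) (h : r ≤ r') :
    smoothWt N s r ≤ smoothWt N s r' := by
  have : 0 < N := by linarith
  rw [smoothWt_eq hN hr, smoothWt_eq hN (hr.trans_le h)]
  gcongr

lemma smoothWt_le {r : ℝ} (hr : 0 < r) : smoothWt N s r ≤ r :=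
  mul_le_of_le_one_right hr.le (smoothMul_le_one r)

lemma smoothWt_le_rpow (hN : 1 ≤ N) {r : ℝ} (hr : 0 < r) :
    smoothWt N s r ≤ N ^ (1 - s) * r ^ s := by
  rw [smoothWt_eq hN hr]
  exact min_le_right _ _

lemma rpow_le_smoothWt (hN : 1 ≤ N) (hs1 : s < 1) {r : ℝ} (hr : 1 ≤ r) :
    r ^ s ≤ smoothWt N s r := by
  have h0 : 0 < r := by linarith
  rw [smoothWt_eq hN h0]
  refine le_min ?_ ?_
  · calc r ^ s ≤ r ^ (1 : ℝ) := Real.rpow_le_rpow_of_exponent_le hr hs1.le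
      _ = r := Real.rpow_one r
  · exact le_mul_of_one_le_left (by positivity) (Real.one_le_rpow hN (by linarith))

lemma one_le_smoothWt (hN : 1 ≤ N) (hs0 : 0 < s) (hs1 : s < 1) {r : ℝ} (hr : 1 ≤ r) :
    1 ≤ smoothWt N s r :=
  (Real.one_le_rpow hr hs0.le).trans (rpow_le_smoothWt hN hs1 hr)

lemma smoothWt_mul_le (hN : 1 ≤ N) (hs1 : s < 1) {r c : ℝ} (hr : 0 < r) (hc : 1 ≤ c) :
    smoothWt N s (c * r) ≤ c * smoothWt N s r := by
  unfold smoothWt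
  rw [mul_assoc]
  gcongr
  exact smoothMul_anti hN hs1 hr (by nlinarith)

lemma smoothWt_eq_self (hs1 : s < 1) {r : ℝ} (hr : 0 < r) (h : r ≤ N) :
    smoothWt N s r = r := by
  rw [smoothWt, smoothMul_eq_one hs1 hr h, mul_one]

lemma le_smoothWt_of_le (hN : 1 ≤ N) (hs0 : 0 < s) (hs1 : s < 1) {r x : ℝ} (hx : 0 < x)
    (hxN : x ≤ N) (hxr : x ≤ r) : x ≤ smoothWt N s r := by
  rw [← smoothWt_eq_self (N := N) hs1 hx hxN]
  exact smoothWt_mono hN hs0 hx hxr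

lemma rpow_div_smoothWt_le (hN : 1 ≤ N) (hs0 : 0 < s) (hs1 : s < 1) {r e A : ℝ}
    (hA : 1 ≤ A) (hr : N ≤ A * r) (he0 : 0 ≤ e) (he : e ≤ s) :
    r ^ e / smoothWt N s r ≤ A * N ^ (e - 1) := by
  have hN0 : 0 < N := by linarith
  have hr0 : 0 < r := by
    by_contra h
    nlinarith
  rw [div_le_iff₀ (smoothWt_pos hN hr0), smoothWt_eq hN hr0, mul_min_of_nonneg _ _ (by positivity)]
  have hrN : N / A ≤ r := by rwa [div_le_iff₀ (by linarith), mul_comm]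
  have key : ∀ p : ℝ, p ≤ 0 → -1 ≤ p → r ^ p ≤ A * N ^ p := by
    intro p hp hp1
    calc r ^ p ≤ (N / A) ^ p := Real.rpow_le_rpow_of_nonpos (by positivity) hrN hp
      _ = N ^ p * A ^ (-p) := by
        rw [Real.div_rpow hN0.le (by linarith), Real.rpow_neg (by linarith), div_eq_mul_inv]
      _ ≤ N ^ p * A := by
        gcongr
        calc A ^ (-p) ≤ A ^ (1 : ℝ) := Real.rpow_le_rpow_of_exponent_le hA (by linarith)
          _ = A := Real.rpow_one A
      _ = A * N ^ p := mul_comm _ _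
  refine le_min ?_ ?_
  · have h := key (e - 1) (by linarith) (by linarith)
    calc r ^ e = r ^ (e - 1) * r := by
          rw [← Real.rpow_add_one hr0.ne']; congr 1; ring
      _ ≤ A * N ^ (e - 1) * r := by gcongr
  · have h := key (e - s) (by linarith) (by linarith)
    calc r ^ e = r ^ (e - s) * r ^ s := by
          rw [← Real.rpow_add hr0]; congr 1; ring
      _ ≤ A * N ^ (e - s) * r ^ s := by gcongr
      _ = A * N ^ (e - 1) * (N ^ (1 - s) * r ^ s) := by
          rw [show e - s = (e - 1) + (1 - s) by ring, Real.rpow_add hN0]; ring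

lemma smoothMul_le_mul (hN : 1 ≤ N) (hs0 : 0 < s) (hs1 : s < 1) {r r' c : ℝ} (hr : 0 < r)
    (hr' : 0 < r') (hc : 1 ≤ c) (h : r' ≤ c * r) : smoothMul N s r ≤ c * smoothMul N s r' := by
  rcases le_total r r' with h1 | h1
  · have h2 := smoothWt_mono (N := N) hN hs0 hr h1
    unfold smoothWt at h2
    have h3 := smoothMul_pos (s := s) hN hr'
    have : r * smoothMul N s r ≤ r * (c * smoothMul N s r') := by
      calc _ ≤ r' * smoothMul N s r' := h2
        _ ≤ (c * r) * smoothMul N s r' := by gcongr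
        _ = _ := by ring
    exact le_of_mul_le_mul_left this hr
  · have h2 := smoothMul_anti hN hs1 hr' h1
    have h3 := smoothMul_pos (s := s) hN hr'
    nlinarith

lemma continuousOn_smoothMul (hs1 : s < 1) :
    ContinuousOn (smoothMul N s) (Ioi 0) := by
  unfold smoothMul
  refine ContinuousOn.inf continuousOn_const (ContinuousOn.rpow_const ?_ ?_)
  · exact continuousOn_const.div continuousOn_id (fun x hx => ne_of_gt hx)
  · intro x _
    right; linarith

lemma continuous_smoothMul_jap (hs1 : s < 1) {n : ℕ} :
    Continuous (fun x : Rn n => smoothMul N s (jap x)) :=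
  (continuousOn_smoothMul hs1).comp_continuous continuous_jap (fun x => jap_pos x)

lemma continuous_smoothWt_jap (hs1 : s < 1) {n : ℕ} :
    Continuous (fun x : Rn n => smoothWt N s (jap x)) :=
  continuous_jap.mul (continuous_smoothMul_jap hs1)

end multiplier

/-! ### Kernel estimates in the plane -/

/-- The point of the plane with given coordinates. -/
def pt (x y : ℝ) : Rn 2 := !₂[x, y]

@[simp] lemma pt_zero (x y : ℝ) : pt x y 0 = x := rfl
@[simp] lemma pt_one (x y : ℝ) : pt x y 1 = y := rfl

lemma norm_sq_plane (b : Rn 2) : ‖b‖ ^ 2 = b 0 ^ 2 + b 1 ^ 2 := by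
  rw [EuclideanSpace.norm_sq_eq]
  simp

lemma inner_plane (b c : Rn 2) : ⟪b, c⟫ = b 0 * c 0 + b 1 * c 1 := by
  simp [PiLp.inner_apply, mul_comm]

lemma measurePreserving_pt : MeasurePreserving (fun p : ℝ × ℝ => pt p.1 p.2) := by
  have h1 := (volume_preserving_finTwoArrow ℝ).symm
  have h2 := PiLp.volume_preserving_toLp (Fin 2)
  have h3 := h2.comp h1
  have h4 : (fun p : ℝ × ℝ => pt p.1 p.2) = WithLp.toLp 2 ∘ ⇑MeasurableEquiv.finTwoArrow.symm := by
    ext p i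
    fin_cases i <;> rfl
  rw [h4]
  exact h3

lemma lintegral_plane {F : Rn 2 → ℝ≥0∞} (hF : Measurable F) :
    ∫⁻ b, F b = ∫⁻ x, ∫⁻ y, F (pt x y) := by
  rw [← measurePreserving_pt.lintegral_comp hF, Measure.volume_eq_prod, lintegral_prod]
  exact (hF.comp measurePreserving_pt.measurable).aemeasurable

lemma lintegral_plane' {F : Rn 2 → ℝ≥0∞} (hF : Measurable F) :
    ∫⁻ b, F b = ∫⁻ y, ∫⁻ x, F (pt x y) := by
  rw [lintegral_plane hF, lintegral_lintegral_swap]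
  exact (hF.comp measurePreserving_pt.measurable).aemeasurable

lemma measurable_pt : Measurable (fun p : ℝ × ℝ => pt p.1 p.2) := measurePreserving_pt.measurable

lemma abs_coord_le_norm (b : Rn 2) (i : Fin 2) : |b i| ≤ ‖b‖ := by
  have := PiLp.norm_apply_le b i
  simpa using this

lemma exists_large_coord (c : Rn 2) : ‖c‖ ≤ 2 * |c 0| ∨ ‖c‖ ≤ 2 * |c 1| := by
  by_contra! h
  have := norm_sq_plane c
  nlinarith [abs_nonneg (c 0), abs_nonneg (c 1), sq_abs (c 0), sq_abs (c 1), norm_nonneg c]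

/-- One-dimensional change of variables with a lower bound on the derivative. -/
lemma lintegral_comp_le_of_deriv {S : Set ℝ} (hS : MeasurableSet S) {h h' : ℝ → ℝ} {d : ℝ}
    (hd : 0 < d) (hh : ∀ x ∈ S, HasDerivAt h (h' x) x) (hinj : InjOn h S)
    (hlow : ∀ x ∈ S, d ≤ |h' x|) (k : ℝ → ℝ≥0∞) :
    ∫⁻ x in S, k (h x) ≤ (∫⁻ z, k z) / ENNReal.ofReal d := by
  rw [ENNReal.le_div_iff_mul_le (by simp [hd]) (by simp), mul_comm,
    ← lintegral_const_mul' _ _ ENNReal.ofReal_ne_top]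
  calc ∫⁻ x in S, ENNReal.ofReal d * k (h x)
      ≤ ∫⁻ x in S, ENNReal.ofReal |h' x| * k (h x) :=
        setLIntegral_mono' hS fun x hx => by gcongr; exact hlow x hx
    _ = ∫⁻ z in h '' S, k z :=
        (lintegral_image_eq_lintegral_abs_deriv_mul hS
          (fun x hx => (hh x hx).hasDerivWithinAt) hinj k).symm
    _ ≤ ∫⁻ z, k z := setLIntegral_le_lintegral _ _

lemma lintegral_comp_affine_le {a d : ℝ} (b : ℝ) (hd : 0 < d) (ha : d ≤ |a|) (k : ℝ → ℝ≥0∞) :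
    ∫⁻ x, k (b + a * x) ≤ (∫⁻ z, k z) / ENNReal.ofReal d := by
  have ha0 : a ≠ 0 := by rintro rfl; simp at ha; linarith
  have := lintegral_comp_le_of_deriv (S := univ) (h := fun x => b + a * x) (h' := fun _ => a)
    MeasurableSet.univ hd
    (fun x _ => by simpa using ((hasDerivAt_id x).const_mul a).const_add b)
    (fun x _ y _ hxy => by simpa [ha0] using hxy) (fun x _ => ha) k
  simpa using this

lemma japR_sq (x : ℝ) : japR x ^ 2 = 1 + x ^ 2 := by
  unfold japR
  exact Real.sq_sqrt (by positivity)

lemma one_le_japR (x : ℝ) : 1 ≤ japR x := by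
  unfold japR
  exact Real.one_le_sqrt.mpr (by nlinarith [sq_nonneg x])

lemma japR_pos (x : ℝ) : 0 < japR x := lt_of_lt_of_le one_pos (one_le_japR x)

lemma continuous_japR : Continuous japR := by
  unfold japR
  fun_prop

lemma japR_coord_le_jap (b : Rn 2) (i : Fin 2) : japR (b i) ≤ jap b := by
  unfold japR jap
  refine Real.sqrt_le_sqrt ?_
  have := abs_coord_le_norm b i
  have := sq_abs (b i)
  nlinarith [abs_nonneg (b i)]

lemma lintegral_japR_rpow_lt_top {r : ℝ} (hr : 1 < r) :
    ∫⁻ x, ENNReal.ofReal (japR x ^ (-r)) < ⊤ := by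
  have h := integrable_rpow_neg_one_add_norm_sq (E := ℝ) (μ := volume) (r := r) (by simpa using hr)
  have h2 : ∀ x : ℝ, japR x ^ (-r) = (1 + ‖x‖ ^ 2) ^ (-r / 2) := by
    intro x
    rw [japR, Real.sqrt_eq_rpow, ← Real.rpow_mul (by positivity)]
    congr 1
    · simp
    · ring
  simp_rw [h2]
  exact h.lintegral_lt_top

/-- A line-averaged kernel bound. -/
lemma exists_lintegral_line_le {r : ℝ} (hr : 1 < r) :
    ∃ C : ℝ≥0∞, C ≠ ⊤ ∧ ∀ (k : ℝ → ℝ≥0∞), Measurable k → ∀ (c : Rn 2) (μ : ℝ), c ≠ 0 →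
      ∫⁻ b, k (μ + 2 * ⟪b, c⟫) * ENNReal.ofReal (jap b ^ (-r))
        ≤ C * (∫⁻ z, k z) / ENNReal.ofReal ‖c‖ := by
  set I := ∫⁻ x, ENNReal.ofReal (japR x ^ (-r)) with hI
  refine ⟨I, (lintegral_japR_rpow_lt_top hr).ne, fun k hk c μ hc => ?_⟩
  have hm : Measurable fun b : Rn 2 => k (μ + 2 * ⟪b, c⟫) * ENNReal.ofReal (jap b ^ (-r)) :=
    (hk.comp (by fun_prop)).mul
      ((continuous_jap.measurable.pow_const _).ennreal_ofReal)
  have hw : ∀ (b : Rn 2) (i : Fin 2),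
      ENNReal.ofReal (jap b ^ (-r)) ≤ ENNReal.ofReal (japR (b i) ^ (-r)) := fun b i =>
    ENNReal.ofReal_le_ofReal
      (Real.rpow_le_rpow_of_nonpos (japR_pos _) (japR_coord_le_jap b i) (by linarith))
  have hc' : 0 < ‖c‖ := norm_pos_iff.mpr hc
  have hmJ : Measurable fun x => ENNReal.ofReal (japR x ^ (-r)) :=
    (continuous_japR.measurable.pow_const _).ennreal_ofReal
  rw [mul_div_assoc]
  rcases exists_large_coord c with h | h
  · rw [lintegral_plane' hm]
    calc ∫⁻ y, ∫⁻ x, k (μ + 2 * ⟪pt x y, c⟫) * ENNReal.ofReal (jap (pt x y) ^ (-r))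
        ≤ ∫⁻ y, ((∫⁻ z, k z) / ENNReal.ofReal ‖c‖) * ENNReal.ofReal (japR y ^ (-r)) := by
          refine lintegral_mono fun y => ?_
          calc _ ≤ ∫⁻ x, k ((μ + 2 * y * c 1) + (2 * c 0) * x) *
              ENNReal.ofReal (japR y ^ (-r)) := by
                refine lintegral_mono fun x => ?_
                refine mul_le_mul' (le_of_eq ?_) (hw (pt x y) 1)
                congr 1
                rw [inner_plane]; simp; ring
            _ = (∫⁻ x, k ((μ + 2 * y * c 1) + (2 * c 0) * x)) * ENNReal.ofReal (japR y ^ (-r)) :=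
                lintegral_mul_const' _ _ ENNReal.ofReal_ne_top
            _ ≤ _ := by
                gcongr
                exact lintegral_comp_affine_le _ hc' (by rw [abs_mul]; simpa using h) k
      _ = _ := by rw [lintegral_const_mul _ hmJ, mul_comm]
  · rw [lintegral_plane hm]
    calc ∫⁻ x, ∫⁻ y, k (μ + 2 * ⟪pt x y, c⟫) * ENNReal.ofReal (jap (pt x y) ^ (-r))
        ≤ ∫⁻ x, ((∫⁻ z, k z) / ENNReal.ofReal ‖c‖) * ENNReal.ofReal (japR x ^ (-r)) := by
          refine lintegral_mono fun x => ?_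
          calc _ ≤ ∫⁻ y, k ((μ + 2 * x * c 0) + (2 * c 1) * y) *
              ENNReal.ofReal (japR x ^ (-r)) := by
                refine lintegral_mono fun y => ?_
                refine mul_le_mul' (le_of_eq ?_) (hw (pt x y) 0)
                congr 1
                rw [inner_plane]; simp; ring
            _ = (∫⁻ y, k ((μ + 2 * x * c 0) + (2 * c 1) * y)) * ENNReal.ofReal (japR x ^ (-r)) :=
                lintegral_mul_const' _ _ ENNReal.ofReal_ne_top
            _ ≤ _ := by
                gcongr
                exact lintegral_comp_affine_le _ hc' (by rw [abs_mul]; simpa using h) k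
      _ = _ := by rw [lintegral_const_mul _ hmJ, mul_comm]

/-- One-dimensional convolution bound with an inverse square root singularity. -/
lemma exists_lintegral_inv_sqrt_le {r : ℝ} (hr : 1 / 2 < r) :
    ∃ C : ℝ≥0∞, C ≠ ⊤ ∧ ∀ x : ℝ,
      ∫⁻ e, ENNReal.ofReal (|e - x| ^ (-(1/2) : ℝ) * japR e ^ (-r)) ≤ C := by
  have hloc : IntegrableOn (fun u : ℝ => |u| ^ (-(1/2) : ℝ)) (Icc (-1) 1) := by
    have h0 : IntervalIntegrable (fun u : ℝ => |u| ^ (-(1/2) : ℝ)) volume 0 1 := by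
      refine (intervalIntegral.intervalIntegrable_rpow' (r := -(1/2)) (by norm_num)).congr ?_
      intro u hu
      rw [uIoc_of_le zero_le_one] at hu
      simp only [abs_of_pos hu.1]
    have h1 : IntervalIntegrable (fun u : ℝ => |u| ^ (-(1/2) : ℝ)) volume (-1) 0 := by
      rw [IntervalIntegrable.iff_comp_neg]
      simpa using h0.symm
    rw [integrableOn_Icc_iff_integrableOn_Ioc]
    exact (intervalIntegrable_iff_integrableOn_Ioc_of_le (by norm_num)).mp (h1.trans h0)
  have hm : Measurable fun u : ℝ => ENNReal.ofReal (|u| ^ (-(1/2) : ℝ)) := by fun_prop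
  set C1 := ∫⁻ u in Icc (-1 : ℝ) 1, ENNReal.ofReal (|u| ^ (-(1/2) : ℝ)) with hC1
  set C2 := ∫⁻ u, ENNReal.ofReal (japR u ^ (-(1/2 + r))) with hC2
  have hC1t : C1 ≠ ⊤ := hloc.lintegral_lt_top.ne
  have hC2t : C2 ≠ ⊤ := (lintegral_japR_rpow_lt_top (by linarith)).ne
  have hmJ : Measurable fun x => ENNReal.ofReal (japR x ^ (-(1/2 + r))) :=
    (continuous_japR.measurable.pow_const _).ennreal_ofReal
  refine ⟨C1 + (2 * C2 + C2 * 2), by finiteness, fun x => ?_⟩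
  have key : ∀ e : ℝ, ENNReal.ofReal (|e - x| ^ (-(1/2) : ℝ) * japR e ^ (-r)) ≤
      (Icc (-1 : ℝ) 1).indicator (fun u => ENNReal.ofReal (|u| ^ (-(1/2) : ℝ))) (e - x)
      + (2 * ENNReal.ofReal (japR (e - x) ^ (-(1/2 + r)))
      + ENNReal.ofReal (japR e ^ (-(1/2 + r))) * 2) := by
    intro e
    have hje := one_le_japR e
    have hju := one_le_japR (e - x)
    rcases le_or_gt |e - x| 1 with h | h
    · rw [indicator_of_mem (mem_Icc.mpr (abs_le.mp h))]
      refine le_add_right (ENNReal.ofReal_le_ofReal ?_)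
      exact mul_le_of_le_one_right (by positivity)
        (Real.rpow_le_one_of_one_le_of_nonpos hje (by linarith))
    · refine le_add_left ?_
      have h2 : japR (e - x) ≤ 2 * |e - x| := by
        have := japR_sq (e - x)
        rw [← sq_abs (e - x)] at this
        nlinarith
      have h3 : |e - x| ^ (-(1/2) : ℝ) ≤ 2 * japR (e - x) ^ (-(1/2) : ℝ) := by
        calc |e - x| ^ (-(1/2) : ℝ) ≤ (japR (e - x) / 2) ^ (-(1/2) : ℝ) :=
              Real.rpow_le_rpow_of_nonpos (by linarith) (by linarith) (by norm_num)
          _ = 2 ^ (1/2 : ℝ) * japR (e - x) ^ (-(1/2) : ℝ) := by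
              rw [Real.div_rpow (by linarith) (by norm_num), Real.rpow_neg zero_le_two]
              field_simp
          _ ≤ _ := by
              gcongr
              calc (2 : ℝ) ^ (1/2 : ℝ) ≤ 2 ^ (1 : ℝ) :=
                    Real.rpow_le_rpow_of_exponent_le (by norm_num) (by norm_num)
                _ = 2 := Real.rpow_one 2
      rcases le_total (japR (e - x)) (japR e) with h4 | h4
      · refine le_add_right ?_
        rw [← ENNReal.ofReal_ofNat, ← ENNReal.ofReal_mul (by norm_num)]
        refine ENNReal.ofReal_le_ofReal ?_
        rw [neg_add, Real.rpow_add (by linarith), ← mul_assoc]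
        have h5 : japR e ^ (-r) ≤ japR (e - x) ^ (-r) :=
          Real.rpow_le_rpow_of_nonpos (by linarith) h4 (by linarith)
        gcongr
      · refine le_add_left ?_
        rw [← ENNReal.ofReal_ofNat, ← ENNReal.ofReal_mul (by positivity)]
        refine ENNReal.ofReal_le_ofReal ?_
        rw [neg_add, Real.rpow_add (by linarith)]
        have h5 : japR (e - x) ^ (-(1/2) : ℝ) ≤ japR e ^ (-(1/2) : ℝ) :=
          Real.rpow_le_rpow_of_nonpos (by linarith) h4 (by norm_num)
        calc _ ≤ (2 * japR e ^ (-(1/2) : ℝ)) * japR e ^ (-r) := by gcongr; linarith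
          _ = _ := by ring
  refine (lintegral_mono key).trans ?_
  have e1 : ∫⁻ e, (Icc (-1 : ℝ) 1).indicator (fun u => ENNReal.ofReal (|u| ^ (-(1/2) : ℝ)))
      (e - x) = C1 := by
    rw [lintegral_sub_right_eq_self, lintegral_indicator measurableSet_Icc]
  have e2 : ∫⁻ e, ENNReal.ofReal (japR (e - x) ^ (-(1/2 + r))) = C2 :=
    lintegral_sub_right_eq_self (fun u => ENNReal.ofReal (japR u ^ (-(1/2 + r)))) x
  have m1 : Measurable fun e => (Icc (-1 : ℝ) 1).indicator
      (fun u => ENNReal.ofReal (|u| ^ (-(1/2) : ℝ))) (e - x) :=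
    (hm.indicator measurableSet_Icc).comp (measurable_id.sub_const x)
  have m2 : Measurable fun e => ENNReal.ofReal (japR (e - x) ^ (-(1/2 + r))) :=
    hmJ.comp (measurable_id.sub_const x)
  rw [lintegral_add_left m1, e1, lintegral_add_left (m2.const_mul 2),
    lintegral_const_mul 2 m2, lintegral_mul_const _ hmJ, e2]

lemma exists_lintegral_riesz_le {r : ℝ} (hr : 1 < r) :
    ∃ C : ℝ≥0∞, C ≠ ⊤ ∧ ∀ ξ : Rn 2,
      ∫⁻ e, ENNReal.ofReal (jap e ^ (-r)) / ENNReal.ofReal ‖ξ - e‖ ≤ C := by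
  obtain ⟨C, hC, h⟩ := exists_lintegral_inv_sqrt_le (r := r / 2) (by linarith)
  refine ⟨C * C, by finiteness, fun ξ => ?_⟩
  have hm : Measurable fun e : Rn 2 => ENNReal.ofReal (jap e ^ (-r)) / ENNReal.ofReal ‖ξ - e‖ :=
    (continuous_jap.measurable.pow_const _).ennreal_ofReal.div (by fun_prop)
  have key : ∀ x y : ℝ, x ≠ ξ 0 → y ≠ ξ 1 →
      ENNReal.ofReal (jap (pt x y) ^ (-r)) / ENNReal.ofReal ‖ξ - pt x y‖ ≤
        ENNReal.ofReal (|x - ξ 0| ^ (-(1/2) : ℝ) * japR x ^ (-(r / 2))) *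
        ENNReal.ofReal (|y - ξ 1| ^ (-(1/2) : ℝ) * japR y ^ (-(r / 2))) := by
    intro x y hx hy
    have h0 : 0 < |x - ξ 0| := abs_pos.mpr (sub_ne_zero.mpr hx)
    have h1 : 0 < |y - ξ 1| := abs_pos.mpr (sub_ne_zero.mpr hy)
    have hn0 : |x - ξ 0| ≤ ‖ξ - pt x y‖ := by
      have := abs_coord_le_norm (ξ - pt x y) 0
      rwa [PiLp.sub_apply, pt_zero, abs_sub_comm] at this
    have hn1 : |y - ξ 1| ≤ ‖ξ - pt x y‖ := by
      have := abs_coord_le_norm (ξ - pt x y) 1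
      rwa [PiLp.sub_apply, pt_one, abs_sub_comm] at this
    have hn : 0 < ‖ξ - pt x y‖ := h0.trans_le hn0
    have hj0 : japR x ≤ jap (pt x y) := japR_coord_le_jap (pt x y) 0
    have hj1 : japR y ≤ jap (pt x y) := japR_coord_le_jap (pt x y) 1
    have px := japR_pos x
    have py := japR_pos y
    have pj := jap_pos (pt x y)
    rw [← ENNReal.ofReal_div_of_pos hn, ← ENNReal.ofReal_mul (by positivity)]
    refine ENNReal.ofReal_le_ofReal ?_
    have e1 : jap (pt x y) ^ (-r) ≤ japR x ^ (-(r / 2)) * japR y ^ (-(r / 2)) := by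
      rw [show -r = -(r / 2) + -(r / 2) by ring, Real.rpow_add pj]
      have a1 := Real.rpow_le_rpow_of_nonpos px hj0 (z := -(r / 2)) (by linarith)
      have a2 := Real.rpow_le_rpow_of_nonpos py hj1 (z := -(r / 2)) (by linarith)
      gcongr
    have e2 : ‖ξ - pt x y‖⁻¹ ≤ |x - ξ 0| ^ (-(1/2) : ℝ) * |y - ξ 1| ^ (-(1/2) : ℝ) := by
      rw [← Real.rpow_neg_one, show (-1 : ℝ) = -(1/2) + -(1/2) by ring, Real.rpow_add hn]
      have a1 := Real.rpow_le_rpow_of_nonpos h0 hn0 (z := -(1 / 2)) (by norm_num)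
      have a2 := Real.rpow_le_rpow_of_nonpos h1 hn1 (z := -(1 / 2)) (by norm_num)
      gcongr
    rw [div_eq_mul_inv]
    calc _ ≤ (japR x ^ (-(r / 2)) * japR y ^ (-(r / 2))) *
        (|x - ξ 0| ^ (-(1/2) : ℝ) * |y - ξ 1| ^ (-(1/2) : ℝ)) := by gcongr
      _ = _ := by ring
  rw [lintegral_plane hm]
  have ae : ∀ z : ℝ, ∀ᵐ x : ℝ, x ≠ z := fun z => by simp [ae_iff, measure_singleton]
  calc _ ≤ ∫⁻ x, ENNReal.ofReal (|x - ξ 0| ^ (-(1/2) : ℝ) * japR x ^ (-(r / 2))) * C := by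
        refine lintegral_mono_ae ?_
        filter_upwards [ae (ξ 0)] with x hx
        calc _ ≤ ∫⁻ y, ENNReal.ofReal (|x - ξ 0| ^ (-(1/2) : ℝ) * japR x ^ (-(r / 2))) *
              ENNReal.ofReal (|y - ξ 1| ^ (-(1/2) : ℝ) * japR y ^ (-(r / 2))) := by
              refine lintegral_mono_ae ?_
              filter_upwards [ae (ξ 1)] with y hy
              exact key x y hx hy
          _ ≤ _ := by
              rw [lintegral_const_mul' _ _ ENNReal.ofReal_ne_top]
              gcongr
              exact h _
    _ ≤ _ := by
        rw [lintegral_mul_const' _ _ hC]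
        gcongr
        exact h _

/-- The resonance function of the cubic interaction. -/
def phase (ξ a b : Rn 2) : ℝ := ‖ξ‖ ^ 2 - ‖a‖ ^ 2 + ‖b‖ ^ 2 - ‖ξ - a + b‖ ^ 2

lemma phase_eq (ξ a b : Rn 2) : phase ξ a b = 2 * ⟪ξ - a, a - b⟫ := by
  unfold phase
  simp only [norm_sq_plane, inner_plane, PiLp.sub_apply, PiLp.add_apply]
  ring

lemma phase_eq' (ξ a d : Rn 2) : phase ξ a (d - (ξ - a)) = 2 * ⟪ξ - a, ξ - d⟫ := by
  rw [phase_eq]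
  congr 2
  abel

lemma continuous_phase : Continuous fun q : Rn 2 × Rn 2 × Rn 2 => phase q.1 q.2.1 q.2.2 := by
  unfold phase
  fun_prop

/-- The Sobolev weight of negative order on the Fourier side. -/
def jw (r : ℝ) (x : Rn 2) : ℝ≥0∞ := ENNReal.ofReal (jap x ^ (-r))

lemma measurable_jw (r : ℝ) : Measurable (jw r) :=
  (continuous_jap.measurable.pow_const _).ennreal_ofReal

lemma jw_ne_top (r : ℝ) (x : Rn 2) : jw r x ≠ ⊤ := ENNReal.ofReal_ne_top

lemma ae_ne_plane (z : Rn 2) : ∀ᵐ x : Rn 2, x ≠ z := by simp [ae_iff, measure_singleton]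

lemma exists_lintegral_phase_pair {r : ℝ} (hr : 1 < r) :
    ∃ C : ℝ≥0∞, C ≠ ⊤ ∧ ∀ (k : ℝ → ℝ≥0∞), Measurable k → ∀ (ξ : Rn 2) (μ : ℝ),
      (∫⁻ a, ∫⁻ b, k (μ - phase ξ a b) * (jw r a * jw r b) ≤ C * ∫⁻ z, k z) ∧
      (∫⁻ a, ∫⁻ d, k (μ - phase ξ a (d - (ξ - a))) * (jw r a * jw r d) ≤ C * ∫⁻ z, k z) := by
  obtain ⟨C1, hC1, h1⟩ := exists_lintegral_line_le hr
  obtain ⟨C2, hC2, h2⟩ := exists_lintegral_riesz_le hr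
  have main : ∀ (k : ℝ → ℝ≥0∞), Measurable k → ∀ (ξ : Rn 2) (ν : Rn 2 → ℝ),
      ∫⁻ a, ∫⁻ b, k (ν a + 2 * ⟪b, ξ - a⟫) * (jw r a * jw r b) ≤ C1 * C2 * ∫⁻ z, k z := by
    intro k hk ξ ν
    calc _ ≤ ∫⁻ a, (C1 * ∫⁻ z, k z) * (jw r a / ENNReal.ofReal ‖ξ - a‖) := by
          refine lintegral_mono_ae ?_
          filter_upwards [ae_ne_plane ξ] with a ha
          calc _ = jw r a * ∫⁻ b, k (ν a + 2 * ⟪b, ξ - a⟫) * jw r b := by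
                rw [← lintegral_const_mul' _ _ (jw_ne_top r a)]
                exact lintegral_congr fun b => by ring
            _ ≤ jw r a * (C1 * (∫⁻ z, k z) / ENNReal.ofReal ‖ξ - a‖) := by
                gcongr
                exact h1 k hk _ _ (sub_ne_zero.mpr ha.symm)
            _ = _ := by simp only [div_eq_mul_inv]; ring
      _ = (C1 * ∫⁻ z, k z) * ∫⁻ a, (jw r a / ENNReal.ofReal ‖ξ - a‖) := by
          refine lintegral_const_mul _ ?_
          exact (measurable_jw r).div (by fun_prop)
      _ ≤ (C1 * ∫⁻ z, k z) * C2 := by gcongr; exact h2 ξ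
      _ = _ := by ring
  refine ⟨C1 * C2, by finiteness, fun k hk ξ μ => ⟨?_, ?_⟩⟩
  · convert main k hk ξ (fun a => μ - 2 * ⟪ξ - a, a⟫) using 6 with a b
    rw [phase_eq, inner_sub_right, real_inner_comm b]
    ring_nf
  · convert main k hk ξ (fun a => μ - 2 * ⟪ξ - a, ξ⟫) using 6 with a b
    rw [phase_eq', inner_sub_right, real_inner_comm b]
    ring_nf

lemma lintegral_quadratic_le {σ c ν : ℝ} (hσ : σ = 1 ∨ σ = -1) (hc : c ≠ 0) (k : ℝ → ℝ≥0∞) :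
    ∫⁻ x in {x : ℝ | |x| ≤ |c| / 4}, k (σ * x ^ 2 + (c - x) ^ 2 + ν)
      ≤ (∫⁻ z, k z) / ENNReal.ofReal |c| := by
  have hc0 : 0 < |c| := abs_pos.mpr hc
  have hsum : ∀ z : ℝ, |z| ≤ |c| / 2 → |c| ≤ |(1 + σ) * z - 2 * c| := by
    intro z hz
    have h1 : |(1 + σ) * z| ≤ |c| := by
      rcases hσ with rfl | rfl
      · rw [abs_mul]; norm_num; linarith
      · simp
    have h2 := abs_sub_abs_le_abs_sub (2 * c) ((1 + σ) * z)
    rw [abs_sub_comm, abs_mul 2 c, abs_two] at h2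
    linarith
  refine lintegral_comp_le_of_deriv (h' := fun x => (1 + σ) * (2 * x) - 2 * c)
    (measurableSet_le (by fun_prop) (by fun_prop)) hc0 ?_ ?_ ?_ k
  · intro x _
    have h1 : HasDerivAt (fun x : ℝ => σ * x ^ 2 + (c - x) ^ 2 + ν)
        (σ * (2 * x) + 2 * (c - x) * (-1)) x := by
      have a := ((hasDerivAt_id x).pow 2).const_mul σ
      have b := ((hasDerivAt_id x).const_sub c).pow 2
      simpa using (a.add b).add_const ν
    convert h1 using 1
    ring
  · intro x hx y hy hxy
    simp only [mem_ofPred_eq] at hx hy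
    have h1 : (x - y) * ((1 + σ) * (x + y) - 2 * c) = 0 := by
      simp only at hxy
      linear_combination hxy
    rcases mul_eq_zero.mp h1 with h | h
    · linarith
    · have := hsum (x + y) ((abs_add_le x y).trans (by linarith))
      rw [h, abs_zero] at this
      linarith
  · intro x hx
    simp only [mem_ofPred_eq] at hx
    refine hsum (2 * x) ?_
    rw [abs_mul, abs_two]; linarith

lemma exists_lintegral_transversal_le {r : ℝ} (hr : 1 < r) :
    ∃ C : ℝ≥0∞, C ≠ ⊤ ∧ ∀ (k : ℝ → ℝ≥0∞), Measurable k → ∀ (σ : ℝ), (σ = 1 ∨ σ = -1) →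
      ∀ (c : Rn 2) (ν : ℝ),
      ∫⁻ b in {b | 13 * jap b ≤ jap c}, k (σ * ‖b‖ ^ 2 + ‖c - b‖ ^ 2 + ν) * jw r b
        ≤ C * (∫⁻ z, k z) / ENNReal.ofReal (jap c) := by
  set I := ∫⁻ x, ENNReal.ofReal (japR x ^ (-r)) with hI
  refine ⟨I * 3, ENNReal.mul_ne_top (lintegral_japR_rpow_lt_top hr).ne (by simp),
    fun k hk σ hσ c ν => ?_⟩
  have hcp := jap_pos c
  rcases lt_or_ge (jap c) 13 with hc13 | hc13
  · have : {b : Rn 2 | 13 * jap b ≤ jap c} = ∅ := by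
      ext b
      simp only [mem_ofPred_eq, mem_empty_iff_false, iff_false, not_le]
      linarith [one_le_jap b]
    simp [this]
  have hcn : (4 / 5) * jap c ≤ ‖c‖ := by
    have := jap_sq c
    nlinarith [norm_nonneg c]
  have hS : MeasurableSet {b : Rn 2 | 13 * jap b ≤ jap c} :=
    measurableSet_le (continuous_jap.measurable.const_mul _) measurable_const
  set F : Rn 2 → ℝ≥0∞ := fun b => k (σ * ‖b‖ ^ 2 + ‖c - b‖ ^ 2 + ν) * jw r b with hF
  have hm : Measurable ({b : Rn 2 | 13 * jap b ≤ jap c}.indicator F) :=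
    ((hk.comp (by fun_prop)).mul (measurable_jw r)).indicator hS
  have hw : ∀ (b : Rn 2) (i : Fin 2), jw r b ≤ ENNReal.ofReal (japR (b i) ^ (-r)) := fun b i =>
    ENNReal.ofReal_le_ofReal
      (Real.rpow_le_rpow_of_nonpos (japR_pos _) (japR_coord_le_jap b i) (by linarith))
  have hmJ : Measurable fun x => ENNReal.ofReal (japR x ^ (-r)) :=
    (continuous_japR.measurable.pow_const _).ennreal_ofReal
  have hinv : ∀ x : ℝ, ‖c‖ ≤ 2 * |x| → x ≠ 0 ∧
      (∫⁻ z, k z) / ENNReal.ofReal |x| ≤ 3 * (∫⁻ z, k z) / ENNReal.ofReal (jap c) := by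
    intro x hx
    have hx0 : 0 < |x| := by linarith
    refine ⟨abs_pos.mp hx0, ?_⟩
    rw [ENNReal.div_le_iff (by simpa using hx0) (by simp), ← ENNReal.mul_div_right_comm,
      ENNReal.le_div_iff_mul_le (by simp [hcp]) (by simp)]
    calc (∫⁻ z, k z) * ENNReal.ofReal (jap c) ≤ (∫⁻ z, k z) * ENNReal.ofReal (3 * |x|) := by
          gcongr; linarith
      _ = _ := by rw [ENNReal.ofReal_mul (by norm_num), ENNReal.ofReal_ofNat]; ring
  have hcoord : ∀ (b : Rn 2) (i : Fin 2), ‖c‖ ≤ 2 * |c i| → 13 * jap b ≤ jap c →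
      |b i| ≤ |c i| / 4 := by
    intro b i h1 h2
    have := abs_coord_le_norm b i
    have := norm_le_jap b
    linarith
  have hSm : ∀ x : ℝ, MeasurableSet {y : ℝ | |y| ≤ |x| / 4} := fun x =>
    measurableSet_le (by fun_prop) (by fun_prop)
  rw [← lintegral_indicator hS]
  rcases exists_large_coord c with h | h
  · obtain ⟨hx0, hx1⟩ := hinv _ h
    rw [lintegral_plane' hm]
    calc _ ≤ ∫⁻ y, (3 * (∫⁻ z, k z) / ENNReal.ofReal (jap c)) * ENNReal.ofReal (japR y ^ (-r)) := by
          refine lintegral_mono fun y => ?_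
          calc _ ≤ ∫⁻ x, {x : ℝ | |x| ≤ |c 0| / 4}.indicator (fun x => k (σ * x ^ 2 + (c 0 - x) ^ 2
                + (σ * y ^ 2 + (c 1 - y) ^ 2 + ν))) x * ENNReal.ofReal (japR y ^ (-r)) := by
                refine lintegral_mono fun x => indicator_apply_le' (fun hb => ?_) (fun _ => zero_le)
                have := hcoord (pt x y) 0 h hb
                rw [indicator_of_mem (by simpa using this)]
                refine mul_le_mul' (le_of_eq ?_) (hw (pt x y) 1)
                congr 1
                simp only [norm_sq_plane, PiLp.sub_apply, pt_zero, pt_one]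
                ring
            _ ≤ _ := by
                rw [lintegral_mul_const' _ _ ENNReal.ofReal_ne_top, lintegral_indicator (hSm _)]
                gcongr
                exact (lintegral_quadratic_le hσ hx0 k).trans hx1
      _ = _ := by rw [lintegral_const_mul _ hmJ]; simp only [div_eq_mul_inv]; ring
  · obtain ⟨hx0, hx1⟩ := hinv _ h
    rw [lintegral_plane hm]
    calc _ ≤ ∫⁻ x, (3 * (∫⁻ z, k z) / ENNReal.ofReal (jap c)) * ENNReal.ofReal (japR x ^ (-r)) := by
          refine lintegral_mono fun x => ?_
          calc _ ≤ ∫⁻ y, {y : ℝ | |y| ≤ |c 1| / 4}.indicator (fun y => k (σ * y ^ 2 + (c 1 - y) ^ 2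
                + (σ * x ^ 2 + (c 0 - x) ^ 2 + ν))) y * ENNReal.ofReal (japR x ^ (-r)) := by
                refine lintegral_mono fun y => indicator_apply_le' (fun hb => ?_) (fun _ => zero_le)
                have := hcoord (pt x y) 1 h hb
                rw [indicator_of_mem (by simpa using this)]
                refine mul_le_mul' (le_of_eq ?_) (hw (pt x y) 0)
                congr 1
                simp only [norm_sq_plane, PiLp.sub_apply, pt_zero, pt_one]
                ring
            _ ≤ _ := by
                rw [lintegral_mul_const' _ _ ENNReal.ofReal_ne_top, lintegral_indicator (hSm _)]
                gcongr
                exact (lintegral_quadratic_le hσ hx0 k).trans hx1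
      _ = _ := by rw [lintegral_const_mul _ hmJ]; simp only [div_eq_mul_inv]; ring

lemma lintegral_radial_le (k : ℝ → ℝ≥0∞) (hk : Measurable k) (ν : ℝ) :
    ∫⁻ b : Rn 2, k (2 * ‖b‖ ^ 2 + ν) ≤ ENNReal.ofReal (2 * Real.pi) * ∫⁻ z, k z := by
  have hm : Measurable fun b : Rn 2 => k (2 * ‖b‖ ^ 2 + ν) := hk.comp (by fun_prop)
  rw [← measurePreserving_pt.lintegral_comp hm, ← lintegral_comp_polarCoord_symm,
    polarCoord_target, Measure.volume_eq_prod, setLIntegral_prod]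
  · have e : ∀ r θ : ℝ, ENNReal.ofReal r • k (2 * ‖pt (polarCoord.symm (r, θ)).1
        (polarCoord.symm (r, θ)).2‖ ^ 2 + ν) = ENNReal.ofReal r * k (2 * r ^ 2 + ν) := by
      intro r θ
      rw [norm_sq_plane, smul_eq_mul]
      congr 2
      simp only [polarCoord_symm_apply, pt_zero, pt_one]
      linear_combination (2 * r ^ 2) * Real.sin_sq_add_cos_sq θ
    rw [lintegral_congr fun x => lintegral_congr fun y => e x y]
    simp only [lintegral_const, Measure.restrict_apply MeasurableSet.univ, univ_inter,
      Real.volume_Ioo]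
    rw [lintegral_mul_const' _ _ ENNReal.ofReal_ne_top, mul_comm]
    refine mul_le_mul' (ENNReal.ofReal_le_ofReal (by linarith)) ?_
    have h := lintegral_image_eq_lintegral_abs_deriv_mul (measurableSet_Ioi (a := (0:ℝ)))
      (f := fun r => 2 * r ^ 2 + ν) (f' := fun r => 4 * r) ?_ ?_ k
    · calc _ ≤ ∫⁻ x in Ioi 0, ENNReal.ofReal |4 * x| * k (2 * x ^ 2 + ν) := by
            refine setLIntegral_mono' measurableSet_Ioi fun x hx => ?_
            gcongr
            rw [mem_Ioi] at hx
            rw [abs_of_pos (by linarith)]; linarith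
        _ = _ := h.symm
        _ ≤ _ := setLIntegral_le_lintegral _ _
    · intro x _
      have a : HasDerivAt (fun r : ℝ => 2 * r ^ 2 + ν) (2 * (2 * x)) x := by
        simpa using (((hasDerivAt_id x).pow 2).const_mul 2).add_const ν
      rw [← mul_assoc, show (2 * 2 : ℝ) = 4 by norm_num] at a
      exact a.hasDerivWithinAt
    · intro x hx y hy hxy
      simp only [mem_Ioi] at hx hy hxy
      nlinarith
  · refine (Measurable.smul (f := fun p : ℝ × ℝ => ENNReal.ofReal p.1) (by fun_prop)
      ?_).aemeasurable
    exact (hm.comp measurable_pt).comp continuous_polarCoord_symm.measurable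

lemma lintegral_circle_le (k : ℝ → ℝ≥0∞) (hk : Measurable k) (c : Rn 2) (ν : ℝ) :
    ∫⁻ b : Rn 2, k (‖b‖ ^ 2 + ‖c - b‖ ^ 2 + ν) ≤ ENNReal.ofReal (2 * Real.pi) * ∫⁻ z, k z := by
  rw [← lintegral_add_right_eq_self _ ((1/2 : ℝ) • c)]
  refine le_trans (le_of_eq (lintegral_congr fun b => ?_))
    (lintegral_radial_le k hk (‖c‖ ^ 2 / 2 + ν))
  congr 1
  simp only [norm_sq_plane, PiLp.sub_apply, PiLp.add_apply, PiLp.smul_apply, smul_eq_mul]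
  ring

/-! ### Oscillatory integrals -/

/-- The Fourier transform of the Gaussian time cutoff. -/
def gaussKer (z : ℝ) : ℝ≥0∞ := ENNReal.ofReal (Real.sqrt Real.pi * Real.exp (-z ^ 2 / 4))

lemma measurable_gaussKer : Measurable gaussKer := by
  unfold gaussKer
  fun_prop

lemma gaussKer_neg (z : ℝ) : gaussKer (-z) = gaussKer z := by simp [gaussKer]

lemma lintegral_gaussKer_lt_top : ∫⁻ z, gaussKer z < ⊤ := by
  unfold gaussKer
  refine Integrable.lintegral_lt_top (Integrable.const_mul ?_ _)
  convert integrable_exp_neg_mul_sq (b := 1/4) (by norm_num) using 3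
  ring

lemma integral_gaussian_osc (z : ℝ) :
    ‖∫ t : ℝ, cexp (I * z * t) * cexp (-t ^ 2)‖ₑ = gaussKer z := by
  have h := fourierIntegral_gaussian (b := 1) (by simp) (z : ℂ)
  simp only [neg_mul, one_mul, div_one, mul_one] at h
  rw [h, ← ofReal_norm, norm_mul]
  unfold gaussKer
  congr 2
  · rw [show (1 / 2 : ℂ) = ((1/2 : ℝ) : ℂ) by push_cast; rfl,
      Complex.norm_cpow_real, Complex.norm_real, Real.norm_of_nonneg Real.pi_pos.le,
      Real.sqrt_eq_rpow]
  · rw [Complex.norm_exp]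
    congr 1
    norm_cast

lemma norm_exp_I_mul_real (x : ℝ) : ‖cexp (I * x)‖ = 1 := by
  rw [mul_comm]; exact Complex.norm_exp_ofReal_mul_I x

lemma norm_exp_I_mul_real_mul (x y : ℝ) : ‖cexp (I * x * y)‖ = 1 := by
  rw [mul_assoc, ← Complex.ofReal_mul]; exact norm_exp_I_mul_real _

lemma ennreal_mul_le_sq_add_sq (a b : ℝ≥0∞) : a * b ≤ a ^ 2 + b ^ 2 := by
  rcases le_total a b with h | h
  · exact le_add_left (by rw [sq]; gcongr)
  · exact le_add_right (by rw [sq]; gcongr)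

section osc
variable {P : Type*} [MeasurableSpace P] {ν : Measure P} [SFinite ν]

lemma lintegral_gaussian_osc_sq_le {F : P → ℂ} {φ : P → ℝ} (hF : Integrable F ν)
    (hφ : Measurable φ) :
    ∫⁻ t : ℝ, ENNReal.ofReal (Real.exp (-t ^ 2)) * ‖∫ p, cexp (I * φ p * t) * F p ∂ν‖ₑ ^ 2
      ≤ ∫⁻ q, gaussKer (φ q.1 - φ q.2) * (‖F q.1‖ₑ * ‖F q.2‖ₑ) ∂(ν.prod ν) := by
  set G : P × P → ℂ := fun q => F q.1 * conj (F q.2) with hG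
  have hGi : Integrable G (ν.prod ν) := hF.mul_prod (hF.norm.congr' (by
    exact (continuous_star.comp_aestronglyMeasurable hF.1)) (by simp))
  have hgi : Integrable (fun t : ℝ => cexp (-t ^ 2)) := by
    have := integrable_cexp_neg_mul_sq (b := 1) (by simp)
    simpa using this
  have hosc : ∀ t : ℝ, (∫ p, cexp (I * φ p * t) * F p ∂ν) *
      conj (∫ p, cexp (I * φ p * t) * F p ∂ν) =
      ∫ q, cexp (I * (φ q.1 - φ q.2 : ℝ) * t) * G q ∂(ν.prod ν) := by
    intro t
    rw [← integral_conj, ← integral_prod_mul]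
    refine integral_congr_ae (Filter.Eventually.of_forall fun q => ?_)
    simp only [hG, map_mul]
    rw [← Complex.exp_conj]
    simp only [map_mul, Complex.conj_I, Complex.conj_ofReal]
    rw [show cexp (I * ↑(φ q.1 - φ q.2) * ↑t) = cexp (I * φ q.1 * t) * cexp (-I * φ q.2 * t) by
      rw [← Complex.exp_add]; congr 1; push_cast; ring]
    ring
  have hprod : Integrable (fun z : ℝ × P × P => cexp (I * (φ z.2.1 - φ z.2.2 : ℝ) * z.1) *
      (cexp (-z.1 ^ 2) * G z.2)) (volume.prod (ν.prod ν)) := by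
    refine (hgi.mul_prod hGi).bdd_mul (c := 1) ?_ ?_
    · refine Measurable.aestronglyMeasurable ?_
      fun_prop
    · exact Filter.Eventually.of_forall fun z => (norm_exp_I_mul_real_mul _ _).le
  have hsq : ∀ t : ℝ, ENNReal.ofReal (Real.exp (-t ^ 2)) * ‖∫ p, cexp (I * φ p * t) * F p ∂ν‖ₑ ^ 2
      = ENNReal.ofReal (Real.exp (-t ^ 2) * ‖∫ p, cexp (I * φ p * t) * F p ∂ν‖ ^ 2) := by
    intro t
    rw [ENNReal.ofReal_mul (Real.exp_pos _).le, ENNReal.ofReal_pow (norm_nonneg _), ofReal_norm]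
  have hre : ∀ t : ℝ, ((Real.exp (-t ^ 2) * ‖∫ p, cexp (I * φ p * t) * F p ∂ν‖ ^ 2 : ℝ) : ℂ)
      = ∫ q, cexp (I * (φ q.1 - φ q.2 : ℝ) * t) * (cexp (-t ^ 2) * G q) ∂(ν.prod ν) := by
    intro t
    push_cast
    rw [← Complex.mul_conj', hosc, ← integral_const_mul]
    refine integral_congr_ae (Filter.Eventually.of_forall fun q => ?_)
    push_cast
    ring
  have hintg : Integrable (fun t : ℝ => Real.exp (-t ^ 2) * ‖∫ p, cexp (I * φ p * t) *
      F p ∂ν‖ ^ 2) := by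
    have := hprod.integral_prod_left
    simp only at this
    have h2 := this.re
    refine h2.congr (Filter.Eventually.of_forall fun t => ?_)
    simp only
    rw [← hre t, RCLike.re_to_complex, Complex.ofReal_re]
  simp_rw [hsq]
  rw [← ofReal_integral_eq_lintegral_ofReal hintg
    (Filter.Eventually.of_forall fun t => by positivity)]
  have h0 : ‖((∫ t : ℝ, Real.exp (-t ^ 2) * ‖∫ p, cexp (I * φ p * t) * F p ∂ν‖ ^ 2 : ℝ) : ℂ)‖ₑ =
      ENNReal.ofReal (∫ t : ℝ, Real.exp (-t ^ 2) * ‖∫ p, cexp (I * φ p * t) * F p ∂ν‖ ^ 2) := by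
    rw [← ofReal_norm, Complex.norm_real, Real.norm_of_nonneg
      (integral_nonneg fun t => by positivity)]
  rw [← h0, ← integral_complex_ofReal]
  simp_rw [hre]
  rw [integral_integral_swap hprod]
  refine (enorm_integral_le_lintegral_enorm _).trans (lintegral_mono fun q => ?_)
  have : ∫ t : ℝ, cexp (I * (φ q.1 - φ q.2 : ℝ) * t) * (cexp (-t ^ 2) * G q)
      = (∫ t : ℝ, cexp (I * (φ q.1 - φ q.2 : ℝ) * t) * cexp (-t ^ 2)) * G q := by
    rw [← integral_mul_const]
    simp only [mul_assoc]
  rw [this, enorm_mul, integral_gaussian_osc, hG]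
  simp [enorm_mul]

lemma lintegral_gaussian_osc_schur {F : P → ℂ} {φ : P → ℝ} (hF : Integrable F ν)
    (hφ : Measurable φ) {u g : P → ℝ≥0∞} (hu : Measurable u) (hg : Measurable g)
    (hFu : ∀ p, ‖F p‖ₑ ≤ u p * g p) {A : ℝ≥0∞}
    (hA : ∀ μ, ∫⁻ p, gaussKer (μ - φ p) * u p ^ 2 ∂ν ≤ A) :
    ∫⁻ t : ℝ, ENNReal.ofReal (Real.exp (-t ^ 2)) * ‖∫ p, cexp (I * φ p * t) * F p ∂ν‖ₑ ^ 2
      ≤ 2 * A * ∫⁻ p, g p ^ 2 ∂ν := by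
  refine (lintegral_gaussian_osc_sq_le hF hφ).trans ?_
  have mk := measurable_gaussKer
  have half : ∫⁻ q, gaussKer (φ q.1 - φ q.2) * (g q.1 ^ 2 * u q.2 ^ 2) ∂(ν.prod ν)
      ≤ A * ∫⁻ p, g p ^ 2 ∂ν := by
    rw [lintegral_prod _ (by fun_prop), mul_comm, ← lintegral_mul_const _ (by fun_prop)]
    refine lintegral_mono fun x => ?_
    calc _ = ∫⁻ y, g x ^ 2 * (gaussKer (φ x - φ y) * u y ^ 2) ∂ν :=
          lintegral_congr fun y => by ring
      _ = g x ^ 2 * ∫⁻ y, (gaussKer (φ x - φ y) * u y ^ 2) ∂ν :=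
          lintegral_const_mul _ (by fun_prop)
      _ ≤ _ := by gcongr; exact hA _
  calc _ ≤ ∫⁻ q, (gaussKer (φ q.1 - φ q.2) * (g q.1 ^ 2 * u q.2 ^ 2) +
        gaussKer (φ q.1 - φ q.2) * (u q.1 ^ 2 * g q.2 ^ 2)) ∂(ν.prod ν) := by
        refine lintegral_mono fun q => ?_
        rw [← mul_add]
        gcongr
        calc ‖F q.1‖ₑ * ‖F q.2‖ₑ ≤ (u q.1 * g q.1) * (u q.2 * g q.2) := by gcongr <;> exact hFu _
          _ = (g q.1 * u q.2) * (u q.1 * g q.2) := by ring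
          _ ≤ _ := by
              simp only [← mul_pow]
              exact ennreal_mul_le_sq_add_sq _ _
    _ = (∫⁻ q, gaussKer (φ q.1 - φ q.2) * (g q.1 ^ 2 * u q.2 ^ 2) ∂(ν.prod ν)) +
        ∫⁻ q, gaussKer (φ q.1 - φ q.2) * (u q.1 ^ 2 * g q.2 ^ 2) ∂(ν.prod ν) :=
        lintegral_add_left (by fun_prop) _
    _ = (∫⁻ q, gaussKer (φ q.1 - φ q.2) * (g q.1 ^ 2 * u q.2 ^ 2) ∂(ν.prod ν)) +
        ∫⁻ q, gaussKer (φ q.1 - φ q.2) * (g q.1 ^ 2 * u q.2 ^ 2) ∂(ν.prod ν) := by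
        congr 1
        rw [← lintegral_prod_swap]
        refine lintegral_congr fun q => ?_
        simp only [Prod.fst_swap, Prod.snd_swap]
        rw [← gaussKer_neg, neg_sub]
        ring
    _ ≤ _ := by rw [two_mul, add_mul]; gcongr

end osc

/-! ### Trilinear operators -/

/-- The polynomially decaying profile of order `n`. -/
def decay (n : ℕ) (x : Rn 2) : ℝ := (jap x ^ n)⁻¹

lemma decay_pos (n : ℕ) (x : Rn 2) : 0 < decay n x := inv_pos.mpr (pow_pos (jap_pos x) n)

lemma decay_le_one (n : ℕ) (x : Rn 2) : decay n x ≤ 1 :=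
  inv_le_one_of_one_le₀ (one_le_pow₀ (one_le_jap x))

lemma continuous_decay (n : ℕ) : Continuous (decay n) :=
  (continuous_jap.pow n).inv₀ fun x => (pow_pos (jap_pos x) n).ne'

lemma decay_anti {m n : ℕ} (h : m ≤ n) (x : Rn 2) : decay n x ≤ decay m x := by
  unfold decay
  have := jap_pos x
  have := one_le_jap x
  gcongr

lemma jap_pow_mul_decay {m n : ℕ} (x : Rn 2) : jap x ^ m * decay (m + n) x = decay n x := by
  unfold decay
  have := jap_pos x
  rw [pow_add]
  field_simp

lemma integrable_decay {n : ℕ} (hn : 3 ≤ n) : Integrable (decay n) := by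
  have h := integrable_rpow_neg_one_add_norm_sq (E := Rn 2) (μ := volume) (r := 3)
    (by simp; norm_num)
  refine h.mono' (continuous_decay n).aestronglyMeasurable (Filter.Eventually.of_forall fun x => ?_)
  rw [Real.norm_of_nonneg (decay_pos n x).le]
  refine (decay_anti hn x).trans (le_of_eq ?_)
  unfold decay jap
  rw [← Real.rpow_natCast, Real.sqrt_eq_rpow, ← Real.rpow_mul (by positivity),
    ← Real.rpow_neg (by positivity)]
  norm_num

/-- Continuous functions with decay of order eight. -/
def Rapid (C : ℝ) (f : Rn 2 → ℂ) : Prop := Continuous f ∧ ∀ x, ‖f x‖ ≤ C * decay 8 x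

lemma Rapid.integrable {C : ℝ} {f : Rn 2 → ℂ} (h : Rapid C f) : Integrable f :=
  ((integrable_decay (n := 8) (by norm_num)).const_mul C).mono' h.1.aestronglyMeasurable
    (Filter.Eventually.of_forall h.2)

lemma Rapid.nonneg {C : ℝ} {f : Rn 2 → ℂ} (h : Rapid C f) : 0 ≤ C := by
  have := (norm_nonneg _).trans (h.2 0)
  have := decay_pos 8 0
  by_contra! h0
  nlinarith

lemma Rapid.norm_le {C : ℝ} {f : Rn 2 → ℂ} (h : Rapid C f) (x : Rn 2) : ‖f x‖ ≤ C :=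
  (h.2 x).trans (mul_le_of_le_one_right h.nonneg (decay_le_one 8 x))

/-- The weighted modulus of a function. -/
def wabs (θ : Rn 2 → ℝ) (f : Rn 2 → ℂ) (x : Rn 2) : ℝ≥0∞ := ENNReal.ofReal (θ x) * ‖f x‖ₑ

/-- The squared weighted norm on the Fourier side. -/
def wnorm (θ : Rn 2 → ℝ) (f : Rn 2 → ℂ) : ℝ≥0∞ := ∫⁻ x, wabs θ f x ^ 2

lemma measurable_wabs {θ : Rn 2 → ℝ} {f : Rn 2 → ℂ} (hθ : Continuous θ) (hf : Continuous f) :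
    Measurable (wabs θ f) := hθ.measurable.ennreal_ofReal.mul hf.measurable.enorm

/-- The cubic interaction at output frequency `ξ`. -/
def cub (f₁ f₂ f₃ : Rn 2 → ℂ) (ξ : Rn 2) (p : Rn 2 × Rn 2) : ℂ :=
  f₁ p.1 * conj (f₂ p.2) * f₃ (ξ - p.1 + p.2)

/-- The trilinear operator with symbol `σ` in the interaction picture. -/
def tri (σ : Rn 2 × Rn 2 × Rn 2 → ℝ) (t : ℝ) (f₁ f₂ f₃ : Rn 2 → ℂ) (ξ : Rn 2) : ℂ :=
  ∫ p : Rn 2 × Rn 2, cexp (I * phase ξ p.1 p.2 * t) * (σ (ξ, p) * cub f₁ f₂ f₃ ξ p)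

lemma continuous_phase_right (ξ : Rn 2) :
    Continuous fun p : Rn 2 × Rn 2 => phase ξ p.1 p.2 :=
  continuous_phase.comp (f := fun p : Rn 2 × Rn 2 => (ξ, p)) (by fun_prop)

lemma continuous_slice {Z : Type*} [TopologicalSpace Z] {σ : Rn 2 × Rn 2 × Rn 2 → Z}
    (hσ : Continuous σ) (ξ : Rn 2) : Continuous fun p : Rn 2 × Rn 2 => σ (ξ, p) :=
  hσ.comp (by fun_prop)

lemma continuous_cub {f₁ f₂ f₃ : Rn 2 → ℂ} (h₁ : Continuous f₁) (h₂ : Continuous f₂)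
    (h₃ : Continuous f₃) : Continuous fun q : Rn 2 × Rn 2 × Rn 2 => cub f₁ f₂ f₃ q.1 q.2 := by
  unfold cub
  fun_prop

lemma norm_cub (f₁ f₂ f₃ : Rn 2 → ℂ) (ξ : Rn 2) (p : Rn 2 × Rn 2) :
    ‖cub f₁ f₂ f₃ ξ p‖ = ‖f₁ p.1‖ * ‖f₂ p.2‖ * ‖f₃ (ξ - p.1 + p.2)‖ := by
  simp [cub]

lemma norm_cub_le {C : ℝ} {f₁ f₂ f₃ : Rn 2 → ℂ} (h₁ : Rapid C f₁) (h₂ : Rapid C f₂)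
    (h₃ : Rapid C f₃) (ξ : Rn 2) (p : Rn 2 × Rn 2) :
    ‖cub f₁ f₂ f₃ ξ p‖ ≤ C ^ 3 * (decay 8 p.1 * decay 8 p.2) := by
  have hC := h₁.nonneg
  have := decay_pos 8 p.1
  have := decay_pos 8 p.2
  rw [norm_cub]
  calc _ ≤ (C * decay 8 p.1) * (C * decay 8 p.2) * C := by
        gcongr
        · exact h₁.2 _
        · exact h₂.2 _
        · exact h₃.norm_le _
    _ = _ := by ring

/-- Symbols that are continuous, and bounded at each fixed output frequency. -/
def IsSymbol (σ : Rn 2 × Rn 2 × Rn 2 → ℝ) : Prop :=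
  Continuous σ ∧ ∀ ξ, ∃ M, ∀ p, |σ (ξ, p)| ≤ M

lemma integrable_decay_prod : Integrable fun p : Rn 2 × Rn 2 => decay 8 p.1 * decay 8 p.2 :=
  (integrable_decay (by norm_num)).mul_prod (integrable_decay (by norm_num))

lemma integrable_sym_cub {σ : Rn 2 × Rn 2 × Rn 2 → ℝ} (hσ : IsSymbol σ) {C : ℝ}
    {f₁ f₂ f₃ : Rn 2 → ℂ} (h₁ : Rapid C f₁) (h₂ : Rapid C f₂) (h₃ : Rapid C f₃) (ξ : Rn 2) :
    Integrable fun p : Rn 2 × Rn 2 => (σ (ξ, p) : ℂ) * cub f₁ f₂ f₃ ξ p := by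
  obtain ⟨M, hM⟩ := hσ.2 ξ
  have hM0 : 0 ≤ M := (abs_nonneg _).trans (hM 0)
  refine ((integrable_decay_prod.const_mul (C ^ 3)).const_mul M).mono' ?_ ?_
  · refine Continuous.aestronglyMeasurable ?_
    refine (Complex.continuous_ofReal.comp (continuous_slice hσ.1 ξ)).mul ?_
    exact continuous_slice (continuous_cub h₁.1 h₂.1 h₃.1) ξ
  · refine Filter.Eventually.of_forall fun p => ?_
    rw [norm_mul, Complex.norm_real]
    gcongr
    · exact hM p
    · exact norm_cub_le h₁ h₂ h₃ ξ p

lemma lintegral_cubic_tonelli {g₁ g₂ g₃ : Rn 2 → ℝ≥0∞} (h₁ : Measurable g₁) (h₂ : Measurable g₂)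
    (h₃ : Measurable g₃) :
    ∫⁻ ξ, ∫⁻ p : Rn 2 × Rn 2, g₁ p.1 * g₂ p.2 * g₃ (ξ - p.1 + p.2)
      = (∫⁻ x, g₁ x) * (∫⁻ x, g₂ x) * ∫⁻ x, g₃ x := by
  rw [lintegral_lintegral_swap (by fun_prop)]
  have : ∀ p : Rn 2 × Rn 2, ∫⁻ ξ, g₁ p.1 * g₂ p.2 * g₃ (ξ - p.1 + p.2)
      = g₁ p.1 * g₂ p.2 * ∫⁻ x, g₃ x := by
    intro p
    rw [lintegral_const_mul _ (by fun_prop)]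
    congr 1
    rw [← lintegral_add_right_eq_self g₃ (-p.1 + p.2)]
    refine lintegral_congr fun x => ?_
    congr 1
    abel
  simp_rw [this]
  rw [lintegral_mul_const _ (by fun_prop), Measure.volume_eq_prod,
    lintegral_prod_mul h₁.aemeasurable h₂.aemeasurable]

/-- The space-time kernel constant of a symbol with respect to a weight. -/
def KernelBound (θ : Rn 2 → ℝ) (σ : Rn 2 × Rn 2 × Rn 2 → ℝ) (A : ℝ≥0∞) : Prop :=
  ∀ ξ μ, ∫⁻ p : Rn 2 × Rn 2, gaussKer (μ - phase ξ p.1 p.2) *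
    ENNReal.ofReal (|σ (ξ, p)| / (θ p.1 * θ p.2 * θ (ξ - p.1 + p.2))) ^ 2 ≤ A

lemma aestronglyMeasurable_tri {X : Type*} [MeasurableSpace X] [TopologicalSpace X]
    [OpensMeasurableSpace X] [SecondCountableTopology X] {F : X → Rn 2 × Rn 2 → ℂ}
    (hF : Continuous (Function.uncurry F)) : StronglyMeasurable fun x => ∫ p, F x p := by
  have : StronglyMeasurable (Function.uncurry F) := hF.stronglyMeasurable
  exact this.integral_prod_right

lemma continuous_tri_integrand {σ : Rn 2 × Rn 2 × Rn 2 → ℝ} (hσ : IsSymbol σ)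
    {f₁ f₂ f₃ : ℝ → Rn 2 → ℂ} (h₁ : Continuous (Function.uncurry f₁))
    (h₂ : Continuous (Function.uncurry f₂)) (h₃ : Continuous (Function.uncurry f₃)) :
    Continuous fun q : (ℝ × ℝ × Rn 2) × Rn 2 × Rn 2 =>
      cexp (I * phase q.1.2.2 q.2.1 q.2.2 * q.1.1) * (σ (q.1.2.2, q.2) *
        cub (f₁ q.1.2.1) (f₂ q.1.2.1) (f₃ q.1.2.1) q.1.2.2 q.2) := by
  have hph : Continuous fun q : (ℝ × ℝ × Rn 2) × Rn 2 × Rn 2 => phase q.1.2.2 q.2.1 q.2.2 :=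
    continuous_phase.comp (f := fun q : (ℝ × ℝ × Rn 2) × Rn 2 × Rn 2 => (q.1.2.2, q.2))
      (by fun_prop)
  have hs : Continuous fun q : (ℝ × ℝ × Rn 2) × Rn 2 × Rn 2 => σ (q.1.2.2, q.2) :=
    hσ.1.comp (by fun_prop)
  have k₁ : Continuous fun q : (ℝ × ℝ × Rn 2) × Rn 2 × Rn 2 => f₁ q.1.2.1 q.2.1 :=
    h₁.comp (f := fun q : (ℝ × ℝ × Rn 2) × Rn 2 × Rn 2 => (q.1.2.1, q.2.1)) (by fun_prop)
  have k₂ : Continuous fun q : (ℝ × ℝ × Rn 2) × Rn 2 × Rn 2 => f₂ q.1.2.1 q.2.2 :=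
    h₂.comp (f := fun q : (ℝ × ℝ × Rn 2) × Rn 2 × Rn 2 => (q.1.2.1, q.2.2)) (by fun_prop)
  have k₃ : Continuous fun q : (ℝ × ℝ × Rn 2) × Rn 2 × Rn 2 =>
      f₃ q.1.2.1 (q.1.2.2 - q.2.1 + q.2.2) :=
    h₃.comp (f := fun q : (ℝ × ℝ × Rn 2) × Rn 2 × Rn 2 =>
      (q.1.2.1, q.1.2.2 - q.2.1 + q.2.2)) (by fun_prop)
  unfold cub
  have ht : Continuous fun q : (ℝ × ℝ × Rn 2) × Rn 2 × Rn 2 => q.1.1 := by fun_prop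
  exact (Complex.continuous_exp.comp ((continuous_const.mul
    (Complex.continuous_ofReal.comp hph)).mul (Complex.continuous_ofReal.comp ht))).mul
    ((Complex.continuous_ofReal.comp hs).mul ((k₁.mul (Complex.continuous_conj.comp k₂)).mul k₃))

/-- Joint measurability of the trilinear operator in (phase time, argument time, frequency). -/
lemma stronglyMeasurable_tri {σ : Rn 2 × Rn 2 × Rn 2 → ℝ} (hσ : IsSymbol σ)
    {f₁ f₂ f₃ : ℝ → Rn 2 → ℂ} (h₁ : Continuous (Function.uncurry f₁))
    (h₂ : Continuous (Function.uncurry f₂)) (h₃ : Continuous (Function.uncurry f₃)) :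
    StronglyMeasurable fun q : ℝ × ℝ × Rn 2 =>
      tri σ q.1 (f₁ q.2.1) (f₂ q.2.1) (f₃ q.2.1) q.2.2 :=
  aestronglyMeasurable_tri (continuous_tri_integrand hσ h₁ h₂ h₃)

lemma lintegral_tri_free_le {θ : Rn 2 → ℝ} (hθ : Continuous θ) (hθ0 : ∀ x, 0 < θ x)
    {σ : Rn 2 × Rn 2 × Rn 2 → ℝ} (hσ : IsSymbol σ) {A : ℝ≥0∞} (hA : KernelBound θ σ A) {C : ℝ}
    {f₁ f₂ f₃ : Rn 2 → ℂ} (h₁ : Rapid C f₁) (h₂ : Rapid C f₂) (h₃ : Rapid C f₃)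
    {δ : ℝ} (hδ1 : δ ≤ 1) :
    ∫⁻ t in Icc 0 δ, ∫⁻ ξ, ‖tri σ t f₁ f₂ f₃ ξ‖ₑ ^ 2
      ≤ ENNReal.ofReal (Real.exp 1) * (2 * A * (wnorm θ f₁ * wnorm θ f₂ * wnorm θ f₃)) := by
  have hmeas : Measurable fun q : ℝ × Rn 2 => tri σ q.1 f₁ f₂ f₃ q.2 :=
    ((stronglyMeasurable_tri hσ (f₁ := fun _ => f₁) (f₂ := fun _ => f₂) (f₃ := fun _ => f₃)
      (h₁.1.comp continuous_snd) (h₂.1.comp continuous_snd)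
        (h₃.1.comp continuous_snd)).measurable.comp
      (g := fun q : ℝ × ℝ × Rn 2 => tri σ q.1 f₁ f₂ f₃ q.2.2)
      (f := fun q : ℝ × Rn 2 => (q.1, (0 : ℝ), q.2)) (by fun_prop))
  have hg₁ := measurable_wabs hθ h₁.1
  have hg₂ := measurable_wabs hθ h₂.1
  have hg₃ := measurable_wabs hθ h₃.1
  have main : ∀ ξ, ∫⁻ t : ℝ, ENNReal.ofReal (Real.exp (-t ^ 2)) * ‖tri σ t f₁ f₂ f₃ ξ‖ₑ ^ 2 ≤
      2 * A * ∫⁻ p : Rn 2 × Rn 2, (wabs θ f₁ p.1 * wabs θ f₂ p.2 *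
        wabs θ f₃ (ξ - p.1 + p.2)) ^ 2 := by
    intro ξ
    refine lintegral_gaussian_osc_schur (integrable_sym_cub hσ h₁ h₂ h₃ ξ)
      (continuous_phase_right ξ).measurable
      (u := fun p => ENNReal.ofReal (|σ (ξ, p)| / (θ p.1 * θ p.2 * θ (ξ - p.1 + p.2)))) ?_ ?_ ?_
      (hA ξ)
    · have h2 : Measurable fun p : Rn 2 × Rn 2 => σ (ξ, p) := (continuous_slice hσ.1 ξ).measurable
      have h3 := hθ.measurable
      have h4 : Measurable fun p : Rn 2 × Rn 2 => θ p.1 * θ p.2 * θ (ξ - p.1 + p.2) := by fun_prop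
      exact (h2.abs.div h4).ennreal_ofReal
    · exact ((hg₁.comp measurable_fst).mul (hg₂.comp measurable_snd)).mul
        (hg₃.comp (f := fun p : Rn 2 × Rn 2 => ξ - p.1 + p.2) (by fun_prop))
    · intro p
      have t1 := hθ0 p.1
      have t2 := hθ0 p.2
      have t3 := hθ0 (ξ - p.1 + p.2)
      simp only [wabs, ← ofReal_norm]
      rw [← ENNReal.ofReal_mul t1.le, ← ENNReal.ofReal_mul t2.le, ← ENNReal.ofReal_mul t3.le,
        ← ENNReal.ofReal_mul (by positivity), ← ENNReal.ofReal_mul (by positivity),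
        ← ENNReal.ofReal_mul (by positivity)]
      refine ENNReal.ofReal_le_ofReal (le_of_eq ?_)
      rw [norm_mul, norm_cub, Complex.norm_real, Real.norm_eq_abs]
      field_simp
  have tot : ∫⁻ ξ, ∫⁻ t : ℝ, ENNReal.ofReal (Real.exp (-t ^ 2)) * ‖tri σ t f₁ f₂ f₃ ξ‖ₑ ^ 2 ≤
      2 * A * (wnorm θ f₁ * wnorm θ f₂ * wnorm θ f₃) := by
    refine (lintegral_mono main).trans ?_
    simp only [mul_pow]
    rw [lintegral_const_mul]
    · refine le_of_eq ?_
      congr 1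
      exact lintegral_cubic_tonelli (hg₁.pow_const 2) (hg₂.pow_const 2) (hg₃.pow_const 2)
    · refine Measurable.lintegral_prod_right' (f := fun q : Rn 2 × Rn 2 × Rn 2 =>
        wabs θ f₁ q.2.1 ^ 2 * wabs θ f₂ q.2.2 ^ 2 * wabs θ f₃ (q.1 - q.2.1 + q.2.2) ^ 2) ?_
      exact (((hg₁.pow_const 2).comp (by fun_prop)).mul ((hg₂.pow_const 2).comp (by fun_prop))).mul
        ((hg₃.pow_const 2).comp (f := fun q : Rn 2 × Rn 2 × Rn 2 => q.1 - q.2.1 + q.2.2)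
          (by fun_prop))
  have hsq : Measurable fun q : ℝ × Rn 2 => ‖tri σ q.1 f₁ f₂ f₃ q.2‖ₑ ^ 2 :=
    hmeas.enorm.pow_const 2
  have hexp : Measurable fun t : ℝ => ENNReal.ofReal (Real.exp (-t ^ 2)) := by fun_prop
  calc _ ≤ ∫⁻ t in Icc 0 δ, ENNReal.ofReal (Real.exp 1) *
        ∫⁻ ξ, ENNReal.ofReal (Real.exp (-t ^ 2)) * ‖tri σ t f₁ f₂ f₃ ξ‖ₑ ^ 2 := by
        refine setLIntegral_mono' measurableSet_Icc fun t ht => ?_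
        rw [lintegral_const_mul' _ _ ENNReal.ofReal_ne_top, ← mul_assoc,
          ← ENNReal.ofReal_mul (by positivity), ← Real.exp_add]
        refine le_mul_of_one_le_left' ?_
        rw [ENNReal.one_le_ofReal]
        refine Real.one_le_exp ?_
        nlinarith [ht.1, ht.2]
    _ ≤ ∫⁻ t, ENNReal.ofReal (Real.exp 1) *
        ∫⁻ ξ, ENNReal.ofReal (Real.exp (-t ^ 2)) * ‖tri σ t f₁ f₂ f₃ ξ‖ₑ ^ 2 :=
        setLIntegral_le_lintegral _ _
    _ ≤ _ := by
        rw [lintegral_const_mul' _ _ ENNReal.ofReal_ne_top, lintegral_lintegral_swap]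
        · gcongr
        · exact ((hexp.comp measurable_fst).mul hsq).aemeasurable

/-! ### Trilinear operators along a flow -/

/-- A pair `(v, f)` of rapidly decaying functions with `∂ₜ v = f` on `(0, δ)`. -/
structure IsFlow (δ C : ℝ) (v f : ℝ → Rn 2 → ℂ) : Prop where
  cont : Continuous (Function.uncurry v)
  cont_deriv : Continuous (Function.uncurry f)
  rapid : ∀ t, Rapid C (v t)
  rapid_deriv : ∀ t, Rapid C (f t)
  hasDerivAt : ∀ t ∈ Ioo 0 δ, ∀ ξ, HasDerivAt (fun s => v s ξ) (f t ξ) t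

/-- The derivative of the cubic interaction along a flow. -/
def cubDeriv (v f : ℝ → Rn 2 → ℂ) (ξ : Rn 2) (s : ℝ) (p : Rn 2 × Rn 2) : ℂ :=
  cub (f s) (v s) (v s) ξ p + cub (v s) (f s) (v s) ξ p + cub (v s) (v s) (f s) ξ p

lemma IsFlow.mono {δ δ' C : ℝ} {v f : ℝ → Rn 2 → ℂ} (h : IsFlow δ C v f) (hδ : δ' ≤ δ) :
    IsFlow δ' C v f :=
  ⟨h.cont, h.cont_deriv, h.rapid, h.rapid_deriv, fun t ht ξ =>
    h.hasDerivAt t ⟨ht.1, ht.2.trans_le hδ⟩ ξ⟩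

lemma continuous_apply_of_uncurry {v : ℝ → Rn 2 → ℂ} (h : Continuous (Function.uncurry v))
    (ξ : Rn 2) : Continuous fun s => v s ξ :=
  h.comp (f := fun s : ℝ => (s, ξ)) (by fun_prop)

lemma continuous_cub_uncurry {f₁ f₂ f₃ : ℝ → Rn 2 → ℂ} (h₁ : Continuous (Function.uncurry f₁))
    (h₂ : Continuous (Function.uncurry f₂)) (h₃ : Continuous (Function.uncurry f₃)) (ξ : Rn 2) :
    Continuous fun q : ℝ × Rn 2 × Rn 2 => cub (f₁ q.1) (f₂ q.1) (f₃ q.1) ξ q.2 := by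
  have k₁ : Continuous fun q : ℝ × Rn 2 × Rn 2 => f₁ q.1 q.2.1 :=
    h₁.comp (f := fun q : ℝ × Rn 2 × Rn 2 => (q.1, q.2.1)) (by fun_prop)
  have k₂ : Continuous fun q : ℝ × Rn 2 × Rn 2 => f₂ q.1 q.2.2 :=
    h₂.comp (f := fun q : ℝ × Rn 2 × Rn 2 => (q.1, q.2.2)) (by fun_prop)
  have k₃ : Continuous fun q : ℝ × Rn 2 × Rn 2 => f₃ q.1 (ξ - q.2.1 + q.2.2) :=
    h₃.comp (f := fun q : ℝ × Rn 2 × Rn 2 => (q.1, ξ - q.2.1 + q.2.2)) (by fun_prop)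
  exact (k₁.mul (Complex.continuous_conj.comp k₂)).mul k₃

lemma IsFlow.continuous_cubDeriv {δ C : ℝ} {v f : ℝ → Rn 2 → ℂ} (h : IsFlow δ C v f) (ξ : Rn 2) :
    Continuous (Function.uncurry (cubDeriv v f ξ)) :=
  ((continuous_cub_uncurry h.cont_deriv h.cont h.cont ξ).add
    (continuous_cub_uncurry h.cont h.cont_deriv h.cont ξ)).add
    (continuous_cub_uncurry h.cont h.cont h.cont_deriv ξ)

lemma integral_Icc_eq_sub {δ t : ℝ} (ht : t ∈ Icc 0 δ) {g g' : ℝ → ℂ} (hg : Continuous g)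
    (hg' : Continuous g') (hd : ∀ s ∈ Ioo 0 δ, HasDerivAt g (g' s) s) :
    ∫ s in Icc 0 t, g' s = g t - g 0 := by
  rw [integral_Icc_eq_integral_Ioc, ← intervalIntegral.integral_of_le ht.1]
  exact intervalIntegral.integral_eq_sub_of_hasDerivAt_of_le ht.1 hg.continuousOn
    (fun x hx => hd x ⟨hx.1, hx.2.trans_le ht.2⟩) (hg'.intervalIntegrable _ _)

lemma IsFlow.eq_add_integral {δ C : ℝ} {v f : ℝ → Rn 2 → ℂ} (h : IsFlow δ C v f) {t : ℝ}
    (ht : t ∈ Icc 0 δ) (ξ : Rn 2) : v t ξ = v 0 ξ + ∫ s in Icc 0 t, f s ξ := by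
  rw [integral_Icc_eq_sub ht (continuous_apply_of_uncurry h.cont ξ)
    (continuous_apply_of_uncurry h.cont_deriv ξ) fun s hs => h.hasDerivAt s hs ξ]
  ring

lemma IsFlow.integral_cubDeriv {δ C : ℝ} {v f : ℝ → Rn 2 → ℂ} (h : IsFlow δ C v f) {t : ℝ}
    (ht : t ∈ Icc 0 δ) (ξ : Rn 2) (p : Rn 2 × Rn 2) :
    ∫ s in Icc 0 t, cubDeriv v f ξ s p
      = cub (v t) (v t) (v t) ξ p - cub (v 0) (v 0) (v 0) ξ p := by
  refine integral_Icc_eq_sub (g := fun s => cub (v s) (v s) (v s) ξ p) ht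
    ((continuous_cub_uncurry h.cont h.cont h.cont ξ).comp (f := fun s : ℝ => (s, p)) (by fun_prop))
    ((h.continuous_cubDeriv ξ).comp (f := fun s : ℝ => (s, p)) (by fun_prop)) fun s hs => ?_
  have := ((h.hasDerivAt s hs p.1).mul (h.hasDerivAt s hs p.2).star).mul
    (h.hasDerivAt s hs (ξ - p.1 + p.2))
  refine HasDerivAt.congr_deriv (f := fun s => cub (v s) (v s) (v s) ξ p) this ?_
  simp only [cubDeriv, cub, Pi.mul_apply, Complex.star_def]
  ring

lemma IsFlow.norm_cubDeriv_le {δ C : ℝ} {v f : ℝ → Rn 2 → ℂ} (h : IsFlow δ C v f) (ξ : Rn 2)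
    (s : ℝ) (p : Rn 2 × Rn 2) :
    ‖cubDeriv v f ξ s p‖ ≤ 3 * C ^ 3 * (decay 8 p.1 * decay 8 p.2) := by
  have h1 := norm_cub_le (h.rapid_deriv s) (h.rapid s) (h.rapid s) ξ p
  have h2 := norm_cub_le (h.rapid s) (h.rapid_deriv s) (h.rapid s) ξ p
  have h3 := norm_cub_le (h.rapid s) (h.rapid s) (h.rapid_deriv s) ξ p
  have := norm_add₃_le (a := cub (f s) (v s) (v s) ξ p) (b := cub (v s) (f s) (v s) ξ p)
    (c := cub (v s) (v s) (f s) ξ p)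
  unfold cubDeriv
  linarith

lemma norm_cexp_phase (ξ : Rn 2) (p : Rn 2 × Rn 2) (t : ℝ) :
    ‖cexp (I * phase ξ p.1 p.2 * t)‖ = 1 := by
  have : I * (phase ξ p.1 p.2 : ℂ) * t = ((phase ξ p.1 p.2 * t : ℝ) : ℂ) * I := by
    push_cast
    ring
  rw [this, Complex.norm_exp_ofReal_mul_I]

lemma integrable_tri_integrand {σ : Rn 2 × Rn 2 × Rn 2 → ℝ} (hσ : IsSymbol σ) {C : ℝ}
    {f₁ f₂ f₃ : Rn 2 → ℂ} (h₁ : Rapid C f₁) (h₂ : Rapid C f₂) (h₃ : Rapid C f₃) (t : ℝ)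
    (ξ : Rn 2) : Integrable fun p : Rn 2 × Rn 2 =>
      cexp (I * phase ξ p.1 p.2 * t) * (σ (ξ, p) * cub f₁ f₂ f₃ ξ p) := by
  refine (integrable_sym_cub hσ h₁ h₂ h₃ ξ).bdd_mul (c := 1) ?_
    (Filter.Eventually.of_forall fun p => (norm_cexp_phase ξ p t).le)
  refine Continuous.aestronglyMeasurable (Complex.continuous_exp.comp ?_)
  exact (continuous_const.mul (Complex.continuous_ofReal.comp (continuous_phase_right ξ))).mul
    continuous_const

lemma IsFlow.tri_eq {δ C : ℝ} {v f : ℝ → Rn 2 → ℂ} (h : IsFlow δ C v f)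
    {σ : Rn 2 × Rn 2 × Rn 2 → ℝ} (hσ : IsSymbol σ) {t : ℝ} (ht : t ∈ Icc 0 δ) (ξ : Rn 2) :
    tri σ t (v t) (v t) (v t) ξ = tri σ t (v 0) (v 0) (v 0) ξ +
      ∫ s in Icc 0 t, (tri σ t (f s) (v s) (v s) ξ + tri σ t (v s) (f s) (v s) ξ
        + tri σ t (v s) (v s) (f s) ξ) := by
  obtain ⟨M, hM⟩ := hσ.2 ξ
  have hM0 : 0 ≤ M := (abs_nonneg _).trans (hM 0)
  have hC := (h.rapid 0).nonneg
  set E : Rn 2 × Rn 2 → ℂ := fun p => cexp (I * phase ξ p.1 p.2 * t) * σ (ξ, p) with hE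
  have hEc : Continuous E := by
    have h1 := continuous_phase_right ξ
    have h2 := continuous_slice hσ.1 ξ
    exact (Complex.continuous_exp.comp ((continuous_const.mul
      (Complex.continuous_ofReal.comp h1)).mul continuous_const)).mul
      (Complex.continuous_ofReal.comp h2)
  have hEM : ∀ p, ‖E p‖ ≤ M := by
    intro p
    rw [hE]
    simp only
    rw [norm_mul, norm_cexp_phase, one_mul, Complex.norm_real]
    exact hM p
  have hsum : ∀ s, tri σ t (f s) (v s) (v s) ξ + tri σ t (v s) (f s) (v s) ξ
        + tri σ t (v s) (v s) (f s) ξ = ∫ p, E p * cubDeriv v f ξ s p := by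
    intro s
    have i1 := integrable_tri_integrand hσ (h.rapid_deriv s) (h.rapid s) (h.rapid s) t ξ
    have i2 := integrable_tri_integrand hσ (h.rapid s) (h.rapid_deriv s) (h.rapid s) t ξ
    have i3 := integrable_tri_integrand hσ (h.rapid s) (h.rapid s) (h.rapid_deriv s) t ξ
    unfold tri
    have e := integral_add (i1.add i2) i3
    simp only [Pi.add_apply] at e
    rw [← integral_add i1 i2, ← e]
    refine integral_congr_ae (Filter.Eventually.of_forall fun p => ?_)
    simp only [hE, cubDeriv]
    ring
  simp_rw [hsum]
  rw [integral_integral_swap]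
  · have : ∀ p, ∫ s in Icc 0 t, E p * cubDeriv v f ξ s p =
        E p * (cub (v t) (v t) (v t) ξ p - cub (v 0) (v 0) (v 0) ξ p) := fun p => by
      rw [integral_const_mul, h.integral_cubDeriv ht]
    simp_rw [this]
    have i1 := integrable_tri_integrand hσ (h.rapid 0) (h.rapid 0) (h.rapid 0) t ξ
    have i2 := integrable_tri_integrand hσ (h.rapid t) (h.rapid t) (h.rapid t) t ξ
    unfold tri
    rw [← sub_eq_iff_eq_add', ← integral_sub i2 i1]
    refine integral_congr_ae (Filter.Eventually.of_forall fun p => ?_)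
    simp only [hE]
    ring
  · have hb : Integrable (fun q : ℝ × Rn 2 × Rn 2 => (1 : ℝ) * (M * (3 * C ^ 3 *
        (decay 8 q.2.1 * decay 8 q.2.2)))) ((volume.restrict (Icc 0 t)).prod volume) :=
      (integrable_const (1 : ℝ)).mul_prod
        ((integrable_decay_prod.const_mul (3 * C ^ 3)).const_mul M)
    refine hb.mono' ?_ (Filter.Eventually.of_forall fun q => ?_)
    · exact ((hEc.comp continuous_snd).mul (h.continuous_cubDeriv ξ)).aestronglyMeasurable
    · simp only [Function.uncurry]
      rw [norm_mul, one_mul]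
      gcongr
      · exact hEM _
      · exact h.norm_cubDeriv_le ξ q.1 q.2

lemma sq_add_le_ennreal (a b : ℝ≥0∞) : (a + b) ^ 2 ≤ 2 * (a ^ 2 + b ^ 2) := by
  have := ENNReal.rpow_add_le_mul_rpow_add_rpow a b (p := 2) (by norm_num)
  norm_num at this
  exact this

lemma sq_lintegral_mul_le {α : Type*} [MeasurableSpace α] {μ : Measure α} {f g : α → ℝ≥0∞}
    (hf : AEMeasurable f μ) (hg : AEMeasurable g μ) :
    (∫⁻ x, f x * g x ∂μ) ^ 2 ≤ (∫⁻ x, f x ^ 2 ∂μ) * ∫⁻ x, g x ^ 2 ∂μ := by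
  have h := ENNReal.lintegral_mul_le_Lp_mul_Lq μ Real.HolderConjugate.two_two hf hg
  simp only [Pi.mul_apply, ENNReal.rpow_two] at h
  calc _ ≤ _ := pow_le_pow_left' h 2
    _ = _ := by
      rw [mul_pow, ← ENNReal.rpow_natCast, ← ENNReal.rpow_natCast, ← ENNReal.rpow_mul,
        ← ENNReal.rpow_mul]
      norm_num

lemma sq_lintegral_Icc_le {δ : ℝ} {g : ℝ → ℝ≥0∞} (hg : Measurable g) :
    (∫⁻ s in Icc 0 δ, g s) ^ 2 ≤ ENNReal.ofReal δ * ∫⁻ s in Icc 0 δ, g s ^ 2 := by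
  have := sq_lintegral_mul_le (μ := volume.restrict (Icc 0 δ)) (f := fun _ => 1)
    aemeasurable_const hg.aemeasurable
  simpa using this

lemma IsFlow.enorm_tri_sq_le {δ C : ℝ} {v f : ℝ → Rn 2 → ℂ} (h : IsFlow δ C v f)
    {σ : Rn 2 × Rn 2 × Rn 2 → ℝ} (hσ : IsSymbol σ) {t : ℝ} (ht : t ∈ Icc 0 δ) (ξ : Rn 2) :
    ‖tri σ t (v t) (v t) (v t) ξ‖ₑ ^ 2 ≤ 2 * (‖tri σ t (v 0) (v 0) (v 0) ξ‖ₑ ^ 2 +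
      ENNReal.ofReal δ * ∫⁻ s in Icc 0 δ, 4 * (‖tri σ t (f s) (v s) (v s) ξ‖ₑ ^ 2 +
        ‖tri σ t (v s) (f s) (v s) ξ‖ₑ ^ 2 + ‖tri σ t (v s) (v s) (f s) ξ‖ₑ ^ 2)) := by
  have hm : ∀ {f₁ f₂ f₃ : ℝ → Rn 2 → ℂ}, Continuous (Function.uncurry f₁) →
      Continuous (Function.uncurry f₂) → Continuous (Function.uncurry f₃) →
      Measurable fun s => tri σ t (f₁ s) (f₂ s) (f₃ s) ξ := fun h₁ h₂ h₃ =>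
    (stronglyMeasurable_tri hσ h₁ h₂ h₃).measurable.comp
      (f := fun s : ℝ => (t, s, ξ)) (by fun_prop)
  have m1 := hm h.cont_deriv h.cont h.cont
  have m2 := hm h.cont h.cont_deriv h.cont
  have m3 := hm h.cont h.cont h.cont_deriv
  rw [h.tri_eq hσ ht ξ]
  refine (pow_le_pow_left' (enorm_add_le _ _) 2).trans ((sq_add_le_ennreal _ _).trans ?_)
  gcongr
  calc _ ≤ (∫⁻ s in Icc 0 δ, (‖tri σ t (f s) (v s) (v s) ξ‖ₑ + ‖tri σ t (v s) (f s) (v s) ξ‖ₑ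
        + ‖tri σ t (v s) (v s) (f s) ξ‖ₑ)) ^ 2 := by
        refine pow_le_pow_left' ((enorm_integral_le_lintegral_enorm _).trans ?_) 2
        refine (lintegral_mono_set (Icc_subset_Icc_right ht.2)).trans (lintegral_mono fun s => ?_)
        exact (enorm_add_le _ _).trans (add_le_add_left (enorm_add_le _ _) _)
    _ ≤ _ := sq_lintegral_Icc_le ((m1.enorm.add m2.enorm).add m3.enorm)
    _ ≤ _ := by
        gcongr with s
        refine (sq_add_le_ennreal _ _).trans ?_
        rw [show (4 : ℝ≥0∞) = 2 * 2 by norm_num, mul_assoc]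
        gcongr
        rw [mul_add]
        gcongr
        · exact sq_add_le_ennreal _ _
        · exact le_mul_of_one_le_left' (by norm_num)

lemma IsFlow.lintegral_tri_le {δ C : ℝ} (hδ1 : δ ≤ 1) {v f : ℝ → Rn 2 → ℂ}
    (h : IsFlow δ C v f) {θ : Rn 2 → ℝ} (hθ : Continuous θ) (hθ0 : ∀ x, 0 < θ x)
    {σ : Rn 2 × Rn 2 × Rn 2 → ℝ} (hσ : IsSymbol σ) {A : ℝ≥0∞} (hA : KernelBound θ σ A)
    {X : ℝ≥0∞} (hX0 : wnorm θ (v 0) ≤ X) (hX : ∀ t ∈ Icc 0 δ, wnorm θ (v t) ≤ X) :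
    ∫⁻ t in Icc 0 δ, ∫⁻ ξ, ‖tri σ t (v t) (v t) (v t) ξ‖ₑ ^ 2 ≤
      ENNReal.ofReal (Real.exp 1) * (4 * A * (X ^ 3 + 12 * (ENNReal.ofReal δ * (X ^ 2 *
        ∫⁻ s in Icc 0 δ, wnorm θ (f s))))) := by
  set e := ENNReal.ofReal (Real.exp 1) with he
  set F : ℝ → ℝ → Rn 2 → ℝ≥0∞ := fun t s ξ => ‖tri σ t (f s) (v s) (v s) ξ‖ₑ ^ 2 +
        ‖tri σ t (v s) (f s) (v s) ξ‖ₑ ^ 2 + ‖tri σ t (v s) (v s) (f s) ξ‖ₑ ^ 2 with hF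
  have hm : ∀ {f₁ f₂ f₃ : ℝ → Rn 2 → ℂ}, Continuous (Function.uncurry f₁) →
      Continuous (Function.uncurry f₂) → Continuous (Function.uncurry f₃) →
      Measurable fun q : ℝ × ℝ × Rn 2 => ‖tri σ q.1 (f₁ q.2.1) (f₂ q.2.1) (f₃ q.2.1) q.2.2‖ₑ ^ 2 :=
    fun h₁ h₂ h₃ => (stronglyMeasurable_tri hσ h₁ h₂ h₃).measurable.enorm.pow_const 2
  have m1 := hm h.cont_deriv h.cont h.cont
  have m2 := hm h.cont h.cont_deriv h.cont
  have m3 := hm h.cont h.cont h.cont_deriv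
  have hFm : Measurable fun q : ℝ × ℝ × Rn 2 => F q.1 q.2.1 q.2.2 := (m1.add m2).add m3
  have hfree : ∀ s ∈ Icc 0 δ, ∫⁻ t in Icc 0 δ, ∫⁻ ξ, F t s ξ ≤
      3 * (e * (2 * A * (X ^ 2 * wnorm θ (f s)))) := by
    intro s hs
    have r1 := lintegral_tri_free_le hθ hθ0 hσ hA (h.rapid_deriv s) (h.rapid s) (h.rapid s) hδ1
    have r2 := lintegral_tri_free_le hθ hθ0 hσ hA (h.rapid s) (h.rapid_deriv s) (h.rapid s) hδ1
    have r3 := lintegral_tri_free_le hθ hθ0 hσ hA (h.rapid s) (h.rapid s) (h.rapid_deriv s) hδ1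
    have hXs := hX s hs
    have slice : ∀ {G : ℝ × ℝ × Rn 2 → ℝ≥0∞}, Measurable G → ∀ t,
        Measurable fun ξ => G (t, s, ξ) := fun hG t =>
      hG.comp (f := fun ξ : Rn 2 => (t, s, ξ)) (by fun_prop)
    have slice' : ∀ {G : ℝ × ℝ × Rn 2 → ℝ≥0∞}, Measurable G →
        Measurable fun t => ∫⁻ ξ, G (t, s, ξ) := fun {G} hG =>
      Measurable.lintegral_prod_right' (f := fun q : ℝ × Rn 2 => G (q.1, s, q.2))
        (hG.comp (f := fun q : ℝ × Rn 2 => (q.1, s, q.2)) (by fun_prop))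
    have heq : ∀ t, ∫⁻ ξ, F t s ξ = ((∫⁻ ξ, ‖tri σ t (f s) (v s) (v s) ξ‖ₑ ^ 2) +
        ∫⁻ ξ, ‖tri σ t (v s) (f s) (v s) ξ‖ₑ ^ 2) + ∫⁻ ξ, ‖tri σ t (v s) (v s) (f s) ξ‖ₑ ^ 2 := by
      intro t
      rw [← lintegral_add_left (slice m1 t), ← lintegral_add_left]
      exact (slice m1 t).add (slice m2 t)
    simp_rw [heq]
    rw [lintegral_add_left (f := fun t => (∫⁻ ξ, ‖tri σ t (f s) (v s) (v s) ξ‖ₑ ^ 2) +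
        ∫⁻ ξ, ‖tri σ t (v s) (f s) (v s) ξ‖ₑ ^ 2) ((slice' m1).add (slice' m2)),
      lintegral_add_left (f := fun t => ∫⁻ ξ, ‖tri σ t (f s) (v s) (v s) ξ‖ₑ ^ 2) (slice' m1)]
    calc _ ≤ e * (2 * A * (X ^ 2 * wnorm θ (f s))) + e * (2 * A * (X ^ 2 * wnorm θ (f s))) +
          e * (2 * A * (X ^ 2 * wnorm θ (f s))) := by
          refine add_le_add (add_le_add (r1.trans ?_) (r2.trans ?_)) (r3.trans ?_)
          · gcongr e * (2 * A * ?_)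
            calc _ ≤ wnorm θ (f s) * X * X := by gcongr
              _ = _ := by ring
          · gcongr e * (2 * A * ?_)
            calc _ ≤ X * wnorm θ (f s) * X := by gcongr
              _ = _ := by ring
          · gcongr e * (2 * A * ?_)
            calc _ ≤ X * X * wnorm θ (f s) := by gcongr
              _ = _ := by ring
      _ = _ := by ring
  have h0 := lintegral_tri_free_le hθ hθ0 hσ hA (h.rapid 0) (h.rapid 0) (h.rapid 0) hδ1
  have hF2 : Measurable fun q : ℝ × Rn 2 => ∫⁻ s in Icc 0 δ, F q.1 s q.2 :=
    Measurable.lintegral_prod_right' (f := fun q : (ℝ × Rn 2) × ℝ => F q.1.1 q.2 q.1.2)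
      (hFm.comp (f := fun q : (ℝ × Rn 2) × ℝ => (q.1.1, q.2, q.1.2)) (by fun_prop))
  have m0 : Measurable fun q : ℝ × Rn 2 => ‖tri σ q.1 (v 0) (v 0) (v 0) q.2‖ₑ ^ 2 :=
    (hm h.cont h.cont h.cont).comp (f := fun q : ℝ × Rn 2 => (q.1, (0 : ℝ), q.2)) (by fun_prop)
  calc _ ≤ ∫⁻ t in Icc 0 δ, ∫⁻ ξ, 2 * (‖tri σ t (v 0) (v 0) (v 0) ξ‖ₑ ^ 2 +
        ENNReal.ofReal δ * ∫⁻ s in Icc 0 δ, 4 * F t s ξ) :=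
        setLIntegral_mono' measurableSet_Icc fun t ht =>
          lintegral_mono fun ξ => h.enorm_tri_sq_le hσ ht ξ
    _ = 2 * ((∫⁻ t in Icc 0 δ, ∫⁻ ξ, ‖tri σ t (v 0) (v 0) (v 0) ξ‖ₑ ^ 2) +
        ENNReal.ofReal δ * (4 * ∫⁻ t in Icc 0 δ, ∫⁻ ξ, ∫⁻ s in Icc 0 δ, F t s ξ)) := by
        have e1 : ∀ t ξ, ∫⁻ s in Icc 0 δ, 4 * F t s ξ = 4 * ∫⁻ s in Icc 0 δ, F t s ξ := fun t ξ =>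
          lintegral_const_mul' _ _ (by norm_num)
        have e2 : ∀ t, ∫⁻ ξ, 2 * (‖tri σ t (v 0) (v 0) (v 0) ξ‖ₑ ^ 2 +
            ENNReal.ofReal δ * (4 * ∫⁻ s in Icc 0 δ, F t s ξ)) =
            2 * ((∫⁻ ξ, ‖tri σ t (v 0) (v 0) (v 0) ξ‖ₑ ^ 2) +
              ENNReal.ofReal δ * (4 * ∫⁻ ξ, ∫⁻ s in Icc 0 δ, F t s ξ)) := by
          intro t
          rw [lintegral_const_mul' _ _ (by norm_num), lintegral_add_left
            (f := fun ξ => ‖tri σ t (v 0) (v 0) (v 0) ξ‖ₑ ^ 2)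
              (m0.comp (f := fun ξ : Rn 2 => (t, ξ)) (by fun_prop)),
            lintegral_const_mul' _ _ ENNReal.ofReal_ne_top, lintegral_const_mul' _ _ (by norm_num)]
        simp_rw [e1, e2]
        rw [lintegral_const_mul' _ _ (by norm_num), lintegral_add_left m0.lintegral_prod_right',
            lintegral_const_mul' _ _ ENNReal.ofReal_ne_top, lintegral_const_mul' _ _ (by norm_num)]
    _ = 2 * ((∫⁻ t in Icc 0 δ, ∫⁻ ξ, ‖tri σ t (v 0) (v 0) (v 0) ξ‖ₑ ^ 2) +
        ENNReal.ofReal δ * (4 * ∫⁻ s in Icc 0 δ, ∫⁻ t in Icc 0 δ, ∫⁻ ξ, F t s ξ)) := by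
        congr 3
        refine congrArg _ ?_
        have e1 : ∀ t, ∫⁻ ξ, ∫⁻ s in Icc 0 δ, F t s ξ = ∫⁻ s in Icc 0 δ, ∫⁻ ξ, F t s ξ := by
          intro t
          refine lintegral_lintegral_swap (Measurable.aemeasurable ?_)
          exact hFm.comp (f := fun q : Rn 2 × ℝ => (t, q.2, q.1)) (by fun_prop)
        simp_rw [e1]
        refine lintegral_lintegral_swap (Measurable.aemeasurable ?_)
        exact Measurable.lintegral_prod_right' (f := fun q : (ℝ × ℝ) × Rn 2 => F q.1.1 q.1.2 q.2)
          (hFm.comp (f := fun q : (ℝ × ℝ) × Rn 2 => (q.1.1, q.1.2, q.2)) (by fun_prop))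
    _ ≤ 2 * (e * (2 * A * X ^ 3) + ENNReal.ofReal δ * (4 *
        (3 * (e * (2 * A * (X ^ 2 * ∫⁻ s in Icc 0 δ, wnorm θ (f s))))))) := by
        gcongr
        · refine h0.trans ?_
          gcongr e * (2 * A * ?_)
          calc _ ≤ X * X * X := by gcongr
            _ = _ := by ring
        · refine (setLIntegral_mono' measurableSet_Icc hfree).trans (le_of_eq ?_)
          have mw : Measurable fun s => wnorm θ (f s) := by
            refine Measurable.lintegral_prod_right' (f := fun q : ℝ × Rn 2 =>
              wabs θ (f q.1) q.2 ^ 2) ?_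
            exact (((hθ.measurable.ennreal_ofReal).comp measurable_snd).mul
              h.cont_deriv.measurable.enorm).pow_const 2
          rw [lintegral_const_mul _ (by fun_prop), lintegral_const_mul _ (by fun_prop),
            lintegral_const_mul _ (by fun_prop), lintegral_const_mul _ (by fun_prop)]
    _ = _ := by ring

/-! ### The equation on the Fourier side -/

lemma jap_pow_le_sum (ξ a b : Rn 2) (n : ℕ) :
    jap ξ ^ n ≤ 3 ^ n * (jap a ^ n + jap b ^ n + jap (ξ - a + b) ^ n) := by
  have h1 : jap ξ ≤ jap a + jap b + jap (ξ - a + b) := by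
    have e1 : ξ = (a + (ξ - a + b)) - b := by abel
    have e2 := jap_add_le a (ξ - a + b)
    have e3 := jap_sub_le (a + (ξ - a + b)) b
    rw [← e1] at e3
    linarith
  have ha := jap_pos a
  have hb := jap_pos b
  have hc := jap_pos (ξ - a + b)
  obtain ⟨x, hx, hx'⟩ : ∃ x, (x = jap a ∨ x = jap b ∨ x = jap (ξ - a + b)) ∧
      jap ξ ≤ 3 * x := by
    by_contra! h
    have := h _ (Or.inl rfl)
    have := h _ (Or.inr (Or.inl rfl))
    have := h _ (Or.inr (Or.inr rfl))
    linarith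
  calc jap ξ ^ n ≤ (3 * x) ^ n := by
        have := jap_pos ξ
        gcongr
    _ = 3 ^ n * x ^ n := mul_pow _ _ _
    _ ≤ _ := by
        have := pow_pos ha n
        have := pow_pos hb n
        have := pow_pos hc n
        gcongr
        rcases hx with rfl | rfl | rfl <;> linarith

lemma decay_mul_le (ξ a b : Rn 2) (n : ℕ) :
    decay n a * decay n b * decay n (ξ - a + b) ≤ 3 ^ n * decay n ξ *
      (decay n b * decay n (ξ - a + b) + decay n a * decay n (ξ - a + b)
        + decay n a * decay n b) := by
  have h := jap_pow_le_sum ξ a b n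
  unfold decay
  have h0 := pow_pos (jap_pos ξ) n
  have h1 := pow_pos (jap_pos a) n
  have h2 := pow_pos (jap_pos b) n
  have h3 := pow_pos (jap_pos (ξ - a + b)) n
  generalize jap ξ ^ n = x at *
  generalize jap a ^ n = y at *
  generalize jap b ^ n = z at *
  generalize jap (ξ - a + b) ^ n = w at *
  have : 3 ^ n * x⁻¹ * (z⁻¹ * w⁻¹ + y⁻¹ * w⁻¹ + y⁻¹ * z⁻¹)
      = (3 ^ n * (y + z + w)) / x * (y⁻¹ * z⁻¹ * w⁻¹) := by
    field_simp
  rw [this]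
  refine le_mul_of_one_le_left (by positivity) ?_
  rwa [one_le_div h0]

lemma exists_integral_decay_le : ∃ K : ℝ, 0 ≤ K ∧ ∀ ξ : Rn 2,
    Integrable (fun p : Rn 2 × Rn 2 => decay 8 p.1 * decay 8 p.2 * decay 8 (ξ - p.1 + p.2)) ∧
    ∫ p : Rn 2 × Rn 2, decay 8 p.1 * decay 8 p.2 * decay 8 (ξ - p.1 + p.2) ≤ K * decay 8 ξ := by
  set L := ∫ p : Rn 2 × Rn 2, decay 8 p.1 * decay 8 p.2 with hL
  have hL0 : 0 ≤ L := integral_nonneg fun p => mul_nonneg (decay_pos _ _).le (decay_pos _ _).le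
  refine ⟨3 ^ 8 * (L + L + L), by positivity, fun ξ => ?_⟩
  have shear : MeasurePreserving (fun p : Rn 2 × Rn 2 => (p.1, ξ - p.1 + p.2)) := by
    have := (MeasurePreserving.id (volume : Measure (Rn 2))).skew_product (μb := volume)
      (μd := (volume : Measure (Rn 2)))
      (g := fun a b : Rn 2 => ξ - a + b) (by fun_prop)
      (Filter.Eventually.of_forall fun a => (measurePreserving_add_left volume (ξ - a)).map_eq)
    exact this
  have shear' : MeasurePreserving (fun p : Rn 2 × Rn 2 => (ξ - p.1 + p.2, p.2)) := by
    have h1 := (Measure.measurePreserving_swap (μ := (volume : Measure (Rn 2)))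
      (ν := (volume : Measure (Rn 2))))
    have h2 : MeasurePreserving (fun p : Rn 2 × Rn 2 => (p.1, ξ - p.2 + p.1)) := by
      have := (MeasurePreserving.id (volume : Measure (Rn 2))).skew_product (μb := volume)
        (μd := (volume : Measure (Rn 2)))
        (g := fun b a : Rn 2 => ξ - a + b) (by fun_prop)
        (Filter.Eventually.of_forall fun b => by
          have := (Measure.measurePreserving_sub_left (volume : Measure (Rn 2)) (ξ + b)).map_eq
          rw [← this]
          congr 1
          ext1 a
          abel)
      exact this
    exact (h1.comp h2).comp h1
  have i12 := integrable_decay_prod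
  have hc := (continuous_decay 8).measurable
  have m12 : Measurable fun p : Rn 2 × Rn 2 => decay 8 p.1 * decay 8 p.2 := by fun_prop
  have i13 : Integrable fun p : Rn 2 × Rn 2 => decay 8 p.1 * decay 8 (ξ - p.1 + p.2) :=
    (shear.integrable_comp m12.aestronglyMeasurable).mpr i12
  have i23 : Integrable fun p : Rn 2 × Rn 2 => decay 8 p.2 * decay 8 (ξ - p.1 + p.2) := by
    have := (shear'.integrable_comp m12.aestronglyMeasurable).mpr i12
    refine this.congr (Filter.Eventually.of_forall fun p => ?_)
    simp only [Function.comp_apply]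
    ring
  have e13 : ∫ p : Rn 2 × Rn 2, decay 8 p.1 * decay 8 (ξ - p.1 + p.2) = L := by
    have := integral_map shear.aemeasurable (f := fun p : Rn 2 × Rn 2 => decay 8 p.1 * decay 8 p.2)
      m12.aestronglyMeasurable
    rw [shear.map_eq] at this
    exact this.symm
  have e23 : ∫ p : Rn 2 × Rn 2, decay 8 p.2 * decay 8 (ξ - p.1 + p.2) = L := by
    have := integral_map shear'.aemeasurable
      (f := fun p : Rn 2 × Rn 2 => decay 8 p.1 * decay 8 p.2) m12.aestronglyMeasurable
    rw [shear'.map_eq] at this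
    rw [hL, this]
    exact integral_congr_ae (Filter.Eventually.of_forall fun p => mul_comm _ _)
  have hintg := ((i23.add i13).add i12).const_mul (3 ^ 8 * decay 8 ξ)
  have hle : ∀ p : Rn 2 × Rn 2, decay 8 p.1 * decay 8 p.2 * decay 8 (ξ - p.1 + p.2) ≤
      3 ^ 8 * decay 8 ξ * (decay 8 p.2 * decay 8 (ξ - p.1 + p.2) +
        decay 8 p.1 * decay 8 (ξ - p.1 + p.2) + decay 8 p.1 * decay 8 p.2) := fun p =>
    decay_mul_le ξ p.1 p.2 8
  have hI : Integrable
      (fun p : Rn 2 × Rn 2 => decay 8 p.1 * decay 8 p.2 * decay 8 (ξ - p.1 + p.2)) := by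
    refine hintg.mono' (by fun_prop) (Filter.Eventually.of_forall fun p => ?_)
    rw [Real.norm_of_nonneg]
    · exact hle p
    · exact mul_nonneg (mul_nonneg (decay_pos _ _).le (decay_pos _ _).le) (decay_pos _ _).le
  refine ⟨hI, (integral_mono hI hintg hle).trans (le_of_eq ?_)⟩
  have ea := integral_add (i23.add i13) i12
  have eb := integral_add i23 i13
  simp only [Pi.add_apply] at ea
  simp only [Pi.add_apply]
  rw [integral_const_mul, ea, eb, e23, e13]
  ring

/-- The trilinear Fourier multiplier with symbol `σ`. -/
def mult (σ : Rn 2 × Rn 2 × Rn 2 → ℝ) (f : Rn 2 → ℂ) (ξ : Rn 2) : ℂ :=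
  ∫ p : Rn 2 × Rn 2, σ (ξ, p) * cub f f f ξ p

/-- The free Schrödinger spin on the Fourier side. -/
def spin (t : ℝ) (f : Rn 2 → ℂ) (ξ : Rn 2) : ℂ := cexp (I * (t * ‖ξ‖ ^ 2 : ℝ)) * f ξ

lemma isSymbol_one : IsSymbol fun _ => 1 := ⟨continuous_const, fun _ => ⟨1, fun _ => by simp⟩⟩

lemma norm_cexp_I_real (x : ℝ) : ‖cexp (I * x)‖ = 1 := by
  rw [mul_comm, Complex.norm_exp_ofReal_mul_I]

lemma norm_spin (t : ℝ) (f : Rn 2 → ℂ) (ξ : Rn 2) : ‖spin t f ξ‖ = ‖f ξ‖ := by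
  unfold spin
  rw [norm_mul, norm_cexp_I_real, one_mul]

lemma wnorm_spin (θ : Rn 2 → ℝ) (t : ℝ) (f : Rn 2 → ℂ) : wnorm θ (spin t f) = wnorm θ f := by
  unfold wnorm wabs
  simp_rw [← ofReal_norm, norm_spin]

lemma continuous_spin_exp : Continuous fun q : ℝ × Rn 2 => cexp (I * (q.1 * ‖q.2‖ ^ 2 : ℝ)) := by
  have : Continuous fun q : ℝ × Rn 2 => q.1 * ‖q.2‖ ^ 2 := by fun_prop
  exact Complex.continuous_exp.comp (continuous_const.mul (Complex.continuous_ofReal.comp this))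

lemma Rapid.spin {C : ℝ} {f : Rn 2 → ℂ} (h : Rapid C f) (t : ℝ) : Rapid C (spin t f) :=
  ⟨(continuous_spin_exp.comp (f := fun x : Rn 2 => (t, x)) (by fun_prop)).mul h.1,
    fun x => by rw [norm_spin]; exact h.2 x⟩

lemma cexp_phase_mul_cub_spin (t : ℝ) (f : Rn 2 → ℂ) (ξ : Rn 2) (p : Rn 2 × Rn 2) :
    cexp (I * phase ξ p.1 p.2 * t) * cub (spin t f) (spin t f) (spin t f) ξ p =
      cexp (I * (t * ‖ξ‖ ^ 2 : ℝ)) * cub f f f ξ p := by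
  simp only [cub, spin, map_mul, ← Complex.exp_conj, Complex.conj_I, Complex.conj_ofReal]
  have : cexp (I * (t * ‖ξ‖ ^ 2 : ℝ)) = cexp (I * phase ξ p.1 p.2 * t) *
      cexp (I * (t * ‖p.1‖ ^ 2 : ℝ)) * cexp (-I * (t * ‖p.2‖ ^ 2 : ℝ)) *
      cexp (I * (t * ‖ξ - p.1 + p.2‖ ^ 2 : ℝ)) := by
    rw [← Complex.exp_add, ← Complex.exp_add, ← Complex.exp_add]
    congr 1
    unfold phase
    push_cast
    ring
  rw [this]
  ring

lemma tri_spin (σ : Rn 2 × Rn 2 × Rn 2 → ℝ) (t : ℝ) (f : Rn 2 → ℂ) (ξ : Rn 2) :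
    tri σ t (spin t f) (spin t f) (spin t f) ξ = spin t (mult σ f) ξ := by
  unfold tri mult
  rw [spin, ← integral_const_mul]
  refine integral_congr_ae (Filter.Eventually.of_forall fun p => ?_)
  simp only
  rw [mul_left_comm, cexp_phase_mul_cub_spin]
  ring

/-- Rapidly decaying solutions of the cubic Schrödinger equation on the Fourier side. -/
structure FourierSol (T C : ℝ) (W : ℝ → Rn 2 → ℂ) : Prop where
  cont : Continuous (Function.uncurry W)
  rapid : ∀ t, Rapid C (W t)
  hasDerivAt : ∀ t ∈ Ioo 0 T, ∀ ξ,
    HasDerivAt (fun s => W s ξ) (-I * (((‖ξ‖ ^ 2 : ℝ) : ℂ) * W t ξ + mult (fun _ => 1) (W t) ξ)) t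

lemma FourierSol.shift {T T' C t₀ : ℝ} {W : ℝ → Rn 2 → ℂ} (h : FourierSol T C W) (h0 : 0 ≤ t₀)
    (hT : t₀ + T' ≤ T) : FourierSol T' C fun t => W (t₀ + t) where
  cont := h.cont.comp (f := fun q : ℝ × Rn 2 => (t₀ + q.1, q.2)) (by fun_prop)
  rapid t := h.rapid _
  hasDerivAt t ht ξ := by
    have := h.hasDerivAt (t₀ + t) ⟨by linarith [ht.1], by linarith [ht.2]⟩ ξ
    exact this.comp_const_add t₀ t

lemma exists_norm_integral_cub_le : ∃ K : ℝ, 0 ≤ K ∧ ∀ {C M : ℝ} {f₁ f₂ f₃ : Rn 2 → ℂ},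
    Rapid C f₁ → Rapid C f₂ → Rapid C f₃ → 0 ≤ M → ∀ ξ (F : Rn 2 × Rn 2 → ℂ),
    (∀ p, ‖F p‖ ≤ M * ‖cub f₁ f₂ f₃ ξ p‖) → ‖∫ p, F p‖ ≤ M * C ^ 3 * K * decay 8 ξ := by
  obtain ⟨K, hK0, hK⟩ := exists_integral_decay_le
  refine ⟨K, hK0, fun {C M f₁ f₂ f₃} h₁ h₂ h₃ hM ξ F hF => ?_⟩
  have hC := h₁.nonneg
  calc ‖∫ p, F p‖ ≤ ∫ p : Rn 2 × Rn 2, M * C ^ 3 *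
        (decay 8 p.1 * decay 8 p.2 * decay 8 (ξ - p.1 + p.2)) := by
        refine norm_integral_le_of_norm_le ((hK ξ).1.const_mul _)
          (Filter.Eventually.of_forall fun p => (hF p).trans ?_)
        rw [norm_cub]
        have := decay_pos 8 p.1
        have := decay_pos 8 p.2
        calc _ ≤ M * ((C * decay 8 p.1) * (C * decay 8 p.2) * (C * decay 8 (ξ - p.1 + p.2))) := by
              have := decay_pos 8 (ξ - p.1 + p.2)
              refine mul_le_mul_of_nonneg_left (mul_le_mul (mul_le_mul (h₁.2 _) (h₂.2 _)
                (norm_nonneg _) (by positivity)) (h₃.2 _) (norm_nonneg _) (by positivity)) hM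
          _ = _ := by ring
    _ ≤ _ := by
        rw [integral_const_mul, mul_assoc _ K]
        exact mul_le_mul_of_nonneg_left (hK ξ).2 (by positivity)

lemma continuous_mult {C : ℝ} {W : ℝ → Rn 2 → ℂ} (hc : Continuous (Function.uncurry W))
    (hr : ∀ t, Rapid C (W t)) {σ : Rn 2 × Rn 2 × Rn 2 → ℝ} (hσ : Continuous σ) {M : ℝ}
    (hM : ∀ q, |σ q| ≤ M) : Continuous fun q : ℝ × Rn 2 => mult σ (W q.1) q.2 := by
  have hM0 : 0 ≤ M := (abs_nonneg _).trans (hM 0)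
  have hs : IsSymbol σ := ⟨hσ, fun ξ => ⟨M, fun p => hM _⟩⟩
  have hj := (continuous_tri_integrand hs hc hc hc).comp
    (f := fun q : (ℝ × Rn 2) × Rn 2 × Rn 2 => (((0 : ℝ), q.1.1, q.1.2), q.2)) (by fun_prop)
  have hj' : Continuous fun q : (ℝ × Rn 2) × Rn 2 × Rn 2 =>
      (σ (q.1.2, q.2) : ℂ) * cub (W q.1.1) (W q.1.1) (W q.1.1) q.1.2 q.2 := by
    refine hj.congr fun q => ?_
    simp
  unfold mult
  refine continuous_of_dominated (bound := fun p : Rn 2 × Rn 2 =>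
    M * (C ^ 3 * (decay 8 p.1 * decay 8 p.2))) (fun q => ?_)
    (fun q => Filter.Eventually.of_forall fun p => ?_)
    ((integrable_decay_prod.const_mul _).const_mul _)
    (Filter.Eventually.of_forall fun p => ?_)
  · exact (hj'.comp (f := fun p : Rn 2 × Rn 2 => (q, p)) (by fun_prop)).aestronglyMeasurable
  · rw [norm_mul, Complex.norm_real]
    gcongr
    · exact hM _
    · exact norm_cub_le (hr _) (hr _) (hr _) _ _
  · exact hj'.comp (f := fun q : ℝ × Rn 2 => (q, p)) (by fun_prop)

lemma exists_rapid_mult {σ : Rn 2 × Rn 2 × Rn 2 → ℝ} (hσ : Continuous σ) {M : ℝ}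
    (hM : ∀ q, |σ q| ≤ M) (C : ℝ) : ∃ C', ∀ f : Rn 2 → ℂ, Rapid C f → Rapid C' (mult σ f) := by
  obtain ⟨K, hK0, hK⟩ := exists_norm_integral_cub_le
  have hM0 : 0 ≤ M := (abs_nonneg _).trans (hM 0)
  refine ⟨M * C ^ 3 * K, fun f hf => ⟨?_, fun ξ => hK hf hf hf hM0 ξ _ fun p => ?_⟩⟩
  · exact (continuous_mult (W := fun _ => f) (hf.1.comp continuous_snd) (fun _ => hf) hσ hM).comp
      (f := fun x : Rn 2 => ((0 : ℝ), x)) (by fun_prop)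
  · rw [norm_mul, Complex.norm_real]
    gcongr
    exact hM _

lemma Rapid.mono {C C' : ℝ} {f : Rn 2 → ℂ} (h : Rapid C f) (hC : C ≤ C') : Rapid C' f :=
  ⟨h.1, fun x => (h.2 x).trans (by have := decay_pos 8 x; gcongr)⟩

/-- The interaction-picture flow associated with a solution. -/
lemma FourierSol.exists_isFlow {T C : ℝ} {W : ℝ → Rn 2 → ℂ} (h : FourierSol T C W) :
    ∃ C', IsFlow T C' (fun t => spin t (W t))
      (fun t ξ => -I * spin t (mult (fun _ => 1) (W t)) ξ) := by
  obtain ⟨C', hC'⟩ := exists_rapid_mult (σ := fun _ => 1) (M := 1) continuous_const (by simp) C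
  refine ⟨max C C', ?_, ?_, fun t => ((h.rapid t).spin t).mono (le_max_left _ _), fun t => ?_,
    fun t ht ξ => ?_⟩
  · exact continuous_spin_exp.mul h.cont
  · exact continuous_const.mul (continuous_spin_exp.mul
      (continuous_mult h.cont h.rapid (σ := fun _ => 1) (M := 1) continuous_const (by simp)))
  · have := ((hC' _ (h.rapid t)).spin t).mono (le_max_right C C')
    exact ⟨continuous_const.mul this.1, fun x => by simpa using this.2 x⟩
  · have h1 := h.hasDerivAt t ht ξ
    have h2 : HasDerivAt (fun s : ℝ => I * ((s * ‖ξ‖ ^ 2 : ℝ) : ℂ))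
        (I * ((‖ξ‖ ^ 2 : ℝ) : ℂ)) t := by
      have := ((hasDerivAt_id t).mul_const (‖ξ‖ ^ 2)).ofReal_comp.const_mul I
      simpa using this
    refine (h2.cexp.mul h1).congr_deriv ?_
    simp only [spin]
    ring_nf

lemma enorm_tri_spin {σ : Rn 2 × Rn 2 × Rn 2 → ℝ} (t : ℝ) (f : Rn 2 → ℂ)
    (ξ : Rn 2) : ‖tri σ t (spin t f) (spin t f) (spin t f) ξ‖ₑ = ‖mult σ f ξ‖ₑ := by
  rw [tri_spin, ← ofReal_norm, norm_spin, ofReal_norm]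

/-! ### Kernel bounds for the symbols -/

section symbols

variable {N s κ : ℝ}

lemma inv_smoothWt_le (hN : 1 ≤ N) (hs0 : 0 < s) (hs1 : s < 1) (hκ : κ ≤ s) {x : ℝ} (hx : 1 ≤ x) :
    (smoothWt N s x)⁻¹ ≤ x ^ (-κ) := by
  have h0 : 0 < x := by linarith
  rw [Real.rpow_neg h0.le]
  refine inv_anti₀ (Real.rpow_pos_of_pos h0 _) ?_
  exact (Real.rpow_le_rpow_of_exponent_le hx hκ).trans (rpow_le_smoothWt hN hs1 hx)

/-- Sum over pairs of products of negative powers. -/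
def pairSum (κ x y z : ℝ) : ℝ := x ^ (-κ) * y ^ (-κ) + x ^ (-κ) * z ^ (-κ) + y ^ (-κ) * z ^ (-κ)

lemma pairSum_nonneg {x y z : ℝ} (hx : 0 < x) (hy : 0 < y) (hz : 0 < z) : 0 ≤ pairSum κ x y z := by
  unfold pairSum
  positivity

lemma smoothWt_le_sum (hN : 1 ≤ N) (hs0 : 0 < s) (hs1 : s < 1) {w x y z : ℝ} (hw : 1 ≤ w)
    (hx : 1 ≤ x) (hy : 1 ≤ y) (hz : 1 ≤ z) (h : w ≤ x + y + z) :
    smoothWt N s w ≤ 3 * (smoothWt N s x + smoothWt N s y + smoothWt N s z) := by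
  have px := smoothWt_pos (s := s) hN (r := x) (by linarith)
  have py := smoothWt_pos (s := s) hN (r := y) (by linarith)
  have pz := smoothWt_pos (s := s) hN (r := z) (by linarith)
  have key : ∀ u, 1 ≤ u → w ≤ 3 * u → smoothWt N s w ≤ 3 * smoothWt N s u := fun u hu h =>
    (smoothWt_mono hN hs0 (by linarith) h).trans
      (smoothWt_mul_le hN hs1 (by linarith) (by norm_num))
  by_contra! hc
  have h1 : 3 * x < w := by
    by_contra! hh
    linarith [key x hx hh]
  have h2 : 3 * y < w := by
    by_contra! hh
    linarith [key y hy hh]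
  have h3 : 3 * z < w := by
    by_contra! hh
    linarith [key z hz hh]
  linarith

lemma smoothWt_ratio_le (hN : 1 ≤ N) (hs0 : 0 < s) (hs1 : s < 1) (hκ : κ ≤ s) {w x y z : ℝ}
    (hw : 1 ≤ w) (hx : 1 ≤ x) (hy : 1 ≤ y) (hz : 1 ≤ z) (h : w ≤ x + y + z) :
    smoothWt N s w / (smoothWt N s x * smoothWt N s y * smoothWt N s z) ≤
      3 * pairSum κ x y z := by
  have px := smoothWt_pos (s := s) hN (r := x) (by linarith)
  have py := smoothWt_pos (s := s) hN (r := y) (by linarith)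
  have pz := smoothWt_pos (s := s) hN (r := z) (by linarith)
  have ix := inv_smoothWt_le hN hs0 hs1 hκ hx
  have iy := inv_smoothWt_le hN hs0 hs1 hκ hy
  have iz := inv_smoothWt_le hN hs0 hs1 hκ hz
  rw [div_le_iff₀ (by positivity)]
  refine (smoothWt_le_sum hN hs0 hs1 hw hx hy hz h).trans ?_
  rw [mul_assoc]
  refine mul_le_mul_of_nonneg_left ?_ (by norm_num)
  unfold pairSum
  calc _ = ((smoothWt N s x)⁻¹ * (smoothWt N s y)⁻¹ + (smoothWt N s x)⁻¹ * (smoothWt N s z)⁻¹ +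
        (smoothWt N s y)⁻¹ * (smoothWt N s z)⁻¹) *
        (smoothWt N s x * smoothWt N s y * smoothWt N s z) := by
        field_simp
        ring
    _ ≤ _ := by gcongr

lemma prod_smoothMul_le (hN : 1 ≤ N) {x y z : ℝ} (hx : 0 < x) (hy : 0 < y) (hz : 0 < z) :
    smoothMul N s x * smoothMul N s y * smoothMul N s z ≤ smoothMul N s x ∧
    smoothMul N s x * smoothMul N s y * smoothMul N s z ≤ smoothMul N s y ∧
    smoothMul N s x * smoothMul N s y * smoothMul N s z ≤ smoothMul N s z := by
  have px := smoothMul_pos (s := s) hN hx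
  have py := smoothMul_pos (s := s) hN hy
  have pz := smoothMul_pos (s := s) hN hz
  have lx := smoothMul_le_one (N := N) (s := s) x
  have ly := smoothMul_le_one (N := N) (s := s) y
  have lz := smoothMul_le_one (N := N) (s := s) z
  refine ⟨?_, ?_, ?_⟩
  · rw [mul_assoc]
    exact mul_le_of_le_one_right px.le (mul_le_one₀ ly pz.le lz)
  · rw [mul_comm (smoothMul N s x), mul_assoc]
    exact mul_le_of_le_one_right py.le (mul_le_one₀ lx pz.le lz)
  · exact mul_le_of_le_one_left pz.le (mul_le_one₀ lx py.le ly)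

lemma abs_sub_prod_smoothMul_le (hN : 1 ≤ N) (hs0 : 0 < s) (hs1 : s < 1) {w x y z : ℝ}
    (hw : 1 ≤ w) (hx : 1 ≤ x) (hy : 1 ≤ y) (hz : 1 ≤ z) (h : w ≤ x + y + z) :
    |smoothMul N s w - smoothMul N s x * smoothMul N s y * smoothMul N s z|
      ≤ 3 * smoothMul N s w := by
  have px := smoothMul_pos (s := s) hN (r := x) (by linarith)
  have py := smoothMul_pos (s := s) hN (r := y) (by linarith)
  have pz := smoothMul_pos (s := s) hN (r := z) (by linarith)
  have pw := smoothMul_pos (s := s) hN (r := w) (by linarith)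
  obtain ⟨h1, h2, h3⟩ := prod_smoothMul_le (s := s) hN (x := x) (y := y) (z := z) (by linarith)
    (by linarith) (by linarith)
  have pp := mul_pos (mul_pos px py) pz
  have key : ∀ u, 1 ≤ u → w ≤ 3 * u → smoothMul N s u ≤ 3 * smoothMul N s w := fun u hu h =>
    smoothMul_le_mul hN hs0 hs1 (by linarith) (by linarith) (by norm_num) h
  have : smoothMul N s x * smoothMul N s y * smoothMul N s z ≤ 3 * smoothMul N s w := by
    by_contra! hc
    have h1 : 3 * x < w := by
      by_contra! hh
      linarith [key x hx hh]
    have h2 : 3 * y < w := by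
      by_contra! hh
      linarith [key y hy hh]
    have h3 : 3 * z < w := by
      by_contra! hh
      linarith [key z hz hh]
    linarith
  rw [abs_le]
  constructor <;> linarith

lemma inv_prod_smoothWt_le (hN : 1 ≤ N) (hs0 : 0 < s) (hs1 : s < 1) (hκ0 : 0 ≤ κ) (hκ : κ ≤ s)
    {w x y z : ℝ} (hw : w ≤ N / 9) (hx : N < x) (hy : 1 ≤ y) (hz : 1 ≤ z) (h : x ≤ w + y + z) :
    (smoothWt N s x)⁻¹ * (smoothWt N s y)⁻¹ * (smoothWt N s z)⁻¹ ≤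
      3 * N ^ (κ - 2) * (y ^ (-κ) * z ^ (-κ)) := by
  have hN0 : 0 < N := by linarith
  have key : ∀ y z : ℝ, 1 ≤ y → 1 ≤ z → x ≤ w + y + z → z ≤ y →
      (smoothWt N s x)⁻¹ * (smoothWt N s y)⁻¹ * (smoothWt N s z)⁻¹ ≤
        3 * N ^ (κ - 2) * (y ^ (-κ) * z ^ (-κ)) := by
    intro y z hy hz h hzy
    have px := smoothWt_pos (s := s) hN (r := x) (by linarith)
    have py := smoothWt_pos (s := s) hN (r := y) (by linarith)
    have pz := smoothWt_pos (s := s) hN (r := z) (by linarith)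
    have e1 : (smoothWt N s x)⁻¹ ≤ N ^ (-1 : ℝ) := by
      have := rpow_div_smoothWt_le hN hs0 hs1 (r := x) (e := 0) (A := 1) le_rfl (by linarith)
        le_rfl hs0.le
      simpa using this
    have e2 : (smoothWt N s y)⁻¹ ≤ 3 * N ^ (κ - 1) * y ^ (-κ) := by
      have := rpow_div_smoothWt_le hN hs0 hs1 (r := y) (e := κ) (A := 3) (by norm_num)
        (by linarith) hκ0 hκ
      have hy0 : 0 < y := by linarith
      rw [Real.rpow_neg hy0.le, ← div_eq_mul_inv, le_div_iff₀ (by positivity)]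
      rw [mul_comm, ← div_eq_mul_inv]
      exact this
    have e3 := inv_smoothWt_le hN hs0 hs1 hκ hz
    calc _ ≤ N ^ (-1 : ℝ) * (3 * N ^ (κ - 1) * y ^ (-κ)) * z ^ (-κ) := by gcongr
      _ = 3 * (N ^ (-1 : ℝ) * N ^ (κ - 1)) * (y ^ (-κ) * z ^ (-κ)) := by ring
      _ = _ := by
        rw [← Real.rpow_add hN0]
        ring_nf
  rcases le_total z y with hzy | hzy
  · exact key y z hy hz h hzy
  · have := key z y hz hy (by linarith) hzy
    calc _ = (smoothWt N s x)⁻¹ * (smoothWt N s z)⁻¹ * (smoothWt N s y)⁻¹ := by ring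
      _ ≤ _ := this
      _ = _ := by ring

lemma commutator_ratio_le (hN : 1 ≤ N) (hs0 : 0 < s) (hs1 : s < 1) (hκ0 : 0 ≤ κ) (hκ : κ ≤ s)
    {w x y z : ℝ} (hw : 1 ≤ w) (hx : 1 ≤ x) (hy : 1 ≤ y) (hz : 1 ≤ z) (h : w ≤ x + y + z)
    (hx' : x ≤ w + y + z) (hy' : y ≤ w + x + z) (hz' : z ≤ w + x + y) :
    |w⁻¹ * (smoothMul N s w - smoothMul N s x * smoothMul N s y * smoothMul N s z)| /
      (smoothWt N s x * smoothWt N s y * smoothWt N s z) ≤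
      729 * N ^ (κ - 2) * pairSum κ x y z := by
  have hN0 : 0 < N := by linarith
  have hw0 : 0 < w := by linarith
  have px := smoothWt_pos (s := s) hN (r := x) (by linarith)
  have py := smoothWt_pos (s := s) hN (r := y) (by linarith)
  have pz := smoothWt_pos (s := s) hN (r := z) (by linarith)
  have hps := pairSum_nonneg (κ := κ) (x := x) (y := y) (z := z) (by linarith) (by linarith)
    (by linarith)
  have hab := abs_sub_prod_smoothMul_le hN hs0 hs1 hw hx hy hz h
  rw [abs_mul, abs_of_pos (inv_pos.mpr hw0)]
  rcases le_total w (N / 9) with hwN | hwN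
  · by_cases hall : x ≤ N ∧ y ≤ N ∧ z ≤ N
    · rw [smoothMul_eq_one hs1 hw0 (by linarith), smoothMul_eq_one hs1 (by linarith) hall.1,
        smoothMul_eq_one hs1 (by linarith) hall.2.1, smoothMul_eq_one hs1 (by linarith) hall.2.2]
      norm_num
      positivity
    · have hle : w⁻¹ * |smoothMul N s w - smoothMul N s x * smoothMul N s y * smoothMul N s z| /
          (smoothWt N s x * smoothWt N s y * smoothWt N s z) ≤
          3 * ((smoothWt N s x)⁻¹ * (smoothWt N s y)⁻¹ * (smoothWt N s z)⁻¹) := by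
        rw [← mul_inv, ← mul_inv, div_eq_mul_inv]
        refine mul_le_mul_of_nonneg_right ?_ (by positivity)
        calc _ ≤ 1 * (3 : ℝ) := mul_le_mul (inv_le_one_of_one_le₀ hw)
              (hab.trans (by linarith [smoothMul_le_one (N := N) (s := s) w])) (abs_nonneg _)
              zero_le_one
          _ = 3 := one_mul 3
      refine hle.trans ?_
      have n1 : 0 ≤ x ^ (-κ) * y ^ (-κ) := by positivity
      have n2 : 0 ≤ x ^ (-κ) * z ^ (-κ) := by positivity
      have n3 : 0 ≤ y ^ (-κ) * z ^ (-κ) := by positivity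
      have nN : 0 < N ^ (κ - 2) := by positivity
      have fin : ∀ q, 0 ≤ q → q ≤ pairSum κ x y z → 3 * (3 * N ^ (κ - 2) * q) ≤
          729 * N ^ (κ - 2) * pairSum κ x y z := by
        intro q hq0 hq
        have := mul_le_mul_of_nonneg_left hq nN.le
        nlinarith [mul_nonneg nN.le hps]
      rcases not_and_or.mp hall with hc | hc
      · have := inv_prod_smoothWt_le hN hs0 hs1 hκ0 hκ hwN (not_le.mp hc) hy hz hx'
        refine le_trans ?_ (fin _ n3 (by unfold pairSum; linarith))
        linarith
      · rcases not_and_or.mp hc with hc | hc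
        · have := inv_prod_smoothWt_le hN hs0 hs1 hκ0 hκ hwN (not_le.mp hc) hx hz hy'
          refine le_trans ?_ (fin _ n2 (by unfold pairSum; linarith))
          linarith
        · have := inv_prod_smoothWt_le hN hs0 hs1 hκ0 hκ hwN (not_le.mp hc) hx hy hz'
          refine le_trans ?_ (fin _ n1 (by unfold pairSum; linarith))
          linarith
  · have hr := smoothWt_ratio_le hN hs0 hs1 hκ hw hx hy hz h
    have hw2 : w⁻¹ * w⁻¹ ≤ 81 * N ^ (κ - 2) := by
      have h1 : w⁻¹ ≤ 9 * N⁻¹ := by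
        rw [inv_le_comm₀ hw0 (by positivity), mul_inv, inv_inv]
        linarith
      calc w⁻¹ * w⁻¹ ≤ (9 * N⁻¹) * (9 * N⁻¹) := by gcongr
        _ = 81 * N ^ (-2 : ℝ) := by
          rw [Real.rpow_neg hN0.le, Real.rpow_two]
          ring
        _ ≤ _ := by
          gcongr
          linarith
    calc _ ≤ w⁻¹ * (3 * smoothMul N s w) / (smoothWt N s x * smoothWt N s y * smoothWt N s z) := by
          gcongr
      _ = 3 * (w⁻¹ * w⁻¹) *
          (smoothWt N s w / (smoothWt N s x * smoothWt N s y * smoothWt N s z)) := by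
          simp only [show smoothWt N s w = w * smoothMul N s w from rfl]
          field_simp
      _ ≤ 3 * (81 * N ^ (κ - 2)) * (3 * pairSum κ x y z) := by
          have := smoothWt_pos (s := s) hN hw0
          gcongr
      _ = _ := by ring

end symbols

lemma add_sq_three_le (a b c : ℝ) : (a + b + c) ^ 2 ≤ 3 * (a ^ 2 + b ^ 2 + c ^ 2) := by
  nlinarith [sq_nonneg (a - b), sq_nonneg (a - c), sq_nonneg (b - c)]

lemma pairSum_sq_le {κ x y z : ℝ} (hx : 0 < x) (hy : 0 < y) (hz : 0 < z) :
    pairSum κ x y z ^ 2 ≤ 3 * (x ^ (-(2 * κ)) * y ^ (-(2 * κ)) + x ^ (-(2 * κ)) * z ^ (-(2 * κ)) +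
      y ^ (-(2 * κ)) * z ^ (-(2 * κ))) := by
  have e : ∀ u : ℝ, 0 < u → u ^ (-(2 * κ)) = (u ^ (-κ)) ^ 2 := fun u hu => by
    rw [← Real.rpow_natCast, ← Real.rpow_mul hu.le]
    congr 1
    push_cast
    ring
  rw [e x hx, e y hy, e z hz]
  refine (add_sq_three_le _ _ _).trans (le_of_eq ?_)
  ring

lemma phase_swap (ξ a b : Rn 2) : phase ξ (ξ + b - a) b = phase ξ a b := by
  unfold phase
  rw [show ξ - (ξ + b - a) + b = a by abel, show ξ - a + b = ξ + b - a by abel]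
  ring

lemma exists_kernelBound {κ : ℝ} (hκ : 1 / 2 < κ) :
    ∃ K : ℝ≥0∞, K ≠ ⊤ ∧ ∀ (θ : Rn 2 → ℝ) (σ : Rn 2 × Rn 2 × Rn 2 → ℝ) (L : ℝ), 0 ≤ L →
      (∀ ξ p, |σ (ξ, p)| / (θ p.1 * θ p.2 * θ (ξ - p.1 + p.2)) ≤
        L * pairSum κ (jap p.1) (jap p.2) (jap (ξ - p.1 + p.2))) →
      (∀ x, 0 < θ x) → KernelBound θ σ (ENNReal.ofReal L ^ 2 * K) := by
  obtain ⟨C, hC, h⟩ := exists_lintegral_phase_pair (r := 2 * κ) (by linarith)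
  have hG := lintegral_gaussKer_lt_top.ne
  refine ⟨ENNReal.ofReal 3 * (C * (∫⁻ z, gaussKer z) + C * (∫⁻ z, gaussKer z) +
    C * ∫⁻ z, gaussKer z), by finiteness, ?_⟩
  intro θ σ L hL hσ hθ ξ μ
  have hm : Measurable fun p : Rn 2 × Rn 2 => gaussKer (μ - phase ξ p.1 p.2) :=
    measurable_gaussKer.comp (measurable_const.sub (continuous_phase_right ξ).measurable)
  have hj := measurable_jw (2 * κ)
  have hm1 : Measurable fun p : Rn 2 × Rn 2 => jw (2 * κ) p.1 := hj.comp measurable_fst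
  have hm2 : Measurable fun p : Rn 2 × Rn 2 => jw (2 * κ) p.2 := hj.comp measurable_snd
  have hm3 : Measurable fun p : Rn 2 × Rn 2 => jw (2 * κ) (ξ - p.1 + p.2) :=
    hj.comp (by fun_prop)
  have M12 : Measurable fun p : Rn 2 × Rn 2 =>
      gaussKer (μ - phase ξ p.1 p.2) * (jw (2 * κ) p.1 * jw (2 * κ) p.2) := hm.mul (hm1.mul hm2)
  have M13 : Measurable fun p : Rn 2 × Rn 2 => gaussKer (μ - phase ξ p.1 p.2) *
      (jw (2 * κ) p.1 * jw (2 * κ) (ξ - p.1 + p.2)) := hm.mul (hm1.mul hm3)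
  have M23 : Measurable fun p : Rn 2 × Rn 2 => gaussKer (μ - phase ξ p.1 p.2) *
      (jw (2 * κ) p.2 * jw (2 * κ) (ξ - p.1 + p.2)) := hm.mul (hm2.mul hm3)
  have i12 : ∫⁻ p : Rn 2 × Rn 2, gaussKer (μ - phase ξ p.1 p.2) * (jw (2 * κ) p.1 * jw (2 * κ) p.2)
      ≤ C * ∫⁻ z, gaussKer z := by
    rw [Measure.volume_eq_prod, lintegral_prod _ M12.aemeasurable]
    exact (h _ measurable_gaussKer ξ μ).1
  have i13 : ∫⁻ p : Rn 2 × Rn 2, gaussKer (μ - phase ξ p.1 p.2) *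
      (jw (2 * κ) p.1 * jw (2 * κ) (ξ - p.1 + p.2)) ≤ C * ∫⁻ z, gaussKer z := by
    rw [Measure.volume_eq_prod, lintegral_prod _ M13.aemeasurable]
    refine le_trans (le_of_eq ?_) (h _ measurable_gaussKer ξ μ).2
    refine lintegral_congr fun a => ?_
    rw [← lintegral_sub_right_eq_self _ (ξ - a)]
    refine lintegral_congr fun b => ?_
    simp
  have i23 : ∫⁻ p : Rn 2 × Rn 2, gaussKer (μ - phase ξ p.1 p.2) *
      (jw (2 * κ) p.2 * jw (2 * κ) (ξ - p.1 + p.2)) ≤ C * ∫⁻ z, gaussKer z := by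
    rw [Measure.volume_eq_prod, lintegral_prod_symm _ M23.aemeasurable]
    refine le_trans (le_of_eq ?_) i12
    rw [Measure.volume_eq_prod, lintegral_prod_symm _ M12.aemeasurable]
    refine lintegral_congr fun b => ?_
    rw [← lintegral_sub_left_eq_self _ (ξ + b)]
    refine lintegral_congr fun a => ?_
    simp only [phase_swap]
    rw [show ξ - (ξ + b - a) + b = a by abel, mul_comm (jw (2 * κ) b)]
  calc _ ≤ ∫⁻ p : Rn 2 × Rn 2, ENNReal.ofReal L ^ 2 * (ENNReal.ofReal 3 *
        ((gaussKer (μ - phase ξ p.1 p.2) * (jw (2 * κ) p.1 * jw (2 * κ) p.2) +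
        gaussKer (μ - phase ξ p.1 p.2) * (jw (2 * κ) p.1 * jw (2 * κ) (ξ - p.1 + p.2))) +
        gaussKer (μ - phase ξ p.1 p.2) * (jw (2 * κ) p.2 * jw (2 * κ) (ξ - p.1 + p.2)))) := by
        refine lintegral_mono fun p => ?_
        have px := jap_pos p.1
        have py := jap_pos p.2
        have pz := jap_pos (ξ - p.1 + p.2)
        have hp := pairSum_nonneg (κ := κ) px py pz
        have e1 : ENNReal.ofReal (|σ (ξ, p)| / (θ p.1 * θ p.2 * θ (ξ - p.1 + p.2))) ^ 2 ≤
            ENNReal.ofReal L ^ 2 * (ENNReal.ofReal 3 * (jw (2 * κ) p.1 * jw (2 * κ) p.2 +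
              jw (2 * κ) p.1 * jw (2 * κ) (ξ - p.1 + p.2) +
              jw (2 * κ) p.2 * jw (2 * κ) (ξ - p.1 + p.2))) := by
          unfold jw
          rw [← ENNReal.ofReal_mul (by positivity), ← ENNReal.ofReal_mul (by positivity),
            ← ENNReal.ofReal_mul (by positivity), ← ENNReal.ofReal_add (by positivity)
            (by positivity), ← ENNReal.ofReal_add (by positivity) (by positivity),
            ← ENNReal.ofReal_mul (by positivity), ← ENNReal.ofReal_pow hL,
            ← ENNReal.ofReal_mul (by positivity), ← ENNReal.ofReal_pow
              (div_nonneg (abs_nonneg _) (mul_pos (mul_pos (hθ _) (hθ _)) (hθ _)).le)]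
          refine ENNReal.ofReal_le_ofReal ?_
          refine (pow_le_pow_left₀ (div_nonneg (abs_nonneg _)
            (mul_pos (mul_pos (hθ _) (hθ _)) (hθ _)).le) (hσ ξ p) 2).trans ?_
          rw [mul_pow]
          exact mul_le_mul_of_nonneg_left (pairSum_sq_le px py pz) (sq_nonneg L)
        refine (mul_le_mul_right e1 _).trans (le_of_eq ?_)
        ring
    _ ≤ _ := by
        rw [lintegral_const_mul' _ _ (by finiteness), lintegral_const_mul' _ _ (by finiteness),
          lintegral_add_right _ M23,
          lintegral_add_right _ M13]
        gcongr

/-! ### Local well-posedness bounds -/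

section localTheory

variable {θ : Rn 2 → ℝ}

lemma wabs_sq_le (hθ1 : ∀ x, θ x ≤ jap x) {C : ℝ} {f : Rn 2 → ℂ} (h : Rapid C f) (x : Rn 2) :
    wabs θ f x ^ 2 ≤ ENNReal.ofReal (C ^ 2 * decay 7 x) := by
  have hC := h.nonneg
  have hj := jap_pos x
  have hd := decay_pos 7 x
  have h1 : wabs θ f x ≤ ENNReal.ofReal (C * decay 7 x) := by
    unfold wabs
    rw [← ofReal_norm, ← ENNReal.ofReal_mul' (norm_nonneg _)]
    refine ENNReal.ofReal_le_ofReal ?_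
    calc θ x * ‖f x‖ ≤ jap x * (C * decay 8 x) :=
          mul_le_mul (hθ1 x) (h.2 x) (norm_nonneg _) hj.le
      _ = C * (jap x ^ 1 * decay (1 + 7) x) := by
          norm_num
          ring
      _ = _ := by rw [jap_pow_mul_decay]
  refine (pow_le_pow_left' h1 2).trans ?_
  rw [← ENNReal.ofReal_pow (by positivity)]
  refine ENNReal.ofReal_le_ofReal ?_
  rw [mul_pow]
  refine mul_le_mul_of_nonneg_left ?_ (sq_nonneg C)
  have := decay_le_one 7 x
  nlinarith

lemma lintegral_decay_lt_top (C : ℝ) : ∫⁻ x : Rn 2, ENNReal.ofReal (C ^ 2 * decay 7 x) < ⊤ :=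
  ((integrable_decay (n := 7) (by norm_num)).const_mul (C ^ 2)).lintegral_lt_top

lemma wnorm_le_of_rapid (hθ1 : ∀ x, θ x ≤ jap x) {C : ℝ} {f : Rn 2 → ℂ} (h : Rapid C f) :
    wnorm θ f ≤ ∫⁻ x : Rn 2, ENNReal.ofReal (C ^ 2 * decay 7 x) :=
  lintegral_mono fun x => wabs_sq_le hθ1 h x

lemma continuous_wnorm (hθ : Continuous θ) (hθ1 : ∀ x, θ x ≤ jap x) {C : ℝ}
    {v : ℝ → Rn 2 → ℂ} (hv : Continuous (Function.uncurry v)) (hr : ∀ t, Rapid C (v t)) :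
    Continuous fun t => wnorm θ (v t) := by
  refine continuous_iff_continuousAt.mpr fun t => ?_
  refine tendsto_lintegral_filter_of_dominated_convergence
    (fun x => ENNReal.ofReal (C ^ 2 * decay 7 x)) ?_ ?_ (lintegral_decay_lt_top C).ne ?_
  · exact Filter.Eventually.of_forall fun s => (measurable_wabs hθ (hr s).1).pow_const 2
  · exact Filter.Eventually.of_forall fun s => Filter.Eventually.of_forall fun x =>
      wabs_sq_le hθ1 (hr s) x
  · refine Filter.Eventually.of_forall fun x => ?_
    have hc : Continuous fun s => v s x := continuous_apply_of_uncurry hv x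
    have : Continuous fun s => wabs θ (v s) x ^ 2 :=
      (ENNReal.continuous_pow 2).comp
        ((ENNReal.continuous_const_mul ENNReal.ofReal_ne_top).comp hc.enorm)
    exact this.tendsto t

/-- A time-independent majorant of a flow. -/
def flowMaj (δ : ℝ) (v f : ℝ → Rn 2 → ℂ) (ξ : Rn 2) : ℝ≥0∞ :=
  ‖v 0 ξ‖ₑ + ∫⁻ s in Icc 0 δ, ‖f s ξ‖ₑ

lemma measurable_flowMaj {δ C : ℝ} {v f : ℝ → Rn 2 → ℂ} (h : IsFlow δ C v f) (t : ℝ) :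
    Measurable (flowMaj t v f) := by
  refine (h.rapid 0).1.measurable.enorm.add ?_
  exact h.cont_deriv.measurable.enorm.lintegral_prod_left'

lemma IsFlow.enorm_le_flowMaj {δ C : ℝ} {v f : ℝ → Rn 2 → ℂ} (h : IsFlow δ C v f) {t t' : ℝ}
    (ht : t ∈ Icc 0 δ) (htt : t ≤ t') (ξ : Rn 2) : ‖v t ξ‖ₑ ≤ flowMaj t' v f ξ := by
  rw [h.eq_add_integral ht ξ]
  refine (enorm_add_le _ _).trans (add_le_add le_rfl ?_)
  refine (enorm_integral_le_lintegral_enorm _).trans ?_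
  exact lintegral_mono_set (Icc_subset_Icc le_rfl htt)

lemma IsFlow.lintegral_flowMaj_sq_le (hθ : Continuous θ) {δ C : ℝ} {v f : ℝ → Rn 2 → ℂ}
    (h : IsFlow δ C v f) (t : ℝ) :
    ∫⁻ ξ, (ENNReal.ofReal (θ ξ) * flowMaj t v f ξ) ^ 2 ≤
      2 * (wnorm θ (v 0) + ENNReal.ofReal t * ∫⁻ s in Icc 0 t, wnorm θ (f s)) := by
  have hm : Measurable fun q : ℝ × Rn 2 => ENNReal.ofReal (θ q.2) * ‖f q.1 q.2‖ₑ :=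
    (hθ.measurable.ennreal_ofReal.comp measurable_snd).mul h.cont_deriv.measurable.enorm
  calc _ ≤ ∫⁻ ξ, 2 * (wabs θ (v 0) ξ ^ 2 +
        ENNReal.ofReal t * ∫⁻ s in Icc 0 t, wabs θ (f s) ξ ^ 2) := by
        refine lintegral_mono fun ξ => ?_
        simp only [flowMaj]
        rw [mul_add]
        refine (sq_add_le_ennreal _ _).trans ?_
        gcongr
        · exact le_rfl
        · rw [← lintegral_const_mul' _ _ ENNReal.ofReal_ne_top]
          exact sq_lintegral_Icc_le (hm.comp (f := fun s : ℝ => (s, ξ)) (by fun_prop))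
    _ = _ := by
        rw [lintegral_const_mul' _ _ (by finiteness),
          lintegral_add_left ((measurable_wabs hθ (h.rapid 0).1).pow_const 2),
          lintegral_const_mul' _ _ ENNReal.ofReal_ne_top, lintegral_lintegral_swap]
        · rfl
        · exact ((hm.comp measurable_swap).pow_const 2).aemeasurable

lemma IsFlow.wnorm_le (hθ : Continuous θ) {δ C : ℝ} {v f : ℝ → Rn 2 → ℂ}
    (h : IsFlow δ C v f) {t : ℝ} (ht : t ∈ Icc 0 δ) :
    wnorm θ (v t) ≤ 2 * (wnorm θ (v 0) + ENNReal.ofReal t * ∫⁻ s in Icc 0 t, wnorm θ (f s)) := by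
  refine le_trans (lintegral_mono fun ξ => ?_) (h.lintegral_flowMaj_sq_le hθ t)
  exact pow_le_pow_left' (mul_le_mul_right (h.enorm_le_flowMaj ht le_rfl ξ) _) 2

lemma le_two_mul_of_le_add_mul {a b y : ℝ≥0∞} (hb : b ≤ 2⁻¹) (hy : y ≠ ⊤) (h : y ≤ a + b * y) :
    y ≤ 2 * a := by
  by_cases ha : a = ⊤
  · simp [ha]
  lift a to ℝ≥0 using ha
  lift y to ℝ≥0 using hy
  lift b to ℝ≥0 using (hb.trans_lt (by simp)).ne
  rw [← ENNReal.coe_two, ← ENNReal.coe_inv (by norm_num), ENNReal.coe_le_coe] at hb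
  norm_cast at h ⊢
  rw [← NNReal.coe_le_coe] at *
  push_cast at *
  have := mul_le_mul_of_nonneg_right hb y.coe_nonneg
  linarith

/-- Admissible weights together with the multiplier estimate they satisfy. -/
structure GoodWeight (K : ℝ≥0∞) (θ : Rn 2 → ℝ) : Prop where
  cont : Continuous θ
  pos : ∀ x, 0 < θ x
  le_jap : ∀ x, θ x ≤ jap x
  kernel : KernelBound θ (fun q => θ q.1) K

lemma GoodWeight.isSymbol {K : ℝ≥0∞} (h : GoodWeight K θ) :
    IsSymbol fun q : Rn 2 × Rn 2 × Rn 2 => θ q.1 :=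
  ⟨h.cont.comp continuous_fst, fun ξ => ⟨|θ ξ|, fun _ => le_rfl⟩⟩

lemma tri_fst_symbol (t : ℝ) (f : Rn 2 → ℂ) (ξ : Rn 2) :
    tri (fun q => θ q.1) t f f f ξ = θ ξ * tri (fun _ => 1) t f f f ξ := by
  unfold tri
  rw [← integral_const_mul]
  refine integral_congr_ae (Filter.Eventually.of_forall fun p => ?_)
  simp only
  push_cast
  ring

lemma exists_local_bound {K : ℝ≥0∞} (hK : K ≠ ⊤) {R : ℝ≥0∞} (hR0 : R ≠ 0) (hR : R ≠ ⊤) :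
    ∃ δ₀ : ℝ, 0 < δ₀ ∧ δ₀ ≤ 1 ∧ ∃ M : ℝ≥0∞, M ≠ ⊤ ∧ ∀ θ, GoodWeight K θ → ∀ δ C v f, δ ≤ δ₀ →
      IsFlow δ C v f → (∀ t ξ, ‖f t ξ‖ₑ = ‖tri (fun _ => 1) t (v t) (v t) (v t) ξ‖ₑ) →
      wnorm θ (v 0) ≤ R → 0 ≤ δ →
      (∀ t ∈ Icc 0 δ, wnorm θ (v t) ≤ 4 * R) ∧ ∫⁻ s in Icc 0 δ, wnorm θ (f s) ≤ M := by
  set e := ENNReal.ofReal (Real.exp 1) with he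
  have heT : e ≠ ⊤ := ENNReal.ofReal_ne_top
  set M := 2 * (e * (4 * K * (4 * R) ^ 3)) with hM
  set b := e * (4 * K * (12 * (4 * R) ^ 2)) with hb
  have hMT : M ≠ ⊤ := by finiteness
  have hbT : b ≠ ⊤ := by finiteness
  have t1 : Filter.Tendsto (fun δ : ℝ => ENNReal.ofReal δ * b) (𝓝 0) (𝓝 0) := by
    have := ENNReal.Tendsto.mul_const (ENNReal.tendsto_ofReal (Filter.tendsto_id (x := 𝓝 (0:ℝ))))
      (Or.inr hbT)
    simpa using this
  have t2 : Filter.Tendsto (fun δ : ℝ => ENNReal.ofReal δ * M) (𝓝 0) (𝓝 0) := by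
    have := ENNReal.Tendsto.mul_const (ENNReal.tendsto_ofReal (Filter.tendsto_id (x := 𝓝 (0:ℝ))))
      (Or.inr hMT)
    simpa using this
  have ev := (((t1.eventually (gt_mem_nhds (show (0 : ℝ≥0∞) < 2⁻¹ by simp))).and
    (t2.eventually (gt_mem_nhds (pos_iff_ne_zero.mpr hR0)))).and
    (gt_mem_nhds (one_pos : (0:ℝ) < 1))).filter_mono (nhdsWithin_le_nhds (s := Ioi 0))
  obtain ⟨δ₀, ⟨⟨d1, d2⟩, d3⟩, d0⟩ := (ev.and self_mem_nhdsWithin).exists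
  refine ⟨δ₀, d0, d3.le, M, hMT, ?_⟩
  intro θ hθ δ C v f hδ h hf h0 hδ0
  have hYfin : ∀ t, ∫⁻ s in Icc 0 t, wnorm θ (f s) ≠ ⊤ := fun t => by
    refine ne_top_of_le_ne_top ?_ (lintegral_mono fun s =>
      wnorm_le_of_rapid hθ.le_jap (h.rapid_deriv s))
    rw [setLIntegral_const]
    exact ENNReal.mul_ne_top (lintegral_decay_lt_top C).ne (by simp)
  have hwf : ∀ s, wnorm θ (f s) = ∫⁻ ξ, ‖tri (fun q => θ q.1) s (v s) (v s) (v s) ξ‖ₑ ^ 2 := by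
    intro s
    refine lintegral_congr fun ξ => ?_
    rw [tri_fst_symbol, enorm_mul, wabs, hf]
    congr 2
    rw [← ofReal_norm, Complex.norm_real, Real.norm_of_nonneg (hθ.pos ξ).le]
  have stepY : ∀ t, 0 ≤ t → t ≤ δ → (∀ u ∈ Icc 0 t, wnorm θ (v u) ≤ 4 * R) →
      ∫⁻ s in Icc 0 t, wnorm θ (f s) ≤ M := by
    intro t ht0 ht hX
    have hmain := (h.mono ht).lintegral_tri_le (by linarith) hθ.cont hθ.pos hθ.isSymbol hθ.kernel
      (X := 4 * R) (hX 0 ⟨le_rfl, ht0⟩) hX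
    simp only [← hwf] at hmain
    refine le_two_mul_of_le_add_mul (b := ENNReal.ofReal t * b) ?_ (hYfin t) (hmain.trans ?_)
    · exact (mul_le_mul_left (ENNReal.ofReal_le_ofReal (ht.trans hδ)) _).trans d1.le
    · rw [hb]
      refine le_of_eq ?_
      ring
  have hX : ∀ t ∈ Icc 0 δ, wnorm θ (v t) < 4 * R := by
    by_contra! hc
    have hcont := continuous_wnorm hθ.cont hθ.le_jap h.cont h.rapid
    have hclosed : IsClosed {t | 4 * R ≤ wnorm θ (v t)} := isClosed_le continuous_const hcont
    have hcomp : IsCompact (Icc 0 δ ∩ {t | 4 * R ≤ wnorm θ (v t)}) :=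
      isCompact_Icc.inter_right hclosed
    obtain ⟨t₁, ht₁, ht₁'⟩ := hc
    obtain ⟨t, ht⟩ := hcomp.exists_isLeast ⟨t₁, ht₁, ht₁'⟩
    have hlt : ∀ u, 0 ≤ u → u < t → wnorm θ (v u) < 4 * R := by
      intro u hu0 hut
      by_contra! hh
      exact absurd (ht.2 ⟨⟨hu0, hut.le.trans ht.1.1.2⟩, hh⟩) (not_le.mpr hut)
    have hRlt : R < 4 * R := by
      have : (1 : ℝ≥0∞) * R < 4 * R := (ENNReal.mul_lt_mul_iff_left hR0 hR).mpr (by norm_num)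
      simpa using this
    have htpos : 0 < t := by
      rcases ht.1.1.1.lt_or_eq with hp | hp
      · exact hp
      · have := ht.1.2
        rw [← hp] at this
        exact absurd (this.trans h0) (not_le.mpr hRlt)
    have hle : wnorm θ (v t) ≤ 4 * R := by
      have hev : ∀ᶠ u in 𝓝[<] t, wnorm θ (v u) ≤ 4 * R := by
        filter_upwards [Ioo_mem_nhdsLT htpos] with u hu
        exact (hlt u hu.1.le hu.2).le
      exact le_of_tendsto (hcont.continuousWithinAt (s := Iio t)).tendsto hev
    have hall : ∀ u ∈ Icc 0 t, wnorm θ (v u) ≤ 4 * R := by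
      intro u hu
      rcases hu.2.lt_or_eq with hp | hp
      · exact (hlt u hu.1 hp).le
      · exact hp ▸ hle
    have hY := stepY t htpos.le ht.1.1.2 hall
    have hw := h.wnorm_le hθ.cont ht.1.1
    have : wnorm θ (v t) < 4 * R := by
      calc _ ≤ _ := hw
        _ ≤ 2 * (R + ENNReal.ofReal δ₀ * M) := by
            gcongr
            exact ht.1.1.2.trans hδ
        _ < 2 * (R + R) := by
            refine (ENNReal.mul_lt_mul_iff_right (by norm_num) (by norm_num)).mpr ?_
            exact ENNReal.add_lt_add_left hR d2
        _ = 4 * R := by ring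
    exact absurd ht.1.2 (not_le.mpr this)
  exact ⟨fun t ht => (hX t ht).le, stepY δ hδ0 le_rfl fun u hu => (hX u hu).le⟩

end localTheory

/-! ### The smoothing multiplier on the plane -/

section planeMultiplier

/-- The smoothing multiplier evaluated at the Japanese bracket. -/
def imul (N s : ℝ) (x : Rn 2) : ℝ := smoothMul N s (jap x)

/-- The weight `⟨x⟩ m(x)`. -/
def iwt (N s : ℝ) (x : Rn 2) : ℝ := smoothWt N s (jap x)

/-- The product of the multipliers at the three input frequencies. -/
def imul₃ (N s : ℝ) (q : Rn 2 × Rn 2 × Rn 2) : ℝ :=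
  imul N s q.2.1 * imul N s q.2.2 * imul N s (q.1 - q.2.1 + q.2.2)

variable {N s κ : ℝ}

lemma iwt_eq (x : Rn 2) : iwt N s x = jap x * imul N s x := rfl

lemma imul_pos (hN : 1 ≤ N) (x : Rn 2) : 0 < imul N s x := smoothMul_pos hN (jap_pos x)

lemma imul_le_one (x : Rn 2) : imul N s x ≤ 1 := smoothMul_le_one _

lemma iwt_pos (hN : 1 ≤ N) (x : Rn 2) : 0 < iwt N s x := smoothWt_pos hN (jap_pos x)

lemma iwt_le_jap (x : Rn 2) : iwt N s x ≤ jap x := smoothWt_le (jap_pos x)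

lemma continuous_imul (hs1 : s < 1) : Continuous (imul N s) := continuous_smoothMul_jap hs1

lemma continuous_iwt (hs1 : s < 1) : Continuous (iwt N s) := continuous_smoothWt_jap hs1

lemma continuous_imul₃ (hs1 : s < 1) : Continuous (imul₃ N s) := by
  have h := continuous_imul (N := N) hs1
  exact ((h.comp (by fun_prop)).mul (h.comp (by fun_prop))).mul (h.comp (by fun_prop))

lemma imul₃_nonneg (hN : 1 ≤ N) (q : Rn 2 × Rn 2 × Rn 2) : 0 ≤ imul₃ N s q :=
  (mul_pos (mul_pos (imul_pos hN _) (imul_pos hN _)) (imul_pos hN _)).le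

lemma imul₃_le_one (hN : 1 ≤ N) (q : Rn 2 × Rn 2 × Rn 2) : imul₃ N s q ≤ 1 :=
  mul_le_one₀ (mul_le_one₀ (imul_le_one _) (imul_pos hN _).le (imul_le_one _)) (imul_pos hN _).le
    (imul_le_one _)

lemma abs_imul_sub_imul₃_le (hN : 1 ≤ N) (q : Rn 2 × Rn 2 × Rn 2) :
    |imul N s q.1 - imul₃ N s q| ≤ 1 := by
  have h1 := imul₃_nonneg (s := s) hN q
  have h2 := imul₃_le_one (s := s) hN q
  have h3 := imul_pos (s := s) hN q.1
  have h4 := imul_le_one (N := N) (s := s) q.1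
  rw [abs_le]
  constructor <;> linarith

lemma isSymbol_of_bounds {c σ : Rn 2 × Rn 2 × Rn 2 → ℝ} (hc : Continuous c) (hσ : Continuous σ)
    (hc' : ∀ q, c q = c (q.1, 0)) (h1 : ∀ q, |σ q| ≤ 1) : IsSymbol fun q => c q * σ q := by
  refine ⟨hc.mul hσ, fun ξ => ⟨|c (ξ, 0)|, fun p => ?_⟩⟩
  rw [abs_mul, hc']
  exact mul_le_of_le_one_right (abs_nonneg _) (h1 _)

/-- The symbol of the smoothed cubic nonlinearity, weighted by `⟨ξ⟩`. -/
def outSymbol (N s : ℝ) (q : Rn 2 × Rn 2 × Rn 2) : ℝ := jap q.1 * imul₃ N s q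

/-- The commutator symbol. -/
def commSymbol (N s : ℝ) (q : Rn 2 × Rn 2 × Rn 2) : ℝ := imul N s q.1 - imul₃ N s q

/-- The commutator symbol weighted by `⟨ξ⟩⁻¹`. -/
def commWtSymbol (N s : ℝ) (q : Rn 2 × Rn 2 × Rn 2) : ℝ := (jap q.1)⁻¹ * commSymbol N s q

lemma continuous_commSymbol (hs1 : s < 1) : Continuous (commSymbol N s) :=
  ((continuous_imul hs1).comp continuous_fst).sub (continuous_imul₃ hs1)

lemma isSymbol_outSymbol (hN : 1 ≤ N) (hs1 : s < 1) : IsSymbol (outSymbol N s) :=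
  isSymbol_of_bounds (c := fun q => jap q.1) (continuous_jap.comp continuous_fst)
    (continuous_imul₃ hs1) (fun _ => rfl) fun q => by
      rw [abs_of_nonneg (imul₃_nonneg hN q)]
      exact imul₃_le_one hN q

lemma isSymbol_commWtSymbol (hN : 1 ≤ N) (hs1 : s < 1) : IsSymbol (commWtSymbol N s) :=
  isSymbol_of_bounds (c := fun q => (jap q.1)⁻¹)
    ((continuous_jap.comp continuous_fst).inv₀ fun q => (jap_pos q.1).ne')
    (continuous_commSymbol hs1) (fun _ => rfl) (abs_imul_sub_imul₃_le hN)

lemma jap_quad (ξ a b : Rn 2) :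
    jap ξ ≤ jap a + jap b + jap (ξ - a + b) ∧ jap a ≤ jap ξ + jap b + jap (ξ - a + b) ∧
    jap b ≤ jap ξ + jap a + jap (ξ - a + b) ∧ jap (ξ - a + b) ≤ jap ξ + jap a + jap b := by
  refine ⟨?_, ?_, ?_, ?_⟩
  · have h1 := jap_add_le (a - b) (ξ - a + b)
    have h2 := jap_sub_le a b
    rw [show a - b + (ξ - a + b) = ξ by abel] at h1
    linarith
  · have h1 := jap_sub_le (ξ + b) (ξ - a + b)
    have h2 := jap_add_le ξ b
    rw [show ξ + b - (ξ - a + b) = a by abel] at h1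
    linarith
  · have h1 := jap_sub_le (a + (ξ - a + b)) ξ
    have h2 := jap_add_le a (ξ - a + b)
    rw [show a + (ξ - a + b) - ξ = b by abel] at h1
    linarith
  · have h1 := jap_add_le (ξ - a) b
    have h2 := jap_sub_le ξ a
    linarith

lemma exists_goodWeight (hκ : 1 / 2 < κ) (hκs : κ ≤ s) (hs1 : s < 1) :
    ∃ K : ℝ≥0∞, K ≠ ⊤ ∧ ∀ N : ℝ, 1 ≤ N → GoodWeight K (iwt N s) ∧
      KernelBound (iwt N s) (outSymbol N s) K ∧
      KernelBound (iwt N s) (commWtSymbol N s) (ENNReal.ofReal (N ^ (κ - 2)) ^ 2 * K) := by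
  obtain ⟨K, hK, h⟩ := exists_kernelBound hκ
  have hs0 : 0 < s := by linarith
  have hmono : ∀ {L L' : ℝ≥0∞} {θ : Rn 2 → ℝ} {σ}, L ≤ L' → KernelBound θ σ L →
      KernelBound θ σ L' :=
    fun hL hσ ξ μ => (hσ ξ μ).trans hL
  have hL : ∀ L : ℝ, 0 ≤ L → L ≤ 729 → ENNReal.ofReal L ^ 2 * K ≤ ENNReal.ofReal 729 ^ 2 * K := by
    intro L _ hL
    gcongr
  refine ⟨ENNReal.ofReal 729 ^ 2 * K, by finiteness, fun N hN => ⟨⟨continuous_iwt hs1,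
    iwt_pos hN, iwt_le_jap, ?_⟩, ?_, ?_⟩⟩
  · refine hmono (hL 3 (by norm_num) (by norm_num))
      (h _ _ 3 (by norm_num) (fun ξ p => ?_) (iwt_pos hN))
    rw [abs_of_pos (iwt_pos hN _)]
    exact smoothWt_ratio_le hN hs0 hs1 hκs (one_le_jap _) (one_le_jap _) (one_le_jap _)
      (one_le_jap _) (jap_quad ξ p.1 p.2).1
  · refine hmono (hL 1 (by norm_num) (by norm_num))
      (h _ _ 1 (by norm_num) (fun ξ p => ?_) (iwt_pos hN))
    have p0 := jap_pos ξ
    have p1 := jap_pos p.1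
    have p2 := jap_pos p.2
    have p3 := jap_pos (ξ - p.1 + p.2)
    have m1 := imul_pos (s := s) hN p.1
    have m2 := imul_pos (s := s) hN p.2
    have m3 := imul_pos (s := s) hN (ξ - p.1 + p.2)
    have e : |outSymbol N s (ξ, p)| / (iwt N s p.1 * iwt N s p.2 * iwt N s (ξ - p.1 + p.2)) =
        jap ξ * ((jap p.1)⁻¹ * (jap p.2)⁻¹ * (jap (ξ - p.1 + p.2))⁻¹) := by
      rw [outSymbol, abs_of_nonneg (mul_nonneg p0.le (imul₃_nonneg hN _))]
      simp only [imul₃, iwt_eq]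
      field_simp
    rw [e, one_mul]
    have hi : ∀ x : Rn 2, (jap x)⁻¹ ≤ jap x ^ (-κ) := fun x => by
      rw [← Real.rpow_neg_one]
      exact Real.rpow_le_rpow_of_exponent_le (one_le_jap x) (by linarith)
    calc _ ≤ (jap p.1 + jap p.2 + jap (ξ - p.1 + p.2)) *
          ((jap p.1)⁻¹ * (jap p.2)⁻¹ * (jap (ξ - p.1 + p.2))⁻¹) := by
          gcongr
          exact (jap_quad ξ p.1 p.2).1
      _ = (jap p.1)⁻¹ * (jap p.2)⁻¹ + (jap p.1)⁻¹ * (jap (ξ - p.1 + p.2))⁻¹ +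
          (jap p.2)⁻¹ * (jap (ξ - p.1 + p.2))⁻¹ := by
          field_simp
          ring
      _ ≤ _ := by
          unfold pairSum
          gcongr <;> exact hi _
  · have := h (iwt N s) (commWtSymbol N s) (729 * N ^ (κ - 2)) (by positivity) (fun ξ p => by
      obtain ⟨q0, q1, q2, q3⟩ := jap_quad ξ p.1 p.2
      exact commutator_ratio_le hN hs0 hs1 (by linarith) hκs (one_le_jap _) (one_le_jap _)
        (one_le_jap _) (one_le_jap _) q0 q1 q2 q3) (iwt_pos hN)
    refine hmono (le_of_eq ?_) this
    rw [ENNReal.ofReal_mul (by norm_num), mul_pow]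
    ring

lemma mult_fst_mul (c : Rn 2 → ℝ) (σ : Rn 2 × Rn 2 × Rn 2 → ℝ) (f : Rn 2 → ℂ) (ξ : Rn 2) :
    mult (fun q => c q.1 * σ q) f ξ = c ξ * mult σ f ξ := by
  unfold mult
  rw [← integral_const_mul]
  refine integral_congr_ae (Filter.Eventually.of_forall fun p => ?_)
  simp only
  push_cast
  ring

lemma FourierSol.lintegral_mult_mul_le {K : ℝ≥0∞} {δ C : ℝ} {W : ℝ → Rn 2 → ℂ}
    (hW : FourierSol δ C W) (hN : 1 ≤ N) (hs1 : s < 1) (hδ : 0 ≤ δ) (hδ1 : δ ≤ 1)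
    (hG : GoodWeight K (iwt N s)) (h1 : KernelBound (iwt N s) (outSymbol N s) K) {η : ℝ≥0∞}
    (h2 : KernelBound (iwt N s) (commWtSymbol N s) (η ^ 2 * K)) {X M : ℝ≥0∞}
    (hX : ∀ t ∈ Icc 0 δ, wnorm (iwt N s) (W t) ≤ X)
    (hM : ∫⁻ t in Icc 0 δ, wnorm (iwt N s) (mult (fun _ => 1) (W t)) ≤ M) :
    ∫⁻ t in Icc 0 δ, ∫⁻ ξ, ‖mult (imul₃ N s) (W t) ξ‖ₑ * ‖mult (commSymbol N s) (W t) ξ‖ₑ ≤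
      η * (ENNReal.ofReal (Real.exp 1) * (4 * K * (X ^ 3 + 12 * (X ^ 2 * M)))) := by
  obtain ⟨C', h⟩ := hW.exists_isFlow
  set A := ENNReal.ofReal (Real.exp 1) * (4 * K * (X ^ 3 + 12 * (X ^ 2 * M))) with hA
  have hM' : ∫⁻ s_1 in Icc 0 δ, wnorm (iwt N s)
      (fun ξ => -I * spin s_1 (mult (fun _ => 1) (W s_1)) ξ) ≤ M := by
    refine le_trans (le_of_eq ?_) hM
    refine lintegral_congr fun t => ?_
    rw [← wnorm_spin _ t (mult (fun _ => 1) (W t))]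
    unfold wnorm wabs
    have : ‖I‖ₑ = 1 := by simp [← ofReal_norm]
    simp [this]
  have key : ∀ (σ : Rn 2 × Rn 2 × Rn 2 → ℝ) (L : ℝ≥0∞), IsSymbol σ → KernelBound (iwt N s) σ L →
      ∫⁻ t in Icc 0 δ, ∫⁻ ξ, ‖mult σ (W t) ξ‖ₑ ^ 2 ≤ ENNReal.ofReal (Real.exp 1) *
        (4 * L * (X ^ 3 + 12 * (X ^ 2 * M))) := by
    intro σ L hσ hL
    have := h.lintegral_tri_le hδ1 hG.cont hG.pos hσ hL (X := X)
      (by rw [wnorm_spin]; exact hX 0 ⟨le_rfl, hδ⟩) (by intro t ht; rw [wnorm_spin]; exact hX t ht)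
    simp only [enorm_tri_spin] at this
    refine this.trans (mul_le_mul_right (mul_le_mul_right (add_le_add le_rfl
      (mul_le_mul_right ?_ _)) _) _)
    exact (mul_le_mul' (ENNReal.ofReal_le_one.mpr hδ1) (mul_le_mul_right hM' _)).trans_eq
      (one_mul _)
  have hmeas : ∀ σ : Rn 2 × Rn 2 × Rn 2 → ℝ, IsSymbol σ →
      Measurable fun q : ℝ × Rn 2 => ‖mult σ (W q.1) q.2‖ₑ := by
    intro σ hσ
    have := (stronglyMeasurable_tri hσ h.cont h.cont h.cont).measurable.enorm.comp
      (f := fun q : ℝ × Rn 2 => (q.1, q.1, q.2)) (by fun_prop)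
    convert this using 2 with q
    exact (enorm_tri_spin q.1 (W q.1) q.2).symm
  have ms1 := hmeas _ (isSymbol_outSymbol hN hs1)
  have ms2 := hmeas _ (isSymbol_commWtSymbol hN hs1)
  have hprod : ∀ t ξ, ‖mult (imul₃ N s) (W t) ξ‖ₑ * ‖mult (commSymbol N s) (W t) ξ‖ₑ =
      ‖mult (outSymbol N s) (W t) ξ‖ₑ * ‖mult (commWtSymbol N s) (W t) ξ‖ₑ := by
    intro t ξ
    have e1 : mult (outSymbol N s) (W t) ξ = jap ξ * mult (imul₃ N s) (W t) ξ :=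
      mult_fst_mul _ _ _ _
    have e2 : mult (commWtSymbol N s) (W t) ξ = ((jap ξ)⁻¹ : ℝ) * mult (commSymbol N s) (W t) ξ :=
      mult_fst_mul (fun x => (jap x)⁻¹) _ _ _
    rw [e1, e2, ← enorm_mul, ← enorm_mul]
    congr 1
    have : (jap ξ : ℂ) ≠ 0 := by exact_mod_cast (jap_pos ξ).ne'
    push_cast
    field_simp
  simp only [hprod]
  have hsq := sq_lintegral_mul_le (μ := (volume.restrict (Icc (0:ℝ) δ)).prod
      (volume : Measure (Rn 2)))
    ms1.aemeasurable ms2.aemeasurable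
  have ms12 : Measurable fun q : ℝ × Rn 2 => ‖mult (outSymbol N s) (W q.1) q.2‖ₑ *
      ‖mult (commWtSymbol N s) (W q.1) q.2‖ₑ := ms1.mul ms2
  rw [lintegral_prod _ ms12.aemeasurable, lintegral_prod _ (ms1.pow_const 2).aemeasurable,
    lintegral_prod _ (ms2.pow_const 2).aemeasurable] at hsq
  have hfin : (∫⁻ t in Icc 0 δ, ∫⁻ ξ, ‖mult (outSymbol N s) (W t) ξ‖ₑ *
      ‖mult (commWtSymbol N s) (W t) ξ‖ₑ) ^ 2 ≤ (η * A) ^ 2 := by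
    refine hsq.trans ((mul_le_mul' (key _ _ (isSymbol_outSymbol hN hs1) h1)
      (key _ _ (isSymbol_commWtSymbol hN hs1) h2)).trans (le_of_eq ?_))
    rw [hA]
    ring
  exact (ENNReal.pow_le_pow_left_iff two_ne_zero).mp hfin

end planeMultiplier

/-! ### Pointwise bounds for the quadrilinear symbol -/

section quadsymbol

variable {N s ε w x y z : ℝ}

/-- Four numbers at least one satisfying the quadrilateral inequalities. -/
structure Quad (w x y z : ℝ) : Prop where
  one_w : 1 ≤ w
  one_x : 1 ≤ x
  one_y : 1 ≤ y
  one_z : 1 ≤ z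
  le_w : w ≤ x + y + z
  le_x : x ≤ w + y + z
  le_y : y ≤ w + x + z
  le_z : z ≤ w + x + y

lemma Quad.swap_left (h : Quad w x y z) : Quad w y x z :=
  ⟨h.one_w, h.one_y, h.one_x, h.one_z, by linarith [h.le_w], by linarith [h.le_y],
    by linarith [h.le_x], by linarith [h.le_z]⟩

lemma Quad.swap_right (h : Quad w x y z) : Quad w x z y :=
  ⟨h.one_w, h.one_x, h.one_z, h.one_y, by linarith [h.le_w], by linarith [h.le_x],
    by linarith [h.le_z], by linarith [h.le_y]⟩

/-- The quadrilinear symbol after weights are divided out. -/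
def quadSym (N s w x y z : ℝ) : ℝ :=
  w * |smoothMul N s w - smoothMul N s x * smoothMul N s y * smoothMul N s z| /
    (smoothWt N s x * smoothWt N s y * smoothWt N s z)

lemma quadSym_swap_left : quadSym N s w x y z = quadSym N s w y x z := by
  unfold quadSym
  rw [mul_comm (smoothMul N s x), mul_comm (smoothWt N s x)]

lemma quadSym_swap_right : quadSym N s w x y z = quadSym N s w x z y := by
  unfold quadSym
  rw [mul_right_comm, mul_right_comm (smoothWt N s x)]

lemma quadSym_eq_zero (hs1 : s < 1) (h : Quad w x y z) (hx : x ≤ N / 3) (hy : y ≤ N / 3)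
    (hz : z ≤ N / 3) : quadSym N s w x y z = 0 := by
  have h1 := h.one_w; have h2 := h.one_x; have h3 := h.one_y; have h4 := h.one_z
  have h5 := h.le_w
  unfold quadSym
  rw [smoothMul_eq_one hs1 (by linarith) (by linarith : w ≤ N),
    smoothMul_eq_one hs1 (by linarith) (by linarith : x ≤ N),
    smoothMul_eq_one hs1 (by linarith) (by linarith : y ≤ N),
    smoothMul_eq_one hs1 (by linarith) (by linarith : z ≤ N)]
  simp

lemma quadSym_le_ratio (hN : 1 ≤ N) (hs0 : 0 < s) (hs1 : s < 1) (h : Quad w x y z) :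
    quadSym N s w x y z ≤
      3 * smoothWt N s w / (smoothWt N s x * smoothWt N s y * smoothWt N s z) := by
  have h1 := h.one_w
  have px := smoothWt_pos (s := s) hN (lt_of_lt_of_le one_pos h.one_x)
  have py := smoothWt_pos (s := s) hN (lt_of_lt_of_le one_pos h.one_y)
  have pz := smoothWt_pos (s := s) hN (lt_of_lt_of_le one_pos h.one_z)
  have := abs_sub_prod_smoothMul_le hN hs0 hs1 h.one_w h.one_x h.one_y h.one_z h.le_w
  unfold quadSym
  refine div_le_div_of_nonneg_right ?_ (by positivity)
  have h2 : 3 * smoothWt N s w = w * (3 * smoothMul N s w) := by unfold smoothWt; ring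
  rw [h2]
  gcongr

lemma quadSym_le_of_max (hN : 1 ≤ N) (hs0 : 0 < s) (hs1 : s < 1) (h : Quad w x y z)
    (hy : y ≤ x) (hz : z ≤ x) :
    quadSym N s w x y z ≤ 9 / (smoothWt N s y * smoothWt N s z) := by
  have h1 := h.one_w; have h2 := h.one_x
  have px := smoothWt_pos (s := s) hN (lt_of_lt_of_le one_pos h.one_x)
  have py := smoothWt_pos (s := s) hN (lt_of_lt_of_le one_pos h.one_y)
  have pz := smoothWt_pos (s := s) hN (lt_of_lt_of_le one_pos h.one_z)
  refine (quadSym_le_ratio hN hs0 hs1 h).trans ?_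
  have h3 : smoothWt N s w ≤ 3 * smoothWt N s x :=
    (smoothWt_mono hN hs0 (by linarith) (by linarith [h.le_w])).trans
      (smoothWt_mul_le hN hs1 (by linarith) (by norm_num))
  rw [div_le_div_iff₀ (by positivity) (by positivity)]
  have h4 : 0 < smoothWt N s y * smoothWt N s z := by positivity
  nlinarith [mul_le_mul_of_nonneg_right h3 h4.le]

lemma mul_abs_sub_smoothMul_le (hN : 1 ≤ N) (hs0 : 0 < s) (hs1 : s < 1) {w x : ℝ} (hw : 0 < w)
    (hx : 0 < x) :
    w * |smoothMul N s w - smoothMul N s x| ≤ 2 * |w - x| * smoothMul N s x := by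
  have pm := smoothMul_pos (s := s) hN hx
  have pw := smoothMul_pos (s := s) hN hw
  rcases le_total w x with h | h
  · have h1 := smoothMul_anti hN hs1 hw h
    have h2 := smoothWt_mono hN hs0 hw h
    unfold smoothWt at h2
    rw [abs_of_nonneg (by linarith), abs_of_nonpos (by linarith)]
    nlinarith
  · have h1 := smoothMul_anti hN hs1 hx h
    have h2 := smoothWt_mono hN hs0 hx h
    unfold smoothWt at h2
    rw [abs_of_nonpos (by linarith), abs_of_nonneg (by linarith)]
    have h3 : x * (smoothMul N s x - smoothMul N s w) ≤ (w - x) * smoothMul N s x := by nlinarith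
    nlinarith

lemma quadSym_le_of_dominant (hN : 1 ≤ N) (hs0 : 0 < s) (hs1 : s < 1) (h : Quad w x y z)
    (hx : N ≤ 3 * x) (hy : 16 * y ≤ x) (hz : 16 * z ≤ x) (hzy : z ≤ y) :
    quadSym N s w x y z ≤ 12 * (N⁻¹ / smoothWt N s z) ∧
    quadSym N s w x y z ≤ 9 / smoothWt N s y := by
  have h1 := h.one_w; have h2 := h.one_x; have h3 := h.one_y; have h4 := h.one_z
  have hN0 : 0 < N := by linarith
  have px := smoothWt_pos (s := s) hN (lt_of_lt_of_le one_pos h.one_x)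
  have py := smoothWt_pos (s := s) hN (lt_of_lt_of_le one_pos h.one_y)
  have pz := smoothWt_pos (s := s) hN (lt_of_lt_of_le one_pos h.one_z)
  have mx := smoothMul_pos (s := s) hN (lt_of_lt_of_le one_pos h.one_x)
  have oz := one_le_smoothWt hN hs0 hs1 h.one_z
  have hc := quadSym_le_of_max hN hs0 hs1 h (by linarith) (by linarith)
  constructor
  · rcases le_total N y with hyN | hyN
    · refine hc.trans ?_
      have := le_smoothWt_of_le hN hs0 hs1 hN0 le_rfl hyN
      rw [← div_div, ← mul_div_assoc]
      refine div_le_div_of_nonneg_right ?_ pz.le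
      rw [← div_eq_mul_inv]
      gcongr
      norm_num
    · unfold quadSym
      rw [smoothMul_eq_one hs1 (by linarith) hyN,
          smoothMul_eq_one hs1 (by linarith) (hzy.trans hyN),
        smoothWt_eq_self hs1 (by linarith) hyN, mul_one, mul_one]
      have h5 := mul_abs_sub_smoothMul_le hN hs0 hs1 (w := w) (x := x) (by linarith) (by linarith)
      have h6 : |w - x| ≤ 2 * y := by
        rw [abs_le]; constructor <;> linarith [h.le_w, h.le_x]
      have h7 : w * |smoothMul N s w - smoothMul N s x| ≤ 4 * y * smoothMul N s x := by nlinarith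
      have h8 : smoothWt N s x = x * smoothMul N s x := rfl
      rw [h8, ← mul_div_assoc, div_le_div_iff₀ (by positivity) pz]
      have h9 : 1 ≤ N⁻¹ * (3 * x) := by
        rw [inv_mul_eq_div, one_le_div hN0]; exact hx
      calc _ ≤ 4 * y * smoothMul N s x * smoothWt N s z := by gcongr
        _ ≤ 4 * y * smoothMul N s x * smoothWt N s z * (N⁻¹ * (3 * x)) :=
            le_mul_of_one_le_right (by positivity) h9
        _ = _ := by ring
  · refine hc.trans ?_
    rw [div_le_div_iff₀ (by positivity) py]
    nlinarith

/-- Weight of a low frequency `x` interacting with a high frequency `y`. -/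
def lowKer (N s ε x y : ℝ) : ℝ := if 14 * x ≤ y ∧ N ≤ 4 * y then y ^ (2 * ε) / smoothWt N s x else 0

/-- Weight of a pair of frequencies in the comparable regime. -/
def cmpKer (N s x y : ℝ) : ℝ := min 1 (smoothWt N s y / N) / smoothWt N s x

def heavyKer (N s ε x y : ℝ) : ℝ := lowKer N s ε x y + lowKer N s ε y x + N ^ (2 * ε - 1)

def lightKer (N s ε x y : ℝ) : ℝ :=
  N⁻¹ * (lowKer N s ε x y + lowKer N s ε y x) +
    N ^ (2 * ε - 1) * (cmpKer N s x y + cmpKer N s y x)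

lemma heavyKer_comm : heavyKer N s ε x y = heavyKer N s ε y x := by unfold heavyKer; ring

lemma lightKer_comm : lightKer N s ε x y = lightKer N s ε y x := by unfold lightKer; ring

lemma lowKer_nonneg (hN : 1 ≤ N) (hx : 1 ≤ x) (hy : 1 ≤ y) : 0 ≤ lowKer N s ε x y := by
  have px := smoothWt_pos (s := s) hN (lt_of_lt_of_le one_pos hx)
  unfold lowKer
  split_ifs <;> positivity

lemma cmpKer_nonneg (hN : 1 ≤ N) (hx : 1 ≤ x) (hy : 1 ≤ y) : 0 ≤ cmpKer N s x y := by
  have px := smoothWt_pos (s := s) hN (lt_of_lt_of_le one_pos hx)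
  have py := smoothWt_pos (s := s) hN (lt_of_lt_of_le one_pos hy)
  unfold cmpKer
  positivity

lemma lowKer_le_heavyKer (hN : 1 ≤ N) (hx : 1 ≤ x) (hy : 1 ≤ y) :
    lowKer N s ε x y ≤ heavyKer N s ε x y := by
  have := lowKer_nonneg (s := s) (ε := ε) hN hy hx
  unfold heavyKer
  have : 0 ≤ N ^ (2 * ε - 1) := by positivity
  linarith

lemma rpow_le_heavyKer (hN : 1 ≤ N) (hx : 1 ≤ x) (hy : 1 ≤ y) :
    N ^ (2 * ε - 1) ≤ heavyKer N s ε x y := by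
  have := lowKer_nonneg (s := s) (ε := ε) hN hy hx
  have := lowKer_nonneg (s := s) (ε := ε) hN hx hy
  unfold heavyKer
  linarith

lemma lowKer_le_lightKer (hN : 1 ≤ N) (hx : 1 ≤ x) (hy : 1 ≤ y) :
    N⁻¹ * lowKer N s ε x y ≤ lightKer N s ε x y := by
  have h1 := lowKer_nonneg (s := s) (ε := ε) hN hy hx
  have h2 := cmpKer_nonneg (s := s) hN hy hx
  have h3 := cmpKer_nonneg (s := s) hN hx hy
  unfold lightKer
  have h4 : 0 ≤ N ^ (2 * ε - 1) * (cmpKer N s x y + cmpKer N s y x) := by positivity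
  have h5 : 0 ≤ N⁻¹ * lowKer N s ε y x := by positivity
  linarith

lemma cmpKer_le_lightKer (hN : 1 ≤ N) (hx : 1 ≤ x) (hy : 1 ≤ y) :
    N ^ (2 * ε - 1) * cmpKer N s x y ≤ lightKer N s ε x y := by
  have h1 := lowKer_nonneg (s := s) (ε := ε) hN hy hx
  have h2 := cmpKer_nonneg (s := s) hN hy hx
  have h3 := lowKer_nonneg (s := s) (ε := ε) hN hx hy
  unfold lightKer
  have h4 : 0 ≤ N⁻¹ * (lowKer N s ε x y + lowKer N s ε y x) := by positivity
  have h5 : 0 ≤ N ^ (2 * ε - 1) * cmpKer N s y x := by positivity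
  linarith

lemma quad_rpow_le {a b c : ℝ} (hε0 : 0 ≤ ε) (hε : ε ≤ 1 / 2) (hb : 0 < b) (hc : 1 ≤ c)
    (ha : 0 ≤ a) (h : a ≤ c * b) : a ^ (2 * ε) ≤ c * b ^ (2 * ε) := by
  calc a ^ (2 * ε) ≤ (c * b) ^ (2 * ε) := Real.rpow_le_rpow ha h (by linarith)
    _ = c ^ (2 * ε) * b ^ (2 * ε) := Real.mul_rpow (by linarith) hb.le
    _ ≤ c ^ (1 : ℝ) * b ^ (2 * ε) := by
        gcongr
        linarith
    _ = _ := by rw [Real.rpow_one]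

/-- The dominated regime: `x` is much larger than `y ≥ z`. -/
lemma quadSym_dominant (hN : 1 ≤ N) (hs0 : 0 < s) (hs1 : s < 1) (hε0 : 0 ≤ ε) (hε : ε ≤ 1 / 2)
    (h : Quad w x y z) (hx : N ≤ 3 * x) (hy : 16 * y ≤ x) (hz : 16 * z ≤ x) (hzy : z ≤ y)
    {u : ℝ} (hu : u = x ∨ u = w) :
    quadSym N s w x y z * (x + y + z) ^ (2 * ε) ≤ 432 * (N⁻¹ * lowKer N s ε z u) ∧
    quadSym N s w x y z * (x + y + z) ^ (2 * ε) ≤ 432 * lowKer N s ε y u := by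
  have h1 := h.one_w; have h2 := h.one_x; have h3 := h.one_y; have h4 := h.one_z
  have hlw := h.le_w; have hlx := h.le_x
  have hN0 : 0 < N := by linarith
  have py := smoothWt_pos (s := s) hN (lt_of_lt_of_le one_pos h.one_y)
  have pz := smoothWt_pos (s := s) hN (lt_of_lt_of_le one_pos h.one_z)
  obtain ⟨e1, e2⟩ := quadSym_le_of_dominant hN hs0 hs1 h hx hy hz hzy
  have hu1 : 7 * x ≤ 8 * u := by rcases hu with rfl | rfl <;> linarith
  have hu0 : 0 < u := by linarith
  have e3 : (x + y + z) ^ (2 * ε) ≤ 3 * u ^ (2 * ε) :=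
    quad_rpow_le hε0 hε hu0 (by norm_num) (by linarith) (by linarith)
  unfold lowKer
  rw [if_pos (by constructor <;> linarith), if_pos (by constructor <;> linarith)]
  constructor
  · calc _ ≤ 12 * (N⁻¹ / smoothWt N s z) * (3 * u ^ (2 * ε)) := by gcongr
      _ = 36 * (N⁻¹ * (u ^ (2 * ε) / smoothWt N s z)) := by ring
      _ ≤ _ := by gcongr; norm_num
  · calc _ ≤ 9 / smoothWt N s y * (3 * u ^ (2 * ε)) := by gcongr
      _ = 27 * (u ^ (2 * ε) / smoothWt N s y) := by ring
      _ ≤ _ := by gcongr; norm_num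

/-- The comparable regime: the two largest frequencies `x` and `y` are comparable. -/
lemma quadSym_comparable (hN : 1 ≤ N) (hs0 : 0 < s) (hs1 : s < 1) (hε0 : 0 ≤ ε)
    (hε : 2 * ε ≤ s)
    (h : Quad w x y z) (hx : N ≤ 3 * x) (hy : x ≤ 16 * y) (hyx : y ≤ x) (hzy : z ≤ y) :
    quadSym N s w x y z * (x + y + z) ^ (2 * ε) ≤
      20736 * (N ^ (2 * ε - 1) * (min 1 (smoothWt N s w / N) / smoothWt N s z)) := by
  have h1 := h.one_w; have h2 := h.one_x; have h3 := h.one_y; have h4 := h.one_z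
  have hN0 : 0 < N := by linarith
  have px := smoothWt_pos (s := s) hN (lt_of_lt_of_le one_pos h.one_x)
  have py := smoothWt_pos (s := s) hN (lt_of_lt_of_le one_pos h.one_y)
  have pz := smoothWt_pos (s := s) hN (lt_of_lt_of_le one_pos h.one_z)
  have pw := smoothWt_pos (s := s) hN (lt_of_lt_of_le one_pos h.one_w)
  have e1 := quadSym_le_of_max hN hs0 hs1 h hyx (hzy.trans hyx)
  have e2 := quadSym_le_ratio hN hs0 hs1 h
  have e3 : (x + y + z) ^ (2 * ε) ≤ 48 * y ^ (2 * ε) :=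
    quad_rpow_le hε0 (by linarith) (by linarith) (by norm_num) (by linarith) (by linarith)
  have e4 := rpow_div_smoothWt_le (A := 48) (r := y) hN hs0 hs1 (by norm_num) (by linarith)
    (by linarith : 0 ≤ 2 * ε) hε
  have e5 : N / 3 ≤ smoothWt N s x :=
    le_smoothWt_of_le hN hs0 hs1 (by positivity) (by linarith) (by linarith)
  have e6 : quadSym N s w x y z ≤
      9 * min 1 (smoothWt N s w / N) / (smoothWt N s y * smoothWt N s z) := by
    rcases le_total 1 (smoothWt N s w / N) with h5 | h5
    · rw [min_eq_left h5, mul_one]; exact e1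
    · rw [min_eq_right h5]
      refine e2.trans ?_
      rw [mul_assoc, ← div_div]
      refine div_le_div_of_nonneg_right ?_ (by positivity)
      rw [← mul_div_assoc, div_le_div_iff₀ px hN0]
      nlinarith
  have pm : 0 < min 1 (smoothWt N s w / N) := by positivity
  calc _ ≤ 9 * min 1 (smoothWt N s w / N) / (smoothWt N s y * smoothWt N s z) *
        (48 * y ^ (2 * ε)) := by gcongr
    _ = 432 * (min 1 (smoothWt N s w / N) / smoothWt N s z) *
        (y ^ (2 * ε) / smoothWt N s y) := by
        have : smoothWt N s y ≠ 0 := py.ne'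
        field_simp
        ring
    _ ≤ 432 * (min 1 (smoothWt N s w / N) / smoothWt N s z) * (48 * N ^ (2 * ε - 1)) := by
        gcongr
    _ = _ := by ring

lemma quadSym_comparable_cmpKer (hN : 1 ≤ N) (hs0 : 0 < s) (hs1 : s < 1) (hε0 : 0 ≤ ε)
    (hε : 2 * ε ≤ s)
    (h : Quad w x y z) (hx : N ≤ 3 * x) (hy : x ≤ 16 * y) (hyx : y ≤ x) (hzy : z ≤ y) :
    quadSym N s w x y z * (x + y + z) ^ (2 * ε) ≤ 10 ^ 6 * (N ^ (2 * ε - 1) * cmpKer N s z w) ∧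
    quadSym N s w x y z * (x + y + z) ^ (2 * ε) ≤ 10 ^ 6 * (N ^ (2 * ε - 1) * cmpKer N s z x) ∧
    quadSym N s w x y z * (x + y + z) ^ (2 * ε) ≤ 10 ^ 6 * (N ^ (2 * ε - 1) * cmpKer N s z y) ∧
    quadSym N s w x y z * (x + y + z) ^ (2 * ε) ≤ 10 ^ 6 * N ^ (2 * ε - 1) := by
  have h1 := h.one_w; have h2 := h.one_x; have h3 := h.one_y; have h4 := h.one_z
  have hN0 : 0 < N := by linarith
  have pz := smoothWt_pos (s := s) hN (lt_of_lt_of_le one_pos h.one_z)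
  have pw := smoothWt_pos (s := s) hN (lt_of_lt_of_le one_pos h.one_w)
  have oz := one_le_smoothWt hN hs0 hs1 h.one_z
  have e := quadSym_comparable hN hs0 hs1 hε0 hε h hx hy hyx hzy
  have key : ∀ u, N / 48 ≤ u → min 1 (smoothWt N s w / N) / smoothWt N s z ≤
      48 * cmpKer N s z u := by
    intro u hu
    unfold cmpKer
    rw [← mul_div_assoc]
    refine div_le_div_of_nonneg_right ((min_le_left _ _).trans ?_) pz.le
    have h5 : N / 48 ≤ smoothWt N s u :=
      le_smoothWt_of_le hN hs0 hs1 (by positivity) (by linarith) hu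
    rcases le_total 1 (smoothWt N s u / N) with h6 | h6
    · rw [min_eq_left h6]; norm_num
    · rw [min_eq_right h6, ← mul_div_assoc, le_div_iff₀ hN0]; linarith
  have hn : 0 ≤ N ^ (2 * ε - 1) := by positivity
  have hq : ∀ A B D : ℝ, 0 ≤ A → A ≤ 48 * B → 20736 * (D * A) ≤ 10 ^ 6 * (D * B) ∨ D < 0 := by
    intro A B D hA hB
    by_cases hD : 0 ≤ D
    · left
      have : 0 ≤ D * A := by positivity
      have : D * A ≤ D * (48 * B) := by gcongr
      linarith
    · right; linarith
  refine ⟨e.trans ?_, e.trans ?_, e.trans ?_, e.trans ?_⟩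
  · unfold cmpKer
    gcongr
    norm_num
  · exact (hq _ _ _ (by positivity) (key x (by linarith))).resolve_right (not_lt.mpr hn)
  · exact (hq _ _ _ (by positivity) (key y (by linarith))).resolve_right (not_lt.mpr hn)
  · have h5 : min 1 (smoothWt N s w / N) / smoothWt N s z ≤ 1 :=
      (div_le_one pz).mpr ((min_le_left _ _).trans oz)
    nlinarith

/-- The four possible bounds of a quadrilinear interaction. -/
def QuadBound (N s ε w x y z Ψ : ℝ) : Prop :=
  (Ψ ≤ 10 ^ 6 * lightKer N s ε x z ∧ Ψ ≤ 10 ^ 6 * heavyKer N s ε y w) ∨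
  (Ψ ≤ 10 ^ 6 * heavyKer N s ε x z ∧ Ψ ≤ 10 ^ 6 * lightKer N s ε y w) ∨
  (Ψ ≤ 10 ^ 6 * (N⁻¹ * lowKer N s ε z y) ∧ Ψ ≤ 10 ^ 6 * lowKer N s ε x w) ∨
  (Ψ ≤ 10 ^ 6 * lowKer N s ε z y ∧ Ψ ≤ 10 ^ 6 * (N⁻¹ * lowKer N s ε x w))

lemma quadBound_of_le (hN : 1 ≤ N) (hs0 : 0 < s) (hs1 : s < 1) (hε0 : 0 ≤ ε) (hε : 2 * ε ≤ s)
    (h : Quad w x y z) (hzx : z ≤ x) :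
    QuadBound N s ε w x y z (quadSym N s w x y z * (x + y + z) ^ (2 * ε)) ∧
    QuadBound N s ε w z y x (quadSym N s w x y z * (x + y + z) ^ (2 * ε)) := by
  suffices key : ∀ Ψ, Ψ = quadSym N s w x y z * (x + y + z) ^ (2 * ε) →
      (Ψ ≤ 10 ^ 6 * lightKer N s ε x z ∧ Ψ ≤ 10 ^ 6 * heavyKer N s ε y w) ∨
      (Ψ ≤ 10 ^ 6 * heavyKer N s ε x z ∧ Ψ ≤ 10 ^ 6 * lightKer N s ε y w) ∨
      ((Ψ ≤ 10 ^ 6 * (N⁻¹ * lowKer N s ε z y) ∧ Ψ ≤ 10 ^ 6 * lowKer N s ε x w) ∧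
      (Ψ ≤ 10 ^ 6 * lowKer N s ε x y ∧ Ψ ≤ 10 ^ 6 * (N⁻¹ * lowKer N s ε z w))) by
    unfold QuadBound
    rw [lightKer_comm (x := z), heavyKer_comm (x := z)]
    rcases key _ rfl with a | a | a
    · exact ⟨Or.inl a, Or.inl a⟩
    · exact ⟨Or.inr (Or.inl a), Or.inr (Or.inl a)⟩
    · exact ⟨Or.inr (Or.inr (Or.inl a.1)), Or.inr (Or.inr (Or.inr a.2))⟩
  rintro Ψ rfl
  have h1 := h.one_w; have h2 := h.one_x; have h3 := h.one_y; have h4 := h.one_z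
  have hε' : ε ≤ 1 / 2 := by linarith
  have hN0 : 0 ≤ N := by linarith
  by_cases hsmall : x ≤ N / 3 ∧ y ≤ N / 3
  · refine Or.inl ?_
    rw [quadSym_eq_zero hs1 h hsmall.1 hsmall.2 (hzx.trans hsmall.1), zero_mul]
    have := rpow_le_heavyKer (s := s) (ε := ε) hN h3 h1
    have := lowKer_le_lightKer (s := s) (ε := ε) hN h2 h4
    have := lowKer_nonneg (s := s) (ε := ε) hN h2 h4
    have : 0 ≤ N ^ (2 * ε - 1) := by positivity
    have : 0 ≤ N⁻¹ * lowKer N s ε x z := by positivity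
    constructor <;> linarith
  have hbig : N ≤ 3 * x ∨ N ≤ 3 * y := by
    by_contra! hc
    exact hsmall ⟨by linarith [hc.1], by linarith [hc.2]⟩
  have H := rpow_le_heavyKer (s := s) (ε := ε) hN h3 h1
  have H' := rpow_le_heavyKer (s := s) (ε := ε) hN h2 h4
  have Lzx := cmpKer_le_lightKer (s := s) (ε := ε) hN h4 h2
  rw [lightKer_comm] at Lzx
  have Lyw := cmpKer_le_lightKer (s := s) (ε := ε) hN h3 h1
  have Kzx := lowKer_nonneg (s := s) (ε := ε) hN h4 h2
  have Kyw := lowKer_nonneg (s := s) (ε := ε) hN h3 h1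
  have Kzy := lowKer_nonneg (s := s) (ε := ε) hN h4 h3
  have Kxw := lowKer_nonneg (s := s) (ε := ε) hN h2 h1
  have Kzx' : 0 ≤ N⁻¹ * lowKer N s ε z x := by positivity
  have Kyw' : 0 ≤ N⁻¹ * lowKer N s ε y w := by positivity
  have Kzy' : 0 ≤ N⁻¹ * lowKer N s ε z y := by positivity
  have lzx := lowKer_le_lightKer (s := s) (ε := ε) hN h4 h2
  rw [lightKer_comm] at lzx
  have lyw := lowKer_le_lightKer (s := s) (ε := ε) hN h3 h1
  have hzx' := lowKer_le_heavyKer (s := s) (ε := ε) hN h4 h2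
  rw [heavyKer_comm] at hzx'
  have hyw' := lowKer_le_heavyKer (s := s) (ε := ε) hN h3 h1
  rcases le_total y x with hyx | hxy
  · have hx : N ≤ 3 * x := by rcases hbig with h5 | h5 <;> linarith
    rcases le_total z y with hzy | hyz
    · by_cases hdom : 16 * y ≤ x
      · obtain ⟨a, -⟩ := quadSym_dominant hN hs0 hs1 hε0 hε' h hx hdom (by linarith) hzy
          (Or.inl rfl)
        obtain ⟨-, b⟩ := quadSym_dominant hN hs0 hs1 hε0 hε' h hx hdom (by linarith) hzy
          (Or.inr rfl)
        exact Or.inl ⟨by linarith, by linarith⟩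
      · obtain ⟨-, b, -, d⟩ := quadSym_comparable_cmpKer hN hs0 hs1 hε0 hε h hx (by linarith)
          hyx hzy
        exact Or.inl ⟨by linarith, by linarith⟩
    · rw [quadSym_swap_right, add_right_comm]
      by_cases hdom : 16 * z ≤ x
      · obtain ⟨-, a⟩ := quadSym_dominant hN hs0 hs1 hε0 hε' h.swap_right hx hdom (by linarith) hyz
          (Or.inl rfl)
        obtain ⟨b, -⟩ := quadSym_dominant hN hs0 hs1 hε0 hε' h.swap_right hx hdom (by linarith) hyz
          (Or.inr rfl)
        exact Or.inr (Or.inl ⟨by linarith, by linarith⟩)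
      · obtain ⟨b, -, -, d⟩ := quadSym_comparable_cmpKer hN hs0 hs1 hε0 hε h.swap_right hx
          (by linarith) hzx hyz
        exact Or.inr (Or.inl ⟨by linarith, by linarith⟩)
  · have hy : N ≤ 3 * y := by rcases hbig with h5 | h5 <;> linarith
    rw [quadSym_swap_left, add_comm x y]
    by_cases hdom : 16 * x ≤ y
    · obtain ⟨a, a'⟩ := quadSym_dominant hN hs0 hs1 hε0 hε' h.swap_left hy hdom (by linarith) hzx
        (Or.inl rfl)
      obtain ⟨b, b'⟩ := quadSym_dominant hN hs0 hs1 hε0 hε' h.swap_left hy hdom (by linarith) hzx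
        (Or.inr rfl)
      have Kxy := lowKer_nonneg (s := s) (ε := ε) hN h2 h3
      have Kzw := lowKer_nonneg (s := s) (ε := ε) hN h4 h1
      have Kzw' : 0 ≤ N⁻¹ * lowKer N s ε z w := by positivity
      exact Or.inr (Or.inr ⟨⟨by linarith, by linarith⟩, ⟨by linarith, by linarith⟩⟩)
    · obtain ⟨-, -, b, d⟩ := quadSym_comparable_cmpKer hN hs0 hs1 hε0 hε h.swap_left hy
        (by linarith) hxy hzx
      exact Or.inl ⟨by linarith, by linarith⟩

/-- The pointwise bound of the symbol in terms of the pairing kernels. -/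
lemma quadBound (hN : 1 ≤ N) (hs0 : 0 < s) (hs1 : s < 1) (hε0 : 0 ≤ ε) (hε : 2 * ε ≤ s)
    (h : Quad w x y z) :
    QuadBound N s ε w x y z (quadSym N s w x y z * (x + y + z) ^ (2 * ε)) := by
  rcases le_total z x with hzx | hxz
  · exact (quadBound_of_le hN hs0 hs1 hε0 hε h hzx).1
  · have := (quadBound_of_le hN hs0 hs1 hε0 hε h.swap_left.swap_right.swap_left hxz).2
    rw [show z + y + x = x + y + z by ring] at this
    rwa [quadSym_swap_left, quadSym_swap_right, quadSym_swap_left]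

end quadsymbol

/-! ### Integral bounds for the pairing kernels -/

section pairing

variable {N s ε : ℝ}

lemma measurable_smoothWt (N s : ℝ) : Measurable (smoothWt N s) := by
  unfold smoothWt smoothMul
  fun_prop

lemma measurable_lowKer (N s ε : ℝ) : Measurable fun p : ℝ × ℝ => lowKer N s ε p.1 p.2 := by
  unfold lowKer
  refine Measurable.ite ?_ ?_ measurable_const
  · exact (measurableSet_le (measurable_fst.const_mul 14) measurable_snd).inter
      (measurableSet_le measurable_const (measurable_snd.const_mul 4))
  · exact (measurable_snd.pow_const _).div ((measurable_smoothWt N s).comp measurable_fst)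

lemma measurable_cmpKer (N s : ℝ) : Measurable fun p : ℝ × ℝ => cmpKer N s p.1 p.2 := by
  unfold cmpKer
  have h1 : Measurable fun p : ℝ × ℝ => smoothWt N s p.1 :=
    (measurable_smoothWt N s).comp measurable_fst
  have h2 : Measurable fun p : ℝ × ℝ => smoothWt N s p.2 :=
    (measurable_smoothWt N s).comp measurable_snd
  exact (measurable_const.min (h2.div_const N)).div h1

lemma measurable_heavyKer (N s ε : ℝ) : Measurable fun p : ℝ × ℝ => heavyKer N s ε p.1 p.2 :=
  ((measurable_lowKer N s ε).add ((measurable_lowKer N s ε).comp measurable_swap)).add_const _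

lemma measurable_lightKer (N s ε : ℝ) : Measurable fun p : ℝ × ℝ => lightKer N s ε p.1 p.2 :=
  (((measurable_lowKer N s ε).add
    ((measurable_lowKer N s ε).comp measurable_swap)).const_mul _).add
  (((measurable_cmpKer N s).add ((measurable_cmpKer N s).comp measurable_swap)).const_mul _)

lemma inv_smoothWt_le_of_le (hN : 1 ≤ N) (hs1 : s < 1) (hε : 0 ≤ ε) {b c : ℝ}
    (hb : 1 ≤ b) (hbc : b ≤ c) :
    (smoothWt N s b)⁻¹ ≤ c * (c ^ ε / smoothWt N s c) * b ^ (-(1 + ε)) := by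
  have hb0 : 0 < b := by linarith
  have hc0 : 0 < c := by linarith
  have mb := smoothMul_pos (s := s) hN hb0
  have mc := smoothMul_pos (s := s) hN hc0
  have h1 := smoothMul_anti hN hs1 hb0 hbc
  have h2 : c * (c ^ ε / smoothWt N s c) = c ^ ε / smoothMul N s c := by
    unfold smoothWt; field_simp
  rw [h2, neg_add, Real.rpow_add hb0, Real.rpow_neg_one, Real.rpow_neg hb0.le]
  unfold smoothWt
  rw [mul_inv]
  have h3 : b ^ ε ≤ c ^ ε := Real.rpow_le_rpow hb0.le hbc hε
  have h4 : 1 ≤ c ^ ε * (b ^ ε)⁻¹ := by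
    rw [← div_eq_mul_inv, one_le_div (by positivity)]; exact h3
  calc b⁻¹ * (smoothMul N s b)⁻¹ ≤ b⁻¹ * (smoothMul N s c)⁻¹ := by gcongr
    _ ≤ b⁻¹ * (smoothMul N s c)⁻¹ * (c ^ ε * (b ^ ε)⁻¹) :=
        le_mul_of_one_le_right (by positivity) h4
    _ = _ := by ring

lemma lowKer_le (hN : 1 ≤ N) (hs0 : 0 < s) (hs1 : s < 1) (hε0 : 0 ≤ ε) (hε : 3 * ε ≤ s)
    {b c e : ℝ} (hb : 1 ≤ b) (hec : e ≤ c + b) :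
    lowKer N s ε b e ≤
      if 13 * b ≤ c then 16 * N ^ (3 * ε - 1) * c * b ^ (-(1 + ε)) else 0 := by
  unfold lowKer
  by_cases h : 14 * b ≤ e ∧ N ≤ 4 * e
  · have h13 : 13 * b ≤ c := by linarith [h.1]
    have hc0 : 0 < c := by linarith
    rw [if_pos h, if_pos h13]
    have h1 := inv_smoothWt_le_of_le (s := s) hN hs1 hε0 hb (by linarith : b ≤ c)
    have h2 : e ^ (2 * ε) ≤ 2 * c ^ (2 * ε) :=
      quad_rpow_le hε0 (by linarith) hc0 (by norm_num) (by linarith) (by linarith)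
    have h3 := rpow_div_smoothWt_le (N := N) (A := 8) (r := c) hN hs0 hs1 (by norm_num)
      (by linarith [h.2]) (by linarith : 0 ≤ 3 * ε) hε
    have pc := smoothWt_pos (s := s) hN hc0
    have pb := smoothWt_pos (s := s) hN (r := b) (by linarith)
    rw [div_eq_mul_inv]
    calc _ ≤ 2 * c ^ (2 * ε) * (c * (c ^ ε / smoothWt N s c) * b ^ (-(1 + ε))) := by gcongr
      _ = 2 * c * (c ^ (3 * ε) / smoothWt N s c) * b ^ (-(1 + ε)) := by
          rw [show 3 * ε = 2 * ε + ε by ring, Real.rpow_add hc0]; ring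
      _ ≤ 2 * c * (8 * N ^ (3 * ε - 1)) * b ^ (-(1 + ε)) := by gcongr
      _ = _ := by ring
  · rw [if_neg h]
    split_ifs with h13
    · have : 0 < c := by linarith
      positivity
    · exact le_rfl

lemma cmpKer_le (hN : 1 ≤ N) (hs0 : 0 < s) (hs1 : s < 1) (hε0 : 0 ≤ ε) (hε : ε ≤ s)
    {b c e : ℝ} (hb : 1 ≤ b) (he : 1 ≤ e) (hec : e ≤ c + b) :
    cmpKer N s b e ≤
      (if 13 * b ≤ c then 2 * N ^ (ε - 1) * c * b ^ (-(1 + ε)) else 0) + 14 * N ^ (ε - 1) := by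
  have hN0 : 0 < N := by linarith
  have pb := smoothWt_pos (s := s) hN (r := b) (by linarith)
  by_cases h : 14 * b ≤ e
  · have h13 : 13 * b ≤ c := by linarith
    have hc0 : 0 < c := by linarith
    have pc := smoothWt_pos (s := s) hN hc0
    rw [if_pos h13]
    refine le_add_of_le_of_nonneg ?_ (by positivity)
    have h1 := inv_smoothWt_le_of_le (s := s) hN hs1 hε0 hb (by linarith : b ≤ c)
    have h2 : smoothWt N s e ≤ 2 * smoothWt N s c :=
      (smoothWt_mono hN hs0 (by linarith) (by linarith)).trans
        (smoothWt_mul_le hN hs1 hc0 (by norm_num))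
    have pm : 0 ≤ min 1 (smoothWt N s e / N) := by
      have := smoothWt_pos (s := s) hN (r := e) (by linarith)
      positivity
    have h3 : min 1 (smoothWt N s e / N) * (c ^ ε / smoothWt N s c) ≤ 2 * N ^ (ε - 1) := by
      rcases le_total N c with hc | hc
      · have h4 := rpow_div_smoothWt_le (N := N) (A := 1) (r := c) hN hs0 hs1 le_rfl
          (by linarith) hε0 hε
        have h5 : 0 ≤ c ^ ε / smoothWt N s c := by positivity
        have h6 := min_le_left 1 (smoothWt N s e / N)
        have h7 : 0 < N ^ (ε - 1) := by positivity
        nlinarith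
      · calc _ ≤ (2 * smoothWt N s c / N) * (c ^ ε / smoothWt N s c) := by
              gcongr
              exact (min_le_right _ _).trans (by gcongr)
          _ = 2 * (c ^ ε / N) := by field_simp
          _ ≤ 2 * (N ^ ε / N) := by gcongr
          _ = _ := by rw [Real.rpow_sub hN0, Real.rpow_one]
    unfold cmpKer
    rw [div_eq_mul_inv]
    calc _ ≤ min 1 (smoothWt N s e / N) * (c * (c ^ ε / smoothWt N s c) * b ^ (-(1 + ε))) := by
          gcongr
      _ = (min 1 (smoothWt N s e / N) * (c ^ ε / smoothWt N s c)) * c * b ^ (-(1 + ε)) := by ring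
      _ ≤ _ := by gcongr
  · push Not at h
    refine le_add_of_nonneg_of_le ?_ ?_
    · split_ifs with h13
      · have : 0 < c := by linarith
        positivity
      · exact le_rfl
    · have h2 : smoothWt N s e ≤ 14 * smoothWt N s b :=
        (smoothWt_mono hN hs0 (by linarith) h.le).trans
          (smoothWt_mul_le hN hs1 (by linarith) (by norm_num))
      have h3 : N⁻¹ ≤ N ^ (ε - 1) := by
        rw [← Real.rpow_neg_one]
        exact Real.rpow_le_rpow_of_exponent_le hN (by linarith)
      unfold cmpKer
      calc _ ≤ (14 * smoothWt N s b / N) / smoothWt N s b := by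
            gcongr
            exact (min_le_right _ _).trans (by gcongr)
        _ = 14 * N⁻¹ := by field_simp
        _ ≤ _ := by gcongr

lemma exists_lintegral_line_kernel_le (hε0 : 0 < ε) :
    ∃ C : ℝ≥0∞, C ≠ ⊤ ∧ ∀ (k : ℝ → ℝ≥0∞), Measurable k → ∀ (σ : ℝ), (σ = 1 ∨ σ = -1) →
      ∀ (c : Rn 2) (ν : ℝ) (A : ℝ) (F : Rn 2 → ℝ), 0 ≤ A →
      (∀ b, F b ≤ if 13 * jap b ≤ jap c then A * jap c * jap b ^ (-(1 + ε)) else 0) →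
      ∫⁻ b, ENNReal.ofReal (F b) * k (σ * ‖b‖ ^ 2 + ‖c - b‖ ^ 2 + ν) ≤
        C * (∫⁻ z, k z) * ENNReal.ofReal A := by
  obtain ⟨C, hC, h⟩ := exists_lintegral_transversal_le (r := 1 + ε) (by linarith)
  refine ⟨C, hC, fun k hk σ hσ c ν A F hA hF => ?_⟩
  have hc := jap_pos c
  have hm : MeasurableSet {b : Rn 2 | 13 * jap b ≤ jap c} :=
    measurableSet_le (continuous_jap.measurable.const_mul _) measurable_const
  calc _ ≤ ∫⁻ b, {b : Rn 2 | 13 * jap b ≤ jap c}.indicator (fun b =>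
        ENNReal.ofReal (A * jap c) * (k (σ * ‖b‖ ^ 2 + ‖c - b‖ ^ 2 + ν) * jw (1 + ε) b)) b := by
        refine lintegral_mono fun b => ?_
        by_cases hb : 13 * jap b ≤ jap c
        · rw [indicator_of_mem (by exact hb)]
          have := hF b
          rw [if_pos hb] at this
          unfold jw
          calc _ ≤ ENNReal.ofReal (A * jap c * jap b ^ (-(1 + ε))) *
                k (σ * ‖b‖ ^ 2 + ‖c - b‖ ^ 2 + ν) := by gcongr
            _ = _ := by rw [ENNReal.ofReal_mul (by positivity)]; ring
        · rw [indicator_of_notMem (by exact hb)]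
          have := hF b
          rw [if_neg hb] at this
          rw [ENNReal.ofReal_of_nonpos this, zero_mul]
    _ = ENNReal.ofReal (A * jap c) * ∫⁻ b in {b : Rn 2 | 13 * jap b ≤ jap c},
        k (σ * ‖b‖ ^ 2 + ‖c - b‖ ^ 2 + ν) * jw (1 + ε) b := by
        rw [lintegral_indicator hm, lintegral_const_mul' _ _ ENNReal.ofReal_ne_top]
    _ ≤ ENNReal.ofReal (A * jap c) * (C * (∫⁻ z, k z) / ENNReal.ofReal (jap c)) := by
        gcongr; exact h k hk σ hσ c ν
    _ = _ := by
        rw [ENNReal.ofReal_mul hA, mul_assoc, ENNReal.mul_div_cancel, mul_comm]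
        · simpa using hc
        · exact ENNReal.ofReal_ne_top

lemma jap_le_jap_sub_add (b c : Rn 2) : jap (c - b) ≤ jap c + jap b := jap_sub_le c b

lemma measurable_ker_slice {F : ℝ → ℝ → ℝ} (hF : Measurable fun p : ℝ × ℝ => F p.1 p.2)
    (c : Rn 2) : Measurable fun b : Rn 2 => ENNReal.ofReal (F (jap b) (jap (c - b))) := by
  have h1 : Measurable fun b : Rn 2 => jap b := continuous_jap.measurable
  have h2 : Measurable fun b : Rn 2 => jap (c - b) :=
    (continuous_jap.comp (continuous_const.sub continuous_id)).measurable
  exact (hF.comp (h1.prodMk h2)).ennreal_ofReal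

lemma measurable_quad_slice {k : ℝ → ℝ≥0∞} (hk : Measurable k) (σ : ℝ) (c : Rn 2) (ν : ℝ) :
    Measurable fun b : Rn 2 => k (σ * ‖b‖ ^ 2 + ‖c - b‖ ^ 2 + ν) :=
  hk.comp (by fun_prop : Continuous fun b : Rn 2 => σ * ‖b‖ ^ 2 + ‖c - b‖ ^ 2 + ν).measurable

lemma exists_lintegral_lowKer_le (hε0 : 0 < ε) :
    ∃ C : ℝ≥0∞, C ≠ ⊤ ∧ ∀ N s : ℝ, 1 ≤ N → 0 < s → s < 1 → 3 * ε ≤ s →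
      ∀ (k : ℝ → ℝ≥0∞), Measurable k → ∀ (σ : ℝ), (σ = 1 ∨ σ = -1) → ∀ (c : Rn 2) (ν : ℝ),
      ∫⁻ b, ENNReal.ofReal (lowKer N s ε (jap b) (jap (c - b))) *
        k (σ * ‖b‖ ^ 2 + ‖c - b‖ ^ 2 + ν) ≤ C * (∫⁻ z, k z) * ENNReal.ofReal (N ^ (3 * ε - 1)) := by
  obtain ⟨C, hC, h⟩ := exists_lintegral_line_kernel_le hε0
  refine ⟨C * 16, by finiteness, fun N s hN hs0 hs1 hεs k hk σ hσ c ν => ?_⟩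
  refine (h k hk σ hσ c ν (16 * N ^ (3 * ε - 1)) _ (by positivity) fun b => ?_).trans (le_of_eq ?_)
  · exact lowKer_le hN hs0 hs1 hε0.le hεs (one_le_jap b) (jap_le_jap_sub_add b c)
  · rw [ENNReal.ofReal_mul (by norm_num)]
    norm_num
    ring

lemma exists_lintegral_cmpKer_le (hε0 : 0 < ε) :
    ∃ C : ℝ≥0∞, C ≠ ⊤ ∧ ∀ N s : ℝ, 1 ≤ N → 0 < s → s < 1 → 3 * ε ≤ s →
      ∀ (k : ℝ → ℝ≥0∞), Measurable k → ∀ (c : Rn 2) (ν : ℝ),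
      ∫⁻ b, ENNReal.ofReal (cmpKer N s (jap b) (jap (c - b))) *
        k (1 * ‖b‖ ^ 2 + ‖c - b‖ ^ 2 + ν) ≤ C * (∫⁻ z, k z) * ENNReal.ofReal (N ^ (3 * ε - 1)) := by
  obtain ⟨C, hC, h⟩ := exists_lintegral_line_kernel_le hε0
  refine ⟨C * 2 + 14 * ENNReal.ofReal (2 * Real.pi), by finiteness,
    fun N s hN hs0 hs1 hεs k hk c ν => ?_⟩
  have hN0 : 0 < N := by linarith
  have hpow : ENNReal.ofReal (N ^ (ε - 1)) ≤ ENNReal.ofReal (N ^ (3 * ε - 1)) :=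
    ENNReal.ofReal_le_ofReal (Real.rpow_le_rpow_of_exponent_le hN (by linarith))
  set F : Rn 2 → ℝ := fun b =>
    if 13 * jap b ≤ jap c then 2 * N ^ (ε - 1) * jap c * jap b ^ (-(1 + ε)) else 0 with hF
  have h1 := h k hk 1 (Or.inl rfl) c ν (2 * N ^ (ε - 1)) F (by positivity) fun b => le_rfl
  have h2 := lintegral_circle_le k hk c ν
  have hmk := measurable_quad_slice hk 1 c ν
  calc _ ≤ ∫⁻ b, (ENNReal.ofReal (F b) * k (1 * ‖b‖ ^ 2 + ‖c - b‖ ^ 2 + ν) +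
        ENNReal.ofReal (14 * N ^ (ε - 1)) * k (1 * ‖b‖ ^ 2 + ‖c - b‖ ^ 2 + ν)) := by
        refine lintegral_mono fun b => ?_
        rw [← add_mul]
        gcongr
        refine le_trans (ENNReal.ofReal_le_ofReal ?_) ENNReal.ofReal_add_le
        exact cmpKer_le hN hs0 hs1 hε0.le (by linarith) (one_le_jap b) (one_le_jap _)
          (jap_le_jap_sub_add b c)
    _ = (∫⁻ b, ENNReal.ofReal (F b) * k (1 * ‖b‖ ^ 2 + ‖c - b‖ ^ 2 + ν)) +
        ENNReal.ofReal (14 * N ^ (ε - 1)) * ∫⁻ b, k (1 * ‖b‖ ^ 2 + ‖c - b‖ ^ 2 + ν) := by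
        rw [lintegral_add_right _ (hmk.const_mul _), lintegral_const_mul _ hmk]
    _ ≤ C * (∫⁻ z, k z) * ENNReal.ofReal (2 * N ^ (ε - 1)) +
        ENNReal.ofReal (14 * N ^ (ε - 1)) * (ENNReal.ofReal (2 * Real.pi) * ∫⁻ z, k z) := by
        gcongr
        simpa only [one_mul] using h2
    _ = (C * 2 + 14 * ENNReal.ofReal (2 * Real.pi)) * (∫⁻ z, k z) *
        ENNReal.ofReal (N ^ (ε - 1)) := by
        rw [ENNReal.ofReal_mul (by norm_num), ENNReal.ofReal_mul (p := 14) (by norm_num)]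
        norm_num
        ring
    _ ≤ _ := by gcongr

/-- The kernel balancing the light and heavy bounds. -/
def pairKer (N s ε x y : ℝ) : ℝ :=
  N ^ (1 / 2 : ℝ) * lightKer N s ε x y + N ^ (-(1 / 2) : ℝ) * heavyKer N s ε x y

lemma measurable_pairKer (N s ε : ℝ) : Measurable fun p : ℝ × ℝ => pairKer N s ε p.1 p.2 :=
  ((measurable_lightKer N s ε).const_mul _).add ((measurable_heavyKer N s ε).const_mul _)

lemma ofReal_pairKer_le (hN : 1 ≤ N) (x y : ℝ) :
    ENNReal.ofReal (pairKer N s ε x y) ≤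
      2 * ENNReal.ofReal (N ^ (-(1 / 2) : ℝ)) * (ENNReal.ofReal (lowKer N s ε x y) +
        ENNReal.ofReal (lowKer N s ε y x)) +
      ENNReal.ofReal (N ^ (2 * ε - 1 / 2)) * (ENNReal.ofReal (cmpKer N s x y) +
        ENNReal.ofReal (cmpKer N s y x)) + ENNReal.ofReal (N ^ (2 * ε - 3 / 2)) := by
  have hN0 : 0 < N := by linarith
  have h : pairKer N s ε x y = 2 * N ^ (-(1 / 2) : ℝ) * (lowKer N s ε x y + lowKer N s ε y x) +
      N ^ (2 * ε - 1 / 2) * (cmpKer N s x y + cmpKer N s y x) + N ^ (2 * ε - 3 / 2) := by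
    unfold pairKer lightKer heavyKer
    have e1 : N ^ (-(1 / 2) : ℝ) = N ^ (1 / 2 : ℝ) * N⁻¹ := by
      rw [← Real.rpow_neg_one, ← Real.rpow_add hN0]; norm_num
    have e2 : N ^ (2 * ε - 1 / 2) = N ^ (1 / 2 : ℝ) * N ^ (2 * ε - 1) := by
      rw [← Real.rpow_add hN0]; ring_nf
    have e3 : N ^ (2 * ε - 3 / 2) = N ^ (-(1 / 2) : ℝ) * N ^ (2 * ε - 1) := by
      rw [← Real.rpow_add hN0]; ring_nf
    rw [e2, e3, e1]
    ring
  rw [h]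
  refine ENNReal.ofReal_add_le.trans (add_le_add_left (ENNReal.ofReal_add_le.trans
    (add_le_add ?_ ?_)) _)
  · rw [ENNReal.ofReal_mul (by positivity), ENNReal.ofReal_mul (by norm_num)]
    norm_num
    gcongr
    exact ENNReal.ofReal_add_le
  · rw [ENNReal.ofReal_mul (by positivity)]
    gcongr
    exact ENNReal.ofReal_add_le

lemma exists_lintegral_pairKer_le (hε0 : 0 < ε) :
    ∃ C : ℝ≥0∞, C ≠ ⊤ ∧ ∀ N s : ℝ, 1 ≤ N → 0 < s → s < 1 → 3 * ε ≤ s →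
      ∀ (k : ℝ → ℝ≥0∞), Measurable k → ∀ (c : Rn 2) (ν : ℝ),
      ∫⁻ b, ENNReal.ofReal (pairKer N s ε (jap b) (jap (c - b))) *
        k (1 * ‖b‖ ^ 2 + ‖c - b‖ ^ 2 + ν) ≤
        C * (∫⁻ z, k z) * ENNReal.ofReal (N ^ (5 * ε - 3 / 2)) := by
  obtain ⟨C, hC, h⟩ := exists_lintegral_lowKer_le hε0
  obtain ⟨D, hD, h'⟩ := exists_lintegral_cmpKer_le hε0
  refine ⟨4 * C + 2 * D + ENNReal.ofReal (2 * Real.pi), by finiteness,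
    fun N s hN hs0 hs1 hεs k hk c ν => ?_⟩
  have hN0 : 0 < N := by linarith
  set K := ∫⁻ z, k z
  set κ : Rn 2 → ℝ≥0∞ := fun b => k (1 * ‖b‖ ^ 2 + ‖c - b‖ ^ 2 + ν) with hκ
  have hmk : Measurable κ := measurable_quad_slice hk 1 c ν
  have refl : ∀ F : ℝ → ℝ → ℝ, ∫⁻ b, ENNReal.ofReal (F (jap (c - b)) (jap b)) * κ b =
      ∫⁻ b, ENNReal.ofReal (F (jap b) (jap (c - b))) * κ b := by
    intro F
    rw [← lintegral_sub_left_eq_self _ c]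
    refine lintegral_congr fun b => ?_
    simp only [hκ, sub_sub_cancel]
    ring_nf
  have i1 := h N s hN hs0 hs1 hεs k hk 1 (Or.inl rfl) c ν
  have i2 := h' N s hN hs0 hs1 hεs k hk c ν
  have i3 : ∫⁻ b, κ b ≤ ENNReal.ofReal (2 * Real.pi) * K := by
    have := lintegral_circle_le k hk c ν
    simpa only [hκ, one_mul] using this
  have m1 : Measurable fun b => ENNReal.ofReal (lowKer N s ε (jap b) (jap (c - b))) * κ b :=
    (measurable_ker_slice (measurable_lowKer N s ε) c).mul hmk
  have m2 : Measurable fun b => ENNReal.ofReal (lowKer N s ε (jap (c - b)) (jap b)) * κ b :=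
    (measurable_ker_slice (F := fun x y => lowKer N s ε y x)
    ((measurable_lowKer N s ε).comp measurable_swap) c).mul hmk
  have m3 : Measurable fun b => ENNReal.ofReal (cmpKer N s (jap b) (jap (c - b))) * κ b :=
    (measurable_ker_slice (measurable_cmpKer N s) c).mul hmk
  have m4 : Measurable fun b => ENNReal.ofReal (cmpKer N s (jap (c - b)) (jap b)) * κ b :=
    (measurable_ker_slice (F := fun x y => cmpKer N s y x)
    ((measurable_cmpKer N s).comp measurable_swap) c).mul hmk
  have p1 : ENNReal.ofReal (N ^ (-(1 / 2) : ℝ)) * ENNReal.ofReal (N ^ (3 * ε - 1)) ≤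
      ENNReal.ofReal (N ^ (5 * ε - 3 / 2)) := by
    rw [← ENNReal.ofReal_mul (by positivity), ← Real.rpow_add hN0]
    exact ENNReal.ofReal_le_ofReal (Real.rpow_le_rpow_of_exponent_le hN (by linarith))
  have p2 : ENNReal.ofReal (N ^ (2 * ε - 1 / 2)) * ENNReal.ofReal (N ^ (3 * ε - 1)) ≤
      ENNReal.ofReal (N ^ (5 * ε - 3 / 2)) := by
    rw [← ENNReal.ofReal_mul (by positivity), ← Real.rpow_add hN0]
    exact ENNReal.ofReal_le_ofReal (Real.rpow_le_rpow_of_exponent_le hN (by linarith))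
  have p3 : ENNReal.ofReal (N ^ (2 * ε - 3 / 2)) ≤ ENNReal.ofReal (N ^ (5 * ε - 3 / 2)) :=
    ENNReal.ofReal_le_ofReal (Real.rpow_le_rpow_of_exponent_le hN (by linarith))
  set P := ENNReal.ofReal (N ^ (5 * ε - 3 / 2))
  calc _ ≤ ∫⁻ b, (2 * ENNReal.ofReal (N ^ (-(1 / 2) : ℝ)) *
          (ENNReal.ofReal (lowKer N s ε (jap b) (jap (c - b))) * κ b +
            ENNReal.ofReal (lowKer N s ε (jap (c - b)) (jap b)) * κ b) +
        ENNReal.ofReal (N ^ (2 * ε - 1 / 2)) *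
          (ENNReal.ofReal (cmpKer N s (jap b) (jap (c - b))) * κ b +
            ENNReal.ofReal (cmpKer N s (jap (c - b)) (jap b)) * κ b) +
        ENNReal.ofReal (N ^ (2 * ε - 3 / 2)) * κ b) := by
        refine lintegral_mono fun b => ?_
        refine (mul_le_mul_left (ofReal_pairKer_le hN (jap b) (jap (c - b))) _).trans (le_of_eq ?_)
        simp only [hκ]
        ring
    _ = 2 * ENNReal.ofReal (N ^ (-(1 / 2) : ℝ)) *
          ((∫⁻ b, ENNReal.ofReal (lowKer N s ε (jap b) (jap (c - b))) * κ b) +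
            ∫⁻ b, ENNReal.ofReal (lowKer N s ε (jap (c - b)) (jap b)) * κ b) +
        ENNReal.ofReal (N ^ (2 * ε - 1 / 2)) *
          ((∫⁻ b, ENNReal.ofReal (cmpKer N s (jap b) (jap (c - b))) * κ b) +
            ∫⁻ b, ENNReal.ofReal (cmpKer N s (jap (c - b)) (jap b)) * κ b) +
        ENNReal.ofReal (N ^ (2 * ε - 3 / 2)) * ∫⁻ b, κ b := by
        have m12 : Measurable fun b => ENNReal.ofReal (lowKer N s ε (jap b) (jap (c - b))) * κ b +
            ENNReal.ofReal (lowKer N s ε (jap (c - b)) (jap b)) * κ b := m1.add m2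
        have m34 : Measurable fun b => ENNReal.ofReal (cmpKer N s (jap b) (jap (c - b))) * κ b +
            ENNReal.ofReal (cmpKer N s (jap (c - b)) (jap b)) * κ b := m3.add m4
        rw [lintegral_add_right _ (hmk.const_mul _), lintegral_add_right _ (m34.const_mul _),
          lintegral_const_mul _ m12, lintegral_const_mul _ m34,
          lintegral_add_left m1, lintegral_add_left m3, lintegral_const_mul _ hmk]
    _ ≤ 2 * ENNReal.ofReal (N ^ (-(1 / 2) : ℝ)) *
          (C * K * ENNReal.ofReal (N ^ (3 * ε - 1)) + C * K * ENNReal.ofReal (N ^ (3 * ε - 1))) +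
        ENNReal.ofReal (N ^ (2 * ε - 1 / 2)) *
          (D * K * ENNReal.ofReal (N ^ (3 * ε - 1)) + D * K * ENNReal.ofReal (N ^ (3 * ε - 1))) +
        ENNReal.ofReal (N ^ (2 * ε - 3 / 2)) * (ENNReal.ofReal (2 * Real.pi) * K) := by
        rw [refl (lowKer N s ε), refl (cmpKer N s)]
        gcongr
    _ = 4 * C * K * (ENNReal.ofReal (N ^ (-(1 / 2) : ℝ)) * ENNReal.ofReal (N ^ (3 * ε - 1))) +
        2 * D * K * (ENNReal.ofReal (N ^ (2 * ε - 1 / 2)) * ENNReal.ofReal (N ^ (3 * ε - 1))) +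
        ENNReal.ofReal (2 * Real.pi) * K * ENNReal.ofReal (N ^ (2 * ε - 3 / 2)) := by ring
    _ ≤ 4 * C * K * P + 2 * D * K * P + ENNReal.ofReal (2 * Real.pi) * K * P := by gcongr
    _ = _ := by ring

end pairing

/-! ### The quadrilinear estimate -/

section quadrilinear

variable {N s ε : ℝ}

lemma balanced_mul_le {Ψ α β l M : ℝ} (hl : 0 < l) (hM : 0 ≤ M) (h1 : l * Ψ ≤ M * α)
    (h2 : l⁻¹ * Ψ ≤ M * β) (P R : ℝ≥0∞) :
    ENNReal.ofReal Ψ * (P * R) ≤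
      ENNReal.ofReal M * (ENNReal.ofReal α * P ^ 2 + ENNReal.ofReal β * R ^ 2) := by
  set q := ENNReal.ofReal (Real.sqrt l)
  set q' := ENNReal.ofReal (Real.sqrt l)⁻¹
  have hsq : 0 < Real.sqrt l := Real.sqrt_pos.mpr hl
  have hqq : q * q' = 1 := by
    rw [← ENNReal.ofReal_mul hsq.le, mul_inv_cancel₀ hsq.ne', ENNReal.ofReal_one]
  have hq : q ^ 2 = ENNReal.ofReal l := by
    rw [← ENNReal.ofReal_pow hsq.le, Real.sq_sqrt hl.le]
  have hq' : q' ^ 2 = ENNReal.ofReal l⁻¹ := by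
    rw [← ENNReal.ofReal_pow (by positivity), inv_pow, Real.sq_sqrt hl.le]
  have e1 : ENNReal.ofReal l * ENNReal.ofReal Ψ ≤ ENNReal.ofReal M * ENNReal.ofReal α := by
    rw [← ENNReal.ofReal_mul hl.le, ← ENNReal.ofReal_mul hM]
    exact ENNReal.ofReal_le_ofReal h1
  have e2 : ENNReal.ofReal l⁻¹ * ENNReal.ofReal Ψ ≤ ENNReal.ofReal M * ENNReal.ofReal β := by
    rw [← ENNReal.ofReal_mul (by positivity), ← ENNReal.ofReal_mul hM]
    exact ENNReal.ofReal_le_ofReal h2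
  calc ENNReal.ofReal Ψ * (P * R) = ENNReal.ofReal Ψ * ((q * P) * (q' * R)) := by
        rw [show (q * P) * (q' * R) = (q * q') * (P * R) by ring, hqq, one_mul]
    _ ≤ ENNReal.ofReal Ψ * ((q * P) ^ 2 + (q' * R) ^ 2) := by
        gcongr; exact ennreal_mul_le_sq_add_sq _ _
    _ = (ENNReal.ofReal l * ENNReal.ofReal Ψ) * P ^ 2 +
        (ENNReal.ofReal l⁻¹ * ENNReal.ofReal Ψ) * R ^ 2 := by
        rw [mul_pow, mul_pow, hq, hq']; ring
    _ ≤ (ENNReal.ofReal M * ENNReal.ofReal α) * P ^ 2 +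
        (ENNReal.ofReal M * ENNReal.ofReal β) * R ^ 2 := by gcongr
    _ = _ := by ring

lemma heavyKer_nonneg {x y : ℝ} (hN : 1 ≤ N) (hx : 1 ≤ x) (hy : 1 ≤ y) :
    0 ≤ heavyKer N s ε x y :=
  le_trans (by positivity) (rpow_le_heavyKer hN hx hy)

lemma lightKer_nonneg {x y : ℝ} (hN : 1 ≤ N) (hx : 1 ≤ x) (hy : 1 ≤ y) :
    0 ≤ lightKer N s ε x y := by
  have := lowKer_nonneg (s := s) (ε := ε) hN hx hy
  exact le_trans (by positivity) (lowKer_le_lightKer hN hx hy)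

/-- The kernel in the regime of two adjacent high frequencies. -/
def lineKer (N s ε x y : ℝ) : ℝ := N ^ (-(1 / 2) : ℝ) * lowKer N s ε x y

lemma QuadBound.mul_le {w x y z Ψ : ℝ} (hN : 1 ≤ N) (hw : 1 ≤ w) (hx : 1 ≤ x) (hy : 1 ≤ y)
    (hz : 1 ≤ z) (h : QuadBound N s ε w x y z Ψ) (g₀ g₁ g₂ g₃ : ℝ≥0∞) :
    ENNReal.ofReal Ψ * (g₀ * g₁ * g₂ * g₃) ≤ ENNReal.ofReal (10 ^ 6) *
      (ENNReal.ofReal (pairKer N s ε x z) * (g₀ ^ 2 * g₂ ^ 2) +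
        ENNReal.ofReal (pairKer N s ε y w) * (g₁ ^ 2 * g₃ ^ 2) +
        (ENNReal.ofReal (lineKer N s ε z y) * (g₀ ^ 2 * g₁ ^ 2) +
        ENNReal.ofReal (lineKer N s ε x w) * (g₂ ^ 2 * g₃ ^ 2))) := by
  have hN0 : 0 < N := by linarith
  set l := N ^ (1 / 2 : ℝ) with hl
  have hl0 : 0 < l := by positivity
  have hlN : l * N⁻¹ = l⁻¹ := by
    rw [hl, ← Real.rpow_neg_one, ← Real.rpow_add hN0, ← Real.rpow_neg hN0.le]; norm_num
  obtain ⟨r, hr⟩ : ∃ r, r = l⁻¹ := ⟨_, rfl⟩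
  obtain ⟨n, hn⟩ : ∃ n, n = N⁻¹ := ⟨_, rfl⟩
  have hr0 : 0 < r := hr ▸ inv_pos.mpr hl0
  have hri : r⁻¹ = l := by rw [hr, inv_inv]
  have hli : N ^ (-(1 / 2) : ℝ) = r := by rw [hr]; exact Real.rpow_neg hN0.le _
  rw [← hn, ← hr] at hlN
  have a1 := heavyKer_nonneg (s := s) (ε := ε) hN hx hz
  have a2 := lightKer_nonneg (s := s) (ε := ε) hN hx hz
  have a3 := heavyKer_nonneg (s := s) (ε := ε) hN hy hw
  have a4 := lightKer_nonneg (s := s) (ε := ε) hN hy hw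
  have pxz : pairKer N s ε x z = l * lightKer N s ε x z + r * heavyKer N s ε x z := by
    rw [pairKer, hli]
  have pyw : pairKer N s ε y w = l * lightKer N s ε y w + r * heavyKer N s ε y w := by
    rw [pairKer, hli]
  have b1 : 0 ≤ l * lightKer N s ε x z := by positivity
  have b2 : 0 ≤ r * heavyKer N s ε x z := by positivity
  have b3 : 0 ≤ l * lightKer N s ε y w := by positivity
  have b4 : 0 ≤ r * heavyKer N s ε y w := by positivity
  have lzy : lineKer N s ε z y = r * lowKer N s ε z y := by rw [lineKer, hli]
  have lxw : lineKer N s ε x w = r * lowKer N s ε x w := by rw [lineKer, hli]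
  unfold QuadBound at h
  rw [← hn] at h
  rcases h with ⟨h1, h2⟩ | ⟨h1, h2⟩ | ⟨h1, h2⟩ | ⟨h1, h2⟩
  · have c1 := mul_le_mul_of_nonneg_left h1 hl0.le
    have c2 := mul_le_mul_of_nonneg_left h2 hr0.le
    have := balanced_mul_le (α := pairKer N s ε x z) (β := pairKer N s ε y w) (M := 10 ^ 6)
      hl0 (by norm_num) (by rw [pxz]; linarith) (by rw [pyw, ← hr]; linarith) (g₀ * g₂) (g₁ * g₃)
    rw [show g₀ * g₁ * g₂ * g₃ = (g₀ * g₂) * (g₁ * g₃) by ring]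
    refine this.trans ?_
    rw [mul_pow, mul_pow]
    exact mul_le_mul_right le_self_add _
  · have c1 := mul_le_mul_of_nonneg_left h1 hr0.le
    have c2 := mul_le_mul_of_nonneg_left h2 hl0.le
    have := balanced_mul_le (α := pairKer N s ε x z) (β := pairKer N s ε y w) (M := 10 ^ 6)
      hr0 (by norm_num) (by rw [pxz]; linarith) (by rw [pyw, hri]; linarith)
      (g₀ * g₂) (g₁ * g₃)
    rw [show g₀ * g₁ * g₂ * g₃ = (g₀ * g₂) * (g₁ * g₃) by ring]
    refine this.trans ?_
    rw [mul_pow, mul_pow]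
    exact mul_le_mul_right le_self_add _
  · have c1 := mul_le_mul_of_nonneg_left h1 hl0.le
    have c2 := mul_le_mul_of_nonneg_left h2 hr0.le
    have := balanced_mul_le (α := lineKer N s ε z y) (β := lineKer N s ε x w) (M := 10 ^ 6)
      hl0 (by norm_num) (by rw [lzy, ← hlN]; linarith) (by rw [lxw, ← hr]; linarith)
      (g₀ * g₁) (g₂ * g₃)
    rw [show g₀ * g₁ * g₂ * g₃ = (g₀ * g₁) * (g₂ * g₃) by ring]
    refine this.trans ?_
    rw [mul_pow, mul_pow]
    exact mul_le_mul_right le_add_self _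
  · have c1 := mul_le_mul_of_nonneg_left h1 hr0.le
    have c2 := mul_le_mul_of_nonneg_left h2 hl0.le
    have := balanced_mul_le (α := lineKer N s ε z y) (β := lineKer N s ε x w) (M := 10 ^ 6)
      hr0 (by norm_num) (by rw [lzy]; linarith)
      (by rw [hri, lxw, ← hlN]; linarith)
      (g₀ * g₁) (g₂ * g₃)
    rw [show g₀ * g₁ * g₂ * g₃ = (g₀ * g₁) * (g₂ * g₃) by ring]
    refine this.trans ?_
    rw [mul_pow, mul_pow]
    exact mul_le_mul_right le_add_self _

lemma lintegral_cyc {H : Rn 2 × Rn 2 × Rn 2 → ℝ≥0∞} (hH : Measurable H) :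
    ∫⁻ x, ∫⁻ a, ∫⁻ b, H (x, a, b) = ∫⁻ a, ∫⁻ b, ∫⁻ x, H (x, a, b) := by
  have h1 : ∀ x, ∫⁻ a, ∫⁻ b, H (x, a, b) = ∫⁻ p : Rn 2 × Rn 2, H (x, p) := fun x =>
    (lintegral_prod (fun p => H (x, p)) (hH.comp measurable_prodMk_left).aemeasurable).symm
  have h2 : Measurable fun p : Rn 2 × Rn 2 => ∫⁻ x, H (x, p) := hH.lintegral_prod_left'
  simp only [h1]
  rw [lintegral_lintegral_swap (f := fun x p => H (x, p)) hH.aemeasurable]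
  exact lintegral_prod _ h2.aemeasurable

lemma lintegral_swap_inner {H : Rn 2 × Rn 2 × Rn 2 → ℝ≥0∞} (hH : Measurable H) :
    ∫⁻ x, ∫⁻ a, ∫⁻ b, H (x, a, b) = ∫⁻ x, ∫⁻ b, ∫⁻ a, H (x, a, b) :=
  lintegral_congr fun _ =>
    lintegral_lintegral_swap (hH.comp measurable_prodMk_left).aemeasurable

lemma lintegral_sq_sq_le {g : Rn 2 → ℝ≥0∞} (hg : Measurable g) {F : Rn 2 → Rn 2 → Rn 2 → ℝ≥0∞}
    (hF : ∀ x y, Measurable (F x y)) {B : ℝ≥0∞} (hB : ∀ x y, ∫⁻ z, F x y z ≤ B) :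
    ∫⁻ x, ∫⁻ y, ∫⁻ z, F x y z * (g x ^ 2 * g y ^ 2) ≤ B * (∫⁻ x, g x ^ 2) ^ 2 := by
  have hg2 : Measurable fun x => g x ^ 2 := hg.pow_const 2
  calc _ ≤ ∫⁻ x, ∫⁻ y, B * (g x ^ 2 * g y ^ 2) := by
        refine lintegral_mono fun x => lintegral_mono fun y => ?_
        rw [lintegral_mul_const _ (hF x y)]
        gcongr
        exact hB x y
    _ = ∫⁻ x, (B * ∫⁻ y, g y ^ 2) * g x ^ 2 := by
        refine lintegral_congr fun x => ?_
        rw [lintegral_const_mul _ (hg2.const_mul _), lintegral_const_mul _ hg2]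
        ring
    _ = _ := by rw [lintegral_const_mul _ hg2]; ring

lemma measurable_piece {G : ℝ → ℝ → ℝ} (hG : Measurable fun p : ℝ × ℝ => G p.1 p.2)
    {k : ℝ → ℝ≥0∞} (hk : Measurable k) {g : Rn 2 → ℝ≥0∞} (hg : Measurable g)
    {u v x y : Rn 2 × Rn 2 × Rn 2 → Rn 2} {φ : Rn 2 × Rn 2 × Rn 2 → ℝ} (hu : Continuous u)
    (hv : Continuous v) (hx : Continuous x) (hy : Continuous y) (hφ : Continuous φ) :
    Measurable fun q => ENNReal.ofReal (G (jap (u q)) (jap (v q))) * k (φ q) *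
      (g (x q) ^ 2 * g (y q) ^ 2) := by
  have h1 : Measurable fun q => jap (u q) := (continuous_jap.comp hu).measurable
  have h2 : Measurable fun q => jap (v q) := (continuous_jap.comp hv).measurable
  have h3 := (hG.comp (h1.prodMk h2)).ennreal_ofReal
  have h4 := hk.comp hφ.measurable
  have h5 := (hg.comp hx.measurable).pow_const 2
  have h6 := (hg.comp hy.measurable).pow_const 2
  exact (h3.mul h4).mul (h5.mul h6)

lemma lintegral_slice_sq_sq_le {G : ℝ → ℝ → ℝ} (hG : Measurable fun p : ℝ × ℝ => G p.1 p.2)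
    {k : ℝ → ℝ≥0∞} (hk : Measurable k) {g : Rn 2 → ℝ≥0∞} (hg : Measurable g) {B : ℝ≥0∞} {σ : ℝ}
    (hB : ∀ (c : Rn 2) (ν : ℝ), ∫⁻ b, ENNReal.ofReal (G (jap b) (jap (c - b))) *
      k (σ * ‖b‖ ^ 2 + ‖c - b‖ ^ 2 + ν) ≤ B) (c : Rn 2 → Rn 2 → Rn 2) (ν : Rn 2 → Rn 2 → ℝ) :
    ∫⁻ x, ∫⁻ y, ∫⁻ z, ENNReal.ofReal (G (jap z) (jap (c x y - z))) *
      k (σ * ‖z‖ ^ 2 + ‖c x y - z‖ ^ 2 + ν x y) * (g x ^ 2 * g y ^ 2) ≤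
      B * (∫⁻ x, g x ^ 2) ^ 2 :=
  lintegral_sq_sq_le hg (F := fun x y z => ENNReal.ofReal (G (jap z) (jap (c x y - z))) *
      k (σ * ‖z‖ ^ 2 + ‖c x y - z‖ ^ 2 + ν x y))
    (fun _ _ => (measurable_ker_slice hG _).mul (measurable_quad_slice hk σ _ _)) fun _ _ => hB _ _

section pairings

variable {G : ℝ → ℝ → ℝ} {k : ℝ → ℝ≥0∞} {g : Rn 2 → ℝ≥0∞} {B : ℝ≥0∞}

/-- Pairing of the output with the conjugated frequency. -/
lemma lintegral_pair_outer_le (hG : Measurable fun p : ℝ × ℝ => G p.1 p.2)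
    (hk : Measurable k) (hk' : ∀ z, k (-z) = k z) (hg : Measurable g)
    (hB : ∀ (c : Rn 2) (ν : ℝ), ∫⁻ b, ENNReal.ofReal (G (jap b) (jap (c - b))) *
      k (1 * ‖b‖ ^ 2 + ‖c - b‖ ^ 2 + ν) ≤ B) :
    ∫⁻ ξ, ∫⁻ a, ∫⁻ b, ENNReal.ofReal (G (jap a) (jap (ξ - a + b))) * k (phase ξ a b) *
      (g ξ ^ 2 * g b ^ 2) ≤ B * (∫⁻ x, g x ^ 2) ^ 2 := by
  have hm := measurable_piece hG hk hg (u := fun q => q.2.1) (v := fun q => q.1 - q.2.1 + q.2.2)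
    (x := fun q => q.1) (y := fun q => q.2.2) (by fun_prop) (by fun_prop) (by fun_prop)
    (by fun_prop) continuous_phase
  rw [lintegral_swap_inner hm]
  refine le_trans (le_of_eq ?_) (lintegral_slice_sq_sq_le hG hk hg hB (fun x y => x + y)
    fun x y => -‖x‖ ^ 2 - ‖y‖ ^ 2)
  refine lintegral_congr fun x => lintegral_congr fun y => lintegral_congr fun z => ?_
  simp only
  rw [← hk' (phase x z y), show x - z + y = x + y - z by abel, phase,
    show x - z + y = x + y - z by abel]
  ring_nf

/-- Pairing of the two unconjugated input frequencies. -/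
lemma lintegral_pair_inner_le (hG : Measurable fun p : ℝ × ℝ => G p.1 p.2)
    (hk : Measurable k) (hg : Measurable g)
    (hB : ∀ (c : Rn 2) (ν : ℝ), ∫⁻ b, ENNReal.ofReal (G (jap b) (jap (c - b))) *
      k (1 * ‖b‖ ^ 2 + ‖c - b‖ ^ 2 + ν) ≤ B) :
    ∫⁻ ξ, ∫⁻ a, ∫⁻ b, ENNReal.ofReal (G (jap b) (jap ξ)) * k (phase ξ a b) *
      (g a ^ 2 * g (ξ - a + b) ^ 2) ≤ B * (∫⁻ x, g x ^ 2) ^ 2 := by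
  have hm := measurable_piece hG hk hg (u := fun q => q.2.2) (v := fun q => q.1)
    (x := fun q => q.2.1) (y := fun q => q.1 - q.2.1 + q.2.2) (by fun_prop) (by fun_prop)
    (by fun_prop) (by fun_prop) continuous_phase
  have hm' := measurable_piece hG hk hg (u := fun q => q.2.1) (v := fun q => q.1 + q.2.2 - q.2.1)
    (x := fun q => q.1) (y := fun q => q.2.2)
    (φ := fun q => 1 * ‖q.2.1‖ ^ 2 + ‖q.1 + q.2.2 - q.2.1‖ ^ 2 + (-‖q.1‖ ^ 2 - ‖q.2.2‖ ^ 2))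
    (by fun_prop) (by fun_prop) (by fun_prop) (by fun_prop) (by fun_prop)
  rw [lintegral_cyc hm]
  refine le_trans (le_of_eq ?_) (lintegral_slice_sq_sq_le hG hk hg hB (fun x y => x + y)
    fun x y => -‖x‖ ^ 2 - ‖y‖ ^ 2)
  rw [← lintegral_swap_inner hm']
  refine lintegral_congr fun a => lintegral_congr fun b => ?_
  rw [← lintegral_add_right_eq_self _ (a - b)]
  refine lintegral_congr fun x => ?_
  simp only
  rw [phase, show x + (a - b) - a + b = x by abel, show x + (a - b) = a + x - b by abel]
  ring_nf

/-- Pairing of the output with the first input frequency. -/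
lemma lintegral_pair_left_le (hG : Measurable fun p : ℝ × ℝ => G p.1 p.2)
    (hk : Measurable k) (hg : Measurable g)
    (hB : ∀ (c : Rn 2) (ν : ℝ), ∫⁻ b, ENNReal.ofReal (G (jap b) (jap (c - b))) *
      k (-1 * ‖b‖ ^ 2 + ‖c - b‖ ^ 2 + ν) ≤ B) :
    ∫⁻ ξ, ∫⁻ a, ∫⁻ b, ENNReal.ofReal (G (jap (ξ - a + b)) (jap b)) * k (phase ξ a b) *
      (g ξ ^ 2 * g a ^ 2) ≤ B * (∫⁻ x, g x ^ 2) ^ 2 := by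
  refine le_trans (le_of_eq ?_) (lintegral_slice_sq_sq_le hG hk hg hB (fun x y => x - y)
    fun x y => ‖x‖ ^ 2 - ‖y‖ ^ 2)
  refine lintegral_congr fun x => lintegral_congr fun a => ?_
  rw [← lintegral_add_right_eq_self _ (a - x)]
  refine lintegral_congr fun b => ?_
  have e : x - a + (b + (a - x)) = b := by abel
  simp only [phase]
  rw [e, show b + (a - x) = -(x - a - b) by abel, jap_neg, norm_neg]
  ring_nf

/-- Pairing of the conjugated frequency with the last input frequency. -/
lemma lintegral_pair_right_le (hG : Measurable fun p : ℝ × ℝ => G p.1 p.2)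
    (hk : Measurable k) (hg : Measurable g)
    (hB : ∀ (c : Rn 2) (ν : ℝ), ∫⁻ b, ENNReal.ofReal (G (jap b) (jap (c - b))) *
      k (-1 * ‖b‖ ^ 2 + ‖c - b‖ ^ 2 + ν) ≤ B) :
    ∫⁻ ξ, ∫⁻ a, ∫⁻ b, ENNReal.ofReal (G (jap a) (jap ξ)) * k (phase ξ a b) *
      (g b ^ 2 * g (ξ - a + b) ^ 2) ≤ B * (∫⁻ x, g x ^ 2) ^ 2 := by
  have hm := measurable_piece hG hk hg (u := fun q => q.2.1) (v := fun q => q.1)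
    (x := fun q => q.2.2) (y := fun q => q.1 - q.2.1 + q.2.2) (by fun_prop) (by fun_prop)
    (by fun_prop) (by fun_prop) continuous_phase
  have hm' := measurable_piece hG hk hg (u := fun q => q.1) (v := fun q => q.2.1 - q.2.2 - q.1)
    (x := fun q => q.2.1) (y := fun q => q.2.2)
    (φ := fun q => -1 * ‖q.1‖ ^ 2 + ‖q.2.1 - q.2.2 - q.1‖ ^ 2 + (‖q.2.1‖ ^ 2 - ‖q.2.2‖ ^ 2))
    (by fun_prop) (by fun_prop) (by fun_prop) (by fun_prop) (by fun_prop)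
  rw [lintegral_cyc hm]
  refine le_trans (le_of_eq ?_) (lintegral_slice_sq_sq_le hG hk hg hB (fun x y => x - y)
    fun x y => ‖x‖ ^ 2 - ‖y‖ ^ 2)
  rw [← lintegral_cyc hm']
  refine lintegral_congr fun a => lintegral_congr fun b => ?_
  rw [← lintegral_add_right_eq_self _ (a - b)]
  refine lintegral_congr fun x => ?_
  simp only
  rw [phase, show x + (a - b) - a + b = x by abel, show x + (a - b) = -(b - x - a) by abel,
    jap_neg, norm_neg]
  ring_nf

end pairings

lemma measurable_lineKer (N s ε : ℝ) : Measurable fun p : ℝ × ℝ => lineKer N s ε p.1 p.2 :=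
  (measurable_lowKer N s ε).const_mul _

lemma lintegral_triple {H : Rn 2 × Rn 2 × Rn 2 → ℝ≥0∞} (hH : Measurable H) :
    ∫⁻ q, H q = ∫⁻ x, ∫⁻ a, ∫⁻ b, H (x, a, b) := by
  rw [Measure.volume_eq_prod, lintegral_prod _ hH.aemeasurable]
  exact lintegral_congr fun x =>
    lintegral_prod (fun p => H (x, p)) (hH.comp measurable_prodMk_left).aemeasurable

lemma quad_jap (ξ : Rn 2) (p : Rn 2 × Rn 2) :
    Quad (jap ξ) (jap p.1) (jap p.2) (jap (ξ - p.1 + p.2)) := by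
  obtain ⟨h0, h1, h2, h3⟩ := jap_quad ξ p.1 p.2
  exact ⟨one_le_jap _, one_le_jap _, one_le_jap _, one_le_jap _, h0, h1, h2, h3⟩

lemma lintegral_add_four {X : Type*} [MeasurableSpace X] {μ : Measure X} {F₁ F₂ F₃ F₄ : X → ℝ≥0∞}
    (h₂ : Measurable F₂) (h₃ : Measurable F₃) (h₄ : Measurable F₄) :
    ∫⁻ x, (F₁ x + F₂ x + (F₃ x + F₄ x)) ∂μ =
      ∫⁻ x, F₁ x ∂μ + ∫⁻ x, F₂ x ∂μ + (∫⁻ x, F₃ x ∂μ + ∫⁻ x, F₄ x ∂μ) := by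
  have h : Measurable fun x => F₃ x + F₄ x := h₃.add h₄
  rw [lintegral_add_right _ h, lintegral_add_right _ h₂, lintegral_add_right _ h₄]

/-- The quadrilinear estimate for the resonant energy increment. -/
lemma exists_quadrilinear_le (hε0 : 0 < ε) :
    ∃ C : ℝ≥0∞, C ≠ ⊤ ∧ ∀ N s : ℝ, 1 ≤ N → 0 < s → s < 1 → 3 * ε ≤ s →
      ∀ k : ℝ → ℝ≥0∞, Measurable k → (∀ z, k (-z) = k z) → ∀ g : Rn 2 → ℝ≥0∞, Measurable g →
      ∫⁻ ξ, ∫⁻ p : Rn 2 × Rn 2,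
        ENNReal.ofReal (quadSym N s (jap ξ) (jap p.1) (jap p.2) (jap (ξ - p.1 + p.2)) *
          (jap p.1 + jap p.2 + jap (ξ - p.1 + p.2)) ^ (2 * ε)) * k (phase ξ p.1 p.2) *
        (g ξ * g p.1 * g p.2 * g (ξ - p.1 + p.2)) ≤
        C * (∫⁻ z, k z) * ENNReal.ofReal (N ^ (5 * ε - 3 / 2)) * (∫⁻ x, g x ^ 2) ^ 2 := by
  obtain ⟨C, hC, h⟩ := exists_lintegral_lowKer_le hε0
  obtain ⟨D, hD, h'⟩ := exists_lintegral_pairKer_le hε0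
  refine ⟨ENNReal.ofReal (10 ^ 6) * (D + D + (C + C)), by finiteness,
    fun N s hN hs0 hs1 hεs k hk hk' g hg => ?_⟩
  have hN0 : 0 < N := by linarith
  set η := ENNReal.ofReal (N ^ (5 * ε - 3 / 2))
  have hpair := h' N s hN hs0 hs1 hεs k hk
  have hline : ∀ (c : Rn 2) (ν : ℝ), ∫⁻ b, ENNReal.ofReal (lineKer N s ε (jap b) (jap (c - b))) *
      k (-1 * ‖b‖ ^ 2 + ‖c - b‖ ^ 2 + ν) ≤ C * (∫⁻ z, k z) * η := by
    intro c ν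
    have hm : Measurable fun b : Rn 2 => ENNReal.ofReal (lowKer N s ε (jap b) (jap (c - b))) *
        k (-1 * ‖b‖ ^ 2 + ‖c - b‖ ^ 2 + ν) :=
      (measurable_ker_slice (measurable_lowKer N s ε) c).mul (measurable_quad_slice hk _ c ν)
    calc _ = ENNReal.ofReal (N ^ (-(1 / 2) : ℝ)) *
          ∫⁻ b, ENNReal.ofReal (lowKer N s ε (jap b) (jap (c - b))) *
            k (-1 * ‖b‖ ^ 2 + ‖c - b‖ ^ 2 + ν) := by
          rw [← lintegral_const_mul _ hm]
          refine lintegral_congr fun b => ?_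
          rw [lineKer, ENNReal.ofReal_mul (by positivity), mul_assoc]
      _ ≤ ENNReal.ofReal (N ^ (-(1 / 2) : ℝ)) *
          (C * (∫⁻ z, k z) * ENNReal.ofReal (N ^ (3 * ε - 1))) := by
          gcongr
          exact h N s hN hs0 hs1 hεs k hk (-1) (Or.inr rfl) c ν
      _ = C * (∫⁻ z, k z) * ENNReal.ofReal (N ^ (-(1 / 2) + (3 * ε - 1))) := by
          rw [Real.rpow_add hN0, ENNReal.ofReal_mul (by positivity)]; ring
      _ ≤ _ := by
          refine mul_le_mul_right (ENNReal.ofReal_le_ofReal ?_) _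
          exact Real.rpow_le_rpow_of_exponent_le hN (by linarith)
  have mA := measurable_piece (measurable_pairKer N s ε) hk hg (u := fun q => q.2.1)
    (v := fun q => q.1 - q.2.1 + q.2.2) (x := fun q => q.1) (y := fun q => q.2.2)
    (by fun_prop) (by fun_prop) (by fun_prop) (by fun_prop) continuous_phase
  have mB := measurable_piece (measurable_pairKer N s ε) hk hg (u := fun q => q.2.2)
    (v := fun q => q.1) (x := fun q => q.2.1) (y := fun q => q.1 - q.2.1 + q.2.2)
    (by fun_prop) (by fun_prop) (by fun_prop) (by fun_prop) continuous_phase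
  have mC := measurable_piece (measurable_lineKer N s ε) hk hg
    (u := fun q => q.1 - q.2.1 + q.2.2) (v := fun q => q.2.2) (x := fun q => q.1)
    (y := fun q => q.2.1)
    (by fun_prop) (by fun_prop) (by fun_prop) (by fun_prop) continuous_phase
  have mD := measurable_piece (measurable_lineKer N s ε) hk hg (u := fun q => q.2.1)
    (v := fun q => q.1) (x := fun q => q.2.2) (y := fun q => q.1 - q.2.1 + q.2.2)
    (by fun_prop) (by fun_prop) (by fun_prop) (by fun_prop) continuous_phase
  have tA := lintegral_pair_outer_le (measurable_pairKer N s ε) hk hk' hg hpair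
  have tB := lintegral_pair_inner_le (measurable_pairKer N s ε) hk hg hpair
  have tC := lintegral_pair_left_le (measurable_lineKer N s ε) hk hg hline
  have tD := lintegral_pair_right_le (measurable_lineKer N s ε) hk hg hline
  rw [← lintegral_triple mA] at tA
  rw [← lintegral_triple mB] at tB
  rw [← lintegral_triple mC] at tC
  rw [← lintegral_triple mD] at tD
  calc _ ≤ ∫⁻ ξ, ∫⁻ p : Rn 2 × Rn 2, ENNReal.ofReal (10 ^ 6) * (_ + _ + (_ + _)) :=
        lintegral_mono fun ξ => lintegral_mono fun p => ?_
    _ = ∫⁻ q : Rn 2 × Rn 2 × Rn 2, _ :=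
        (lintegral_prod _ (((mA.add mB).add (mC.add mD)).const_mul _).aemeasurable).symm
    _ ≤ ENNReal.ofReal (10 ^ 6) * (D * (∫⁻ z, k z) * η * (∫⁻ x, g x ^ 2) ^ 2 +
          D * (∫⁻ z, k z) * η * (∫⁻ x, g x ^ 2) ^ 2 +
          (C * (∫⁻ z, k z) * η * (∫⁻ x, g x ^ 2) ^ 2 +
          C * (∫⁻ z, k z) * η * (∫⁻ x, g x ^ 2) ^ 2)) := by
        rw [lintegral_const_mul _ ((mA.add mB).add (mC.add mD))]
        refine mul_le_mul_right ?_ _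
        refine (lintegral_add_four mB mC mD).le.trans ?_
        exact add_le_add (add_le_add tA tB) (add_le_add tC tD)
    _ = _ := by ring
  have := (quadBound hN hs0 hs1 hε0.le (by linarith) (quad_jap ξ p)).mul_le hN (one_le_jap _)
    (one_le_jap _) (one_le_jap _) (one_le_jap _) (g ξ) (g p.1) (g p.2) (g (ξ - p.1 + p.2))
  calc _ = ENNReal.ofReal (quadSym N s (jap ξ) (jap p.1) (jap p.2) (jap (ξ - p.1 + p.2)) *
          (jap p.1 + jap p.2 + jap (ξ - p.1 + p.2)) ^ (2 * ε)) *
          (g ξ * g p.1 * g p.2 * g (ξ - p.1 + p.2)) * k (phase ξ p.1 p.2) := by ring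
    _ ≤ _ := mul_le_mul_left this _
    _ = _ := by simp only; ring

end quadrilinear

/-! ### The resonant part of the energy increment -/

lemma enorm_osc_le {δ : ℝ} (hδ : 0 ≤ δ) (hδ1 : δ ≤ 1) {g g' : ℝ → ℂ} (hg : Continuous g)
    (hg' : Continuous g') (hd : ∀ t ∈ Ioo 0 δ, HasDerivAt g (g' t) t) (ω : ℝ) {P : ℝ≥0∞}
    (hP : ∀ t ∈ Icc 0 δ, ‖g t‖ₑ ≤ P) (hP' : ∫⁻ t in Icc 0 δ, ‖g' t‖ₑ ≤ 4 * P) :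
    ‖∫ t in Icc 0 δ, cexp (I * ω * t) * g t‖ₑ ≤ ENNReal.ofReal (7 * (japR ω)⁻¹) * P := by
  set A := ∫ t in Icc 0 δ, cexp (I * ω * t) * g t with hA
  have he : ∀ t : ℝ, ‖cexp (I * ω * t)‖ₑ = 1 := by
    intro t
    rw [← ofReal_norm, show I * (ω : ℂ) * t = I * ((ω * t : ℝ) : ℂ) by push_cast; ring,
      norm_cexp_I_real, ENNReal.ofReal_one]
  have hec : Continuous fun t : ℝ => cexp (I * ω * t) := by fun_prop
  have h1 : ‖A‖ₑ ≤ P := by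
    refine (enorm_integral_le_lintegral_enorm _).trans ?_
    calc _ ≤ ∫⁻ _ in Icc 0 δ, P := by
          refine setLIntegral_mono measurable_const fun t ht => ?_
          rw [enorm_mul, he, one_mul]
          exact hP t ht
      _ = P * ENNReal.ofReal δ := by simp
      _ ≤ P * 1 := by
          gcongr
          exact ENNReal.ofReal_le_one.mpr hδ1
      _ = P := mul_one P
  have h2 : ENNReal.ofReal |ω| * ‖A‖ₑ ≤ 6 * P := by
    have hderiv : ∀ t ∈ Ioo 0 δ, HasDerivAt (fun t : ℝ => cexp (I * ω * t) * g t)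
        (I * ω * (cexp (I * ω * t) * g t) + cexp (I * ω * t) * g' t) t := by
      intro t ht
      have h3 : HasDerivAt (fun t : ℝ => cexp (I * ω * t)) (cexp (I * ω * t) * (I * ω)) t := by
        have := ((hasDerivAt_id (t : ℂ)).const_mul (I * ω)).cexp.comp_ofReal
        simpa using this
      refine (h3.mul (hd t ht)).congr_deriv (f := fun t : ℝ => cexp (I * ω * t) * g t) ?_
      ring
    have hi : ∀ {F : ℝ → ℂ}, Continuous F → Integrable F (volume.restrict (Icc 0 δ)) := fun hF =>
      hF.continuousOn.integrableOn_compact isCompact_Icc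
    have hcg : Continuous fun t : ℝ => cexp (I * ω * t) * g t := hec.mul hg
    have hcg' : Continuous fun t : ℝ => cexp (I * ω * t) * g' t := hec.mul hg'
    have hft := integral_Icc_eq_sub (t := δ) (g' := fun t : ℝ => I * ω * (cexp (I * ω * t) * g t) +
      cexp (I * ω * t) * g' t) ⟨hδ, le_rfl⟩ hcg
      ((continuous_const.mul hcg).add hcg') hderiv
    rw [integral_add (f := fun t : ℝ => I * ω * (cexp (I * ω * t) * g t))
      (hi (continuous_const.mul hcg)) (hi hcg'), integral_const_mul, ← hA] at hft
    have h4 : I * ω * A = cexp (I * ω * δ) * g δ - cexp (I * ω * (0 : ℝ)) * g 0 -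
        ∫ t in Icc 0 δ, cexp (I * ω * t) * g' t := by rw [← hft]; ring
    have h5 : ENNReal.ofReal |ω| * ‖A‖ₑ = ‖I * ω * A‖ₑ := by
      rw [← ofReal_norm (I * ω * A), ← ofReal_norm A, ← ENNReal.ofReal_mul (abs_nonneg _)]
      simp
    rw [h5, h4]
    refine (enorm_sub_le).trans ?_
    have h6 : ‖∫ t in Icc 0 δ, cexp (I * ω * t) * g' t‖ₑ ≤ 4 * P := by
      refine (enorm_integral_le_lintegral_enorm _).trans (le_trans (le_of_eq ?_) hP')
      refine lintegral_congr fun t => ?_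
      rw [enorm_mul, he, one_mul]
    calc _ ≤ (P + P) + 4 * P := by
          refine add_le_add ((enorm_sub_le).trans (add_le_add ?_ ?_)) h6
          · rw [enorm_mul, he, one_mul]; exact hP _ ⟨hδ, le_rfl⟩
          · rw [enorm_mul, he, one_mul]; exact hP _ ⟨le_rfl, hδ⟩
      _ = 6 * P := by ring
  have hj := japR_pos ω
  have hj1 : japR ω ≤ 1 + |ω| := by
    have := japR_sq ω
    rw [← sq_abs ω] at this
    nlinarith [abs_nonneg ω]
  have h3 : ENNReal.ofReal (japR ω) * ‖A‖ₑ ≤ 7 * P := by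
    calc _ ≤ ENNReal.ofReal (1 + |ω|) * ‖A‖ₑ := by gcongr
      _ = ‖A‖ₑ + ENNReal.ofReal |ω| * ‖A‖ₑ := by
          rw [ENNReal.ofReal_add zero_le_one (abs_nonneg _), ENNReal.ofReal_one]; ring
      _ ≤ P + 6 * P := add_le_add h1 h2
      _ = 7 * P := by ring
  calc ‖A‖ₑ = ENNReal.ofReal (japR ω)⁻¹ * (ENNReal.ofReal (japR ω) * ‖A‖ₑ) := by
        rw [← mul_assoc, ← ENNReal.ofReal_mul (by positivity), inv_mul_cancel₀ hj.ne',
          ENNReal.ofReal_one, one_mul]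
    _ ≤ ENNReal.ofReal (japR ω)⁻¹ * (7 * P) := by gcongr
    _ = _ := by
        rw [ENNReal.ofReal_mul (by norm_num), ENNReal.ofReal_ofNat]; ring

lemma IsFlow.enorm_osc_quad_le {δ C : ℝ} {v f : ℝ → Rn 2 → ℂ} (h : IsFlow δ C v f) (hδ : 0 ≤ δ)
    (hδ1 : δ ≤ 1) (ξ : Rn 2) (p : Rn 2 × Rn 2) :
    ‖∫ t in Icc 0 δ, cexp (I * phase ξ p.1 p.2 * t) *
      (conj (v t ξ) * cub (v t) (v t) (v t) ξ p)‖ₑ ≤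
      ENNReal.ofReal (7 * (japR (phase ξ p.1 p.2))⁻¹) *
        (flowMaj δ v f ξ * flowMaj δ v f p.1 * flowMaj δ v f p.2 *
          flowMaj δ v f (ξ - p.1 + p.2)) := by
  set V := flowMaj δ v f
  have hv : ∀ x, ∀ t ∈ Icc 0 δ, ‖v t x‖ₑ ≤ V x := fun x t ht => h.enorm_le_flowMaj ht ht.2 x
  have hc : ∀ x, Continuous fun t => v t x := continuous_apply_of_uncurry h.cont
  have hc' : ∀ x, Continuous fun t => f t x := continuous_apply_of_uncurry h.cont_deriv
  have hconj : ∀ z : ℂ, ‖conj z‖ₑ = ‖z‖ₑ := fun z => by simp [← ofReal_norm]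
  have hcc : Continuous fun t => conj (v t ξ) := Complex.continuous_conj.comp (hc ξ)
  have hcc' : Continuous fun t => conj (f t ξ) := Complex.continuous_conj.comp (hc' ξ)
  have hb : Continuous fun t => cub (v t) (v t) (v t) ξ p :=
    (continuous_cub_uncurry h.cont h.cont h.cont ξ).comp (f := fun s : ℝ => (s, p)) (by fun_prop)
  have hb' : Continuous fun t => cubDeriv v f ξ t p :=
    (h.continuous_cubDeriv ξ).comp (f := fun s : ℝ => (s, p)) (by fun_prop)
  refine enorm_osc_le hδ hδ1 (g := fun t => conj (v t ξ) * cub (v t) (v t) (v t) ξ p)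
    (g' := fun t : ℝ => conj (f t ξ) * cub (v t) (v t) (v t) ξ p +
    conj (v t ξ) * cubDeriv v f ξ t p) (hcc.mul hb) ((hcc'.mul hb).add (hcc.mul hb'))
    (fun t ht => ?_) _ (fun t ht => ?_) ?_
  · have h3 := ((h.hasDerivAt t ht p.1).mul (h.hasDerivAt t ht p.2).star).mul
      (h.hasDerivAt t ht (ξ - p.1 + p.2))
    refine HasDerivAt.congr_deriv (f := fun t => conj (v t ξ) * cub (v t) (v t) (v t) ξ p)
      ((h.hasDerivAt t ht ξ).star.mul h3) ?_
    simp only [cubDeriv, cub, Pi.mul_apply, Complex.star_def]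
    ring
  · simp only [cub, enorm_mul, hconj, ← mul_assoc]
    have := hv ξ t ht
    have := hv p.1 t ht
    have := hv p.2 t ht
    have := hv (ξ - p.1 + p.2) t ht
    gcongr
  · have hF : ∀ x, ∫⁻ t in Icc 0 δ, ‖f t x‖ₑ ≤ V x := fun x => le_add_self
    have hm : ∀ x, Measurable fun t => ‖f t x‖ₑ := fun x => (hc' x).measurable.enorm
    have hk : ∀ (x : Rn 2) (R : ℝ≥0∞), ∫⁻ t in Icc 0 δ, ‖f t x‖ₑ * R ≤ V x * R := fun x R => by
      rw [lintegral_mul_const _ (hm x)]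
      exact mul_le_mul_left (hF x) _
    have hs : ∀ x R, Measurable fun t => ‖f t x‖ₑ * R := fun x R => (hm x).mul_const R
    have hsum := lintegral_add_four (μ := volume.restrict (Icc 0 δ))
      (F₁ := fun t => ‖f t ξ‖ₑ * (V p.1 * V p.2 * V (ξ - p.1 + p.2)))
      (hs p.1 (V ξ * V p.2 * V (ξ - p.1 + p.2))) (hs p.2 (V ξ * V p.1 * V (ξ - p.1 + p.2)))
      (hs (ξ - p.1 + p.2) (V ξ * V p.1 * V p.2))
    have hle := add_le_add
      (add_le_add (hk ξ (V p.1 * V p.2 * V (ξ - p.1 + p.2)))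
        (hk p.1 (V ξ * V p.2 * V (ξ - p.1 + p.2))))
      (add_le_add (hk p.2 (V ξ * V p.1 * V (ξ - p.1 + p.2)))
        (hk (ξ - p.1 + p.2) (V ξ * V p.1 * V p.2)))
    rw [← hsum] at hle
    refine le_trans (setLIntegral_mono' measurableSet_Icc fun t ht => ?_)
      (hle.trans (le_of_eq (by ring)))
    have e0 := hv ξ t ht
    have e1 := hv p.1 t ht
    have e2 := hv p.2 t ht
    have e3 := hv (ξ - p.1 + p.2) t ht
    calc _ ≤ ‖f t ξ‖ₑ * (‖v t p.1‖ₑ * ‖v t p.2‖ₑ * ‖v t (ξ - p.1 + p.2)‖ₑ) +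
          ‖v t ξ‖ₑ * (‖f t p.1‖ₑ * ‖v t p.2‖ₑ * ‖v t (ξ - p.1 + p.2)‖ₑ +
            ‖v t p.1‖ₑ * ‖f t p.2‖ₑ * ‖v t (ξ - p.1 + p.2)‖ₑ +
            ‖v t p.1‖ₑ * ‖v t p.2‖ₑ * ‖f t (ξ - p.1 + p.2)‖ₑ) := by
          refine (enorm_add_le _ _).trans (add_le_add ?_ ?_)
          · simp [cub, enorm_mul]
          · rw [enorm_mul, hconj]
            refine mul_le_mul_right ?_ _
            refine (enorm_add_le _ _).trans (add_le_add ((enorm_add_le _ _).trans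
              (add_le_add ?_ ?_)) ?_) <;> simp [cub, enorm_mul]
      _ = ‖f t ξ‖ₑ * (‖v t p.1‖ₑ * ‖v t p.2‖ₑ * ‖v t (ξ - p.1 + p.2)‖ₑ) +
          ‖f t p.1‖ₑ * (‖v t ξ‖ₑ * ‖v t p.2‖ₑ * ‖v t (ξ - p.1 + p.2)‖ₑ) +
          (‖f t p.2‖ₑ * (‖v t ξ‖ₑ * ‖v t p.1‖ₑ * ‖v t (ξ - p.1 + p.2)‖ₑ) +
          ‖f t (ξ - p.1 + p.2)‖ₑ * (‖v t ξ‖ₑ * ‖v t p.1‖ₑ * ‖v t p.2‖ₑ)) := by ring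
      _ ≤ _ := by gcongr

lemma abs_phase_le (ξ : Rn 2) (p : Rn 2 × Rn 2) :
    |phase ξ p.1 p.2| ≤ 2 * (jap p.1 + jap p.2 + jap (ξ - p.1 + p.2)) ^ 2 := by
  rw [phase_eq, abs_mul, abs_two]
  have h := abs_real_inner_le_norm (ξ - p.1) (p.1 - p.2)
  have h1 : ‖ξ - p.1‖ ≤ jap (ξ - p.1 + p.2) + jap p.2 := by
    have := norm_sub_le (ξ - p.1 + p.2) p.2
    rw [add_sub_cancel_right] at this
    linarith [norm_le_jap (ξ - p.1 + p.2), norm_le_jap p.2]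
  have h2 : ‖p.1 - p.2‖ ≤ jap p.1 + jap p.2 := by
    linarith [norm_sub_le p.1 p.2, norm_le_jap p.1, norm_le_jap p.2]
  have := jap_pos p.1
  have := jap_pos p.2
  have := jap_pos (ξ - p.1 + p.2)
  have h3 := mul_le_mul h1 h2 (norm_nonneg _) (by positivity)
  nlinarith

lemma osc_weight_le {ε A z : ℝ} (hε : 0 < ε) (hε1 : ε ≤ 1) (hA : 1 ≤ A) (hz : |z| ≤ 2 * A ^ 2) :
    7 * (japR z)⁻¹ ≤ 21 * (A ^ (2 * ε) * japR z ^ (-(1 + ε))) := by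
  have hj := japR_pos z
  have hj1 : japR z ≤ 3 * A ^ 2 := by
    have h0 : japR z ≤ 1 + |z| := by
      have := japR_sq z
      rw [← sq_abs z] at this
      nlinarith [abs_nonneg z]
    nlinarith
  have h1 : japR z ^ ε ≤ 3 * A ^ (2 * ε) := by
    calc japR z ^ ε ≤ (3 * A ^ 2) ^ ε := Real.rpow_le_rpow hj.le hj1 hε.le
      _ = 3 ^ ε * A ^ (2 * ε) := by
          rw [Real.mul_rpow (by norm_num) (by positivity), ← Real.rpow_natCast A 2,
            ← Real.rpow_mul (by positivity)]
          norm_num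
      _ ≤ 3 * A ^ (2 * ε) := by
          gcongr
          simpa using Real.rpow_le_rpow_of_exponent_le (x := 3) (by norm_num) hε1
  have h2 : (japR z)⁻¹ = japR z ^ ε * japR z ^ (-(1 + ε)) := by
    rw [← Real.rpow_add hj, ← Real.rpow_neg_one]
    congr 1
    ring
  have h3 : 0 < japR z ^ (-(1 + ε)) := Real.rpow_pos_of_pos hj _
  rw [h2]
  nlinarith [mul_le_mul_of_nonneg_right h1 h3.le]

lemma continuous_imul_jap_sq {N s : ℝ} (hs1 : s < 1) :
    Continuous fun x : Rn 2 => jap x ^ 2 * imul N s x :=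
  (continuous_jap.pow 2).mul (continuous_imul hs1)

lemma abs_commSymbol_le {N s : ℝ} (hN : 1 ≤ N) (q : Rn 2 × Rn 2 × Rn 2) : |commSymbol N s q| ≤ 1 :=
  abs_imul_sub_imul₃_le hN q

lemma jap_sq_mul_rapid {C : ℝ} {f : Rn 2 → ℂ} (h : Rapid C f) (x : Rn 2) :
    jap x ^ 2 * ‖f x‖ ≤ C * decay 6 x := by
  calc _ ≤ jap x ^ 2 * (C * decay 8 x) := by
        gcongr
        exact h.2 x
    _ = C * (jap x ^ 2 * decay (2 + 6) x) := by ring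
    _ = C * decay 6 x := by rw [jap_pow_mul_decay]

lemma conj_mul_cub_eq_spin (t : ℝ) (f : Rn 2 → ℂ) (ξ : Rn 2) (p : Rn 2 × Rn 2) :
    cexp (I * phase ξ p.1 p.2 * t) *
      (conj (spin t f ξ) * cub (spin t f) (spin t f) (spin t f) ξ p) =
      conj (f ξ) * cub f f f ξ p := by
  have h := cexp_phase_mul_cub_spin t f ξ p
  have h2 : conj (cexp (I * (t * ‖ξ‖ ^ 2 : ℝ))) * cexp (I * (t * ‖ξ‖ ^ 2 : ℝ)) = 1 := by
    rw [mul_comm, Complex.mul_conj, Complex.normSq_eq_norm_sq, norm_cexp_I_real]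
    simp
  calc _ = conj (spin t f ξ) * (cexp (I * phase ξ p.1 p.2 * t) *
        cub (spin t f) (spin t f) (spin t f) ξ p) := by ring
    _ = conj (f ξ) * cub f f f ξ p *
        (conj (cexp (I * (t * ‖ξ‖ ^ 2 : ℝ))) * cexp (I * (t * ‖ξ‖ ^ 2 : ℝ))) := by
        rw [h, spin, map_mul]
        ring
    _ = _ := by rw [h2, mul_one]

theorem exists_enorm_resonant_le {ε : ℝ} (hε : 0 < ε) (hε1 : ε ≤ 1) :
    ∃ K : ℝ≥0∞, K ≠ ⊤ ∧ ∀ N s : ℝ, 1 ≤ N → 0 < s → s < 1 → 3 * ε ≤ s →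
      ∀ (δ C : ℝ) (W : ℝ → Rn 2 → ℂ), FourierSol δ C W → 0 ≤ δ → δ ≤ 1 →
      ‖∫ t in Icc 0 δ, ∫ ξ, ((jap ξ ^ 2 * imul N s ξ : ℝ) : ℂ) *
        (conj (W t ξ) * mult (commSymbol N s) (W t) ξ)‖ₑ ≤
      K * ENNReal.ofReal (N ^ (5 * ε - 3 / 2)) *
        (wnorm (iwt N s) (W 0) + ∫⁻ t in Icc 0 δ, wnorm (iwt N s)
          (mult (fun _ => 1) (W t))) ^ 2 := by
  obtain ⟨L, hL, hquad⟩ := exists_quadrilinear_le hε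
  set k : ℝ → ℝ≥0∞ := fun z => ENNReal.ofReal (japR z ^ (-(1 + ε))) with hk
  have hkm : Measurable k := (continuous_japR.measurable.pow_const _).ennreal_ofReal
  have hke : ∀ z, k (-z) = k z := fun z => by simp [hk, japR]
  have hkt : ∫⁻ z, k z ≠ ⊤ := (lintegral_japR_rpow_lt_top (by linarith)).ne
  refine ⟨21 * (L * (∫⁻ z, k z)) * 4, by finiteness, fun N s hN hs0 hs1 hεs δ C W hW hδ hδ1 => ?_⟩
  obtain ⟨C', h⟩ := hW.exists_isFlow
  have hC' := (h.rapid 0).nonneg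
  set v : ℝ → Rn 2 → ℂ := fun t => spin t (W t) with hv
  set f : ℝ → Rn 2 → ℂ := fun t ξ => -I * spin t (mult (fun _ => 1) (W t)) ξ with hf
  set σ : Rn 2 × Rn 2 × Rn 2 → ℝ := fun q => jap q.1 ^ 2 * imul N s q.1 * commSymbol N s q with hσ
  have hσc : Continuous σ := ((continuous_imul_jap_sq hs1).comp continuous_fst).mul
    (continuous_commSymbol hs1)
  set G : ℝ → Rn 2 × Rn 2 × Rn 2 → ℂ := fun t q => (σ q : ℂ) *
    (cexp (I * phase q.1 q.2.1 q.2.2 * t) *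
      (conj (v t q.1) * cub (v t) (v t) (v t) q.1 q.2)) with hG
  have hGc : Continuous (Function.uncurry G) := by
    have k0 : Continuous fun q : ℝ × Rn 2 × Rn 2 × Rn 2 => v q.1 q.2.1 :=
      h.cont.comp (f := fun q : ℝ × Rn 2 × Rn 2 × Rn 2 => (q.1, q.2.1)) (by fun_prop)
    have k1 : Continuous fun q : ℝ × Rn 2 × Rn 2 × Rn 2 => v q.1 q.2.2.1 :=
      h.cont.comp (f := fun q : ℝ × Rn 2 × Rn 2 × Rn 2 => (q.1, q.2.2.1)) (by fun_prop)
    have k2 : Continuous fun q : ℝ × Rn 2 × Rn 2 × Rn 2 => v q.1 q.2.2.2 :=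
      h.cont.comp (f := fun q : ℝ × Rn 2 × Rn 2 × Rn 2 => (q.1, q.2.2.2)) (by fun_prop)
    have k3 : Continuous fun q : ℝ × Rn 2 × Rn 2 × Rn 2 => v q.1 (q.2.1 - q.2.2.1 + q.2.2.2) :=
      h.cont.comp (f := fun q : ℝ × Rn 2 × Rn 2 × Rn 2 => (q.1, q.2.1 - q.2.2.1 + q.2.2.2))
        (by fun_prop)
    have hph : Continuous fun q : ℝ × Rn 2 × Rn 2 × Rn 2 => phase q.2.1 q.2.2.1 q.2.2.2 :=
      continuous_phase.comp continuous_snd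
    exact (Complex.continuous_ofReal.comp (hσc.comp continuous_snd)).mul
      ((Complex.continuous_exp.comp ((continuous_const.mul
        (Complex.continuous_ofReal.comp hph)).mul
        (Complex.continuous_ofReal.comp continuous_fst))).mul
      ((Complex.continuous_conj.comp k0).mul ((k1.mul (Complex.continuous_conj.comp k2)).mul k3)))
  have hσle : ∀ q, |σ q| ≤ jap q.1 ^ 2 := by
    intro q
    have h1 := imul_pos (s := s) hN q.1
    have h2 := imul_le_one (N := N) (s := s) q.1
    have h3 := abs_commSymbol_le (s := s) hN q
    simp only [hσ, abs_mul, abs_of_pos h1, abs_of_pos (pow_pos (jap_pos q.1) 2)]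
    have : imul N s q.1 * |commSymbol N s q| ≤ 1 := mul_le_one₀ h2 (abs_nonneg _) h3
    nlinarith [pow_pos (jap_pos q.1) 2]
  have hGb : ∀ t q, ‖G t q‖ ≤ C' ^ 4 * (decay 6 q.1 * (decay 8 q.2.1 * decay 8 q.2.2)) := by
    intro t q
    have h1 := norm_cub_le (h.rapid t) (h.rapid t) (h.rapid t) q.1 q.2
    have h2 := jap_sq_mul_rapid (h.rapid t) q.1
    have := decay_pos 6 q.1
    simp only [hG]
    rw [norm_mul, norm_mul, norm_mul, norm_cexp_phase, Complex.norm_real, RCLike.norm_conj, one_mul,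
      ← mul_assoc]
    calc _ ≤ (C' * decay 6 q.1) * (C' ^ 3 * (decay 8 q.2.1 * decay 8 q.2.2)) := by
          refine mul_le_mul (le_trans ?_ h2) h1 (norm_nonneg _) (by positivity)
          exact mul_le_mul_of_nonneg_right (hσle q) (norm_nonneg _)
      _ = _ := by ring
  have hdom : Integrable fun q : Rn 2 × Rn 2 × Rn 2 =>
      C' ^ 4 * (decay 6 q.1 * (decay 8 q.2.1 * decay 8 q.2.2)) :=
    ((integrable_decay (n := 6) (by norm_num)).mul_prod integrable_decay_prod).const_mul _
  have hGt : ∀ t, Integrable (G t) := fun t => hdom.mono'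
    (hGc.comp (f := fun q => (t, q)) (by fun_prop)).aestronglyMeasurable
    (Filter.Eventually.of_forall (hGb t))
  have hGi : Integrable (Function.uncurry G) ((volume.restrict (Icc 0 δ)).prod volume) := by
    have h1 := ((integrable_const (1 : ℝ) (μ := volume.restrict (Icc (0 : ℝ) δ))).mul_prod hdom)
    refine h1.mono' hGc.aestronglyMeasurable (Filter.Eventually.of_forall fun q => ?_)
    rw [one_mul]
    exact hGb q.1 q.2
  have hinner : ∀ t ξ, ((jap ξ ^ 2 * imul N s ξ : ℝ) : ℂ) *
      (conj (W t ξ) * mult (commSymbol N s) (W t) ξ) = ∫ p, G t (ξ, p) := by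
    intro t ξ
    rw [mult, ← integral_const_mul, ← integral_const_mul]
    refine integral_congr_ae (Filter.Eventually.of_forall fun p => ?_)
    simp only [hG, hσ, hv]
    rw [conj_mul_cub_eq_spin]
    push_cast
    ring
  have hswap : ∫ t in Icc 0 δ, ∫ ξ, ((jap ξ ^ 2 * imul N s ξ : ℝ) : ℂ) *
        (conj (W t ξ) * mult (commSymbol N s) (W t) ξ) = ∫ q, ∫ t in Icc 0 δ, G t q := by
    rw [← integral_integral_swap hGi]
    refine integral_congr_ae (Filter.Eventually.of_forall fun t => ?_)
    simp only [hinner]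
    exact (integral_prod _ (hGt t)).symm
  set V := flowMaj δ v f
  set g : Rn 2 → ℝ≥0∞ := fun x => ENNReal.ofReal (iwt N s x) * V x with hg
  have hVm : Measurable V := measurable_flowMaj h δ
  have hgm : Measurable g := (continuous_iwt hs1).measurable.ennreal_ofReal.mul hVm
  have hg2 : ∫⁻ x, g x ^ 2 ≤ 2 * (wnorm (iwt N s) (W 0) +
      ∫⁻ t in Icc 0 δ, wnorm (iwt N s) (mult (fun _ => 1) (W t))) := by
    refine (IsFlow.lintegral_flowMaj_sq_le (continuous_iwt hs1) h δ).trans ?_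
    refine mul_le_mul_right (add_le_add ?_ ?_) _
    · rw [hv, wnorm_spin]
    · refine (mul_le_of_le_one_left zero_le (ENNReal.ofReal_le_one.mpr hδ1)).trans (le_of_eq ?_)
      refine lintegral_congr fun t => ?_
      rw [← wnorm_spin _ t (mult (fun _ => 1) (W t))]
      unfold wnorm wabs
      have : ‖I‖ₑ = 1 := by simp [← ofReal_norm]
      simp [hf, this]
  have hpt : ∀ q : Rn 2 × Rn 2 × Rn 2, ‖∫ t in Icc 0 δ, G t q‖ₑ ≤
      21 * (ENNReal.ofReal (quadSym N s (jap q.1) (jap q.2.1) (jap q.2.2)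
        (jap (q.1 - q.2.1 + q.2.2)) * (jap q.2.1 + jap q.2.2 + jap (q.1 - q.2.1 + q.2.2)) ^
            (2 * ε)) *
        k (phase q.1 q.2.1 q.2.2) *
        (g q.1 * g q.2.1 * g q.2.2 * g (q.1 - q.2.1 + q.2.2))) := by
    rintro ⟨ξ, p⟩
    simp only [hG]
    rw [integral_const_mul, enorm_mul]
    refine (mul_le_mul_right (h.enorm_osc_quad_le hδ hδ1 ξ p) _).trans ?_
    have p0 := iwt_pos (s := s) hN ξ
    have p1 := iwt_pos (s := s) hN p.1
    have p2 := iwt_pos (s := s) hN p.2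
    have p3 := iwt_pos (s := s) hN (ξ - p.1 + p.2)
    have hA1 : 1 ≤ jap p.1 + jap p.2 + jap (ξ - p.1 + p.2) := by
      linarith [one_le_jap p.1, jap_pos p.2, jap_pos (ξ - p.1 + p.2)]
    have hw := osc_weight_le hε hε1 hA1 (abs_phase_le ξ p)
    set A := jap p.1 + jap p.2 + jap (ξ - p.1 + p.2)
    set Q := quadSym N s (jap ξ) (jap p.1) (jap p.2) (jap (ξ - p.1 + p.2)) with hQ
    have hm := imul_pos (s := s) hN ξ
    have hQe : |σ (ξ, p)| = Q * (iwt N s ξ * iwt N s p.1 * iwt N s p.2 *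
        iwt N s (ξ - p.1 + p.2)) := by
      have e1 : Q = jap ξ * |commSymbol N s (ξ, p)| /
          (iwt N s p.1 * iwt N s p.2 * iwt N s (ξ - p.1 + p.2)) := rfl
      simp only [hσ, abs_mul, abs_of_pos hm, abs_of_pos (pow_pos (jap_pos ξ) 2)]
      rw [e1, iwt_eq ξ]
      field_simp
    have hQ0 : 0 ≤ Q := by
      by_contra! hneg
      have := abs_nonneg (σ (ξ, p))
      rw [hQe] at this
      have : 0 < iwt N s ξ * iwt N s p.1 * iwt N s p.2 * iwt N s (ξ - p.1 + p.2) := by positivity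
      nlinarith
    have hAp : 0 ≤ A ^ (2 * ε) := Real.rpow_nonneg (by linarith) _
    have e2 : ‖((σ (ξ, p) : ℝ) : ℂ)‖ₑ = ENNReal.ofReal |σ (ξ, p)| := by
      rw [← ofReal_norm, Complex.norm_real, Real.norm_eq_abs]
    rw [e2, hQe]
    calc _ ≤ ENNReal.ofReal (Q * (iwt N s ξ * iwt N s p.1 * iwt N s p.2 *
          iwt N s (ξ - p.1 + p.2))) * (ENNReal.ofReal (21 * (A ^ (2 * ε) *
            japR (phase ξ p.1 p.2) ^ (-(1 + ε)))) * (V ξ * V p.1 * V p.2 * V (ξ - p.1 + p.2))) := by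
          gcongr
      _ = _ := by
          simp only [hg, hk]
          rw [ENNReal.ofReal_mul hQ0, ENNReal.ofReal_mul (by positivity),
            ENNReal.ofReal_mul (by positivity), ENNReal.ofReal_mul p0.le,
            ENNReal.ofReal_mul (by norm_num), ENNReal.ofReal_mul hAp, ENNReal.ofReal_mul hQ0,
            ENNReal.ofReal_ofNat]
          ring
  rw [hswap]
  refine (enorm_integral_le_lintegral_enorm _).trans ((lintegral_mono hpt).trans ?_)
  have hprod : ∀ F : Rn 2 × Rn 2 × Rn 2 → ℝ≥0∞, ∫⁻ q, F q ≤ ∫⁻ ξ, ∫⁻ p, F (ξ, p) := fun F =>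
    lintegral_prod_le F
  rw [lintegral_const_mul' _ _ (by norm_num)]
  refine (mul_le_mul_right ((hprod _).trans (hquad N s hN hs0 hs1 hεs k hkm hke g hgm)) _).trans ?_
  calc _ ≤ 21 * (L * (∫⁻ z, k z) * ENNReal.ofReal (N ^ (5 * ε - 3 / 2)) *
        (2 * (wnorm (iwt N s) (W 0) +
          ∫⁻ t in Icc 0 δ, wnorm (iwt N s) (mult (fun _ => 1) (W t)))) ^ 2) := by gcongr
    _ = _ := by ring

/-! ### The modified energy -/

section dominated

variable {δ : ℝ} {b : Rn 2 → ℝ}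

lemma continuous_integral_of_le {Y : Type*} [TopologicalSpace Y] [FirstCountableTopology Y]
    {F : Y → Rn 2 → ℂ} (hF : Continuous (Function.uncurry F)) (hb : Integrable b)
    (hFb : ∀ y x, ‖F y x‖ ≤ b x) : Continuous fun y => ∫ x, F y x :=
  continuous_of_dominated
    (fun y => (hF.comp (f := fun x => (y, x)) (by fun_prop)).aestronglyMeasurable)
    (fun y => Filter.Eventually.of_forall (hFb y)) hb
    (Filter.Eventually.of_forall fun x => hF.comp (f := fun y => (y, x)) (by fun_prop))

lemma integrable_of_le {F : Rn 2 → ℂ} (hF : Continuous F) (hb : Integrable b)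
    (hFb : ∀ x, ‖F x‖ ≤ b x) : Integrable F :=
  hb.mono' hF.aestronglyMeasurable (Filter.Eventually.of_forall hFb)

variable {F F' : ℝ → Rn 2 → ℂ}

lemma hasDerivAt_integral_of_le (hF : Continuous (Function.uncurry F))
    (hF' : Continuous (Function.uncurry F')) (hb : Integrable b) (hFb : ∀ t x, ‖F t x‖ ≤ b x)
    (hFb' : ∀ t x, ‖F' t x‖ ≤ b x)
    (hd : ∀ t ∈ Ioo 0 δ, ∀ x, HasDerivAt (fun s => F s x) (F' t x) t) {t : ℝ} (ht : t ∈ Ioo 0 δ) :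
    HasDerivAt (fun s => ∫ x, F s x) (∫ x, F' t x) t := by
  have hs : ∀ t, Continuous (F t) := fun t => hF.comp (f := fun x => (t, x)) (by fun_prop)
  have hs' : ∀ t, Continuous (F' t) := fun t => hF'.comp (f := fun x => (t, x)) (by fun_prop)
  exact (hasDerivAt_integral_of_dominated_loc_of_deriv_le (bound := b) (s := Ioo 0 δ)
    (isOpen_Ioo.mem_nhds ht) (Filter.Eventually.of_forall fun t => (hs t).aestronglyMeasurable)
    (integrable_of_le (hs t) hb (hFb t)) (hs' t).aestronglyMeasurable
    (Filter.Eventually.of_forall fun x t _ => hFb' t x) hb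
    (Filter.Eventually.of_forall fun x t ht => hd t ht x)).2

lemma integral_sub_integral_of_le (hδ : 0 ≤ δ) (hF : Continuous (Function.uncurry F))
    (hF' : Continuous (Function.uncurry F')) (hb : Integrable b) (hFb : ∀ t x, ‖F t x‖ ≤ b x)
    (hFb' : ∀ t x, ‖F' t x‖ ≤ b x)
    (hd : ∀ t ∈ Ioo 0 δ, ∀ x, HasDerivAt (fun s => F s x) (F' t x) t) :
    ∫ t in Icc 0 δ, ∫ x, F' t x = (∫ x, F δ x) - ∫ x, F 0 x :=
  integral_Icc_eq_sub ⟨hδ, le_rfl⟩ (continuous_integral_of_le hF hb hFb)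
    (continuous_integral_of_le hF' hb hFb')
    fun _ ht => hasDerivAt_integral_of_le hF hF' hb hFb hFb' hd ht

end dominated

/-- Convolution on the frequency plane. -/
def pconv (f g : Rn 2 → ℂ) (ζ : Rn 2) : ℂ := ∫ a, f a * g (ζ - a)

lemma pconv_comm (f g : Rn 2 → ℂ) (ζ : Rn 2) : pconv f g ζ = pconv g f ζ := by
  unfold pconv
  rw [← integral_sub_left_eq_self _ volume ζ]
  refine integral_congr_ae (Filter.Eventually.of_forall fun a => ?_)
  simp only [sub_sub_cancel, mul_comm]

lemma decay_mul_sub_le (ζ a : Rn 2) :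
    decay 6 a * decay 6 (ζ - a) ≤ 8 * (decay 3 ζ * decay 3 a) := by
  have h : jap ζ ≤ 2 * (jap a * jap (ζ - a)) := by
    have h1 := jap_add_le a (ζ - a)
    rw [add_sub_cancel] at h1
    nlinarith [one_le_jap a, one_le_jap (ζ - a)]
  have pa := jap_pos a
  have pb := jap_pos (ζ - a)
  have pz := jap_pos ζ
  have h3 : jap ζ ^ 3 ≤ 8 * (jap a ^ 3 * jap (ζ - a) ^ 3) := by
    calc _ ≤ (2 * (jap a * jap (ζ - a))) ^ 3 := by gcongr
      _ = _ := by ring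
  have e : decay 6 a * decay 6 (ζ - a) ≤ decay 6 a * decay 3 (ζ - a) := by
    have := decay_pos 6 a
    gcongr
    exact decay_anti (by norm_num) _
  refine e.trans ?_
  unfold decay
  have h6 : jap a ^ 6 = jap a ^ 3 * jap a ^ 3 := by ring
  rw [h6]
  have q1 := pow_pos pa 3
  have q2 := pow_pos pb 3
  have q3 := pow_pos pz 3
  generalize jap a ^ 3 = x at *
  generalize jap (ζ - a) ^ 3 = y at *
  generalize jap ζ ^ 3 = z at *
  have : (x * x)⁻¹ * y⁻¹ = x⁻¹ * (x * y)⁻¹ := by field_simp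
  rw [this, ← mul_assoc, mul_comm (8 * z⁻¹)]
  gcongr
  rw [← div_eq_mul_inv, le_div_iff₀ q3, inv_mul_le_iff₀ (by positivity)]
  linarith

lemma integrable_decay_three : Integrable fun q : Rn 2 × Rn 2 => decay 3 q.1 * decay 3 q.2 :=
  (integrable_decay (n := 3) (by norm_num)).mul_prod (integrable_decay (n := 3) (by norm_num))

/-- Functions decaying at sixth order. -/
def Fast (C : ℝ) (f : Rn 2 → ℂ) : Prop := Continuous f ∧ ∀ x, ‖f x‖ ≤ C * decay 6 x

lemma Fast.nonneg {C : ℝ} {f : Rn 2 → ℂ} (h : Fast C f) : 0 ≤ C := by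
  have := (norm_nonneg _).trans (h.2 0)
  have := decay_pos 6 0
  by_contra! h0
  nlinarith

lemma Rapid.fast {C : ℝ} {f : Rn 2 → ℂ} (h : Rapid C f) : Fast C f :=
  ⟨h.1, fun x => (h.2 x).trans (mul_le_mul_of_nonneg_left (decay_anti (by norm_num) x) h.nonneg)⟩

lemma Fast.norm_mul_le {C C' : ℝ} {f g : Rn 2 → ℂ} (hf : Fast C f) (hg : Fast C' g) (ζ a : Rn 2) :
    ‖f a * g (ζ - a)‖ ≤ 8 * (C * C') * (decay 3 ζ * decay 3 a) := by
  have := hf.nonneg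
  have := hg.nonneg
  have := decay_pos 6 a
  rw [norm_mul]
  calc _ ≤ (C * decay 6 a) * (C' * decay 6 (ζ - a)) :=
        mul_le_mul (hf.2 _) (hg.2 _) (norm_nonneg _) (by positivity)
    _ = C * C' * (decay 6 a * decay 6 (ζ - a)) := by ring
    _ ≤ C * C' * (8 * (decay 3 ζ * decay 3 a)) :=
        mul_le_mul_of_nonneg_left (decay_mul_sub_le ζ a) (by positivity)
    _ = _ := by ring

lemma Fast.norm_pconv_le {C C' : ℝ} {f g : Rn 2 → ℂ} (hf : Fast C f) (hg : Fast C' g) (ζ : Rn 2) :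
    ‖pconv f g ζ‖ ≤ 8 * (C * C') * (∫ a, decay 3 a) * decay 3 ζ := by
  calc _ ≤ ∫ a, 8 * (C * C') * decay 3 ζ * decay 3 a := by
        refine norm_integral_le_of_norm_le
          ((integrable_decay (n := 3) (by norm_num)).const_mul _)
          (Filter.Eventually.of_forall fun a => (hf.norm_mul_le hg ζ a).trans (le_of_eq ?_))
        ring
    _ = _ := by
        rw [integral_const_mul]
        ring

lemma continuous_pconv {C C' : ℝ} {f g : ℝ → Rn 2 → ℂ} (hf : Continuous (Function.uncurry f))
    (hg : Continuous (Function.uncurry g)) (hf' : ∀ t, Fast C (f t)) (hg' : ∀ t, Fast C' (g t)) :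
    Continuous fun q : ℝ × Rn 2 => pconv (f q.1) (g q.1) q.2 := by
  have hC := (hf' 0).nonneg
  have hC' := (hg' 0).nonneg
  refine continuous_integral_of_le (b := fun a => 8 * (C * C') * decay 3 a)
    (F := fun (q : ℝ × Rn 2) a => f q.1 a * g q.1 (q.2 - a)) ?_
    ((integrable_decay (n := 3) (by norm_num)).const_mul _) fun q a => ?_
  · exact (hf.comp (f := fun p : (ℝ × Rn 2) × Rn 2 => (p.1.1, p.2)) (by fun_prop)).mul
      (hg.comp (f := fun p : (ℝ × Rn 2) × Rn 2 => (p.1.1, p.1.2 - p.2)) (by fun_prop))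
  · refine ((hf' q.1).norm_mul_le (hg' q.1) q.2 a).trans ?_
    have := decay_pos 3 a
    have := decay_le_one 3 q.2
    gcongr
    exact mul_le_of_le_one_left (by positivity) this

lemma Fast.continuous_pconv {C C' : ℝ} {f g : Rn 2 → ℂ} (hf : Fast C f) (hg : Fast C' g) :
    Continuous (pconv f g) :=
  (_root_.continuous_pconv (f := fun _ => f) (g := fun _ => g) (hf.1.comp continuous_snd)
    (hg.1.comp continuous_snd) (fun _ => hf) fun _ => hg).comp
    (f := fun x => ((0 : ℝ), x)) (by fun_prop)

lemma mult_one_eq {C : ℝ} {f : Rn 2 → ℂ} (hf : Rapid C f) (a : Rn 2) :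
    mult (fun _ => 1) f a = ∫ ζ, pconv f f ζ * conj (f (ζ - a)) := by
  have hi := integrable_sym_cub (σ := fun _ => 1) isSymbol_one hf hf hf a
  unfold mult
  rw [Measure.volume_eq_prod] at hi ⊢
  rw [integral_prod_symm _ hi, ← integral_sub_right_eq_self _ a]
  refine integral_congr_ae (Filter.Eventually.of_forall fun ζ => ?_)
  simp only [cub, pconv]
  rw [← integral_mul_const]
  refine integral_congr_ae (Filter.Eventually.of_forall fun p => ?_)
  simp only [show a - p + (ζ - a) = ζ - p by abel]
  push_cast
  ring

lemma integral_conj_pconv_mul {C C' : ℝ} {f g : Rn 2 → ℂ} (hf : Rapid C f) (hg : Fast C' g) :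
    ∫ ζ, conj (pconv f f ζ) * pconv g f ζ = ∫ a, g a * conj (mult (fun _ => 1) f a) := by
  have hB := hf.fast.norm_pconv_le hf.fast
  have hC := hf.nonneg
  have hC' := hg.nonneg
  set B := pconv f f with hBdef
  have hBc : Continuous B := hf.fast.continuous_pconv hf.fast
  set M := 8 * (C * C) * (∫ a, decay 3 a) with hM
  have hL0 : 0 ≤ ∫ a, decay 3 a := integral_nonneg fun a => (decay_pos _ _).le
  have hM0 : 0 ≤ M := by positivity
  have hi : Integrable (Function.uncurry fun ζ a => conj (B ζ) * (g a * f (ζ - a)))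
      ((volume : Measure (Rn 2)).prod (volume : Measure (Rn 2))) := by
    refine (integrable_decay_three.const_mul (M * (8 * (C' * C)))).mono' ?_
      (Filter.Eventually.of_forall fun q => ?_)
    · exact ((Complex.continuous_conj.comp (hBc.comp continuous_fst)).mul
        ((hg.1.comp continuous_snd).mul (hf.1.comp (by fun_prop)))).aestronglyMeasurable
    · simp only [Function.uncurry]
      rw [norm_mul, RCLike.norm_conj]
      have h1 : ‖B q.1‖ ≤ M := (hB q.1).trans (mul_le_of_le_one_right hM0 (decay_le_one _ _))
      have h2 := hg.norm_mul_le hf.fast q.1 q.2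
      calc _ ≤ M * (8 * (C' * C) * (decay 3 q.1 * decay 3 q.2)) :=
            mul_le_mul h1 h2 (norm_nonneg _) hM0
        _ = _ := by ring
  calc _ = ∫ ζ, ∫ a, conj (B ζ) * (g a * f (ζ - a)) := by
        refine integral_congr_ae (Filter.Eventually.of_forall fun ζ => ?_)
        simp only [pconv]
        rw [integral_const_mul]
    _ = ∫ a, ∫ ζ, conj (B ζ) * (g a * f (ζ - a)) := integral_integral_swap hi
    _ = _ := by
        refine integral_congr_ae (Filter.Eventually.of_forall fun a => ?_)
        simp only
        rw [mult_one_eq hf, ← integral_conj, ← integral_const_mul]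
        refine integral_congr_ae (Filter.Eventually.of_forall fun ζ => ?_)
        simp only [map_mul, Complex.conj_conj]
        ring

section energyIdentity

variable {δ C : ℝ} {w w' : ℝ → Rn 2 → ℂ}

lemma integral_mul_normSq_sub (hδ : 0 ≤ δ) {c b : Rn 2 → ℝ} (hcc : Continuous c)
    (hc0 : ∀ x, 0 ≤ c x) (hb : Integrable b) (hc : Continuous (Function.uncurry w))
    (hc' : Continuous (Function.uncurry w')) (hwb : ∀ t x, c x * (‖w t x‖ * ‖w t x‖) ≤ b x)
    (hwb' : ∀ t x, c x * (‖w t x‖ * ‖w' t x‖) ≤ b x)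
    (hd : ∀ t ∈ Ioo 0 δ, ∀ x, HasDerivAt (fun s => w s x) (w' t x) t) :
    Continuous (fun t => ∫ x, (c x : ℂ) * (conj (w t x) * w' t x)) ∧
    ∫ t in Icc 0 δ, 2 * (∫ x, (c x : ℂ) * (conj (w t x) * w' t x)).re =
      (∫ x, c x * ‖w δ x‖ ^ 2) - ∫ x, c x * ‖w 0 x‖ ^ 2 := by
  have hcC : Continuous fun q : ℝ × Rn 2 => (c q.2 : ℂ) :=
    Complex.continuous_ofReal.comp (hcc.comp continuous_snd)
  have hwc : Continuous fun q : ℝ × Rn 2 => conj (Function.uncurry w q) :=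
    Complex.continuous_conj.comp hc
  have hwc' : Continuous fun q : ℝ × Rn 2 => conj (Function.uncurry w' q) :=
    Complex.continuous_conj.comp hc'
  have hn : ∀ (x : Rn 2) (z z' : ℂ), ‖(c x : ℂ) * (conj z * z')‖ = c x * (‖z‖ * ‖z'‖) :=
    fun x z z' => by
      rw [norm_mul, norm_mul, RCLike.norm_conj, Complex.norm_real, Real.norm_of_nonneg (hc0 x)]
  have hz : Continuous (Function.uncurry fun t x => (c x : ℂ) * (conj (w t x) * w' t x)) :=
    hcC.mul (hwc.mul hc')
  have hzb : ∀ t x, ‖(c x : ℂ) * (conj (w t x) * w' t x)‖ ≤ b x := fun t x => by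
    rw [hn]; exact hwb' t x
  have hF : Continuous (Function.uncurry fun t x => (c x : ℂ) * (conj (w t x) * w t x)) :=
    hcC.mul (hwc.mul hc)
  have hF' : Continuous (Function.uncurry fun t x =>
      (c x : ℂ) * (conj (w' t x) * w t x + conj (w t x) * w' t x)) :=
    hcC.mul ((hwc'.mul hc).add (hwc.mul hc'))
  have hFb : ∀ t x, ‖(c x : ℂ) * (conj (w t x) * w t x)‖ ≤ 2 * b x := fun t x => by
    rw [hn]
    have := mul_nonneg (hc0 x) (mul_nonneg (norm_nonneg (w t x)) (norm_nonneg (w t x)))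
    linarith [hwb t x]
  have hFb' : ∀ t x, ‖(c x : ℂ) * (conj (w' t x) * w t x + conj (w t x) * w' t x)‖ ≤ 2 * b x := by
    intro t x
    rw [mul_add]
    refine (norm_add_le _ _).trans ?_
    rw [hn, hn, mul_comm ‖w' t x‖]
    linarith [hwb' t x]
  have key := integral_sub_integral_of_le hδ hF hF' (hb.const_mul 2) hFb hFb'
    (fun t ht x => ((hd t ht x).star.mul (hd t ht x)).const_mul _)
  refine ⟨continuous_integral_of_le hz hb hzb, ?_⟩
  have hpt : ∀ t, ((2 * (∫ x, (c x : ℂ) * (conj (w t x) * w' t x)).re : ℝ) : ℂ) =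
      ∫ x, (c x : ℂ) * (conj (w' t x) * w t x + conj (w t x) * w' t x) := by
    intro t
    have iz : Integrable fun x => (c x : ℂ) * (conj (w t x) * w' t x) :=
      integrable_of_le (hz.comp (f := fun x => (t, x)) (by fun_prop)) hb (hzb t)
    have ic : Integrable fun x => conj ((c x : ℂ) * (conj (w t x) * w' t x)) := by
      simpa using
        Complex.conjLIE.toContinuousLinearEquiv.toContinuousLinearMap.integrable_comp iz
    have e := Complex.add_conj (∫ x, (c x : ℂ) * (conj (w t x) * w' t x))
    rw [← e, ← integral_conj, ← integral_add iz ic]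
    refine integral_congr_ae (Filter.Eventually.of_forall fun x => ?_)
    simp only [map_mul, Complex.conj_ofReal, Complex.conj_conj]
    ring
  have hsq : ∀ t, ((∫ x, c x * ‖w t x‖ ^ 2 : ℝ) : ℂ) = ∫ x, (c x : ℂ) * (conj (w t x) * w t x) := by
    intro t
    rw [← integral_complex_ofReal]
    refine integral_congr_ae (Filter.Eventually.of_forall fun x => ?_)
    simp only
    rw [mul_comm (conj (w t x)), Complex.mul_conj, Complex.normSq_eq_norm_sq]
    push_cast
    ring
  apply Complex.ofReal_injective
  rw [← integral_complex_ofReal, integral_congr_ae (Filter.Eventually.of_forall hpt), key,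
    Complex.ofReal_sub, hsq, hsq]

lemma hasDerivAt_pconv (hc : Continuous (Function.uncurry w))
    (hc' : Continuous (Function.uncurry w')) (hf : ∀ t, Fast C (w t)) (hw' : ∀ t, Fast C (w' t))
    (hd : ∀ t ∈ Ioo 0 δ, ∀ x, HasDerivAt (fun s => w s x) (w' t x) t) {t : ℝ} (ht : t ∈ Ioo 0 δ)
    (ζ : Rn 2) :
    HasDerivAt (fun s => pconv (w s) (w s) ζ) (2 * pconv (w' t) (w t) ζ) t := by
  have hC := (hf 0).nonneg
  have h := hasDerivAt_integral_of_le (δ := δ) (t := t)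
    (F := fun t a => w t a * w t (ζ - a))
    (F' := fun t a => w' t a * w t (ζ - a) + w t a * w' t (ζ - a))
    (b := fun a => 2 * (8 * (C * C)) * decay 3 a) ?_ ?_
    ((integrable_decay (n := 3) (by norm_num)).const_mul _) ?_ ?_ ?_ ht
  · refine h.congr_deriv ?_
    have i1 : Integrable fun a => w' t a * w t (ζ - a) := integrable_of_le
      (b := fun a => 8 * (C * C) * (decay 3 ζ * decay 3 a))
      ((hw' t).1.mul ((hf t).1.comp (by fun_prop)))
      (((integrable_decay (n := 3) (by norm_num)).const_mul _).const_mul _)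
      ((hw' t).norm_mul_le (hf t) ζ)
    have i2 : Integrable fun a => w t a * w' t (ζ - a) := integrable_of_le
      (b := fun a => 8 * (C * C) * (decay 3 ζ * decay 3 a))
      ((hf t).1.mul ((hw' t).1.comp (by fun_prop)))
      (((integrable_decay (n := 3) (by norm_num)).const_mul _).const_mul _)
      ((hf t).norm_mul_le (hw' t) ζ)
    rw [integral_add i1 i2]
    have := pconv_comm (w t) (w' t) ζ
    simp only [pconv] at this
    rw [this]
    simp only [pconv]
    ring
  · exact (hc.comp (f := fun p : ℝ × Rn 2 => (p.1, p.2)) (by fun_prop)).mul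
      (hc.comp (f := fun p : ℝ × Rn 2 => (p.1, ζ - p.2)) (by fun_prop))
  · exact ((hc'.comp (f := fun p : ℝ × Rn 2 => (p.1, p.2)) (by fun_prop)).mul
      (hc.comp (f := fun p : ℝ × Rn 2 => (p.1, ζ - p.2)) (by fun_prop))).add
      ((hc.comp (f := fun p : ℝ × Rn 2 => (p.1, p.2)) (by fun_prop)).mul
      (hc'.comp (f := fun p : ℝ × Rn 2 => (p.1, ζ - p.2)) (by fun_prop)))
  · intro t a
    refine ((hf t).norm_mul_le (hf t) ζ a).trans ?_
    have := decay_pos 3 a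
    have := decay_le_one 3 ζ
    have : decay 3 ζ * decay 3 a ≤ decay 3 a := mul_le_of_le_one_left (by positivity) this
    have : 8 * (C * C) * (decay 3 ζ * decay 3 a) ≤ 8 * (C * C) * decay 3 a := by gcongr
    have : 0 ≤ 8 * (C * C) * decay 3 a := by positivity
    linarith
  · intro t a
    have h1 := (hw' t).norm_mul_le (hf t) ζ a
    have h2 := (hf t).norm_mul_le (hw' t) ζ a
    have h3 := norm_add_le (w' t a * w t (ζ - a)) (w t a * w' t (ζ - a))
    have := decay_pos 3 a
    have := decay_le_one 3 ζ
    have : decay 3 ζ * decay 3 a ≤ decay 3 a := mul_le_of_le_one_left (by positivity) this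
    have : 8 * (C * C) * (decay 3 ζ * decay 3 a) ≤ 8 * (C * C) * decay 3 a := by gcongr
    linarith
  · intro t ht a
    refine ((hd t ht a).mul (hd t ht (ζ - a))).congr_deriv
      (f := fun t => w t a * w t (ζ - a)) ?_
    ring

/-- The energy of a function on the Fourier side. -/
def fourierEnergy (f : Rn 2 → ℂ) : ℝ :=
  (1 / 2) * (∫ ξ, jap ξ ^ 2 * ‖f ξ‖ ^ 2) + (1 / 4) * ∫ ζ, ‖pconv f f ζ‖ ^ 2

lemma fourierEnergy_sub (hδ : 0 ≤ δ) (hc : Continuous (Function.uncurry w))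
    (hc' : Continuous (Function.uncurry w')) (hw : ∀ t, Rapid C (w t)) (hw' : ∀ t, Fast C (w' t))
    (hd : ∀ t ∈ Ioo 0 δ, ∀ x, HasDerivAt (fun s => w s x) (w' t x) t) :
    ∫ t in Icc 0 δ, ((∫ ξ, ((jap ξ ^ 2 : ℝ) : ℂ) * (conj (w t ξ) * w' t ξ)) +
      ∫ ξ, w' t ξ * conj (mult (fun _ => 1) (w t) ξ)).re =
      fourierEnergy (w δ) - fourierEnergy (w 0) := by
  have hC := (hw 0).nonneg
  have hf : ∀ t, Fast C (w t) := fun t => (hw t).fast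
  have hL0 : 0 ≤ ∫ a : Rn 2, decay 3 a := integral_nonneg fun a => (decay_pos _ _).le
  set M := 2 * (8 * (C * C) * (∫ a, decay 3 a)) with hM
  have hM0 : 0 ≤ M := by positivity
  have hB : ∀ t ζ, ‖pconv (w t) (w t) ζ‖ ≤ M * decay 3 ζ := fun t ζ => by
    have h1 := (hf t).norm_pconv_le (hf t) ζ
    have h2 := (norm_nonneg _).trans h1
    rw [hM, mul_assoc]
    linarith
  have hB' : ∀ t ζ, ‖2 * pconv (w' t) (w t) ζ‖ ≤ M * decay 3 ζ := fun t ζ => by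
    have h1 := (hw' t).norm_pconv_le (hf t) ζ
    rw [norm_mul, Complex.norm_ofNat, hM, mul_assoc 2]
    linarith
  clear_value M
  have hMd : ∀ (ζ : Rn 2) (x y : ℝ), 0 ≤ y → x ≤ M * decay 3 ζ → y ≤ M * decay 3 ζ →
      (1 : ℝ) * (x * y) ≤ M * M * decay 3 ζ := fun ζ x y hy h1 h2 => by
    have hd := decay_pos 3 ζ
    have h3 : decay 3 ζ * decay 3 ζ ≤ 1 * decay 3 ζ :=
      mul_le_mul_of_nonneg_right (decay_le_one 3 ζ) hd.le
    calc (1 : ℝ) * (x * y) = x * y := one_mul _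
      _ ≤ (M * decay 3 ζ) * (M * decay 3 ζ) := mul_le_mul h1 h2 hy (hy.trans h2)
      _ = M * M * (decay 3 ζ * decay 3 ζ) := by ring
      _ ≤ M * M * (1 * decay 3 ζ) := mul_le_mul_of_nonneg_left h3 (by positivity)
      _ = _ := by ring
  obtain ⟨pc, pe⟩ := integral_mul_normSq_sub hδ (c := fun _ => 1) (b := fun ζ => M * M * decay 3 ζ)
    (w := fun t ζ => pconv (w t) (w t) ζ) (w' := fun t ζ => 2 * pconv (w' t) (w t) ζ)
    continuous_const (fun _ => zero_le_one)
    ((integrable_decay (n := 3) (by norm_num)).const_mul _) (continuous_pconv hc hc hf hf)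
    (continuous_const.mul (continuous_pconv hc' hc hw' hf))
    (fun t ζ => hMd ζ _ _ (norm_nonneg _) (hB t ζ) (hB t ζ))
    (fun t ζ => hMd ζ _ _ (norm_nonneg _) (hB t ζ) (hB' t ζ))
    (fun t ht ζ => hasDerivAt_pconv hc hc' hf hw' hd ht ζ)
  have hjw : ∀ {g : Rn 2 → ℂ}, Fast C g → ∀ t ξ,
      jap ξ ^ 2 * (‖w t ξ‖ * ‖g ξ‖) ≤ C * C * decay 6 ξ := by
    intro g hg t ξ
    have h1 := jap_sq_mul_rapid (hw t) ξ
    have h2 : ‖g ξ‖ ≤ C := (hg.2 ξ).trans (mul_le_of_le_one_right hC (decay_le_one _ _))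
    have := decay_pos 6 ξ
    calc _ = (jap ξ ^ 2 * ‖w t ξ‖) * ‖g ξ‖ := by ring
      _ ≤ (C * decay 6 ξ) * C := mul_le_mul h1 h2 (norm_nonneg _) (by positivity)
      _ = _ := by ring
  obtain ⟨kc, ke⟩ := integral_mul_normSq_sub hδ (c := fun ξ => jap ξ ^ 2)
    (b := fun ζ => C * C * decay 6 ζ) (continuous_jap.pow 2) (fun ξ => by positivity)
    ((integrable_decay (n := 6) (by norm_num)).const_mul _) hc hc'
    (fun t ξ => hjw (hf t) t ξ) (fun t ξ => hjw (hw' t) t ξ) hd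
  have hintg : ∀ {g : ℝ → ℂ}, Continuous g →
      Integrable (fun t => 2 * (g t).re) (volume.restrict (Icc 0 δ)) := fun hg =>
    (continuous_const.mul (Complex.continuous_re.comp hg)).continuousOn.integrableOn_compact
      isCompact_Icc
  have hy : ∀ t, ∫ x, ((1 : ℝ) : ℂ) * (conj (pconv (w t) (w t) x) * (2 * pconv (w' t) (w t) x)) =
      2 * ∫ ξ, w' t ξ * conj (mult (fun _ => 1) (w t) ξ) := by
    intro t
    rw [← integral_conj_pconv_mul (hw t) (hw' t), ← integral_const_mul]
    refine integral_congr_ae (Filter.Eventually.of_forall fun ξ => ?_)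
    push_cast
    ring
  have hsplit : ∀ t, ((∫ ξ, ((jap ξ ^ 2 : ℝ) : ℂ) * (conj (w t ξ) * w' t ξ)) +
      ∫ ξ, w' t ξ * conj (mult (fun _ => 1) (w t) ξ)).re =
      (1 / 2) * (2 * (∫ ξ, ((jap ξ ^ 2 : ℝ) : ℂ) * (conj (w t ξ) * w' t ξ)).re) +
      (1 / 4) * (2 * (∫ x, ((1 : ℝ) : ℂ) *
        (conj (pconv (w t) (w t) x) * (2 * pconv (w' t) (w t) x))).re) := by
    intro t
    rw [hy, Complex.add_re]
    simp only [Complex.mul_re, Complex.re_ofNat, Complex.im_ofNat]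
    ring
  rw [integral_congr_ae (Filter.Eventually.of_forall hsplit),
    integral_add ((hintg kc).const_mul _) ((hintg pc).const_mul _), integral_const_mul (1 / 2),
    integral_const_mul (1 / 4), ke, pe, fourierEnergy, fourierEnergy]
  simp only [one_mul]
  ring

end energyIdentity

section increment

/-- The sesquilinear pairing with a real weight. -/
def wpair (c : Rn 2 → ℝ) (f g : Rn 2 → ℂ) : ℂ := ∫ ξ, (c ξ : ℂ) * (f ξ * conj (g ξ))

lemma conj_wpair (c : Rn 2 → ℝ) (f g : Rn 2 → ℂ) : conj (wpair c f g) = wpair c g f := by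
  unfold wpair
  rw [← integral_conj]
  refine integral_congr_ae (Filter.Eventually.of_forall fun ξ => ?_)
  simp only [map_mul, Complex.conj_ofReal, Complex.conj_conj]
  ring

lemma wpair_self_im (c : Rn 2 → ℝ) (f : Rn 2 → ℂ) : (wpair c f f).im = 0 :=
  Complex.conj_eq_iff_im.mp (conj_wpair c f f)

lemma norm_wpair_le {c : Rn 2 → ℝ} (hcb : ∀ x, |c x| ≤ jap x ^ 4) {C C' : ℝ}
    {f g : Rn 2 → ℂ} (hf : Rapid C f) (hg : Rapid C' g) (ξ : Rn 2) :
    ‖(c ξ : ℂ) * (f ξ * conj (g ξ))‖ ≤ C * C' * decay 8 ξ := by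
  have hC := hf.nonneg
  have hC' := hg.nonneg
  have := decay_pos 8 ξ
  rw [norm_mul, norm_mul, RCLike.norm_conj, Complex.norm_real, Real.norm_eq_abs]
  calc _ ≤ jap ξ ^ 4 * ((C * decay 8 ξ) * (C' * decay 8 ξ)) :=
        mul_le_mul (hcb ξ) (mul_le_mul (hf.2 ξ) (hg.2 ξ) (norm_nonneg _) (by positivity))
          (by positivity) (by positivity)
    _ = C * C' * decay 8 ξ * (jap ξ ^ 4 * decay (4 + 4) ξ) := by norm_num; ring
    _ ≤ C * C' * decay 8 ξ * 1 := by
        rw [jap_pow_mul_decay]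
        exact mul_le_mul_of_nonneg_left (decay_le_one _ _) (by positivity)
    _ = _ := mul_one _

lemma integrable_wpair {c : Rn 2 → ℝ} (hc : Continuous c) (hcb : ∀ x, |c x| ≤ jap x ^ 4) {C C' : ℝ}
    {f g : Rn 2 → ℂ} (hf : Rapid C f) (hg : Rapid C' g) :
    Integrable fun ξ => (c ξ : ℂ) * (f ξ * conj (g ξ)) :=
  integrable_of_le ((Complex.continuous_ofReal.comp hc).mul
    (hf.1.mul (Complex.continuous_conj.comp hg.1)))
    ((integrable_decay (n := 8) (by norm_num)).const_mul _) (norm_wpair_le hcb hf hg)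

lemma continuous_wpair {c : Rn 2 → ℝ} (hc : Continuous c) (hcb : ∀ x, |c x| ≤ jap x ^ 4) {C C' : ℝ}
    {f g : ℝ → Rn 2 → ℂ} (hfc : Continuous (Function.uncurry f))
    (hgc : Continuous (Function.uncurry g)) (hf : ∀ t, Rapid C (f t)) (hg : ∀ t, Rapid C' (g t)) :
    Continuous fun t => wpair c (f t) (g t) :=
  continuous_integral_of_le
    (F := fun t ξ => (c ξ : ℂ) * (f t ξ * conj (g t ξ)))
    ((Complex.continuous_ofReal.comp (hc.comp continuous_snd)).mul
      (hfc.mul (Complex.continuous_conj.comp hgc)))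
    ((integrable_decay (n := 8) (by norm_num)).const_mul (C * C'))
    fun t => norm_wpair_le hcb (hf t) (hg t)

variable {N s : ℝ}

lemma mult_imul₃_eq (f : Rn 2 → ℂ) (ξ : Rn 2) :
    mult (imul₃ N s) f ξ = mult (fun _ => 1) (fun x => (imul N s x : ℂ) * f x) ξ := by
  refine integral_congr_ae (Filter.Eventually.of_forall fun p => ?_)
  simp only [imul₃, cub, map_mul, Complex.conj_ofReal]
  push_cast
  ring

lemma isSymbol_of_abs_le {σ : Rn 2 × Rn 2 × Rn 2 → ℝ} (hσ : Continuous σ) {M : ℝ}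
    (hM : ∀ q, |σ q| ≤ M) : IsSymbol σ := by
  have hM0 : 0 ≤ M := (abs_nonneg _).trans (hM 0)
  exact ⟨hσ, fun ξ => ⟨M, fun p => hM _⟩⟩

lemma abs_imul₃_le (hN : 1 ≤ N) (q : Rn 2 × Rn 2 × Rn 2) : |imul₃ N s q| ≤ 1 := by
  rw [abs_of_nonneg (imul₃_nonneg hN q)]
  exact imul₃_le_one hN q

lemma imul_mul_mult_one (hN : 1 ≤ N) (hs1 : s < 1) {C : ℝ} {f : Rn 2 → ℂ} (hf : Rapid C f)
    (ξ : Rn 2) : (imul N s ξ : ℂ) * mult (fun _ => 1) f ξ =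
      mult (commSymbol N s) f ξ + mult (imul₃ N s) f ξ := by
  rw [← mult_fst_mul]
  unfold mult
  rw [← integral_add
    (integrable_sym_cub (isSymbol_of_abs_le (continuous_commSymbol hs1) (abs_commSymbol_le hN))
      hf hf hf ξ)
    (integrable_sym_cub (isSymbol_of_abs_le (continuous_imul₃ hs1) (abs_imul₃_le hN)) hf hf hf ξ)]
  refine integral_congr_ae (Filter.Eventually.of_forall fun p => ?_)
  simp only [commSymbol]
  push_cast
  ring

/-- The non-conservative part of the derivative of the energy comes from the commutator. -/
lemma energyDeriv_re {C C' : ℝ} {w D P : Rn 2 → ℂ} (hw : Rapid C w) (hD : Rapid C' D)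
    (hP : Rapid C' P) (hPw : ∀ ξ, P ξ = mult (fun _ => 1) w ξ) {w' : Rn 2 → ℂ}
    (hw' : ∀ ξ, w' ξ = -I * (((‖ξ‖ ^ 2 : ℝ) : ℂ) * w ξ + (D ξ + P ξ))) :
    ((∫ ξ, ((jap ξ ^ 2 : ℝ) : ℂ) * (conj (w ξ) * w' ξ)) +
      ∫ ξ, w' ξ * conj (mult (fun _ => 1) w ξ)).re =
    (wpair (fun ξ => jap ξ ^ 2) D w + wpair (fun _ => 1) D P).im := by
  have hj : ∀ x : Rn 2, 1 ≤ jap x := one_le_jap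
  have hjs : ∀ x : Rn 2, jap x ^ 2 = 1 + ‖x‖ ^ 2 := fun x => jap_sq x
  have c1 : Continuous fun _ : Rn 2 => (1 : ℝ) := continuous_const
  have c2 : Continuous fun x : Rn 2 => jap x ^ 2 := continuous_jap.pow 2
  have c3 : Continuous fun x : Rn 2 => ‖x‖ ^ 2 := by fun_prop
  have c4 : Continuous fun x : Rn 2 => jap x ^ 2 * ‖x‖ ^ 2 := c2.mul c3
  have b1 : ∀ x : Rn 2, |(1 : ℝ)| ≤ jap x ^ 4 := fun x => by
    rw [abs_one]; exact one_le_pow₀ (hj x)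
  have b2 : ∀ x : Rn 2, |jap x ^ 2| ≤ jap x ^ 4 := fun x => by
    rw [abs_of_nonneg (by positivity)]; exact pow_le_pow_right₀ (hj x) (by norm_num)
  have b3 : ∀ x : Rn 2, |‖x‖ ^ 2| ≤ jap x ^ 4 := fun x => by
    rw [abs_of_nonneg (by positivity)]
    exact le_trans (by linarith [hjs x]) ((le_abs_self _).trans (b2 x))
  have b4 : ∀ x : Rn 2, |jap x ^ 2 * ‖x‖ ^ 2| ≤ jap x ^ 4 := fun x => by
    rw [abs_of_nonneg (by positivity)]
    nlinarith [hjs x, sq_nonneg (jap x)]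
  have i1 := integrable_wpair c4 b4 hw hw
  have i2 := integrable_wpair c2 b2 hD hw
  have i3 := integrable_wpair c3 b3 hP hw
  have i4 := integrable_wpair c1 b1 hP hw
  have i5 := integrable_wpair c3 b3 hw hP
  have i6 := integrable_wpair c1 b1 hD hP
  have i7 := integrable_wpair c1 b1 hP hP
  have hz : ∫ ξ, ((jap ξ ^ 2 : ℝ) : ℂ) * (conj (w ξ) * w' ξ) =
      -I * ((wpair (fun x => jap x ^ 2 * ‖x‖ ^ 2) w w + wpair (fun x => jap x ^ 2) D w) +
        (wpair (fun x => ‖x‖ ^ 2) P w + wpair (fun _ => 1) P w)) := by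
    unfold wpair
    rw [← integral_add' i1 i2, ← integral_add' i3 i4, ← integral_add' (i1.add i2) (i3.add i4),
      ← integral_const_mul]
    refine integral_congr_ae (Filter.Eventually.of_forall fun ξ => ?_)
    simp only [Pi.add_apply]
    rw [hw', hjs]
    push_cast
    ring
  have hy : ∫ ξ, w' ξ * conj (mult (fun _ => 1) w ξ) =
      -I * ((wpair (fun x => ‖x‖ ^ 2) w P + wpair (fun _ => 1) D P) + wpair (fun _ => 1) P P) := by
    unfold wpair
    rw [← integral_add' i5 i6, ← integral_add' (i5.add i6) i7, ← integral_const_mul]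
    refine integral_congr_ae (Filter.Eventually.of_forall fun ξ => ?_)
    simp only [Pi.add_apply]
    rw [hw', ← hPw]
    push_cast
    ring
  have hPim : (wpair (fun _ => 1) P w).im = 0 := by
    rw [← conj_wpair, Complex.conj_im, neg_eq_zero]
    have e : wpair (fun _ => 1) w P = ∫ ζ, conj (pconv w w ζ) * pconv w w ζ := by
      rw [integral_conj_pconv_mul hw hw.fast]
      refine integral_congr_ae (Filter.Eventually.of_forall fun ξ => ?_)
      simp only [hPw]
      push_cast
      ring
    rw [e]
    refine Complex.conj_eq_iff_im.mp ?_
    rw [← integral_conj]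
    refine integral_congr_ae (Filter.Eventually.of_forall fun ξ => ?_)
    simp only [map_mul, Complex.conj_conj]
    ring
  have h1 := wpair_self_im (fun x => jap x ^ 2 * ‖x‖ ^ 2) w
  have h2 := wpair_self_im (fun _ => 1) P
  have h3 : (wpair (fun x => ‖x‖ ^ 2) P w).im = -(wpair (fun x => ‖x‖ ^ 2) w P).im := by
    rw [← conj_wpair, Complex.conj_im]
  rw [hz, hy]
  simp only [Complex.add_re, Complex.mul_re, Complex.neg_re, Complex.neg_im, Complex.I_re,
    Complex.I_im, Complex.add_im, h1, h2, h3, hPim]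
  ring

lemma FourierSol.energy_increment_le {δ C : ℝ} {W : ℝ → Rn 2 → ℂ} (hW : FourierSol δ C W)
    (hN : 1 ≤ N) (hs1 : s < 1) (hδ : 0 ≤ δ) :
    ENNReal.ofReal |fourierEnergy (fun ξ => (imul N s ξ : ℂ) * W δ ξ) -
      fourierEnergy (fun ξ => (imul N s ξ : ℂ) * W 0 ξ)| ≤
    ‖∫ t in Icc 0 δ, ∫ ξ, ((jap ξ ^ 2 * imul N s ξ : ℝ) : ℂ) *
      (conj (W t ξ) * mult (commSymbol N s) (W t) ξ)‖ₑ +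
    ∫⁻ t in Icc 0 δ, ∫⁻ ξ,
      ‖mult (imul₃ N s) (W t) ξ‖ₑ * ‖mult (commSymbol N s) (W t) ξ‖ₑ := by
  obtain ⟨C₁, hC₁⟩ := exists_rapid_mult (σ := fun _ => 1) (M := 1) continuous_const (by simp) C
  obtain ⟨C₂, hC₂⟩ := exists_rapid_mult (continuous_commSymbol (N := N) hs1)
    (abs_commSymbol_le hN) C
  obtain ⟨C₃, hC₃⟩ := exists_rapid_mult (continuous_imul₃ (N := N) hs1) (abs_imul₃_le hN) C
  have hmc := Complex.continuous_ofReal.comp (continuous_imul (N := N) hs1)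
  have hm1 : ∀ x z, ‖(imul N s x : ℂ) * z‖ ≤ ‖z‖ := fun x z => by
    rw [norm_mul, Complex.norm_real, Real.norm_of_nonneg (imul_pos hN x).le]
    exact mul_le_of_le_one_left (norm_nonneg _) (imul_le_one x)
  have hw : ∀ t, Rapid C fun ξ => (imul N s ξ : ℂ) * W t ξ := fun t =>
    ⟨hmc.mul (hW.rapid t).1, fun x => (hm1 _ _).trans ((hW.rapid t).2 x)⟩
  have hwc : Continuous (Function.uncurry fun t ξ => (imul N s ξ : ℂ) * W t ξ) :=
    (hmc.comp continuous_snd).mul hW.cont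
  have hDc : Continuous fun q : ℝ × Rn 2 => mult (commSymbol N s) (W q.1) q.2 :=
    continuous_mult hW.cont hW.rapid (continuous_commSymbol hs1) (abs_commSymbol_le hN)
  have hPc : Continuous fun q : ℝ × Rn 2 => mult (imul₃ N s) (W q.1) q.2 :=
    continuous_mult hW.cont hW.rapid (continuous_imul₃ hs1) (abs_imul₃_le hN)
  have hD : ∀ t, Rapid (max C₂ C₃) (mult (commSymbol N s) (W t)) := fun t =>
    (hC₂ _ (hW.rapid t)).mono (le_max_left _ _)
  have hP : ∀ t, Rapid (max C₂ C₃) (mult (imul₃ N s) (W t)) := fun t =>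
    (hC₃ _ (hW.rapid t)).mono (le_max_right _ _)
  set w' : ℝ → Rn 2 → ℂ := fun t ξ => (imul N s ξ : ℂ) *
    (-I * (((‖ξ‖ ^ 2 : ℝ) : ℂ) * W t ξ + mult (fun _ => 1) (W t) ξ)) with hw'
  have h1c : Continuous fun q : ℝ × Rn 2 => mult (fun _ => 1) (W q.1) q.2 :=
    continuous_mult hW.cont hW.rapid (σ := fun _ => 1) (M := 1) continuous_const (by simp)
  have hw'c : Continuous (Function.uncurry w') := by
    refine (hmc.comp continuous_snd).mul (continuous_const.mul (Continuous.add ?_ h1c))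
    exact (Complex.continuous_ofReal.comp (by fun_prop)).mul hW.cont
  have hC := (hW.rapid 0).nonneg
  have hC₁0 := (hC₁ _ (hW.rapid 0)).nonneg
  have hw'f : ∀ t, Fast (C + C₁) (w' t) := fun t => by
    refine ⟨hw'c.comp (f := fun x => (t, x)) (by fun_prop), fun x => ?_⟩
    refine (hm1 _ _).trans ?_
    rw [norm_mul, norm_neg, Complex.norm_I, one_mul, add_mul]
    refine (norm_add_le _ _).trans (add_le_add ?_ ?_)
    · rw [norm_mul, Complex.norm_real, Real.norm_of_nonneg (by positivity)]
      refine le_trans ?_ (jap_sq_mul_rapid (hW.rapid t) x)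
      exact mul_le_mul_of_nonneg_right (by linarith [jap_sq x]) (norm_nonneg _)
    · exact (hC₁ _ (hW.rapid t)).fast.2 x
  have hd : ∀ t ∈ Ioo 0 δ, ∀ x, HasDerivAt (fun s_1 => (imul N s x : ℂ) * W s_1 x) (w' t x) t :=
    fun t ht x => (hW.hasDerivAt t ht x).const_mul _
  have key := fourierEnergy_sub hδ hwc hw'c
    (fun t => (hw t).mono (le_add_of_nonneg_right hC₁0)) hw'f hd
  have hpt : ∀ t, ((∫ ξ, ((jap ξ ^ 2 : ℝ) : ℂ) * (conj ((imul N s ξ : ℂ) * W t ξ) * w' t ξ)) +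
      ∫ ξ, w' t ξ * conj (mult (fun _ => 1) (fun x => (imul N s x : ℂ) * W t x) ξ)).re =
      (wpair (fun ξ => jap ξ ^ 2) (mult (commSymbol N s) (W t)) (fun ξ => (imul N s ξ : ℂ) * W t ξ)
        + wpair (fun _ => 1) (mult (commSymbol N s) (W t)) (mult (imul₃ N s) (W t))).im := fun t =>
    energyDeriv_re (hw t) (hD t) (hP t) (mult_imul₃_eq _) fun ξ => by
      rw [← imul_mul_mult_one hN hs1 (hW.rapid t), hw']
      ring
  have hj : ∀ x : Rn 2, 1 ≤ jap x := one_le_jap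
  have zc := continuous_wpair (c := fun ξ => jap ξ ^ 2)
    (f := fun t => mult (commSymbol N s) (W t)) (continuous_jap.pow 2) (fun x => by
    rw [abs_of_nonneg (by positivity)]; exact pow_le_pow_right₀ (hj x) (by norm_num)) hDc hwc hD hw
  have yc := continuous_wpair (c := fun _ => 1) (f := fun t => mult (commSymbol N s) (W t))
    (g := fun t => mult (imul₃ N s) (W t)) continuous_const (fun x => by
    rw [abs_one]; exact one_le_pow₀ (hj x)) hDc hPc hD hP
  have hintg : ∀ {g : ℝ → ℂ}, Continuous g → Integrable g (volume.restrict (Icc 0 δ)) := fun hg =>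
    hg.continuousOn.integrableOn_compact isCompact_Icc
  rw [← key, integral_congr_ae (Filter.Eventually.of_forall hpt)]
  have him : ∫ t in Icc 0 δ, (wpair (fun ξ => jap ξ ^ 2) (mult (commSymbol N s) (W t))
      (fun ξ => (imul N s ξ : ℂ) * W t ξ) +
      wpair (fun _ => 1) (mult (commSymbol N s) (W t)) (mult (imul₃ N s) (W t))).im =
      (∫ t in Icc 0 δ, (wpair (fun ξ => jap ξ ^ 2) (mult (commSymbol N s) (W t))
      (fun ξ => (imul N s ξ : ℂ) * W t ξ) +
      wpair (fun _ => 1) (mult (commSymbol N s) (W t)) (mult (imul₃ N s) (W t)))).im :=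
    integral_im ((hintg zc).add (hintg yc))
  rw [him, integral_add (hintg zc) (hintg yc)]
  refine (ENNReal.ofReal_le_ofReal (Complex.abs_im_le_norm _)).trans ?_
  rw [ofReal_norm]
  refine (enorm_add_le _ _).trans (add_le_add (le_of_eq ?_) ?_)
  · congr 1
    refine integral_congr_ae (Filter.Eventually.of_forall fun t => ?_)
    refine integral_congr_ae (Filter.Eventually.of_forall fun ξ => ?_)
    simp only [map_mul, Complex.conj_ofReal]
    push_cast
    ring
  · refine (enorm_integral_le_lintegral_enorm _).trans (lintegral_mono fun t => ?_)
    refine (enorm_integral_le_lintegral_enorm _).trans (lintegral_mono fun ξ => le_of_eq ?_)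
    rw [Complex.ofReal_one, one_mul, enorm_mul, mul_comm]
    congr 1
    rw [← ofReal_norm, RCLike.norm_conj, ofReal_norm]

end increment

section energyBounds

variable {N s : ℝ}

lemma wnorm_iwt_eq (hN : 1 ≤ N) (f : Rn 2 → ℂ) :
    wnorm (iwt N s) f = wnorm jap (fun ξ => (imul N s ξ : ℂ) * f ξ) := by
  refine lintegral_congr fun ξ => ?_
  rw [wabs, wabs, iwt_eq, ENNReal.ofReal_mul (jap_pos ξ).le, enorm_mul, mul_assoc]
  congr 3
  rw [← ofReal_norm, Complex.norm_real, Real.norm_of_nonneg (imul_pos hN ξ).le]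

lemma wabs_sq (θ : Rn 2 → ℝ) {w : Rn 2 → ℂ} {ξ : Rn 2} (h : 0 ≤ θ ξ) :
    wabs θ w ξ ^ 2 = ENNReal.ofReal (θ ξ ^ 2 * ‖w ξ‖ ^ 2) := by
  rw [wabs, ← ofReal_norm, ← ENNReal.ofReal_mul h, ← ENNReal.ofReal_pow (by positivity), mul_pow]

lemma Rapid.integrable_mul_normSq {C : ℝ} {w : Rn 2 → ℂ} (hw : Rapid C w) {g : Rn 2 → ℝ}
    (hg : Continuous g) (hg0 : ∀ ξ, 0 ≤ g ξ) (hgj : ∀ ξ, g ξ ≤ jap ξ ^ 2) :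
    Integrable fun ξ => g ξ * ‖w ξ‖ ^ 2 := by
  have hC := hw.nonneg
  refine ((integrable_decay (n := 6) (by norm_num)).const_mul (C * C)).mono'
    (hg.mul (hw.1.norm.pow 2)).aestronglyMeasurable (Filter.Eventually.of_forall fun ξ => ?_)
  have := decay_pos 6 ξ
  have := hg0 ξ
  rw [Real.norm_of_nonneg (by positivity)]
  calc g ξ * ‖w ξ‖ ^ 2 ≤ jap ξ ^ 2 * ‖w ξ‖ ^ 2 := by
        gcongr
        exact hgj ξ
    _ = (jap ξ ^ 2 * ‖w ξ‖) * ‖w ξ‖ := by ring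
    _ ≤ (C * decay 6 ξ) * C := mul_le_mul (jap_sq_mul_rapid hw ξ) (hw.norm_le ξ)
        (norm_nonneg _) (by positivity)
    _ = _ := by ring

lemma integral_jap_sq_eq {C : ℝ} {w : Rn 2 → ℂ} (hw : Rapid C w) :
    ENNReal.ofReal (∫ ξ, jap ξ ^ 2 * ‖w ξ‖ ^ 2) = wnorm jap w := by
  have hi := hw.integrable_mul_normSq (g := fun ξ => jap ξ ^ 2) (continuous_jap.pow 2)
    (fun ξ => by positivity)
    fun ξ => le_rfl
  rw [ofReal_integral_eq_lintegral_ofReal hi (Filter.Eventually.of_forall fun ξ => by positivity)]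
  exact lintegral_congr fun ξ => (wabs_sq jap (jap_pos ξ).le).symm

lemma wnorm_jap_le_energy {C : ℝ} {w : Rn 2 → ℂ} (hw : Rapid C w) :
    wnorm jap w ≤ ENNReal.ofReal (2 * fourierEnergy w) := by
  rw [← integral_jap_sq_eq hw]
  refine ENNReal.ofReal_le_ofReal ?_
  have : 0 ≤ ∫ ζ, ‖pconv w w ζ‖ ^ 2 := integral_nonneg fun ζ => by positivity
  rw [fourierEnergy]
  linarith

lemma lintegral_enorm_pconv_sq_le {w : Rn 2 → ℂ} (hw : Continuous w) :
    ∫⁻ ζ, ‖pconv w w ζ‖ₑ ^ 2 ≤ ENNReal.ofReal (∫ a, decay 4 a) * wnorm jap w ^ 2 := by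
  set L := ENNReal.ofReal (∫ a : Rn 2, decay 4 a) with hL
  have hLe : L = ∫⁻ a : Rn 2, ENNReal.ofReal (decay 4 a) :=
    ofReal_integral_eq_lintegral_ofReal (integrable_decay (by norm_num))
      (Filter.Eventually.of_forall fun a => (decay_pos _ _).le)
  have mw : Measurable (wabs jap w) := measurable_wabs continuous_jap hw
  have md : Measurable fun a : Rn 2 => ENNReal.ofReal (decay 1 a) :=
    (continuous_decay 1).measurable.ennreal_ofReal
  have hone : ∀ a : Rn 2, ‖w a‖ₑ = wabs jap w a * ENNReal.ofReal (decay 1 a) := fun a => by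
    rw [wabs, mul_right_comm, ← ENNReal.ofReal_mul (jap_pos a).le, decay, pow_one,
      mul_inv_cancel₀ (jap_pos a).ne', ENNReal.ofReal_one, one_mul]
  have hpt : ∀ ζ, ‖pconv w w ζ‖ₑ ^ 2 ≤
      (∫⁻ a, wabs jap w a ^ 2 * wabs jap w (ζ - a) ^ 2) * L := by
    intro ζ
    have h1 : ‖pconv w w ζ‖ₑ ≤ ∫⁻ a, (wabs jap w a * wabs jap w (ζ - a)) *
        (ENNReal.ofReal (decay 1 a) * ENNReal.ofReal (decay 1 (ζ - a))) := by
      refine (enorm_integral_le_lintegral_enorm _).trans (le_of_eq (lintegral_congr fun a => ?_))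
      rw [enorm_mul, hone, hone (ζ - a)]
      ring
    have m1 : Measurable fun a => wabs jap w a * wabs jap w (ζ - a) :=
      mw.mul (mw.comp (measurable_const.sub measurable_id))
    have m2 : Measurable fun a : Rn 2 => ENNReal.ofReal (decay 1 a) *
        ENNReal.ofReal (decay 1 (ζ - a)) :=
      md.mul (md.comp (measurable_const.sub measurable_id))
    refine (pow_le_pow_left' h1 2).trans (
      (sq_lintegral_mul_le m1.aemeasurable m2.aemeasurable).trans
      (mul_le_mul' (le_of_eq (lintegral_congr fun a => mul_pow _ _ _)) ?_))
    have h3 : ∀ a : Rn 2, (ENNReal.ofReal (decay 1 a) * ENNReal.ofReal (decay 1 (ζ - a))) ^ 2 ≤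
        ENNReal.ofReal (1 / 2) * ENNReal.ofReal (decay 4 a) +
        ENNReal.ofReal (1 / 2) * ENNReal.ofReal (decay 4 (ζ - a)) := by
      intro a
      have p1 := decay_pos 1 a
      have p2 := decay_pos 1 (ζ - a)
      have e : ∀ x : Rn 2, decay 4 x = decay 1 x ^ 4 := fun x => by
        simp only [decay, pow_one, inv_pow]
      rw [← ENNReal.ofReal_mul p1.le, ← ENNReal.ofReal_pow (by positivity),
        ← ENNReal.ofReal_mul (by norm_num), ← ENNReal.ofReal_mul (by norm_num),
        ← ENNReal.ofReal_add (by rw [e]; positivity) (by rw [e]; positivity)]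
      refine ENNReal.ofReal_le_ofReal ?_
      rw [e, e]
      nlinarith [sq_nonneg (decay 1 a ^ 2 - decay 1 (ζ - a) ^ 2)]
    refine (lintegral_mono h3).trans (le_of_eq ?_)
    have md4 : Measurable fun a : Rn 2 => ENNReal.ofReal (decay 4 a) :=
      (continuous_decay 4).measurable.ennreal_ofReal
    rw [lintegral_add_left (md4.const_mul _), lintegral_const_mul _ md4,
      lintegral_const_mul' _ _ ENNReal.ofReal_ne_top,
      lintegral_sub_left_eq_self (fun a : Rn 2 => ENNReal.ofReal (decay 4 a)) ζ, ← hLe, ← add_mul,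
      ← ENNReal.ofReal_add (by norm_num) (by norm_num)]
    norm_num
  have mm : Measurable fun q : Rn 2 × Rn 2 => wabs jap w q.2 ^ 2 * wabs jap w (q.1 - q.2) ^ 2 :=
    ((mw.comp measurable_snd).pow_const 2).mul
      ((mw.comp (measurable_fst.sub measurable_snd)).pow_const 2)
  refine (lintegral_mono hpt).trans (le_of_eq ?_)
  rw [lintegral_mul_const' _ _ ENNReal.ofReal_ne_top, mul_comm,
    lintegral_lintegral_swap mm.aemeasurable]
  congr 1
  have hin : ∀ a, ∫⁻ ζ, wabs jap w a ^ 2 * wabs jap w (ζ - a) ^ 2 = wabs jap w a ^ 2 *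
      wnorm jap w :=
    fun a => by
      have m3 : Measurable fun ζ => wabs jap w (ζ - a) ^ 2 :=
        (mw.comp (measurable_id.sub measurable_const)).pow_const 2
      rw [lintegral_const_mul _ m3,
        lintegral_sub_right_eq_self (fun ζ => wabs jap w ζ ^ 2) a, wnorm]
  rw [lintegral_congr hin, lintegral_mul_const _ (mw.pow_const 2), sq, wnorm]

lemma exists_energy_le : ∃ K : ℝ, 0 ≤ K ∧ ∀ (C X : ℝ) (w : Rn 2 → ℂ), Rapid C w → 0 ≤ X →
    wnorm jap w ≤ ENNReal.ofReal X → fourierEnergy w ≤ X + K * X ^ 2 := by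
  have hL : 0 ≤ ∫ a : Rn 2, decay 4 a := integral_nonneg fun a => (decay_pos _ _).le
  refine ⟨∫ a : Rn 2, decay 4 a, hL, fun C X w hw hX h => ?_⟩
  rw [← integral_jap_sq_eq hw] at h
  have h1 : ∫ ξ, jap ξ ^ 2 * ‖w ξ‖ ^ 2 ≤ X := (ENNReal.ofReal_le_ofReal_iff hX).mp h
  have h2 : ∫ ζ, ‖pconv w w ζ‖ ^ 2 ≤ (∫ a : Rn 2, decay 4 a) * X ^ 2 := by
    rw [integral_eq_lintegral_of_nonneg_ae (f := fun ζ => ‖pconv w w ζ‖ ^ 2)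
      (Filter.Eventually.of_forall fun ζ => sq_nonneg _)
      ((hw.fast.continuous_pconv hw.fast).norm.pow 2).aestronglyMeasurable]
    refine ENNReal.toReal_le_of_le_ofReal (by positivity) ?_
    calc ∫⁻ ζ, ENNReal.ofReal (‖pconv w w ζ‖ ^ 2) = ∫⁻ ζ, ‖pconv w w ζ‖ₑ ^ 2 :=
          lintegral_congr fun ζ => by rw [ENNReal.ofReal_pow (norm_nonneg _), ofReal_norm]
      _ ≤ _ := lintegral_enorm_pconv_sq_le hw.1
      _ ≤ _ := by
        rw [ENNReal.ofReal_mul hL, ENNReal.ofReal_pow hX, ← integral_jap_sq_eq hw]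
        exact mul_le_mul' le_rfl (pow_le_pow_left' h 2)
  have h3 : 0 ≤ ∫ ξ, jap ξ ^ 2 * ‖w ξ‖ ^ 2 := integral_nonneg fun ξ => by positivity
  have h4 : 0 ≤ ∫ ζ, ‖pconv w w ζ‖ ^ 2 := integral_nonneg fun ζ => by positivity
  rw [fourierEnergy]
  linarith

end energyBounds

section iteration

variable {s β : ℝ}

lemma enorm_neg_I_mul_spin (t : ℝ) (f : Rn 2 → ℂ) (ξ : Rn 2) : ‖-I * spin t f ξ‖ₑ = ‖f ξ‖ₑ := by
  rw [← ofReal_norm, norm_mul, norm_neg, Complex.norm_I, one_mul, norm_spin, ofReal_norm]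

/-- The energy increment over a time step on which the local theory applies. -/
theorem exists_increment_le (hs : 1 / 2 < s) (hs1 : s < 1) (hβ : β < 3 / 2) {R : ℝ} (hR : 0 < R) :
    ∃ δ₀ : ℝ, 0 < δ₀ ∧ δ₀ ≤ 1 ∧ ∃ A : ℝ, 0 ≤ A ∧ ∀ N : ℝ, 1 ≤ N → ∀ (δ C : ℝ) (W : ℝ → Rn 2 → ℂ),
      0 ≤ δ → δ ≤ δ₀ → FourierSol δ C W → wnorm (iwt N s) (W 0) ≤ ENNReal.ofReal R →
      |fourierEnergy (fun ξ => (imul N s ξ : ℂ) * W δ ξ) -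
        fourierEnergy (fun ξ => (imul N s ξ : ℂ) * W 0 ξ)| ≤ A * N ^ (-β) := by
  set ε : ℝ := min (1 / 10) ((3 / 2 - β) / 5) with hε
  have hε0 : 0 < ε := lt_min (by norm_num) (by linarith)
  have hε1 : ε ≤ 1 / 10 := min_le_left _ _
  have hε2 : ε ≤ (3 / 2 - β) / 5 := min_le_right _ _
  obtain ⟨K₁, hK₁, h₁⟩ := exists_enorm_resonant_le hε0 (by linarith)
  have hκ : 1 / 2 < min s (2 - β) := lt_min hs (by linarith)
  obtain ⟨K₂, hK₂, h₂⟩ := exists_goodWeight hκ (min_le_left _ _) hs1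
  obtain ⟨δ₀, hδ₀, hδ₀1, M, hM, hloc⟩ := exists_local_bound hK₂
    (ENNReal.ofReal_pos.mpr hR).ne' (ENNReal.ofReal_ne_top (r := R))
  set X := 4 * ENNReal.ofReal R with hX
  have hXT : X ≠ ⊤ := by finiteness
  set A := K₁ * (ENNReal.ofReal R + M) ^ 2 +
    ENNReal.ofReal (Real.exp 1) * (4 * K₂ * (X ^ 3 + 12 * (X ^ 2 * M))) with hA
  have hAT : A ≠ ⊤ := by finiteness
  refine ⟨δ₀, hδ₀, hδ₀1, A.toReal, ENNReal.toReal_nonneg, fun N hN δ C W h0 hδ hW hW0 => ?_⟩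
  obtain ⟨C', hflow⟩ := hW.exists_isFlow
  obtain ⟨hG, hout, hcomm⟩ := h₂ N hN
  obtain ⟨hb, hi⟩ := hloc _ hG δ C' _ _ hδ hflow
    (fun t ξ => by rw [enorm_tri_spin, enorm_neg_I_mul_spin]) (by rwa [wnorm_spin]) h0
  have hi' : ∫⁻ t in Icc 0 δ, wnorm (iwt N s) (mult (fun _ => 1) (W t)) ≤ M := by
    refine le_trans (le_of_eq (lintegral_congr fun t => ?_)) hi
    simp only [wnorm, wabs, enorm_neg_I_mul_spin]
  have hδ1 : δ ≤ 1 := hδ.trans hδ₀1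
  have t1 := h₁ N s hN (by linarith) hs1 (by linarith) δ C W hW h0 hδ1
  have t2 := hW.lintegral_mult_mul_le hN hs1 h0 hδ1 hG hout hcomm
    (fun t ht => by have := hb t ht; rwa [wnorm_spin] at this) hi'
  have hN0 : 0 ≤ N ^ (-β) := Real.rpow_nonneg (by linarith) _
  rw [← ENNReal.ofReal_le_ofReal_iff (by positivity), ENNReal.ofReal_mul ENNReal.toReal_nonneg,
    ENNReal.ofReal_toReal hAT]
  refine (hW.energy_increment_le hN hs1 h0).trans ((add_le_add t1 t2).trans ?_)
  rw [hA, add_mul]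
  have p1 : ENNReal.ofReal (N ^ (5 * ε - 3 / 2)) ≤ ENNReal.ofReal (N ^ (-β)) :=
    ENNReal.ofReal_le_ofReal (Real.rpow_le_rpow_of_exponent_le hN (by linarith))
  have p2 : ENNReal.ofReal (N ^ (min s (2 - β) - 2)) ≤ ENNReal.ofReal (N ^ (-β)) :=
    ENNReal.ofReal_le_ofReal (Real.rpow_le_rpow_of_exponent_le hN
      (by linarith [min_le_right s (2 - β)]))
  refine add_le_add ?_ ?_
  · rw [mul_right_comm]
    exact mul_le_mul' (mul_le_mul' le_rfl (pow_le_pow_left' (add_le_add hW0 hi') 2)) p1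
  · rw [mul_comm]
    exact mul_le_mul' le_rfl p2

lemma Rapid.imul_mul {N C : ℝ} (hN : 1 ≤ N) (hs1 : s < 1) {f : Rn 2 → ℂ} (hf : Rapid C f) :
    Rapid C fun ξ => (imul N s ξ : ℂ) * f ξ := by
  refine ⟨(Complex.continuous_ofReal.comp (continuous_imul (N := N) hs1)).mul hf.1, fun x => ?_⟩
  rw [norm_mul, Complex.norm_real, Real.norm_of_nonneg (imul_pos hN x).le]
  exact (mul_le_of_le_one_left (norm_nonneg _) (imul_le_one x)).trans (hf.2 x)

/-- Almost conservation of the modified energy over long times. -/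
theorem exists_energy_global (hs : 1 / 2 < s) (hs1 : s < 1) (hβ : β < 3 / 2) {E₀ : ℝ}
    (hE : 0 < E₀) :
    ∃ A : ℝ, 0 < A ∧ ∀ N : ℝ, 1 ≤ N → ∀ (τ C : ℝ) (W : ℝ → Rn 2 → ℂ), 0 ≤ τ → FourierSol τ C W →
      fourierEnergy (fun ξ => (imul N s ξ : ℂ) * W 0 ξ) ≤ E₀ → A * (1 + τ) ≤ N ^ β →
      fourierEnergy (fun ξ => (imul N s ξ : ℂ) * W τ ξ) ≤ 2 * E₀ := by
  obtain ⟨δ₀, hδ₀, hδ₀1, A, hA, hinc⟩ := exists_increment_le hs hs1 hβ (R := 4 * E₀) (by linarith)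
  refine ⟨2 * (A + 1) / (δ₀ * E₀), by positivity, fun N hN τ C W hτ hW hW0 hτN => ?_⟩
  set n : ℕ := ⌈τ / δ₀⌉₊ + 1 with hn
  have hn0 : (0 : ℝ) < n := by rw [hn]; positivity
  have hn1 : τ / δ₀ ≤ n := by
    rw [hn]; push_cast; linarith [Nat.le_ceil (τ / δ₀)]
  have hn2 : (n : ℝ) ≤ τ / δ₀ + 2 := by
    rw [hn]; push_cast; linarith [Nat.ceil_lt_add_one (div_nonneg hτ hδ₀.le)]
  set δ := τ / n with hδ
  have hδ0 : 0 ≤ δ := by positivity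
  have hδδ : δ ≤ δ₀ := by
    rw [hδ, div_le_iff₀ hn0, mul_comm]
    exact (div_le_iff₀ hδ₀).mp hn1
  have hnδ : n * δ = τ := by rw [hδ]; field_simp
  have hNβ : 0 < N ^ (-β) := Real.rpow_pos_of_pos (by linarith) _
  have hNN : N ^ β * N ^ (-β) = 1 := by
    rw [← Real.rpow_add (by linarith)]; simp
  set a := A * N ^ (-β) with ha
  have ha0 : 0 ≤ a := by positivity
  have hsum : n * a ≤ E₀ := by
    have h1 : (n : ℝ) * δ₀ ≤ 2 * (1 + τ) := by
      calc (n : ℝ) * δ₀ ≤ (τ / δ₀ + 2) * δ₀ := mul_le_mul_of_nonneg_right hn2 hδ₀.le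
        _ = τ + 2 * δ₀ := by field_simp
        _ ≤ _ := by linarith
    have h2 : 2 * (A + 1) * (1 + τ) ≤ N ^ β * (δ₀ * E₀) := by
      rwa [div_mul_eq_mul_div, div_le_iff₀ (by positivity)] at hτN
    refine le_of_mul_le_mul_right ?_ hδ₀
    calc n * a * δ₀ = A * (n * δ₀) * N ^ (-β) := by rw [ha]; ring
      _ ≤ (A + 1) * (2 * (1 + τ)) * N ^ (-β) := by gcongr; linarith
      _ = 2 * (A + 1) * (1 + τ) * N ^ (-β) := by ring
      _ ≤ N ^ β * (δ₀ * E₀) * N ^ (-β) := by gcongr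
      _ = N ^ β * N ^ (-β) * (E₀ * δ₀) := by ring
      _ = E₀ * δ₀ := by rw [hNN, one_mul]
  have key : ∀ k : ℕ, k ≤ n →
      fourierEnergy (fun ξ => (imul N s ξ : ℂ) * W (k * δ) ξ) ≤ E₀ + k * a := by
    intro k
    induction k with
    | zero => intro _; simpa using hW0
    | succ k ih =>
      intro hk
      have ih' := ih (by omega)
      have hk' : (k : ℝ) + 1 ≤ n := by exact_mod_cast hk
      have h1 : (k : ℝ) * a ≤ n * a := by gcongr; linarith
      have hsh : FourierSol δ C fun t => W (k * δ + t) := hW.shift (by positivity) (by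
        rw [← hnδ]; nlinarith)
      have := hinc N hN δ C _ hδ0 hδδ hsh (by
        rw [wnorm_iwt_eq hN]
        refine (wnorm_jap_le_energy ((hsh.rapid 0).imul_mul hN hs1)).trans
          (ENNReal.ofReal_le_ofReal ?_)
        simp only [add_zero]
        linarith)
      simp only [add_zero] at this
      have h2 := (abs_le.mp this).2
      push_cast
      rw [show ((k : ℝ) + 1) * δ = k * δ + δ by ring]
      linarith
  have := key n le_rfl
  rw [hnδ] at this
  linarith

end iteration

/-! ### The Fourier transform of the nonlinearity -/

lemma integrable_conj {f : Rn 2 → ℂ} (hf : Integrable f) : Integrable fun x => conj (f x) :=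
  hf.mono (Complex.continuous_conj.comp_aestronglyMeasurable hf.aestronglyMeasurable)
    (Filter.Eventually.of_forall fun x => by simp)

lemma fourier_eq_integral_cexp (f : Rn 2 → ℂ) (ξ : Rn 2) :
    𝓕 f ξ = ∫ x, Complex.exp (((-2 * Real.pi * ⟪x, ξ⟫ : ℝ) : ℂ) * I) * f x := by
  simp only [Real.fourier_eq', smul_eq_mul]

lemma fourier_conj (f : Rn 2 → ℂ) (ξ : Rn 2) :
    𝓕 (fun x => conj (f x)) ξ = conj (𝓕 f (-ξ)) := by
  rw [fourier_eq_integral_cexp, fourier_eq_integral_cexp, ← integral_conj]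
  refine integral_congr_ae (Filter.Eventually.of_forall fun x => ?_)
  simp only [map_mul, ← Complex.exp_conj, Complex.conj_ofReal, Complex.conj_I, inner_neg_right]
  congr 2
  push_cast
  ring

/-- The Fourier transform turns a product into a convolution. -/
lemma fourier_mul {f h : Rn 2 → ℂ} (hf : Continuous f) (hfi : Integrable f)
    (hFi : Integrable (𝓕 f)) (hh : Integrable h) (ξ : Rn 2) :
    𝓕 (fun x => f x * h x) ξ = ∫ a, 𝓕 f a * 𝓕 h (ξ - a) := by
  have hinv : ∀ x, f x = ∫ a, Complex.exp (((2 * Real.pi * ⟪a, x⟫ : ℝ) : ℂ) * I) * 𝓕 f a := by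
    intro x
    conv_lhs => rw [← hf.fourierInv_fourier_eq hfi hFi]
    simp only [Real.fourierInv_eq', smul_eq_mul]
  have h1 : 𝓕 (fun x => f x * h x) ξ = ∫ x, ∫ a,
      Complex.exp (((-2 * Real.pi * ⟪x, ξ - a⟫ : ℝ) : ℂ) * I) * (h x * 𝓕 f a) := by
    rw [fourier_eq_integral_cexp]
    refine integral_congr_ae (Filter.Eventually.of_forall fun x => ?_)
    simp only
    rw [hinv x, ← integral_mul_const, ← integral_const_mul]
    refine integral_congr_ae (Filter.Eventually.of_forall fun a => ?_)
    simp only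
    have : Complex.exp (((-2 * Real.pi * ⟪x, ξ - a⟫ : ℝ) : ℂ) * I)
        = Complex.exp (((-2 * Real.pi * ⟪x, ξ⟫ : ℝ) : ℂ) * I)
          * Complex.exp (((2 * Real.pi * ⟪a, x⟫ : ℝ) : ℂ) * I) := by
      rw [← Complex.exp_add, inner_sub_right, real_inner_comm x a]
      congr 1
      push_cast
      ring
    rw [this]
    ring
  rw [h1, integral_integral_swap]
  · refine integral_congr_ae (Filter.Eventually.of_forall fun a => ?_)
    simp only
    rw [fourier_eq_integral_cexp h, ← integral_const_mul]
    refine integral_congr_ae (Filter.Eventually.of_forall fun x => ?_)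
    simp only
    ring
  · refine (hh.mul_prod hFi).bdd_mul (c := 1) ?_ ?_
    · exact Continuous.aestronglyMeasurable (by fun_prop)
    · refine Filter.Eventually.of_forall fun p => ?_
      rw [Complex.norm_exp_ofReal_mul_I]

/-- The Fourier transform of the cubic nonlinearity. -/
lemma SchwartzMap.fourier_normSq_mul (f : SchwartzMap (Rn 2) ℂ) {C : ℝ}
    (hF : Rapid C (𝓕 (f : Rn 2 → ℂ))) (ξ : Rn 2) :
    𝓕 (fun x => (‖f x‖ : ℂ) ^ 2 * f x) ξ = mult (fun _ => 1) (𝓕 (f : Rn 2 → ℂ)) ξ := by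
  have hFi : Integrable (𝓕 (f : Rn 2 → ℂ)) := hF.integrable
  have hfi : Integrable (f : Rn 2 → ℂ) := f.integrable
  have hci : Integrable fun x => conj (f x) := integrable_conj hfi
  have hcF : Integrable (𝓕 fun x => conj (f x)) := by
    have : (𝓕 fun x => conj (f x)) = fun ξ => conj (𝓕 (f : Rn 2 → ℂ) (-ξ)) := by
      funext ξ
      exact fourier_conj _ _
    rw [this]
    exact integrable_conj hFi.comp_neg
  obtain ⟨K, hK⟩ := f.decay 0 0
  have hprod : Integrable fun x => conj (f x) * f x := by
    refine hfi.bdd_mul (c := K) hci.aestronglyMeasurable (Filter.Eventually.of_forall fun x => ?_)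
    simpa using hK.2 x
  have h1 : (fun x => (‖f x‖ : ℂ) ^ 2 * f x) = fun x => f x * (conj (f x) * f x) := by
    funext x
    rw [← Complex.conj_mul']
    ring
  have h2 : ∀ η, 𝓕 (fun x => conj (f x) * f x) η
      = ∫ b, conj (𝓕 (f : Rn 2 → ℂ) b) * 𝓕 (f : Rn 2 → ℂ) (η + b) := by
    intro η
    rw [fourier_mul (f := fun x => conj (f x)) (Complex.continuous_conj.comp f.continuous) hci
        hcF hfi,
      ← integral_neg_eq_self]
    refine integral_congr_ae (Filter.Eventually.of_forall fun b => ?_)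
    simp only [fourier_conj, neg_neg, sub_neg_eq_add]
  rw [h1, fourier_mul f.continuous hfi hFi hprod]
  unfold mult cub
  rw [Measure.volume_eq_prod, integral_prod]
  · refine integral_congr_ae (Filter.Eventually.of_forall fun a => ?_)
    simp only
    rw [h2, ← integral_const_mul]
    refine integral_congr_ae (Filter.Eventually.of_forall fun b => ?_)
    simp only [Complex.ofReal_one, one_mul, mul_assoc]
  · exact integrable_sym_cub isSymbol_one hF hF hF ξ

/-! ### Solutions on the Fourier side -/

lemma le_decay_of_pow {a C₀ C₁ : ℝ} {m : ℕ} {x : Rn 2} (ha : 0 ≤ a) (h0 : a ≤ C₀)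
    (h1 : ‖x‖ ^ m * a ≤ C₁) : a ≤ 2 ^ (m - 1) * (C₀ + C₁) * decay m x := by
  have hj : jap x ≤ 1 + ‖x‖ := by
    have := norm_nonneg x
    refine abs_le_of_sq_le_sq' ?_ (by positivity) |>.2
    rw [jap_sq]
    nlinarith
  have h2 : jap x ^ m ≤ 2 ^ (m - 1) * (1 + ‖x‖ ^ m) :=
    (pow_le_pow_left₀ (jap_pos x).le hj m).trans
      (by simpa using add_pow_le zero_le_one (norm_nonneg x) m)
  unfold decay
  rw [← div_eq_mul_inv, le_div_iff₀ (pow_pos (jap_pos x) m)]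
  calc a * jap x ^ m ≤ a * (2 ^ (m - 1) * (1 + ‖x‖ ^ m)) := by gcongr
    _ = 2 ^ (m - 1) * (a + ‖x‖ ^ m * a) := by ring
    _ ≤ _ := by gcongr

lemma norm_laplacian_le {f : Rn 2 → ℂ} (hf : ContDiff ℝ (⊤ : ℕ∞) f) (x : Rn 2) :
    ‖laplacian f x‖ ≤ 2 * ‖iteratedFDeriv ℝ 2 f x‖ := by
  have hd : DifferentiableAt ℝ (fderiv ℝ f) x :=
    (hf.fderiv_right (m := 1) (by norm_cast)).differentiable (by norm_num) x
  have h1 : ∀ i : Fin 2, fderiv ℝ (fun y => fderiv ℝ f y (EuclideanSpace.single i 1)) x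
      (EuclideanSpace.single i 1)
      = iteratedFDeriv ℝ 2 f x fun _ => EuclideanSpace.single i 1 := by
    intro i
    rw [iteratedFDeriv_two_apply, fderiv_clm_apply hd (differentiableAt_const _)]
    simp
  unfold laplacian
  refine (norm_sum_le _ _).trans ?_
  have h2 : ∀ i ∈ Finset.univ, ‖fderiv ℝ (fun y => fderiv ℝ f y (EuclideanSpace.single i 1)) x
      (EuclideanSpace.single (i : Fin 2) 1)‖ ≤ ‖iteratedFDeriv ℝ 2 f x‖ := by
    intro i _
    rw [h1]
    refine (ContinuousMultilinearMap.le_opNorm _ _).trans ?_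
    simp
  simpa using Finset.sum_le_sum h2

/-- The Fourier transform of a second partial derivative. -/
lemma SchwartzMap.fourier_fderiv_fderiv (f : SchwartzMap (Rn 2) ℂ) (e ξ : Rn 2) :
    𝓕 (fun x => fderiv ℝ (fun y => fderiv ℝ f y e) x e) ξ
      = -((4 * Real.pi ^ 2 * ⟪ξ, e⟫ ^ 2 : ℝ) : ℂ) * 𝓕 (f : Rn 2 → ℂ) ξ := by
  have h1 : (fun x => fderiv ℝ (fun y => fderiv ℝ f y e) x e)
      = LineDeriv.lineDerivOp e (LineDeriv.lineDerivOp e f) := by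
    funext x
    rw [SchwartzMap.lineDerivOp_apply_eq_fderiv]
    congr 3
  have hg : (fun x : Rn 2 => ⟪x, e⟫).HasTemperateGrowth :=
    ((innerSL ℝ).flip e).hasTemperateGrowth
  rw [h1, ← SchwartzMap.fourier_coe, SchwartzMap.fourier_lineDerivOp_eq,
    SchwartzMap.fourier_lineDerivOp_eq]
  simp only [smul_apply, SchwartzMap.smulLeftCLM_apply_apply hg, smul_eq_mul,
    Complex.real_smul, SchwartzMap.fourier_coe]
  push_cast
  linear_combination (4 * (Real.pi : ℂ) ^ 2 * (⟪ξ, e⟫ : ℂ) ^ 2 * 𝓕 (f : Rn 2 → ℂ) ξ) * Complex.I_sq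

lemma SchwartzMap.integrable_fderiv_fderiv (f : SchwartzMap (Rn 2) ℂ) (e : Rn 2) :
    Integrable fun x => fderiv ℝ (fun y => fderiv ℝ f y e) x e := by
  have h1 : (fun x => fderiv ℝ (fun y => fderiv ℝ f y e) x e)
      = LineDeriv.lineDerivOp e (LineDeriv.lineDerivOp e f) := by
    funext x
    rw [SchwartzMap.lineDerivOp_apply_eq_fderiv]
    congr 3
  rw [h1]
  exact SchwartzMap.integrable _

lemma fourier_add_apply {f g : Rn 2 → ℂ} (hf : Integrable f) (hg : Integrable g) (ξ : Rn 2) :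
    𝓕 (fun x => f x + g x) ξ = 𝓕 f ξ + 𝓕 g ξ := by
  simp only [Real.fourier_eq]
  rw [← integral_add]
  · simp only [smul_add]
  · exact (Real.fourierIntegral_convergent_iff ξ).2 hf
  · exact (Real.fourierIntegral_convergent_iff ξ).2 hg

/-- The Fourier transform of the Laplacian. -/
lemma SchwartzMap.fourier_laplacian (f : SchwartzMap (Rn 2) ℂ) (ξ : Rn 2) :
    𝓕 (laplacian f) ξ = -((4 * Real.pi ^ 2 * ‖ξ‖ ^ 2 : ℝ) : ℂ) * 𝓕 (f : Rn 2 → ℂ) ξ := by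
  have : laplacian (f : Rn 2 → ℂ) = fun x =>
      fderiv ℝ (fun y => fderiv ℝ f y (EuclideanSpace.single 0 1)) x (EuclideanSpace.single 0 1)
      + fderiv ℝ (fun y => fderiv ℝ f y (EuclideanSpace.single 1 1)) x
        (EuclideanSpace.single 1 1) := by
    funext x
    simp only [laplacian, Fin.sum_univ_two]
  rw [this, fourier_add_apply (f.integrable_fderiv_fderiv _) (f.integrable_fderiv_fderiv _),
    f.fourier_fderiv_fderiv, f.fourier_fderiv_fderiv, EuclideanSpace.real_norm_sq_eq]
  simp only [EuclideanSpace.inner_single_right, Fin.sum_univ_two, one_mul, conj_trivial]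
  push_cast
  ring

lemma SchwartzMap.integrable_laplacian (f : SchwartzMap (Rn 2) ℂ) :
    Integrable (laplacian (f : Rn 2 → ℂ)) := by
  unfold laplacian
  exact integrable_finsetSum _ fun i _ => f.integrable_fderiv_fderiv _

lemma continuous_laplacian_slice {G : Rn 2 × ℝ → ℂ} (hG : ContDiff ℝ (⊤ : ℕ∞) G) :
    Continuous fun p : Rn 2 × ℝ => laplacian (fun y => G (y, p.2)) p.1 := by
  have key : ∀ (e : Rn 2) (H : Rn 2 × ℝ → ℂ), ContDiff ℝ (⊤ : ℕ∞) H →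
      ContDiff ℝ (⊤ : ℕ∞) fun p : Rn 2 × ℝ => fderiv ℝ (fun y => H (y, p.2)) p.1 e := by
    intro e H hH
    refine ContDiff.clm_apply (ContDiff.fderiv (m := (⊤ : ℕ∞))
      (f := fun (p : Rn 2 × ℝ) (y : Rn 2) => H (y, p.2)) ?_ contDiff_fst (by norm_cast))
      contDiff_const
    exact hH.comp (f := fun q : (Rn 2 × ℝ) × Rn 2 => (q.2, q.1.2)) (by fun_prop)
  unfold laplacian
  refine continuous_finsetSum _ fun i _ => ?_
  exact (key _ _ (key (EuclideanSpace.single i 1) G hG)).continuous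

/-- Uniform decay of the Fourier transform of a bounded family of Schwartz functions. -/
lemma exists_rapid_fourier {S : ℝ → SchwartzMap (Rn 2) ℂ}
    (hS : ∀ l m : ℕ, ∃ C : ℝ, ∀ t x, ‖iteratedFDeriv ℝ l (S t) x‖ ≤ C * decay m x) :
    ∃ C, ∀ t, Rapid C (𝓕 (S t : Rn 2 → ℂ)) := by
  choose C hC using fun l => hS l 3
  have hb : ∀ n t w, ‖w‖ ^ n * ‖𝓕 (S t : Rn 2 → ℂ) w‖
      ≤ 2 ^ n * ∑ i ∈ Finset.range (n + 1), ∫ v : Rn 2, C i * decay 3 v := by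
    intro n t w
    have := Real.pow_mul_norm_iteratedFDeriv_fourier_le (K := ⊤) (N := ⊤)
      ((S t).smooth ⊤) (fun k n _ _ => (S t).integrable_pow_mul_iteratedFDeriv volume k n)
      (k := 0) (n := n) le_top le_top w
    simp only [norm_iteratedFDeriv_zero, pow_zero, one_mul, zero_add, Finset.range_one,
      Finset.singleton_product, Finset.sum_map, Function.Embedding.coeFn_mk, Nat.cast_zero,
      mul_zero] at this
    refine this.trans ?_
    refine mul_le_mul_of_nonneg_left (Finset.sum_le_sum fun i _ => ?_) (by positivity)
    refine integral_mono ?_ ((integrable_decay le_rfl).const_mul _) fun v => hC i t v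
    simpa using (S t).integrable_pow_mul_iteratedFDeriv volume 0 i
  refine ⟨_, fun t => ⟨?_, fun ξ => le_decay_of_pow (norm_nonneg _)
    (by simpa using hb 0 t ξ) (hb 8 t ξ)⟩⟩
  rw [← SchwartzMap.fourier_coe]
  exact SchwartzMap.continuous _

section transfer
variable {T : ℝ} {φ : Rn 2 → ℝ → ℂ} {φ₀ : Rn 2 → ℂ}

/-- The time slices of a solution, frozen outside the time interval, as Schwartz functions. -/
lemma IsNLSSolution.exists_slice (h : IsNLSSolution 2 T φ φ₀) (hT : 0 ≤ T) :
    ∃ S : ℝ → SchwartzMap (Rn 2) ℂ, (∀ t, (S t : Rn 2 → ℂ) = fun x => φ x (max 0 (min T t))) ∧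
      ∀ l m : ℕ, ∃ C : ℝ, ∀ t x, ‖iteratedFDeriv ℝ l (S t) x‖ ≤ C * decay m x := by
  have hc : ∀ t, max 0 (min T t) ∈ Icc 0 T := fun t =>
    ⟨le_max_left _ _, max_le hT (min_le_left _ _)⟩
  refine ⟨fun t => ⟨fun x => φ x (max 0 (min T t)),
    h.1.comp (f := fun x : Rn 2 => (x, max 0 (min T t))) (by fun_prop), fun k l => ?_⟩,
    fun t => rfl, fun l m => ?_⟩
  · obtain ⟨C, hC⟩ := h.2.1 k l
    exact ⟨C, fun x => hC _ (hc t) x⟩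
  · obtain ⟨C₀, h0⟩ := h.2.1 0 l
    obtain ⟨C₁, h1⟩ := h.2.1 m l
    exact ⟨_, fun t x => le_decay_of_pow (norm_nonneg _)
      ((one_mul _).symm.trans_le ((congrArg (· * _) (pow_zero ‖x‖)).symm.trans_le
        (h0 _ (hc t) x))) (h1 _ (hc t) x)⟩

/-- The Fourier transform of a solution solves the cubic equation on the frequency side. -/
lemma IsNLSSolution.exists_fourier (h : IsNLSSolution 2 T φ φ₀) (hT : 0 ≤ T) :
    ∃ (C : ℝ) (U : ℝ → Rn 2 → ℂ), Continuous (Function.uncurry U) ∧ (∀ t, Rapid C (U t)) ∧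
      (∀ t ∈ Icc 0 T, U t = 𝓕 fun x => φ x t) ∧ ∀ t ∈ Ioo 0 T, ∀ ξ,
        HasDerivAt (fun s => U s ξ) (-I * (((4 * Real.pi ^ 2 * ‖ξ‖ ^ 2 : ℝ) : ℂ) * U t ξ
          + mult (fun _ => 1) (U t) ξ)) t := by
  obtain ⟨S, hS, hSd⟩ := h.exists_slice hT
  obtain ⟨C, hC⟩ := exists_rapid_fourier hSd
  obtain ⟨K, hK⟩ := hSd 0 3
  obtain ⟨K₂, hK₂⟩ := hSd 2 3
  have hK' : ∀ t x, ‖S t x‖ ≤ K * decay 3 x := fun t x => by simpa using hK t x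
  have hK0 : 0 ≤ K := by
    have := (norm_nonneg _).trans (hK' 0 0)
    exact nonneg_of_mul_nonneg_left this (decay_pos 3 0)
  have hK20 : 0 ≤ K₂ := by
    have := (norm_nonneg _).trans (hK₂ 0 0)
    exact nonneg_of_mul_nonneg_left this (decay_pos 3 0)
  have hSc : Continuous fun p : ℝ × Rn 2 => S p.1 p.2 := by
    simp only [hS]
    exact h.1.continuous.comp (f := fun p : ℝ × Rn 2 => (p.2, max 0 (min T p.1))) (by fun_prop)
  have hLc : Continuous fun p : ℝ × Rn 2 => laplacian (S p.1) p.2 := by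
    simp only [hS]
    exact (continuous_laplacian_slice h.1).comp
      (f := fun p : ℝ × Rn 2 => (p.2, max 0 (min T p.1))) (by fun_prop)
  refine ⟨C, fun t => 𝓕 (S t : Rn 2 → ℂ), ?_, hC, fun t ht => ?_, fun t ht ξ => ?_⟩
  · have : Continuous fun q : ℝ × Rn 2 => ∫ x, Complex.exp
        (((-2 * Real.pi * ⟪x, q.2⟫ : ℝ) : ℂ) * I) * S q.1 x := by
      refine continuous_integral_of_le (b := fun x => K * decay 3 x)
        (F := fun (q : ℝ × Rn 2) x => Complex.exp
          (((-2 * Real.pi * ⟪x, q.2⟫ : ℝ) : ℂ) * I) * S q.1 x) ?_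
        ((integrable_decay le_rfl).const_mul _) fun q x => ?_
      · have h1 : Continuous fun p : (ℝ × Rn 2) × Rn 2 => Complex.exp
          (((-2 * Real.pi * ⟪p.2, p.1.2⟫ : ℝ) : ℂ) * I) := by fun_prop
        exact h1.mul (hSc.comp (f := fun p : (ℝ × Rn 2) × Rn 2 => (p.1.1, p.2)) (by fun_prop))
      · rw [norm_mul, Complex.norm_exp_ofReal_mul_I, one_mul]
        exact hK' q.1 x
    refine this.congr fun q => ?_
    simp only [Function.uncurry, fourier_eq_integral_cexp]
  · simp only [hS]
    rw [min_eq_right ht.2, max_eq_right ht.1]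
  · have hcub : ∀ t x, ‖(‖S t x‖ : ℂ) ^ 2 * S t x‖ ≤ K ^ 3 * decay 3 x := by
      intro t x
      have h2 : ‖S t x‖ ≤ K := (hK' t x).trans (mul_le_of_le_one_right hK0 (decay_le_one 3 x))
      rw [norm_mul, norm_pow, Complex.norm_real, norm_norm]
      calc ‖S t x‖ ^ 2 * ‖S t x‖ ≤ K ^ 2 * (K * decay 3 x) := by
            gcongr
            exact hK' t x
        _ = _ := by ring
    have hcubc : Continuous fun p : ℝ × Rn 2 => (‖S p.1 p.2‖ : ℂ) ^ 2 * S p.1 p.2 := by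
      fun_prop
    have hlap : ∀ t x, ‖laplacian (S t) x‖ ≤ 2 * K₂ * decay 3 x := by
      intro t x
      refine (norm_laplacian_le ((S t).smooth ⊤) x).trans ?_
      linarith [hK₂ t x]
    have hd0 : ∀ x, 0 < decay 3 x := decay_pos 3
    have hder := hasDerivAt_integral_of_le (δ := T)
      (b := fun x => (K + K ^ 3 + 2 * K₂) * decay 3 x)
      (F := fun t x => Complex.exp (((-2 * Real.pi * ⟪x, ξ⟫ : ℝ) : ℂ) * I) * S t x)
      (F' := fun t x => Complex.exp (((-2 * Real.pi * ⟪x, ξ⟫ : ℝ) : ℂ) * I) *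
        (-I * ((‖S t x‖ : ℂ) ^ 2 * S t x - laplacian (S t) x))) ?_ ?_
      ((integrable_decay le_rfl).const_mul _) (fun t x => ?_) (fun t x => ?_) ?_ ht
    · have hcint : Integrable fun x => (‖S t x‖ : ℂ) ^ 2 * S t x :=
        integrable_of_le (hcubc.comp (f := fun x => (t, x)) (by fun_prop))
          ((integrable_decay le_rfl).const_mul _) (hcub t)
      have hval : ∫ x, Complex.exp (((-2 * Real.pi * ⟪x, ξ⟫ : ℝ) : ℂ) * I) *
          (-I * ((‖S t x‖ : ℂ) ^ 2 * S t x - laplacian (S t) x))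
          = -I * (𝓕 (fun x => (‖S t x‖ : ℂ) ^ 2 * S t x) ξ - 𝓕 (laplacian (S t)) ξ) := by
        rw [fourier_eq_integral_cexp, fourier_eq_integral_cexp, ← integral_sub,
          ← integral_const_mul]
        · refine integral_congr_ae (Filter.Eventually.of_forall fun x => ?_)
          simp only
          ring
        · refine hcint.bdd_mul (c := 1) (Continuous.aestronglyMeasurable (by fun_prop))
            (Filter.Eventually.of_forall fun x => ?_)
          rw [Complex.norm_exp_ofReal_mul_I]
        · refine (S t).integrable_laplacian.bdd_mul (c := 1)
            (Continuous.aestronglyMeasurable (by fun_prop))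
            (Filter.Eventually.of_forall fun x => ?_)
          rw [Complex.norm_exp_ofReal_mul_I]
      rw [hval, (S t).fourier_normSq_mul (hC t), (S t).fourier_laplacian] at hder
      refine (hder.congr_deriv ?_).congr_of_eventuallyEq
        (Filter.Eventually.of_forall fun s => fourier_eq_integral_cexp _ _)
      ring
    · have h1 : Continuous fun p : ℝ × Rn 2 => Complex.exp
          (((-2 * Real.pi * ⟪p.2, ξ⟫ : ℝ) : ℂ) * I) := by fun_prop
      exact h1.mul hSc
    · have h1 : Continuous fun p : ℝ × Rn 2 => Complex.exp
          (((-2 * Real.pi * ⟪p.2, ξ⟫ : ℝ) : ℂ) * I) := by fun_prop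
      exact h1.mul (continuous_const.mul (hcubc.sub hLc))
    · rw [norm_mul, Complex.norm_exp_ofReal_mul_I, one_mul]
      refine (hK' t x).trans (mul_le_mul_of_nonneg_right ?_ (hd0 x).le)
      have : 0 ≤ K ^ 3 := by positivity
      linarith
    · rw [norm_mul, Complex.norm_exp_ofReal_mul_I, one_mul, norm_mul, norm_neg, Complex.norm_I,
        one_mul]
      refine (norm_sub_le _ _).trans ((add_le_add (hcub t x) (hlap t x)).trans ?_)
      have := mul_nonneg hK0 (hd0 x).le
      linarith
    · intro t ht x
      have hcl : max 0 (min T t) = t := by rw [min_eq_right ht.2.le, max_eq_right ht.1.le]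
      have hφ : DifferentiableAt ℝ (fun t' => φ x t') t := by
        have : ContDiff ℝ (⊤ : ℕ∞) fun t' => φ x t' :=
          h.1.comp (f := fun t' : ℝ => (x, t')) (by fun_prop)
        exact this.differentiable (by simp) t
      have hpde := h.2.2.1 x t ⟨ht.1.le, ht.2.le⟩
      have hev : (fun s => S s x) =ᶠ[𝓝 t] fun t' => φ x t' := by
        filter_upwards [isOpen_Ioo.mem_nhds ht] with r hr
        rw [hS]
        simp only
        rw [min_eq_right hr.2.le, max_eq_right hr.1.le]
      refine ((hφ.hasDerivAt.congr_of_eventuallyEq hev).const_mul _).congr_deriv ?_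
      congr 1
      rw [hS]
      simp only [hcl]
      linear_combination (-I) * hpde + deriv (fun t' => φ x t') t * Complex.I_sq

end transfer

section dilation
variable {l : ℝ}

/-- The cubic Fourier integral under dilations. -/
lemma mult_one_dilate (hl : 0 < l) (c : ℝ) (f : Rn 2 → ℂ) (ξ : Rn 2) :
    mult (fun _ => 1) (fun η => (c : ℂ) * f (l • η)) ξ
      = ((c ^ 3 * (l ^ 4)⁻¹ : ℝ) : ℂ) * mult (fun _ => 1) f (l • ξ) := by
  have : (volume : Measure (Rn 2 × Rn 2)).IsAddHaarMeasure := by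
    rw [Measure.volume_eq_prod]
    infer_instance
  have h := Measure.integral_comp_smul (volume : Measure (Rn 2 × Rn 2))
    (fun p => cub f f f (l • ξ) p) l
  have hd : Module.finrank ℝ (Rn 2 × Rn 2) = 4 := by simp
  rw [hd, abs_of_pos (by positivity)] at h
  unfold mult
  simp only [Complex.ofReal_one, one_mul]
  rw [Complex.ofReal_mul, mul_assoc, ← Complex.real_smul (x := (l ^ 4)⁻¹), ← h,
    ← integral_const_mul]
  refine integral_congr_ae (Filter.Eventually.of_forall fun p => ?_)
  simp only [cub, Prod.smul_fst, Prod.smul_snd, smul_add, smul_sub, map_mul, Complex.conj_ofReal]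
  push_cast
  ring

/-- The parabolic rescaling of a flow on the frequency side, with the constants that turn the
symbol `4π²‖ξ‖²` into `‖ξ‖²`. -/
def dilate (l : ℝ) (U : ℝ → Rn 2 → ℂ) (τ : ℝ) (ξ : Rn 2) : ℂ :=
  ((l / (2 * Real.pi) : ℝ) : ℂ) * U (τ / (4 * Real.pi ^ 2 * l ^ 2)) (l • ξ)

lemma jap_le_jap_smul (hl : 1 ≤ l) (ξ : Rn 2) : jap ξ ≤ jap (l • ξ) := by
  refine abs_le_of_sq_le_sq' ?_ (jap_pos _).le |>.2
  rw [jap_sq, jap_sq, norm_smul, Real.norm_of_nonneg (by linarith), mul_pow]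
  have := one_le_pow₀ hl (n := 2)
  nlinarith [sq_nonneg ‖ξ‖]

lemma jap_smul_le (hl : 1 ≤ l) (ξ : Rn 2) : jap (l • ξ) ≤ l * jap ξ := by
  have := jap_pos ξ
  refine abs_le_of_sq_le_sq' ?_ (by positivity) |>.2
  rw [mul_pow, jap_sq, jap_sq, norm_smul, Real.norm_of_nonneg (by linarith), mul_pow]
  nlinarith [one_le_pow₀ hl (n := 2)]

lemma fourierSol_dilate (hl : 1 ≤ l) {T C : ℝ} {U : ℝ → Rn 2 → ℂ}
    (hc : Continuous (Function.uncurry U)) (hr : ∀ t, Rapid C (U t))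
    (hd : ∀ t ∈ Ioo 0 T, ∀ ξ, HasDerivAt (fun s => U s ξ)
      (-I * (((4 * Real.pi ^ 2 * ‖ξ‖ ^ 2 : ℝ) : ℂ) * U t ξ + mult (fun _ => 1) (U t) ξ)) t) :
    FourierSol (4 * Real.pi ^ 2 * l ^ 2 * T) (l / (2 * Real.pi) * C) (dilate l U) := by
  have hl0 : 0 < l := by linarith
  have hpi := Real.pi_pos
  have hκ : 0 < 4 * Real.pi ^ 2 * l ^ 2 := by positivity
  have hcont : Continuous (Function.uncurry (dilate l U)) := by
    refine continuous_const.mul (hc.comp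
      (f := fun p : ℝ × Rn 2 => (p.1 / (4 * Real.pi ^ 2 * l ^ 2), l • p.2)) (by fun_prop))
  refine ⟨hcont, fun t => ⟨hcont.comp (f := fun ξ => (t, ξ)) (by fun_prop), fun ξ => ?_⟩,
    fun τ hτ ξ => ?_⟩
  · have hC := (hr 0).nonneg
    have hdec : decay 8 (l • ξ) ≤ decay 8 ξ := by
      unfold decay
      have := jap_pos ξ
      gcongr
      exact jap_le_jap_smul hl ξ
    rw [dilate, norm_mul, Complex.norm_real, Real.norm_of_nonneg (by positivity),
      mul_assoc (l / (2 * Real.pi)) C]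
    have hU : ‖U (t / (4 * Real.pi ^ 2 * l ^ 2)) (l • ξ)‖ ≤ C * decay 8 ξ :=
      ((hr _).2 _).trans (mul_le_mul_of_nonneg_left hdec hC)
    exact mul_le_mul_of_nonneg_left hU (by positivity)
  · have ht : τ / (4 * Real.pi ^ 2 * l ^ 2) ∈ Ioo 0 T :=
      ⟨div_pos hτ.1 hκ, (div_lt_iff₀ hκ).2 (by linarith [hτ.2])⟩
    have h1 := ((hd _ ht (l • ξ)).scomp τ
      ((hasDerivAt_id τ).div_const (4 * Real.pi ^ 2 * l ^ 2))).const_mul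
        ((l / (2 * Real.pi) : ℝ) : ℂ)
    refine h1.congr_deriv ?_
    have h2 : mult (fun _ => 1) (dilate l U τ) ξ = _ :=
      mult_one_dilate hl0 (l / (2 * Real.pi)) (U (τ / (4 * Real.pi ^ 2 * l ^ 2))) ξ
    rw [h2, dilate, norm_smul, Real.norm_of_nonneg hl0.le, Complex.real_smul]
    have hl' : (l : ℂ) ≠ 0 := by exact_mod_cast hl0.ne'
    have hp' : (Real.pi : ℂ) ≠ 0 := by exact_mod_cast hpi.ne'
    push_cast
    field_simp
    ring

end dilation

section sobolevTransfer
variable {s l N C : ℝ}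

lemma sobNorm_sq (f : Rn 2 → ℂ) : sobNorm 2 s f ^ 2 = ∫ ξ, jap ξ ^ (2 * s) * ‖𝓕 f ξ‖ ^ 2 := by
  have h : 0 ≤ ∫ ξ, jap ξ ^ (2 * s) * ‖𝓕 f ξ‖ ^ 2 := integral_nonneg fun ξ => by
    have := jap_pos ξ
    positivity
  rw [sobNorm, ← Real.sqrt_eq_rpow, Real.sq_sqrt h]

lemma Rapid.integrable_sobolev {f : Rn 2 → ℂ} (hf : Rapid C f) (hs1 : s < 1) :
    Integrable fun ξ => jap ξ ^ (2 * s) * ‖f ξ‖ ^ 2 := by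
  refine hf.integrable_mul_normSq (g := fun ξ => jap ξ ^ (2 * s))
    (continuous_jap.rpow_const fun ξ => Or.inl (jap_pos ξ).ne')
    (fun ξ => Real.rpow_nonneg (jap_pos ξ).le _) fun ξ => ?_
  rw [← Real.rpow_natCast]
  refine Real.rpow_le_rpow_of_exponent_le (one_le_jap ξ) ?_
  push_cast
  linarith

lemma integral_dilate (hl : 0 < l) (g : Rn 2 → ℝ) : ∫ ξ, g (l • ξ) = (l ^ 2)⁻¹ * ∫ ξ, g ξ := by
  have hd : Module.finrank ℝ (Rn 2) = 2 := by simp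
  rw [Measure.integral_comp_smul, hd, abs_of_pos (by positivity), smul_eq_mul]

lemma jap_rpow_two_mul (ξ : Rn 2) : jap ξ ^ (2 * s) = (jap ξ ^ s) ^ 2 := by
  rw [← Real.rpow_natCast, ← Real.rpow_mul (jap_pos ξ).le, mul_comm]
  norm_num

lemma norm_imul_mul_sq (hN : 1 ≤ N) (c : ℝ) (ξ : Rn 2) (z : ℂ) :
    jap ξ ^ 2 * ‖(imul N s ξ : ℂ) * ((c : ℂ) * z)‖ ^ 2 = iwt N s ξ ^ 2 * (c ^ 2 * ‖z‖ ^ 2) := by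
  rw [norm_mul, norm_mul, Complex.norm_real, Complex.norm_real,
    Real.norm_of_nonneg (imul_pos hN ξ).le, mul_pow, mul_pow, Real.norm_eq_abs, sq_abs, iwt_eq]
  ring

lemma iwt_le_jap_dilate (hs0 : 0 < s) (hs1 : s < 1) (hN : 1 ≤ N) (hl : 1 ≤ l)
    (hlN : l ^ s = N ^ (1 - s)) (ξ : Rn 2) : iwt N s ξ ≤ 2 * jap (l • ξ) ^ s := by
  have hJ := jap_pos ξ
  have hJ1 : 1 ≤ jap (l • ξ) ^ s := Real.one_le_rpow (one_le_jap _) hs0.le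
  rcases le_total ‖ξ‖ 1 with h | h
  · have := iwt_le_jap (N := N) (s := s) ξ
    have := jap_le_one_add_norm ξ
    linarith
  · have h1 : l * jap ξ ≤ 2 * jap (l • ξ) := by
      have h2 := norm_le_jap (l • ξ)
      rw [norm_smul, Real.norm_of_nonneg (by linarith)] at h2
      have h3 := jap_le_one_add_norm ξ
      nlinarith
    calc iwt N s ξ ≤ N ^ (1 - s) * jap ξ ^ s := smoothWt_le_rpow hN hJ
      _ = (l * jap ξ) ^ s := by rw [← hlN, Real.mul_rpow (by linarith) hJ.le]
      _ ≤ (2 * jap (l • ξ)) ^ s := Real.rpow_le_rpow (by positivity) h1 hs0.le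
      _ = 2 ^ s * jap (l • ξ) ^ s := Real.mul_rpow (by norm_num) (jap_pos _).le
      _ ≤ 2 * jap (l • ξ) ^ s := by
        gcongr
        exact Real.rpow_le_self_of_one_le (by norm_num) hs1.le

/-- The rescaled and smoothed initial data are bounded in `H¹` by the `H^s` norm of the data. -/
lemma integral_imul_dilate_le (hs0 : 0 < s) (hs1 : s < 1) (hN : 1 ≤ N) (hl : 1 ≤ l)
    (hlN : l ^ s = N ^ (1 - s)) {f : Rn 2 → ℂ} (hf : Rapid C f) :
    ∫ ξ, jap ξ ^ 2 * ‖(imul N s ξ : ℂ) * (((l / (2 * Real.pi) : ℝ) : ℂ) * f (l • ξ))‖ ^ 2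
      ≤ ∫ ξ, jap ξ ^ (2 * s) * ‖f ξ‖ ^ 2 := by
  have hl0 : 0 < l := by linarith
  set P := ∫ ξ, jap ξ ^ (2 * s) * ‖f ξ‖ ^ 2 with hP
  have hP0 : 0 ≤ P := integral_nonneg fun ξ => by
    have := jap_pos ξ
    positivity
  have hscale := integral_dilate hl0 fun ξ => jap ξ ^ (2 * s) * ‖f ξ‖ ^ 2
  calc ∫ ξ, jap ξ ^ 2 * ‖(imul N s ξ : ℂ) * (((l / (2 * Real.pi) : ℝ) : ℂ) * f (l • ξ))‖ ^ 2
      ≤ ∫ ξ, (4 * (l / (2 * Real.pi)) ^ 2) * (jap (l • ξ) ^ (2 * s) * ‖f (l • ξ)‖ ^ 2) := by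
        refine integral_mono_of_nonneg (Filter.Eventually.of_forall fun ξ => by positivity)
          (((hf.integrable_sobolev hs1).comp_smul hl0.ne').const_mul _)
          (Filter.Eventually.of_forall fun ξ => ?_)
        simp only
        rw [norm_imul_mul_sq hN, jap_rpow_two_mul]
        have h1 := iwt_le_jap_dilate hs0 hs1 hN hl hlN ξ
        have h2 := pow_le_pow_left₀ (iwt_pos hN ξ).le h1 2
        calc iwt N s ξ ^ 2 * ((l / (2 * Real.pi)) ^ 2 * ‖f (l • ξ)‖ ^ 2)
            ≤ (2 * jap (l • ξ) ^ s) ^ 2 * ((l / (2 * Real.pi)) ^ 2 * ‖f (l • ξ)‖ ^ 2) := by gcongr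
          _ = _ := by ring
    _ = (Real.pi ^ 2)⁻¹ * P := by
        rw [integral_const_mul, hscale]
        have := Real.pi_pos
        field_simp
        ring
    _ ≤ P := by
        refine mul_le_of_le_one_left hP0 (inv_le_one_of_one_le₀ ?_)
        nlinarith [Real.pi_gt_three]

/-- The `H^s` norm is controlled by the rescaled and smoothed `H¹` norm. -/
lemma sobolev_le_integral_imul_dilate (hs0 : 0 < s) (hs1 : s < 1) (hN : 1 ≤ N) (hl : 1 ≤ l)
    {f : Rn 2 → ℂ} {C' : ℝ} (hf : Rapid C f)
    (hW : Rapid C' fun ξ => (imul N s ξ : ℂ) * (((l / (2 * Real.pi) : ℝ) : ℂ) * f (l • ξ))) :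
    ∫ ξ, jap ξ ^ (2 * s) * ‖f ξ‖ ^ 2 ≤ 4 * Real.pi ^ 2 * (l ^ s) ^ 2 *
      ∫ ξ, jap ξ ^ 2 * ‖(imul N s ξ : ℂ) * (((l / (2 * Real.pi) : ℝ) : ℂ) * f (l • ξ))‖ ^ 2 := by
  have hl0 : 0 < l := by linarith
  have hscale := integral_dilate hl0 fun ξ => jap ξ ^ (2 * s) * ‖f ξ‖ ^ 2
  rw [eq_comm, inv_mul_eq_iff_eq_mul₀ (by positivity)] at hscale
  rw [hscale, ← integral_const_mul, ← integral_const_mul]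
  refine integral_mono (((hf.integrable_sobolev hs1).comp_smul hl0.ne').const_mul _)
    ((hW.integrable_mul_normSq (continuous_jap.pow 2) (fun ξ => sq_nonneg (jap ξ))
      fun ξ => le_rfl).const_mul _) fun ξ => ?_
  simp only
  rw [norm_imul_mul_sq hN, jap_rpow_two_mul]
  have hJ := jap_pos ξ
  have hJl := jap_pos (l • ξ)
  have h1 : jap (l • ξ) ^ s ≤ l ^ s * iwt N s ξ := by
    calc jap (l • ξ) ^ s ≤ (l * jap ξ) ^ s :=
          Real.rpow_le_rpow hJl.le (jap_smul_le hl ξ) hs0.le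
      _ = l ^ s * jap ξ ^ s := Real.mul_rpow hl0.le hJ.le
      _ ≤ _ := by
        gcongr
        exact rpow_le_smoothWt hN hs1 (one_le_jap ξ)
  calc l ^ 2 * ((jap (l • ξ) ^ s) ^ 2 * ‖f (l • ξ)‖ ^ 2)
      ≤ l ^ 2 * ((l ^ s * iwt N s ξ) ^ 2 * ‖f (l • ξ)‖ ^ 2) := by gcongr
    _ = _ := by
      have := Real.pi_pos
      field_simp
      ring

end sobolevTransfer

/-! ### The polynomial bound -/

theorem exists_sobNorm_le {s : ℝ} (hs : 4 / 7 < s) (hs1 : s < 1) {B : ℝ} (hB : 0 < B) :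
    ∃ C : ℝ, 0 < C ∧ ∀ T : ℝ, 0 ≤ T → ∀ (φ₀ : SchwartzMap (Rn 2) ℂ), sobNorm 2 s φ₀ ≤ B →
      ∀ φ : Rn 2 → ℝ → ℂ, IsNLSSolution 2 T φ φ₀ →
        sobNorm 2 s (fun x => φ x T) ^ 2 ≤ C * (1 + T) ^ ((1 - s) / ((7 / 4) * s - 1)) := by
  have hs0 : 0 < s := by linarith
  have hpi := Real.pi_pos
  set γ : ℝ := 7 * s / 2 - 2 with hγ
  have hγ0 : 0 < γ := by rw [hγ]; linarith
  set β : ℝ := γ + 2 * ((1 - s) / s) with hβ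
  have hβ1 : β < 3 / 2 := by
    have h1 : β - 3 / 2 = (7 * s - 4) * (s - 1) / (2 * s) := by
      rw [hβ, hγ]
      field_simp
      ring
    have h2 : (7 * s - 4) * (s - 1) / (2 * s) < 0 :=
      div_neg_of_neg_of_pos (mul_neg_of_pos_of_neg (by linarith) (by linarith)) (by linarith)
    linarith
  obtain ⟨K, hK, hen⟩ := exists_energy_le
  set E₀ : ℝ := B ^ 2 + K * (B ^ 2) ^ 2 with hE
  have hE0 : 0 < E₀ := by positivity
  obtain ⟨A, hA, hglob⟩ := exists_energy_global (by linarith) hs1 hβ1 hE0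
  set A' : ℝ := A * (1 + 4 * Real.pi ^ 2) + 1 with hA'
  have hA'1 : 1 ≤ A' := le_add_of_nonneg_left (by positivity)
  set p : ℝ := (1 - s) / ((7 / 4) * s - 1) with hp
  refine ⟨16 * Real.pi ^ 2 * E₀ * A' ^ p, by positivity, fun T hT φ₀ hφ₀ φ h => ?_⟩
  set N : ℝ := (A' * (1 + T)) ^ (1 / γ) with hN
  have hbase : 1 ≤ A' * (1 + T) := by nlinarith
  have hN1 : 1 ≤ N := Real.one_le_rpow hbase (by positivity)
  have hN0 : 0 < N := by linarith
  have hNγ : N ^ γ = A' * (1 + T) := by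
    rw [hN, ← Real.rpow_mul (by linarith), one_div_mul_cancel hγ0.ne', Real.rpow_one]
  set l : ℝ := N ^ ((1 - s) / s) with hl
  have hl1 : 1 ≤ l := Real.one_le_rpow hN1 (div_nonneg (by linarith) hs0.le)
  have hlN : l ^ s = N ^ (1 - s) := by
    rw [hl, ← Real.rpow_mul hN0.le, div_mul_cancel₀ _ hs0.ne']
  have hNβ : N ^ β = A' * (1 + T) * l ^ 2 := by
    rw [hβ, Real.rpow_add hN0, hNγ, hl, ← Real.rpow_natCast, ← Real.rpow_mul hN0.le]
    congr 2
    push_cast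
    ring
  have hls : (l ^ s) ^ 2 = A' ^ p * (1 + T) ^ p := by
    rw [hlN, hN, ← Real.rpow_mul (by linarith), ← Real.rpow_natCast, ← Real.rpow_mul (by linarith),
      ← Real.mul_rpow (by linarith) (by linarith)]
    congr 1
    have h1 : γ = 2 * ((7 / 4) * s - 1) := by rw [hγ]; ring
    have h2 : (7 / 4) * s - 1 ≠ 0 := by linarith
    rw [hp, h1]
    push_cast
    field_simp
  clear_value N l
  obtain ⟨C, U, hUc, hUr, hU, hUd⟩ := h.exists_fourier hT
  have hsol := fourierSol_dilate hl1 hUc hUr hUd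
  have hU0 : U 0 = 𝓕 (φ₀ : Rn 2 → ℂ) := by
    rw [hU 0 ⟨le_rfl, hT⟩]
    congr 1
    funext x
    exact h.2.2.2 x
  have hW0 : dilate l U 0 = fun ξ => ((l / (2 * Real.pi) : ℝ) : ℂ) * U 0 (l • ξ) := by
    funext ξ
    rw [dilate, zero_div]
  have hWT : dilate l U (4 * Real.pi ^ 2 * l ^ 2 * T)
      = fun ξ => ((l / (2 * Real.pi) : ℝ) : ℂ) * U T (l • ξ) := by
    funext ξ
    have : 4 * Real.pi ^ 2 * l ^ 2 ≠ 0 := by positivity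
    rw [dilate, mul_div_cancel_left₀ _ this]
  have hr0 := (hsol.rapid 0).imul_mul hN1 hs1
  have hrT := (hsol.rapid (4 * Real.pi ^ 2 * l ^ 2 * T)).imul_mul hN1 hs1
  have hinit : fourierEnergy (fun ξ => (imul N s ξ : ℂ) * dilate l U 0 ξ) ≤ E₀ := by
    refine hen _ _ _ hr0 (sq_nonneg B) ?_
    rw [← integral_jap_sq_eq hr0]
    refine ENNReal.ofReal_le_ofReal ?_
    rw [hW0]
    refine (integral_imul_dilate_le hs0 hs1 hN1 hl1 hlN (hUr 0)).trans ?_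
    rw [hU0, ← sobNorm_sq]
    exact pow_le_pow_left₀ (Real.rpow_nonneg (integral_nonneg fun ξ => by
      have := jap_pos ξ
      positivity) _) hφ₀ 2
  have hfin := hglob N hN1 _ _ _ (by positivity) hsol hinit (by
    rw [hNβ, hA']
    have h1 : 1 ≤ l ^ 2 := one_le_pow₀ hl1
    have h2 : 0 ≤ 4 * Real.pi ^ 2 := by positivity
    calc A * (1 + 4 * Real.pi ^ 2 * l ^ 2 * T)
        ≤ A * ((1 + 4 * Real.pi ^ 2) * (1 + T) * l ^ 2) := by
          refine mul_le_mul_of_nonneg_left ?_ hA.le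
          have h3 : 0 ≤ T * l ^ 2 := by positivity
          have h4 : 0 ≤ 4 * Real.pi ^ 2 * l ^ 2 := by positivity
          nlinarith
      _ = A * (1 + 4 * Real.pi ^ 2) * (1 + T) * l ^ 2 := by ring
      _ ≤ (A * (1 + 4 * Real.pi ^ 2) + 1) * (1 + T) * l ^ 2 := by
          gcongr
          linarith)
  have hintg := wnorm_jap_le_energy hrT
  rw [← integral_jap_sq_eq hrT] at hintg
  have hintg' := (ENNReal.ofReal_le_ofReal_iff' .. |>.1 hintg)
  have hmain : ∫ ξ, jap ξ ^ 2 * ‖(imul N s ξ : ℂ) *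
      dilate l U (4 * Real.pi ^ 2 * l ^ 2 * T) ξ‖ ^ 2 ≤ 4 * E₀ := by
    rcases hintg' with h1 | h1 <;> linarith
  rw [hWT] at hmain hrT
  rw [sobNorm_sq, ← hU T ⟨hT, le_rfl⟩]
  calc ∫ ξ, jap ξ ^ (2 * s) * ‖U T ξ‖ ^ 2
      ≤ 4 * Real.pi ^ 2 * (l ^ s) ^ 2 * (4 * E₀) :=
        (sobolev_le_integral_imul_dilate hs0 hs1 hN1 hl1 (hUr T) hrT).trans
          (mul_le_mul_of_nonneg_left hmain (by positivity))
    _ = _ := by rw [hls]; ring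

end

/-- Main theorem, n = 2: global-in-time polynomial bound on the H^s norm for s > 4/7. -/
theorem statement_0 :
    ∀ s : ℝ, 4/7 < s → s < 1 →
    ∃ ε₀ > (0:ℝ), ∀ ε : ℝ, 0 < ε → ε < ε₀ →
    ∀ B : ℝ, 0 < B →
    ∃ C > (0:ℝ),
    ∀ T : ℝ, 1 ≤ T →
    ∀ φ₀ : SchwartzMap (Rn 2) ℂ, sobNorm 2 s ⇑φ₀ ≤ B →
    ∀ φ : Rn 2 → ℝ → ℂ, IsNLSSolution 2 T φ ⇑φ₀ →
    sobNorm 2 s (fun x => φ x T) ^ 2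
      ≤ C * (1 + T) ^ ((1 - s) / ((7/4) * s - 1) + ε) := by
  intro s hs hs1
  refine ⟨1, one_pos, fun ε hε _ B hB => ?_⟩
  obtain ⟨C, hC, h⟩ := exists_sobNorm_le hs hs1 hB
  refine ⟨C, hC, fun T hT φ₀ hφ₀ φ hφ => (h T (by linarith) φ₀ hφ₀ φ hφ).trans ?_⟩
  exact mul_le_mul_of_nonneg_left
    (Real.rpow_le_rpow_of_exponent_le (by linarith) (by linarith)) hC.le

end
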